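/- Let Ω ⊂ ℝ³ be a connected open set containing 0. Suppose the residual stress components t_jk, the Lamé parameters λ, μ, and the density ρ > 0 all belong to the Gevrey class G^s(Ω); suppose the operators P₁(x,D) = Σ_{j,k}(μδ_jk + t_jk)∂²_{jk} and P₂(x,D) = Σ_{j,k}((λ+2μ)δ_jk + t_jk)∂²_{jk} are uniformly elliptic; suppose α > 0 satisfies α > (λ₃^ℓ − λ₁^ℓ)/λ₁^ℓ for ℓ = 1,2, where λ₁^ℓ ≤ λ₂^ℓ ≤ λ₃^ℓ are the eigenvalues of the coefficient matrix (a^ℓ_jk(0)) of P_ℓ at 0; and suppose s < 1 + 1/α. If u : Ω → ℝ³ is a smooth solution of the residual stress system ∇·σ + κ²ρu = 0 in Ω, and for every N > 0 one has ∫_{R ≤ |x| ≤ 2R} |u|² dx = O(R^N) as R → 0, then u is identically zero in Ω. -/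

import Mathlib

open MeasureTheory Metric Finset

noncomputable section

/-- `ℝ³` with the Euclidean norm. -/
abbrev E3 := EuclideanSpace ℝ (Fin 3)
/-- `ℝ⁷` with the Euclidean norm. -/
abbrev E7 := EuclideanSpace ℝ (Fin 7)

/-- The partial derivative `∂_i f`. -/
def pd (i : Fin 3) (f : E3 → ℝ) : E3 → ℝ :=
  fun x => fderiv ℝ f x (EuclideanSpace.single i 1)

/-- The multiindex partial derivative `∂^β f`. -/
def mpd (β : Fin 3 → ℕ) (f : E3 → ℝ) : E3 → ℝ :=
  (pd 0)^[β 0] ((pd 1)^[β 1] ((pd 2)^[β 2] f))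

/-- The length `|β|` of a multiindex. -/
def mdeg (β : Fin 3 → ℕ) : ℕ := β 0 + β 1 + β 2

/-- `f` belongs to the Gevrey class `G^s(Ω)`. -/
def GevreyOn (s : ℝ) (Ω : Set E3) (f : E3 → ℝ) : Prop :=
  ContDiffOn ℝ (⊤ : ℕ∞) f Ω ∧ ∃ c > 0, ∃ A > 0, ∀ β : Fin 3 → ℕ, ∀ x ∈ Ω,
    |mpd β f x| ≤ c * A ^ mdeg β * (Nat.factorial (mdeg β) : ℝ) ^ s

/-- The second-order operator `Σ_{j,k} a_jk(x) ∂²_{jk}` applied to a scalar function. -/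
def op2 (a : Fin 3 → Fin 3 → E3 → ℝ) (f : E3 → ℝ) : E3 → ℝ :=
  fun x => ∑ j, ∑ k, a j k x * pd j (pd k f) x

/-- Uniform (strong) ellipticity of `Σ_{j,k} a_jk(x) ∂²_{jk}` on `Ω`. -/
def UnifElliptic (a : Fin 3 → Fin 3 → E3 → ℝ) (Ω : Set E3) : Prop :=
  ∃ c0 > 0, ∀ x ∈ Ω, ∀ ξ : Fin 3 → ℝ,
    c0 * (∑ i, ξ i ^ 2) ≤ ∑ j, ∑ k, a j k x * ξ j * ξ k

/-- The coefficient matrix of the operator at a point. -/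
def coefMatrix (a : Fin 3 → Fin 3 → E3 → ℝ) (x : E3) : Matrix (Fin 3) (Fin 3) ℝ :=
  Matrix.of fun j k => a j k x

/-- `α > (λ₃ - λ₁)/λ₁` where `λ₁ ≤ λ₂ ≤ λ₃` are the eigenvalues of the coefficient
matrix at `0`: equivalently (the eigenvalues being positive), for any pair of
eigenvalues the corresponding ratio is `< α`. -/
def EigCond (a : Fin 3 → Fin 3 → E3 → ℝ) (α : ℝ) : Prop :=
  ∀ h : (coefMatrix a 0).IsHermitian, ∀ i j : Fin 3,
    (h.eigenvalues i - h.eigenvalues j) / h.eigenvalues j < α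

/-- The coefficients `a¹_jk = μ δ_jk + t_jk` of `P₁`. -/
def a1coef (t : Fin 3 → Fin 3 → E3 → ℝ) (mu : E3 → ℝ) : Fin 3 → Fin 3 → E3 → ℝ :=
  fun j k x => mu x * (if j = k then 1 else 0) + t j k x

/-- The coefficients `a²_jk = (λ + 2μ) δ_jk + t_jk` of `P₂`. -/
def a2coef (t : Fin 3 → Fin 3 → E3 → ℝ) (lam mu : E3 → ℝ) : Fin 3 → Fin 3 → E3 → ℝ :=
  fun j k x => (lam x + 2 * mu x) * (if j = k then 1 else 0) + t j k x

/-- The divergence `∇·u`. -/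
def divg (u : E3 → Fin 3 → ℝ) (x : E3) : ℝ := ∑ i, pd i (fun y => u y i) x

/-- The curl `∇×u`. -/
def curl (u : E3 → Fin 3 → ℝ) (x : E3) : Fin 3 → ℝ :=
  ![pd 1 (fun y => u y 2) x - pd 2 (fun y => u y 1) x,
    pd 2 (fun y => u y 0) x - pd 0 (fun y => u y 2) x,
    pd 0 (fun y => u y 1) x - pd 1 (fun y => u y 0) x]

/-- The infinitesimal strain `E = (∇u + (∇u)ᵗ)/2`. -/
def strain (u : E3 → Fin 3 → ℝ) (x : E3) (i j : Fin 3) : ℝ :=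
  (pd j (fun y => u y i) x + pd i (fun y => u y j) x) / 2

/-- The stress tensor `σ = T + (∇u)T + λ(tr E)I + 2μE`. -/
def stress (t : Fin 3 → Fin 3 → E3 → ℝ) (lam mu : E3 → ℝ) (u : E3 → Fin 3 → ℝ)
    (x : E3) (i j : Fin 3) : ℝ :=
  t i j x + (∑ k, pd k (fun y => u y i) x * t k j x)
    + lam x * divg u x * (if i = j then 1 else 0)
    + 2 * mu x * strain u x i j

/-- The residual stress system `∇·σ + κ²ρu = 0` on `Ω`. -/
def ResSystem (t : Fin 3 → Fin 3 → E3 → ℝ) (lam mu rho : E3 → ℝ) (κ : ℝ)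
    (u : E3 → Fin 3 → ℝ) (Ω : Set E3) : Prop :=
  ∀ x ∈ Ω, ∀ i : Fin 3,
    (∑ j, pd j (fun y => stress t lam mu u y i j) x) + κ ^ 2 * rho x * u x i = 0

/-- The vector `U = (u, ∇·u, ∇×u) : Ω → ℝ⁷`. -/
def Ufull (u : E3 → Fin 3 → ℝ) : E3 → Fin 7 → ℝ :=
  fun x => ![u x 0, u x 1, u x 2, divg u x, curl u x 0, curl u x 1, curl u x 2]

/-- The lower-order term `Σ_{|β|≤3} a_β ∂^β U`, component `i`. -/
def lowOrd (aβ : (Fin 3 → ℕ) → E3 → Fin 7 → Fin 7 → ℝ) (U : E3 → Fin 7 → ℝ)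
    (x : E3) (i : Fin 7) : ℝ :=
  ∑ β ∈ Finset.univ.filter (fun β : Fin 3 → Fin 4 => mdeg (fun k => (β k : ℕ)) ≤ 3),
    ∑ j, aβ (fun k => (β k : ℕ)) x i j * mpd (fun k => (β k : ℕ)) (fun y => U y j) x

/-- Smooth functions on `E3`. -/
notation "Sm" => ContDiff ℝ ((⊤ : ℕ∞) : WithTop ℕ∞)

section Calculus

variable {f g : E3 → ℝ} {i j : Fin 3} {x : E3}

@[fun_prop]
theorem contDiff_pd (hf : Sm f) : Sm (pd i f) := by
  have h : ContDiff ℝ (⊤ : ℕ∞) (fderiv ℝ f) := hf.fderiv_right (by simp)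
  exact h.clm_apply contDiff_const

theorem sm_differentiableAt (hf : Sm f) : DifferentiableAt ℝ f x :=
  (hf.differentiable (by simp)) x

theorem pd_add (hf : Sm f) (hg : Sm g) :
    pd i (fun x => f x + g x) = fun x => pd i f x + pd i g x := by
  funext x
  simp [pd, fderiv_fun_add (sm_differentiableAt hf) (sm_differentiableAt hg)]

theorem pd_sub (hf : Sm f) (hg : Sm g) :
    pd i (fun x => f x - g x) = fun x => pd i f x - pd i g x := by
  funext x
  simp [pd, fderiv_fun_sub (sm_differentiableAt hf) (sm_differentiableAt hg)]

theorem pd_neg : pd i (fun x => - f x) = fun x => - pd i f x := by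
  funext x
  simp [pd]

theorem pd_mul (hf : Sm f) (hg : Sm g) :
    pd i (fun x => f x * g x) = fun x => pd i f x * g x + f x * pd i g x := by
  funext x
  simp [pd, fderiv_fun_mul (sm_differentiableAt hf) (sm_differentiableAt hg)]
  ring

theorem pd_const (c : ℝ) : pd i (fun _ => c) = fun _ => 0 := by
  funext x
  simp [pd]

theorem pd_const_mul (c : ℝ) : pd i (fun x => c * f x) = fun x => c * pd i f x := by
  funext x
  by_cases hc : c = 0
  · simp [hc, pd]
  · have : (fun x => c * f x) = c • f := by ext; simp
    simp [pd, this, fderiv_const_smul_field]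

theorem pd_sum {ι : Type*} (s : Finset ι) {F : ι → E3 → ℝ} (hF : ∀ k ∈ s, Sm (F k)) :
    pd i (fun x => ∑ k ∈ s, F k x) = fun x => ∑ k ∈ s, pd i (F k) x := by
  funext x
  simp [pd, fderiv_fun_sum fun k hk => sm_differentiableAt (hF k hk)]

theorem pd_pow (n : ℕ) (hf : Sm f) :
    pd i (fun x => f x ^ (n + 1)) = fun x => (n + 1) * f x ^ n * pd i f x := by
  funext x
  simp [pd, fderiv_fun_pow (n + 1) (sm_differentiableAt hf)]

theorem pd_sq (hf : Sm f) :
    pd i (fun x => f x ^ 2) = fun x => 2 * f x * pd i f x := by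
  simpa [one_add_one_eq_two] using pd_pow (i := i) 1 hf

theorem pd_exp (hf : Sm f) :
    pd i (fun x => Real.exp (f x)) = fun x => Real.exp (f x) * pd i f x := by
  funext x
  simp [pd, fderiv_exp (sm_differentiableAt hf)]

theorem pd_congr {U : Set E3} (hU : IsOpen U) (h : ∀ x ∈ U, f x = g x) :
    ∀ x ∈ U, pd i f x = pd i g x := by
  intro x hx
  have : f =ᶠ[nhds x] g := Filter.eventuallyEq_of_mem (hU.mem_nhds hx) h
  simp [pd, this.fderiv_eq]

theorem pd_comm (hf : Sm f) : pd i (pd j f) = pd j (pd i f) := by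
  funext x
  have hd : DifferentiableAt ℝ (fderiv ℝ f) x :=
    ((hf.fderiv_right (m := (⊤ : ℕ∞)) (by simp)).differentiable (by simp)) x
  have hs : IsSymmSndFDerivAt ℝ f x :=
    hf.contDiffAt.isSymmSndFDerivAt (by simpa using WithTop.coe_le_coe.2 (le_top : (2 : ℕ∞) ≤ ⊤))
  have key : ∀ v w : E3, fderiv ℝ (fun y => fderiv ℝ f y v) x w
      = fderiv ℝ (fderiv ℝ f) x w v := by
    intro v w
    rw [fderiv_clm_apply hd (differentiableAt_const v)]
    simp
  exact (key _ _).trans ((hs _ _).trans (key _ _).symm)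

theorem tsupport_pd_subset : tsupport (pd i f) ⊆ tsupport f :=
  tsupport_fderiv_apply_subset ℝ _

theorem hasCompactSupport_pd (hf : HasCompactSupport f) : HasCompactSupport (pd i f) :=
  hf.fderiv_apply ℝ _

theorem pd_eq_zero_of_notMem (h : x ∉ tsupport f) : pd i f x = 0 :=
  image_eq_zero_of_notMem_tsupport fun h' => h (tsupport_pd_subset h')

theorem pd_pd_eq_zero_of_notMem (h : x ∉ tsupport f) : pd i (pd j f) x = 0 :=
  pd_eq_zero_of_notMem fun h' => h (tsupport_pd_subset h')

theorem sm_integrable (hf : Sm f) (hc : HasCompactSupport f) : Integrable f :=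
  hf.continuous.integrable_of_hasCompactSupport hc

theorem integral_pd_eq_zero (hf : Sm f) (hc : HasCompactSupport f) : ∫ x, pd i f x = 0 := by
  have h := integral_mul_fderiv_eq_neg_fderiv_mul_of_integrable (μ := (volume : Measure E3))
    (𝕜 := ℝ) (f := fun _ => (1 : ℝ)) (g := f) (v := EuclideanSpace.single i 1)
    (by simp) (by
      have : Integrable (pd i f) := sm_integrable (contDiff_pd hf) (hasCompactSupport_pd hc)
      simp only [one_mul]; exact this) (by simpa using sm_integrable hf hc)
    (fun x _ => differentiableAt_const _) (fun x _ => (sm_differentiableAt hf))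
  simpa [pd] using h

/-- Sorting rules for iterated partial derivatives. -/
theorem pd_one_zero (hf : Sm f) : pd 1 (pd 0 f) = pd 0 (pd 1 f) := pd_comm hf
theorem pd_two_zero (hf : Sm f) : pd 2 (pd 0 f) = pd 0 (pd 2 f) := pd_comm hf
theorem pd_two_one (hf : Sm f) : pd 2 (pd 1 f) = pd 1 (pd 2 f) := pd_comm hf

theorem abs_sum_three_le {f : Fin 3 → ℝ} {K : ℝ} (h : ∀ i, |f i| ≤ K) : |∑ i, f i| ≤ 3 * K := by
  calc |∑ i, f i| ≤ ∑ i, |f i| := Finset.abs_sum_le_sum_abs _ _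
    _ ≤ ∑ _i : Fin 3, K := Finset.sum_le_sum fun i _ => h i
    _ = 3 * K := by simp

end Calculus

open scoped MatrixOrder in
open scoped Matrix.Norms.L2Operator in
theorem trace_mul_mul_mul_ge {A H : Matrix (Fin 3) (Fin 3) ℝ} {c : ℝ} (hc : 0 ≤ c)
    (hA : A.PosSemidef) (hAc : (A - c • (1 : Matrix (Fin 3) (Fin 3) ℝ)).PosSemidef)
    (hH : H.transpose = H) : c ^ 2 * (H * H).trace ≤ (A * H * A * H).trace := by
  have key : ∀ B : Matrix (Fin 3) (Fin 3) ℝ, B.PosSemidef →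
      0 ≤ ((A - c • (1 : Matrix (Fin 3) (Fin 3) ℝ)) * (H * B * H)).trace := by
    intro B hB
    have h1 : (H * B * H).PosSemidef := by
      have := hB.mul_mul_conjTranspose_same H
      rwa [Matrix.conjTranspose_eq_transpose_of_trivial, hH] at this
    obtain ⟨C, hC⟩ := CStarAlgebra.nonneg_iff_eq_star_mul_self.1 (Matrix.nonneg_iff_posSemidef.2 h1)
    rw [hC, Matrix.star_eq_conjTranspose, ← mul_assoc, Matrix.trace_mul_comm, ← mul_assoc]
    exact (hAc.mul_mul_conjTranspose_same C).trace_nonneg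
  have h1 := key A hA
  have h2 := key 1 Matrix.PosSemidef.one
  have e1 : ((A - c • (1 : Matrix (Fin 3) (Fin 3) ℝ)) * (H * A * H)).trace
      = (A * H * A * H).trace - c * (H * A * H).trace := by
    rw [sub_mul, Matrix.trace_sub, smul_mul_assoc, one_mul, Matrix.trace_smul, smul_eq_mul]
    simp only [mul_assoc]
  have e2 : ((A - c • (1 : Matrix (Fin 3) (Fin 3) ℝ)) * (H * 1 * H)).trace
      = (H * A * H).trace - c * (H * H).trace := by
    rw [sub_mul, Matrix.trace_sub, smul_mul_assoc, one_mul, Matrix.trace_smul, smul_eq_mul, mul_one,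
      ← mul_assoc, Matrix.trace_mul_comm, ← mul_assoc]
  rw [e1] at h1
  rw [e2] at h2
  nlinarith

theorem sum_hessian_ge {a h : Fin 3 → Fin 3 → ℝ} {c : ℝ} (hc : 0 ≤ c)
    (ha : ∀ j k, a j k = a k j) (hh : ∀ j k, h j k = h k j)
    (hell : ∀ ξ : Fin 3 → ℝ, c * (∑ i, ξ i ^ 2) ≤ ∑ j, ∑ k, a j k * ξ j * ξ k) :
    c ^ 2 * ∑ j, ∑ k, h j k ^ 2 ≤ ∑ l, ∑ m, ∑ k, ∑ j, a l m * h m k * (a k j * h j l) := by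
  set A : Matrix (Fin 3) (Fin 3) ℝ := Matrix.of a with hA
  set H : Matrix (Fin 3) (Fin 3) ℝ := Matrix.of h with hH
  have hAh : A.IsHermitian := by
    ext i j; simp [hA, ha i j]
  have hA1 : A.PosSemidef := by
    refine Matrix.PosSemidef.of_dotProduct_mulVec_nonneg hAh fun x => ?_
    have := hell x
    have h0 : 0 ≤ c * ∑ i, x i ^ 2 := mul_nonneg hc (Finset.sum_nonneg fun _ _ => sq_nonneg _)
    simp [hA, dotProduct, Matrix.mulVec, Fin.sum_univ_three] at *
    nlinarith
  have hA2 : (A - c • (1 : Matrix (Fin 3) (Fin 3) ℝ)).PosSemidef := by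
    refine Matrix.PosSemidef.of_dotProduct_mulVec_nonneg (hAh.sub ?_) fun x => ?_
    · simp [Matrix.IsHermitian]
    · have := hell x
      simp [hA, dotProduct, Matrix.mulVec, Fin.sum_univ_three, Matrix.one_apply] at *
      nlinarith
  have hHt : H.transpose = H := by
    ext i j; simp [hH, hh i j]
  have := trace_mul_mul_mul_ge hc hA1 hA2 hHt
  have e1 : (H * H).trace = ∑ j, ∑ k, h j k ^ 2 := by
    simp only [Matrix.trace, Matrix.diag, Matrix.mul_apply, hH, Matrix.of_apply]
    refine Finset.sum_congr rfl fun i _ => Finset.sum_congr rfl fun j _ => ?_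
    rw [hh j i]; ring
  have e2 : (A * H * A * H).trace = ∑ l, ∑ m, ∑ k, ∑ j, a l m * h m k * (a k j * h j l) := by
    simp only [Matrix.trace, Matrix.diag, Matrix.mul_apply, hH, hA, Matrix.of_apply,
      Fin.sum_univ_three]
    ring
  rwa [e1, e2] at this

/-- The squared length of the gradient. -/
def gsq (w : E3 → ℝ) (x : E3) : ℝ := ∑ k, pd k w x ^ 2

/-- The squared norm of the Hessian. -/
def hsq (w : E3 → ℝ) (x : E3) : ℝ := ∑ j, ∑ k, pd j (pd k w) x ^ 2

theorem gsq_nonneg (w : E3 → ℝ) (x : E3) : 0 ≤ gsq w x := Finset.sum_nonneg fun _ _ => sq_nonneg _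

theorem hsq_nonneg (w : E3 → ℝ) (x : E3) : 0 ≤ hsq w x :=
  Finset.sum_nonneg fun _ _ => Finset.sum_nonneg fun _ _ => sq_nonneg _

theorem sq_pd_le_gsq (w : E3 → ℝ) (x : E3) (k : Fin 3) : pd k w x ^ 2 ≤ gsq w x :=
  Finset.single_le_sum (f := fun k => pd k w x ^ 2) (fun _ _ => sq_nonneg _) (Finset.mem_univ k)

theorem sq_pd_pd_le_hsq (w : E3 → ℝ) (x : E3) (j k : Fin 3) : pd j (pd k w) x ^ 2 ≤ hsq w x :=
  (Finset.single_le_sum (f := fun k => pd j (pd k w) x ^ 2) (fun _ _ => sq_nonneg _)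
    (Finset.mem_univ k)).trans
  (Finset.single_le_sum (f := fun j => ∑ k, pd j (pd k w) x ^ 2)
    (fun _ _ => Finset.sum_nonneg fun _ _ => sq_nonneg _) (Finset.mem_univ j))

theorem abs_pd_le_sqrt_gsq (w : E3 → ℝ) (x : E3) (k : Fin 3) : |pd k w x| ≤ √(gsq w x) :=
  Real.abs_le_sqrt (sq_pd_le_gsq w x k)

theorem abs_pd_pd_le_sqrt_hsq (w : E3 → ℝ) (x : E3) (j k : Fin 3) :
    |pd j (pd k w) x| ≤ √(hsq w x) :=
  Real.abs_le_sqrt (sq_pd_pd_le_hsq w x j k)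

@[fun_prop]
theorem contDiff_gsq {w : E3 → ℝ} (hw : Sm w) : Sm (gsq w) := by
  unfold gsq; fun_prop

@[fun_prop]
theorem contDiff_hsq {w : E3 → ℝ} (hw : Sm w) : Sm (hsq w) := by
  unfold hsq; fun_prop

@[fun_prop]
theorem contDiff_op2 {a : Fin 3 → Fin 3 → E3 → ℝ} {w : E3 → ℝ} (ha : ∀ j k, Sm (a j k))
    (hw : Sm w) : Sm (op2 a w) := by
  unfold op2; fun_prop

theorem gsq_eq_zero_of_notMem {w : E3 → ℝ} {x : E3} (hx : x ∉ tsupport w) : gsq w x = 0 := by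
  simp [gsq, pd_eq_zero_of_notMem hx]

theorem hsq_eq_zero_of_notMem {w : E3 → ℝ} {x : E3} (hx : x ∉ tsupport w) : hsq w x = 0 := by
  simp [hsq, pd_pd_eq_zero_of_notMem hx]

theorem op2_eq_zero_of_notMem {a : Fin 3 → Fin 3 → E3 → ℝ} {w : E3 → ℝ} {x : E3}
    (hx : x ∉ tsupport w) : op2 a w x = 0 := by
  simp [op2, pd_pd_eq_zero_of_notMem hx]

theorem hasCompactSupport_of_forall {f w : E3 → ℝ} (hw : HasCompactSupport w)
    (h : ∀ x, x ∉ tsupport w → f x = 0) : HasCompactSupport f :=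
  HasCompactSupport.intro hw fun x hx => h x hx

theorem sm_integrable_of_forall {f w : E3 → ℝ} (hf : Sm f) (hw : HasCompactSupport w)
    (h : ∀ x, x ∉ tsupport w → f x = 0) : Integrable f :=
  sm_integrable hf (hasCompactSupport_of_forall hw h)

/-- The conormal derivative components `Σ_j a_kj ∂_j w`. -/
def conormal (a : Fin 3 → Fin 3 → E3 → ℝ) (w : E3 → ℝ) (k : Fin 3) (x : E3) : ℝ :=
  ∑ j, a k j x * pd j w x

@[fun_prop]
theorem contDiff_conormal {a : Fin 3 → Fin 3 → E3 → ℝ} {w : E3 → ℝ} {k : Fin 3}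
    (ha : ∀ j k, Sm (a j k)) (hw : Sm w) : Sm (conormal a w k) := by
  unfold conormal; fun_prop

theorem pd_conormal {a : Fin 3 → Fin 3 → E3 → ℝ} {w : E3 → ℝ} (ha : ∀ j k, Sm (a j k))
    (hw : Sm w) (l k : Fin 3) (x : E3) : pd l (conormal a w k) x =
      ∑ j, (pd l (a k j) x * pd j w x + a k j x * pd l (pd j w) x) := by
  unfold conormal
  simp (disch := fun_prop) only [pd_add, pd_mul, Fin.sum_univ_three]

theorem pd_op2 {a : Fin 3 → Fin 3 → E3 → ℝ} {w : E3 → ℝ} (ha : ∀ j k, Sm (a j k))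
    (hw : Sm w) (l : Fin 3) (x : E3) : pd l (op2 a w) x =
      ∑ j, ∑ k, (pd l (a j k) x * pd j (pd k w) x + a j k x * pd l (pd j (pd k w)) x) := by
  unfold op2
  simp (disch := fun_prop) only [pd_add, pd_mul, Fin.sum_univ_three]

theorem hessian_divergence_identity {a : Fin 3 → Fin 3 → E3 → ℝ} {w : E3 → ℝ}
    (ha : ∀ j k, Sm (a j k)) (hw : Sm w) (x : E3) :
    (∑ k, pd k (fun x => conormal a w k x * op2 a w x) x)
      - ∑ l, pd l (fun x => ∑ m, ∑ k, a l m x * pd m (pd k w) x * conormal a w k x) x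
    = (∑ k, ∑ j, a k j x * pd k (pd j w) x) * op2 a w x
      + (∑ k, ∑ j, pd k (a k j) x * pd j w x) * op2 a w x
      + (∑ k, ∑ l, ∑ m, conormal a w k x * (pd k (a l m) x * pd l (pd m w) x))
      - (∑ l, ∑ m, ∑ k, conormal a w k x * (pd l (a l m) x * pd m (pd k w) x))
      - (∑ l, ∑ m, ∑ k, a l m x * pd m (pd k w) x * (∑ j, pd l (a k j) x * pd j w x))
      - ∑ l, ∑ m, ∑ k, a l m x * pd m (pd k w) x * (∑ j, a k j x * pd l (pd j w) x) := by
  simp (disch := fun_prop) only [pd_add, pd_mul, pd_op2, pd_conormal, Fin.sum_univ_three]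
  simp (disch := fun_prop) only [pd_one_zero, pd_two_zero, pd_two_one]
  generalize conormal a w 0 x = p0
  generalize conormal a w 1 x = p1
  generalize conormal a w 2 x = p2
  generalize op2 a w x = Q
  ring

theorem abs_mul_le_mul {a b A B : ℝ} (ha : |a| ≤ A) (hb : |b| ≤ B) : |a * b| ≤ A * B := by
  rw [abs_mul]
  exact mul_le_mul ha hb (abs_nonneg _) ((abs_nonneg _).trans ha)

theorem hsq_le_of_identity {a : Fin 3 → Fin 3 → E3 → ℝ} {w : E3 → ℝ} {x : E3} {c Λ : ℝ}
    (hw : Sm w) (hsym : ∀ j k, a j k x = a k j x)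
    (hc : 0 < c) (hell : ∀ ξ : Fin 3 → ℝ, c * (∑ i, ξ i ^ 2) ≤ ∑ j, ∑ k, a j k x * ξ j * ξ k)
    (hΛ : ∀ j k, |a j k x| ≤ Λ) (hΛ' : ∀ i j k, |pd i (a j k) x| ≤ Λ) {D : ℝ}
    (hD : D = (∑ k, ∑ j, a k j x * pd k (pd j w) x) * op2 a w x
      + (∑ k, ∑ j, pd k (a k j) x * pd j w x) * op2 a w x
      + (∑ k, ∑ l, ∑ m, conormal a w k x * (pd k (a l m) x * pd l (pd m w) x))
      - (∑ l, ∑ m, ∑ k, conormal a w k x * (pd l (a l m) x * pd m (pd k w) x))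
      - (∑ l, ∑ m, ∑ k, a l m x * pd m (pd k w) x * (∑ j, pd l (a k j) x * pd j w x))
      - ∑ l, ∑ m, ∑ k, a l m x * pd m (pd k w) x * (∑ j, a k j x * pd l (pd j w) x)) :
    c ^ 2 / 2 * hsq w x ≤ 2 * op2 a w x ^ 2
      + (81 * Λ ^ 2 / 4 + (243 * Λ ^ 2) ^ 2 / (2 * c ^ 2)) * gsq w x - D := by
  have hmain : c ^ 2 * hsq w x ≤
      ∑ l, ∑ m, ∑ k, a l m x * pd m (pd k w) x * (∑ j, a k j x * pd l (pd j w) x) := by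
    refine (sum_hessian_ge (h := fun j k => pd j (pd k w) x) hc.le hsym
      (fun j k => by rw [pd_comm hw]) hell).trans_eq ?_
    refine Finset.sum_congr rfl fun l _ => Finset.sum_congr rfl fun m _ =>
      Finset.sum_congr rfl fun k _ => ?_
    rw [Finset.mul_sum]
    exact Finset.sum_congr rfl fun j _ => by rw [pd_comm hw (i := j)]
  set s := √(gsq w x) with hs
  set h := √(hsq w x) with hh
  have hgs : gsq w x = s ^ 2 := (Real.sq_sqrt (gsq_nonneg w x)).symm
  have hhs : hsq w x = h ^ 2 := (Real.sq_sqrt (hsq_nonneg w x)).symm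
  have b1 : ∀ j, |pd j w x| ≤ s := abs_pd_le_sqrt_gsq w x
  have b2 : ∀ j k, |pd j (pd k w) x| ≤ h := abs_pd_pd_le_sqrt_hsq w x
  have bp : ∀ k, |conormal a w k x| ≤ 3 * (Λ * s) := fun k =>
    abs_sum_three_le fun j => abs_mul_le_mul (hΛ _ _) (b1 _)
  have bQ : |∑ k, ∑ j, pd k (a k j) x * pd j w x| ≤ 3 * (3 * (Λ * s)) :=
    abs_sum_three_le fun k => abs_sum_three_le fun j => abs_mul_le_mul (hΛ' _ _ _) (b1 _)
  have e1 := abs_mul_le_mul bQ (le_refl |op2 a w x|)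
  have e2 : |∑ k, ∑ l, ∑ m, conormal a w k x * (pd k (a l m) x * pd l (pd m w) x)|
      ≤ 3 * (3 * (3 * (3 * (Λ * s) * (Λ * h)))) :=
    abs_sum_three_le fun k => abs_sum_three_le fun l => abs_sum_three_le fun m =>
      abs_mul_le_mul (bp _) (abs_mul_le_mul (hΛ' _ _ _) (b2 _ _))
  have e3 : |∑ l, ∑ m, ∑ k, conormal a w k x * (pd l (a l m) x * pd m (pd k w) x)|
      ≤ 3 * (3 * (3 * (3 * (Λ * s) * (Λ * h)))) :=
    abs_sum_three_le fun k => abs_sum_three_le fun l => abs_sum_three_le fun m =>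
      abs_mul_le_mul (bp _) (abs_mul_le_mul (hΛ' _ _ _) (b2 _ _))
  have e4 : |∑ l, ∑ m, ∑ k, a l m x * pd m (pd k w) x * (∑ j, pd l (a k j) x * pd j w x)|
      ≤ 3 * (3 * (3 * ((Λ * h) * (3 * (Λ * s))))) :=
    abs_sum_three_le fun k => abs_sum_three_le fun l => abs_sum_three_le fun m =>
      abs_mul_le_mul (abs_mul_le_mul (hΛ _ _) (b2 _ _))
        (abs_sum_three_le fun j => abs_mul_le_mul (hΛ' _ _ _) (b1 _))
  have hQ : (∑ k, ∑ j, a k j x * pd k (pd j w) x) = op2 a w x := rfl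
  rw [hQ] at hD
  have e1' := (abs_le.1 e1).2
  have e2' := (abs_le.1 e2).2
  have e3' := (abs_le.1 e3).1
  have e4' := (abs_le.1 e4).1
  have hy : 243 * Λ ^ 2 * s * h ≤ c ^ 2 / 2 * h ^ 2 + (243 * Λ ^ 2) ^ 2 / (2 * c ^ 2) * s ^ 2 := by
    have : 0 ≤ (c * h - 243 * Λ ^ 2 * s / c) ^ 2 / 2 := by positivity
    have h2 : (c * h - 243 * Λ ^ 2 * s / c) ^ 2 / 2 = c ^ 2 / 2 * h ^ 2 - 243 * Λ ^ 2 * s * h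
      + (243 * Λ ^ 2) ^ 2 / (2 * c ^ 2) * s ^ 2 := by
      field_simp
      ring
    linarith
  have hz : 9 * Λ * s * |op2 a w x| ≤ op2 a w x ^ 2 + 81 * Λ ^ 2 / 4 * s ^ 2 := by
    have := sq_nonneg (|op2 a w x| - 9 * Λ * s / 2)
    rw [← sq_abs (op2 a w x)]
    nlinarith
  rw [hhs] at hmain
  rw [hgs, hhs]
  linarith

/-- The interior `H²` estimate for a second-order elliptic operator. -/
theorem elliptic_L2 {B : Set E3} {a : Fin 3 → Fin 3 → E3 → ℝ} {c Λ : ℝ}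
    (ha : ∀ j k, Sm (a j k)) (hsym : ∀ j k, a j k = a k j) (hc : 0 < c)
    (hell : ∀ x ∈ B, ∀ ξ : Fin 3 → ℝ, c * (∑ i, ξ i ^ 2) ≤ ∑ j, ∑ k, a j k x * ξ j * ξ k)
    (hΛ : ∀ x ∈ B, ∀ j k, |a j k x| ≤ Λ) (hΛ' : ∀ x ∈ B, ∀ i j k, |pd i (a j k) x| ≤ Λ) :
    ∃ C > 0, ∀ w : E3 → ℝ, Sm w → HasCompactSupport w → tsupport w ⊆ B →
      ∫ x, hsq w x ≤ C * ∫ x, (op2 a w x ^ 2 + gsq w x) := by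
  set K := 81 * Λ ^ 2 / 4 + (243 * Λ ^ 2) ^ 2 / (2 * c ^ 2) with hK
  have hK0 : 0 ≤ K := by positivity
  refine ⟨2 / c ^ 2 * (2 + K), by positivity, fun w hw hcw hB => ?_⟩
  have hV1 : ∀ k, Sm (fun x => conormal a w k x * op2 a w x) := fun k => by fun_prop
  have hV2 : ∀ l, Sm (fun x => ∑ m, ∑ k, a l m x * pd m (pd k w) x * conormal a w k x) :=
    fun l => by fun_prop
  have hz1 : ∀ k x, x ∉ tsupport w → conormal a w k x * op2 a w x = 0 := fun k x hx => by
    rw [op2_eq_zero_of_notMem hx, mul_zero]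
  have hz2 : ∀ l x, x ∉ tsupport w →
      ∑ m, ∑ k, a l m x * pd m (pd k w) x * conormal a w k x = 0 := fun l x hx => by
    simp [pd_pd_eq_zero_of_notMem hx]
  have hc1 := fun k => hasCompactSupport_of_forall hcw (hz1 k)
  have hc2 := fun l => hasCompactSupport_of_forall hcw (hz2 l)
  set D : E3 → ℝ := fun x => (∑ k, pd k (fun x => conormal a w k x * op2 a w x) x)
      - ∑ l, pd l (fun x => ∑ m, ∑ k, a l m x * pd m (pd k w) x * conormal a w k x) x with hD
  have hi1 : ∀ k, Integrable (pd k (fun x => conormal a w k x * op2 a w x)) := fun k =>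
    sm_integrable (contDiff_pd (hV1 k)) (hasCompactSupport_pd (hc1 k))
  have hi2 : ∀ l, Integrable
      (pd l (fun x => ∑ m, ∑ k, a l m x * pd m (pd k w) x * conormal a w k x)) := fun l =>
    sm_integrable (contDiff_pd (hV2 l)) (hasCompactSupport_pd (hc2 l))
  have hDi : Integrable D :=
    (integrable_finsetSum _ fun k _ => hi1 k).sub (integrable_finsetSum _ fun k _ => hi2 k)
  have hD0 : ∫ x, D x = 0 := by
    rw [hD, integral_sub (integrable_finsetSum _ fun k _ => hi1 k)
      (integrable_finsetSum _ fun k _ => hi2 k), integral_finsetSum _ fun k _ => hi1 k,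
      integral_finsetSum _ fun k _ => hi2 k]
    simp [integral_pd_eq_zero (hV1 _) (hc1 _), integral_pd_eq_zero (hV2 _) (hc2 _)]
  have hpt : ∀ x, c ^ 2 / 2 * hsq w x ≤ (2 + K) * (op2 a w x ^ 2 + gsq w x) - D x := by
    intro x
    by_cases hx : x ∈ tsupport w
    · have := hsq_le_of_identity hw (fun j k => by rw [hsym]) hc (hell x (hB hx)) (hΛ x (hB hx))
        (hΛ' x (hB hx)) (D := D x) (hessian_divergence_identity ha hw x)
      nlinarith [gsq_nonneg w x, sq_nonneg (op2 a w x)]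
    · have e1 : D x = 0 := by
        simp only [hD]
        have z1 : ∀ k, x ∉ tsupport (fun x => conormal a w k x * op2 a w x) := fun k h =>
          hx (closure_minimal (fun y hy => by
            by_contra h'; exact hy (hz1 k y h')) (isClosed_tsupport w) h)
        have z2 : ∀ l, x ∉ tsupport
            (fun x => ∑ m, ∑ k, a l m x * pd m (pd k w) x * conormal a w k x) := fun k h =>
          hx (closure_minimal (fun y hy => by
            by_contra h'; exact hy (hz2 k y h')) (isClosed_tsupport w) h)
        simp [pd_eq_zero_of_notMem (z1 _), pd_eq_zero_of_notMem (z2 _)]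
      simp [e1, hsq_eq_zero_of_notMem hx, gsq_eq_zero_of_notMem hx, op2_eq_zero_of_notMem hx]
  have hI : Integrable (fun x => op2 a w x ^ 2 + gsq w x) :=
    sm_integrable_of_forall (by fun_prop) hcw fun x hx => by
      simp [gsq_eq_zero_of_notMem hx, op2_eq_zero_of_notMem hx]
  have hIh : Integrable (hsq w) :=
    sm_integrable_of_forall (by fun_prop) hcw fun x hx => hsq_eq_zero_of_notMem hx
  have := integral_mono (hIh.const_mul (c ^ 2 / 2)) ((hI.const_mul (2 + K)).sub hDi) hpt
  simp only [Pi.sub_apply] at this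
  rw [integral_sub (hI.const_mul (2 + K)) hDi, hD0, sub_zero, integral_const_mul,
    integral_const_mul] at this
  have hc2 : 0 < c ^ 2 := by positivity
  calc ∫ x, hsq w x = 2 / c ^ 2 * (c ^ 2 / 2 * ∫ x, hsq w x) := by field_simp
    _ ≤ 2 / c ^ 2 * ((2 + K) * ∫ x, (op2 a w x ^ 2 + gsq w x)) := by gcongr
    _ = _ := by ring

/-- The quadratic form `Σ_jk a_jk ∂_j w ∂_k w`. -/
def energy (a : Fin 3 → Fin 3 → E3 → ℝ) (w : E3 → ℝ) (x : E3) : ℝ :=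
  ∑ k, conormal a w k x * pd k w x

@[fun_prop]
theorem contDiff_energy {a : Fin 3 → Fin 3 → E3 → ℝ} {w : E3 → ℝ}
    (ha : ∀ j k, Sm (a j k)) (hw : Sm w) : Sm (energy a w) := by
  unfold energy; fun_prop

theorem pd_energy {a : Fin 3 → Fin 3 → E3 → ℝ} {w : E3 → ℝ} (ha : ∀ j k, Sm (a j k))
    (hw : Sm w) (l : Fin 3) (x : E3) : pd l (energy a w) x =
      ∑ k, (pd l (conormal a w k) x * pd k w x + conormal a w k x * pd l (pd k w) x) := by
  unfold energy
  simp (disch := fun_prop) only [pd_add, pd_mul, Fin.sum_univ_three]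

/-- The vector field whose divergence appears in the Carleman identity. -/
def carlemanField (a : Fin 3 → Fin 3 → E3 → ℝ) (X : Fin 3 → E3 → ℝ) (q g w : E3 → ℝ)
    (j : Fin 3) (x : E3) : ℝ :=
  -(4 * conormal a w j x * (∑ l, X l x * pd l w x)) + 2 * X j x * energy a w x
    - 2 * X j x * q x * w x ^ 2 - 2 * conormal a w j x * w x * g x

/-- The quadratic form in `(w, ∇ w)` produced by the Carleman identity. -/
def carlemanForm (a : Fin 3 → Fin 3 → E3 → ℝ) (X : Fin 3 → E3 → ℝ) (q g w : E3 → ℝ)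
    (x : E3) : ℝ :=
  4 * (∑ j, ∑ l, conormal a w j x * pd j (X l) x * pd l w x)
    - 2 * (∑ l, ∑ j, ∑ k, X l x * pd l (a j k) x * pd j w x * pd k w x)
    + 2 * (g x - ∑ l, pd l (X l) x) * (energy a w x - q x * w x ^ 2)
    + 2 * (∑ l, X l x * pd l q x) * w x ^ 2
    + 2 * (∑ j, conormal a w j x * pd j g x) * w x

theorem carleman_identity {a : Fin 3 → Fin 3 → E3 → ℝ} {X : Fin 3 → E3 → ℝ} {q g w : E3 → ℝ}
    (ha : ∀ j k, Sm (a j k)) (hsym : ∀ j k, a j k = a k j) (hX : ∀ l, Sm (X l)) (hq : Sm q)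
    (hg : Sm g) (hw : Sm w) (x : E3) :
    -2 * ((∑ j, pd j (conormal a w j) x) + q x * w x)
        * (2 * (∑ l, X l x * pd l w x) + g x * w x)
      = (∑ j, pd j (carlemanField a X q g w j) x) + carlemanForm a X q g w x := by
  have h10 := hsym 1 0
  have h20 := hsym 2 0
  have h21 := hsym 2 1
  unfold carlemanField carlemanForm
  simp (disch := fun_prop) only [pd_add, pd_sub, pd_neg, pd_const_mul, pd_mul, pd_sq, pd_energy,
    Fin.sum_univ_three]
  simp (disch := fun_prop) only [pd_conormal, pd_one_zero, pd_two_zero, pd_two_one, h10, h20, h21,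
    Fin.sum_univ_three, energy, conormal]
  ring

theorem pd_eq_zero_of_forall {f w : E3 → ℝ} (h : ∀ x, x ∉ tsupport w → f x = 0) {i : Fin 3}
    {x : E3} (hx : x ∉ tsupport w) : pd i f x = 0 :=
  pd_eq_zero_of_notMem fun h' => hx (closure_minimal (fun y hy => by
    by_contra h''; exact hy (h y h'')) (isClosed_tsupport w) h')

theorem conormal_eq_zero_of_notMem {a : Fin 3 → Fin 3 → E3 → ℝ} {w : E3 → ℝ} {k : Fin 3} {x : E3}
    (hx : x ∉ tsupport w) : conormal a w k x = 0 := by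
  simp [conormal, pd_eq_zero_of_notMem hx]

theorem energy_eq_zero_of_notMem {a : Fin 3 → Fin 3 → E3 → ℝ} {w : E3 → ℝ} {x : E3}
    (hx : x ∉ tsupport w) : energy a w x = 0 := by
  simp [energy, pd_eq_zero_of_notMem hx]

theorem contDiff_carlemanForm {a : Fin 3 → Fin 3 → E3 → ℝ} {X : Fin 3 → E3 → ℝ} {q g w : E3 → ℝ}
    (ha : ∀ j k, Sm (a j k)) (hX : ∀ l, Sm (X l)) (hq : Sm q) (hg : Sm g) (hw : Sm w) :
    Sm (carlemanForm a X q g w) := by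
  unfold carlemanForm; fun_prop

theorem carlemanForm_eq_zero_of_notMem {a : Fin 3 → Fin 3 → E3 → ℝ} {X : Fin 3 → E3 → ℝ}
    {q g w : E3 → ℝ} {x : E3} (hx : x ∉ tsupport w) : carlemanForm a X q g w x = 0 := by
  simp [carlemanForm, conormal_eq_zero_of_notMem hx, energy_eq_zero_of_notMem hx,
    pd_eq_zero_of_notMem hx, image_eq_zero_of_notMem_tsupport hx]

theorem integral_carlemanForm_le {a : Fin 3 → Fin 3 → E3 → ℝ} {X : Fin 3 → E3 → ℝ}
    {q g w F E : E3 → ℝ} (ha : ∀ j k, Sm (a j k)) (hsym : ∀ j k, a j k = a k j)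
    (hX : ∀ l, Sm (X l)) (hq : Sm q) (hg : Sm g) (hw : Sm w) (hcw : HasCompactSupport w)
    (hF : Sm F) (hE : Sm E) (hF0 : ∀ x, x ∉ tsupport w → F x = 0)
    (hE0 : ∀ x, x ∉ tsupport w → E x = 0)
    (hFE : ∀ x, (∑ j, pd j (conormal a w j) x) + q x * w x
      - (2 * (∑ l, X l x * pd l w x) + g x * w x) = F x - E x) :
    ∫ x, carlemanForm a X q g w x ≤ (∫ x, F x ^ 2) + ∫ x, E x ^ 2 := by
  have hV : ∀ j, Sm (carlemanField a X q g w j) := fun j => by unfold carlemanField; fun_prop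
  have hV0 : ∀ j x, x ∉ tsupport w → carlemanField a X q g w j x = 0 := fun j x hx => by
    simp [carlemanField, conormal_eq_zero_of_notMem hx, energy_eq_zero_of_notMem hx,
      image_eq_zero_of_notMem_tsupport hx]
  have hVi : ∀ j, Integrable (pd j (carlemanField a X q g w j)) := fun j =>
    sm_integrable_of_forall (contDiff_pd (hV j)) hcw fun x hx => pd_eq_zero_of_forall (hV0 j) hx
  have hFi : Integrable (fun x => F x ^ 2) :=
    sm_integrable_of_forall (by fun_prop) hcw fun x hx => by simp [hF0 x hx]
  have hEi : Integrable (fun x => E x ^ 2) :=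
    sm_integrable_of_forall (by fun_prop) hcw fun x hx => by simp [hE0 x hx]
  have hJi : Integrable (carlemanForm a X q g w) :=
    sm_integrable_of_forall (contDiff_carlemanForm ha hX hq hg hw) hcw fun x hx =>
      carlemanForm_eq_zero_of_notMem hx
  have hDi : Integrable (fun x => ∑ j, pd j (carlemanField a X q g w j) x) :=
    integrable_finsetSum _ fun j _ => hVi j
  have hD0 : ∫ x, ∑ j, pd j (carlemanField a X q g w j) x = 0 := by
    rw [integral_finsetSum _ fun j _ => hVi j]
    simp [integral_pd_eq_zero (hV _) (hasCompactSupport_of_forall hcw (hV0 _))]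
  calc ∫ x, carlemanForm a X q g w x
      = (∫ x, ∑ j, pd j (carlemanField a X q g w j) x) + ∫ x, carlemanForm a X q g w x := by
        rw [hD0, zero_add]
    _ = ∫ x, ((∑ j, pd j (carlemanField a X q g w j) x) + carlemanForm a X q g w x) :=
        (integral_add hDi hJi).symm
    _ ≤ ∫ x, (F x ^ 2 + E x ^ 2) := by
        refine integral_mono (hDi.add hJi) (hFi.add hEi) fun x => ?_
        rw [← carleman_identity ha hsym hX hq hg hw x]
        have h := hFE x
        set S := (∑ j, pd j (conormal a w j) x) + q x * w x
        set T := 2 * (∑ l, X l x * pd l w x) + g x * w x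
        have h1 : (S - T) ^ 2 = (F x - E x) ^ 2 := by rw [h]
        nlinarith [sq_nonneg (S + T), sq_nonneg (F x + E x)]
    _ = _ := integral_add hFi hEi

@[fun_prop]
theorem contDiff_coord (i : Fin 3) : Sm (fun x : E3 => x i) :=
  (EuclideanSpace.proj (𝕜 := ℝ) i : E3 →L[ℝ] ℝ).contDiff

theorem pd_coord (i j : Fin 3) : pd i (fun x : E3 => x j) = fun _ => if i = j then 1 else 0 := by
  funext x
  have : fderiv ℝ (fun x : E3 => x j) x = EuclideanSpace.proj (𝕜 := ℝ) j :=
    (EuclideanSpace.proj (𝕜 := ℝ) j : E3 →L[ℝ] ℝ).fderiv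
  simp [pd, this, eq_comm]

/-- The squared distance to `c`. -/
def nsq (c x : E3) : ℝ := ∑ i, (x i - c i) ^ 2

@[fun_prop]
theorem contDiff_nsq (c : E3) : Sm (nsq c) := by
  unfold nsq; fun_prop

theorem nsq_eq (c x : E3) : nsq c x = dist x c ^ 2 := by
  rw [EuclideanSpace.dist_eq, Real.sq_sqrt (Finset.sum_nonneg fun _ _ => sq_nonneg _)]
  simp [nsq, Real.dist_eq, sq_abs]

theorem pd_nsq (c x : E3) (j : Fin 3) : pd j (nsq c) x = 2 * (x j - c j) := by
  unfold nsq
  simp (disch := fun_prop) only [pd_add, pd_sub, pd_sq, pd_const, pd_coord, Fin.sum_univ_three]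
  fin_cases j <;> simp

/-- A smooth function equal to the `p`-th power of the distance to `c` outside the ball of radius
`ε` and vanishing near `c`. -/
def rpw (c : E3) (ε p : ℝ) (x : E3) : ℝ :=
  Real.smoothTransition ((4 * nsq c x - ε ^ 2) / (3 * ε ^ 2)) * nsq c x ^ (p / 2)

variable {c x : E3} {ε p : ℝ}

theorem rpw_eq (hε : 0 < ε) (h : ε ≤ dist x c) : rpw c ε p x = dist x c ^ p := by
  rw [rpw, nsq_eq, Real.smoothTransition.one_of_one_le, one_mul, ← Real.rpow_natCast,
    ← Real.rpow_mul dist_nonneg]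
  · congr 1; push_cast; ring
  · rw [le_div_iff₀ (by positivity)]
    nlinarith

theorem rpw_nonneg : 0 ≤ rpw c ε p x :=
  mul_nonneg (Real.smoothTransition.nonneg _)
    (Real.rpow_nonneg (by rw [nsq_eq]; positivity) _)

theorem sm_rpw (hε : 0 < ε) : Sm (rpw c ε p) := by
  rw [contDiff_iff_contDiffAt]
  intro x
  by_cases hx : x = c
  · have : rpw c ε p =ᶠ[nhds x] fun _ => 0 := by
      filter_upwards [Metric.ball_mem_nhds x (half_pos hε)] with y hy
      rw [hx, mem_ball] at hy
      rw [rpw, Real.smoothTransition.zero_of_nonpos, zero_mul]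
      refine div_nonpos_of_nonpos_of_nonneg ?_ (by positivity)
      rw [nsq_eq]
      nlinarith [dist_nonneg (x := y) (y := c)]
    exact contDiffAt_const.congr_of_eventuallyEq this
  · have h0 : nsq c x ≠ 0 := by
      rw [nsq_eq]; exact pow_ne_zero _ (dist_ne_zero.2 hx)
    have h1 : ContDiff ℝ ((⊤ : ℕ∞) : WithTop ℕ∞)
        (fun x => Real.smoothTransition ((4 * nsq c x - ε ^ 2) / (3 * ε ^ 2))) :=
      Real.smoothTransition.contDiff.comp (by fun_prop)
    exact h1.contDiffAt.mul ((contDiff_nsq c).contDiffAt.rpow_const_of_ne h0)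

theorem isOpen_lt_dist (c : E3) (ε : ℝ) : IsOpen {x : E3 | ε < dist x c} :=
  isOpen_lt continuous_const (by fun_prop)

theorem pd_rpw (hε : 0 < ε) (h : ε < dist x c) (j : Fin 3) :
    pd j (rpw c ε p) x = p * (x j - c j) * rpw c ε (p - 2) x := by
  have hr : 0 < dist x c := hε.trans h
  have h0 : nsq c x ≠ 0 := by rw [nsq_eq]; positivity
  have e1 : pd j (rpw c ε p) x = pd j (fun x => nsq c x ^ (p / 2)) x := by
    refine pd_congr (isOpen_lt_dist c ε) (fun y hy => ?_) x h
    rw [rpw_eq hε (le_of_lt hy), nsq_eq, ← Real.rpow_natCast, ← Real.rpow_mul dist_nonneg]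
    congr 1; push_cast; ring
  have hd := ((sm_differentiableAt (contDiff_nsq c) (x := x)).hasFDerivAt).rpow_const
    (p := p / 2) (Or.inl h0)
  rw [e1, pd, hd.fderiv, rpw_eq hε h.le]
  have e2 := pd_nsq c x j
  rw [pd] at e2
  have e3 : nsq c x ^ (p / 2 - 1) = dist x c ^ (p - 2) := by
    rw [nsq_eq, ← Real.rpow_natCast, ← Real.rpow_mul dist_nonneg]
    congr 1; push_cast; ring
  simp only [smul_apply, smul_eq_mul, e2, e3]
  ring

/-- The multiplier `div (a ∇ψ) + γ`. -/
def carlemanMult (a : Fin 3 → Fin 3 → E3 → ℝ) (ψ γ : E3 → ℝ) (x : E3) : ℝ :=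
  (∑ l, pd l (conormal a ψ l) x) + γ x

@[fun_prop]
theorem contDiff_carlemanMult {a : Fin 3 → Fin 3 → E3 → ℝ} {ψ γ : E3 → ℝ}
    (ha : ∀ j k, Sm (a j k)) (hψ : Sm ψ) (hγ : Sm γ) : Sm (carlemanMult a ψ γ) := by
  unfold carlemanMult; fun_prop

/-- The lower-order part of the Carleman form. -/
def carlemanErr (a : Fin 3 → Fin 3 → E3 → ℝ) (ψ γ w : E3 → ℝ) (x : E3) : ℝ :=
  4 * (∑ j, ∑ l, ∑ m, conormal a w j x * (pd j (a l m) x * pd m ψ x) * pd l w x)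
    - 2 * (∑ l, ∑ j, ∑ k, conormal a ψ l x * pd l (a j k) x * (pd j w x * pd k w x))
    + 2 * (∑ l, conormal a ψ l x * ∑ k, ∑ m, pd l (a k m) x * (pd m ψ x * pd k ψ x)) * w x ^ 2
    + 2 * (∑ j, conormal a w j x * pd j (carlemanMult a ψ γ) x) * w x

theorem carlemanForm_eq {a : Fin 3 → Fin 3 → E3 → ℝ} {ψ γ w : E3 → ℝ}
    (ha : ∀ j k, Sm (a j k)) (hsym : ∀ j k, a j k = a k j) (hψ : Sm ψ) (x : E3) :
    carlemanForm a (conormal a ψ) (energy a ψ) (carlemanMult a ψ γ) w x =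
      (4 * (∑ j, ∑ m, conormal a w j x * pd j (pd m ψ) x * conormal a w m x)
        + 2 * γ x * (energy a w x - energy a ψ x * w x ^ 2)
        + 4 * (∑ l, ∑ k, conormal a ψ l x * conormal a ψ k x * pd l (pd k ψ) x) * w x ^ 2)
      + carlemanErr a ψ γ w x := by
  have h10 := hsym 1 0
  have h20 := hsym 2 0
  have h21 := hsym 2 1
  unfold carlemanForm carlemanErr
  have e : carlemanMult a ψ γ x - ∑ l, pd l (conormal a ψ l) x = γ x := by
    rw [carlemanMult]; ring
  rw [e]
  simp (disch := fun_prop) only [pd_energy, pd_conormal, Fin.sum_univ_three]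
  generalize pd 0 (carlemanMult a ψ γ) x = g0
  generalize pd 1 (carlemanMult a ψ γ) x = g1
  generalize pd 2 (carlemanMult a ψ γ) x = g2
  simp (disch := fun_prop) only [pd_one_zero, pd_two_zero, pd_two_one, h10, h20, h21,
    Fin.sum_univ_three, conormal, energy]
  ring

theorem pd_carlemanMult {a : Fin 3 → Fin 3 → E3 → ℝ} {ψ γ : E3 → ℝ}
    (ha : ∀ j k, Sm (a j k)) (hψ : Sm ψ) (hγ : Sm γ) (j : Fin 3) (x : E3) :
    pd j (carlemanMult a ψ γ) x = (∑ l, ∑ m, (pd j (pd l (a l m)) x * pd m ψ x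
      + pd l (a l m) x * pd j (pd m ψ) x + (pd j (a l m) x * pd l (pd m ψ) x
      + a l m x * pd j (pd l (pd m ψ)) x))) + pd j γ x := by
  have : ∀ l, pd l (conormal a ψ l) =
      fun x => ∑ j, (pd l (a l j) x * pd j ψ x + a l j x * pd l (pd j ψ) x) :=
    fun l => funext fun x => pd_conormal ha hψ l l x
  unfold carlemanMult
  simp (disch := fun_prop) only [this, pd_add, pd_mul, Fin.sum_univ_three]

theorem abs_add_le_of_le {a b A B : ℝ} (ha : |a| ≤ A) (hb : |b| ≤ B) : |a + b| ≤ A + B :=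
  (abs_add_le a b).trans (add_le_add ha hb)

/-- Bounds on the data of the Carleman form at a point at distance `r` from the centre, where the
weight has size `σ`. -/
structure WeightBounds (a : Fin 3 → Fin 3 → E3 → ℝ) (ψ γ : E3 → ℝ) (x : E3) (K r σ : ℝ) :
    Prop where
  one_le : 1 ≤ K
  r_pos : 0 < r
  r_le : r ≤ 1
  one_le_σ : 1 ≤ σ
  a0 : ∀ j k, |a j k x| ≤ K
  a1 : ∀ i j k, |pd i (a j k) x| ≤ K
  a2 : ∀ l i j k, |pd l (pd i (a j k)) x| ≤ K
  ψ1 : ∀ j, |pd j ψ x| ≤ K * (σ / r)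
  ψ2 : ∀ j k, |pd j (pd k ψ) x| ≤ K * (σ / r ^ 2)
  ψ3 : ∀ j k l, |pd j (pd k (pd l ψ)) x| ≤ K * (σ / r ^ 3)
  γ0 : |γ x| ≤ K * (σ / r ^ 2)
  γ1 : ∀ j, |pd j γ x| ≤ K * (σ / r ^ 3)

theorem abs_carlemanErr_le {a : Fin 3 → Fin 3 → E3 → ℝ} {ψ γ w : E3 → ℝ}
    (ha : ∀ j k, Sm (a j k)) (hψ : Sm ψ) (hγ : Sm γ) {x : E3}
    {K r σ : ℝ} (h : WeightBounds a ψ γ x K r σ) :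
    |carlemanErr a ψ γ w x| ≤ 700 * K ^ 5 * (σ / r * gsq w x + σ ^ 3 / r ^ 3 * w x ^ 2
      + σ / r ^ 3 * (√(gsq w x) * |w x|)) := by
  obtain ⟨hK, hr, hr1, hσ, a0, a1, a2, ψ1, ψ2, ψ3, γ0, γ1⟩ := h
  set s := √(gsq w x) with hs
  have hgs : gsq w x = s ^ 2 := (Real.sq_sqrt (gsq_nonneg w x)).symm
  have b1 : ∀ j, |pd j w x| ≤ s := abs_pd_le_sqrt_gsq w x
  have hs0 : 0 ≤ s := Real.sqrt_nonneg _
  have bw : ∀ k, |conormal a w k x| ≤ 3 * (K * s) := fun k =>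
    abs_sum_three_le fun j => abs_mul_le_mul (a0 _ _) (b1 _)
  have bX : ∀ k, |conormal a ψ k x| ≤ 3 * (K * (K * (σ / r))) := fun k =>
    abs_sum_three_le fun j => abs_mul_le_mul (a0 _ _) (ψ1 _)
  have e1 : |∑ j, ∑ l, ∑ m, conormal a w j x * (pd j (a l m) x * pd m ψ x) * pd l w x|
      ≤ 3 * (3 * (3 * (3 * (K * s) * (K * (K * (σ / r))) * s))) :=
    abs_sum_three_le fun j => abs_sum_three_le fun l => abs_sum_three_le fun m =>
      abs_mul_le_mul (abs_mul_le_mul (bw _) (abs_mul_le_mul (a1 _ _ _) (ψ1 _))) (b1 _)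
  have e2 : |∑ l, ∑ j, ∑ k, conormal a ψ l x * pd l (a j k) x * (pd j w x * pd k w x)|
      ≤ 3 * (3 * (3 * (3 * (K * (K * (σ / r))) * K * (s * s)))) :=
    abs_sum_three_le fun j => abs_sum_three_le fun l => abs_sum_three_le fun m =>
      abs_mul_le_mul (abs_mul_le_mul (bX _) (a1 _ _ _)) (abs_mul_le_mul (b1 _) (b1 _))
  have e3 : |∑ l, conormal a ψ l x * ∑ k, ∑ m, pd l (a k m) x * (pd m ψ x * pd k ψ x)|
      ≤ 3 * (3 * (K * (K * (σ / r))) * (3 * (3 * (K * (K * (σ / r) * (K * (σ / r))))))) :=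
    abs_sum_three_le fun j => abs_mul_le_mul (bX _) (abs_sum_three_le fun l =>
      abs_sum_three_le fun m => abs_mul_le_mul (a1 _ _ _) (abs_mul_le_mul (ψ1 _) (ψ1 _)))
  have hr2 : σ / r ≤ σ / r ^ 3 := by
    apply div_le_div_of_nonneg_left (by linarith) (by positivity)
    calc r ^ 3 = r * (r * r) := by ring
      _ ≤ r * (1 * 1) := by gcongr
      _ = r := by ring
  have hr3 : σ / r ^ 2 ≤ σ / r ^ 3 := by
    apply div_le_div_of_nonneg_left (by linarith) (by positivity)
    calc r ^ 3 = r ^ 2 * r := by ring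
      _ ≤ r ^ 2 * 1 := by gcongr
      _ = r ^ 2 := by ring
  have hS : 0 ≤ σ / r ^ 3 := by positivity
  have bg : ∀ j, |pd j (carlemanMult a ψ γ) x| ≤ 37 * K ^ 2 * (σ / r ^ 3) := by
    intro j
    rw [pd_carlemanMult ha hψ hγ]
    refine (abs_add_le_of_le (abs_sum_three_le fun l => abs_sum_three_le fun m =>
      abs_add_le_of_le (abs_add_le_of_le (abs_mul_le_mul (a2 _ _ _ _) (ψ1 _))
        (abs_mul_le_mul (a1 _ _ _) (ψ2 _ _))) (abs_add_le_of_le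
          (abs_mul_le_mul (a1 _ _ _) (ψ2 _ _)) (abs_mul_le_mul (a0 _ _) (ψ3 _ _ _))))
      (γ1 j)).trans ?_
    have h1 : K * (K * (σ / r)) ≤ K * (K * (σ / r ^ 3)) := by gcongr
    have h2 : K * (K * (σ / r ^ 2)) ≤ K * (K * (σ / r ^ 3)) := by gcongr
    have h3 : K * (σ / r ^ 3) ≤ K * (K * (σ / r ^ 3)) := by
      have := mul_nonneg (by linarith : 0 ≤ K) hS
      nlinarith
    nlinarith
  have e4 : |∑ j, conormal a w j x * pd j (carlemanMult a ψ γ) x|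
      ≤ 3 * (3 * (K * s) * (37 * K ^ 2 * (σ / r ^ 3))) :=
    abs_sum_three_le fun j => abs_mul_le_mul (bw _) (bg _)
  have e3' := abs_mul_le_mul e3 (le_refl |w x ^ 2|)
  have e4' := abs_mul_le_mul e4 (le_refl |w x|)
  have tri : |carlemanErr a ψ γ w x| ≤
      4 * (3 * (3 * (3 * (3 * (K * s) * (K * (K * (σ / r))) * s))))
      + 2 * (3 * (3 * (3 * (3 * (K * (K * (σ / r))) * K * (s * s)))))
      + 2 * (3 * (3 * (K * (K * (σ / r))) * (3 * (3 * (K * (K * (σ / r) * (K * (σ / r)))))))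
          * |w x ^ 2|) + 2 * (3 * (3 * (K * s) * (37 * K ^ 2 * (σ / r ^ 3))) * |w x|) := by
    rw [abs_le] at *
    unfold carlemanErr
    constructor <;> nlinarith
  refine tri.trans ?_
  have hK3 : K ^ 3 ≤ K ^ 5 := pow_le_pow_right₀ hK (by norm_num)
  have t1 : 0 ≤ σ / r * s ^ 2 := by positivity
  have t2 : 0 ≤ σ ^ 3 / r ^ 3 * w x ^ 2 := by positivity
  have t3 : 0 ≤ σ / r ^ 3 * (s * |w x|) := by positivity
  have hK5 : 0 ≤ K ^ 5 := by positivity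
  rw [abs_of_nonneg (sq_nonneg (w x)), hgs]
  calc _ = 486 * K ^ 3 * (σ / r * s ^ 2) + 162 * K ^ 5 * (σ ^ 3 / r ^ 3 * w x ^ 2)
        + 666 * K ^ 3 * (σ / r ^ 3 * (s * |w x|)) := by field_simp; ring
    _ ≤ 700 * K ^ 5 * (σ / r * s ^ 2) + 700 * K ^ 5 * (σ ^ 3 / r ^ 3 * w x ^ 2)
        + 700 * K ^ 5 * (σ / r ^ 3 * (s * |w x|)) := by
        gcongr <;> linarith
    _ = _ := by ring

theorem sum_mul_hessian_weight (p ω : Fin 3 → ℝ) (A α : ℝ) :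
    ∑ j, ∑ m, p j * (A * ((α + 2) * (ω j * ω m) - if j = m then 1 else 0)) * p m
      = A * ((α + 2) * (∑ j, p j * ω j) ^ 2 - ∑ j, p j ^ 2) := by
  simp [Fin.sum_univ_three]
  ring

/-- The main part of the Carleman form is bounded below. -/
theorem carleman_main_ge {a : Fin 3 → Fin 3 → E3 → ℝ} {ψ γ w : E3 → ℝ} {x : E3}
    {α σ r κ g₀ : ℝ} {ω : Fin 3 → ℝ} (hα : 0 < α) (hσ : 0 < σ) (hr : 0 < r)
    (h1 : ∀ j, pd j ψ x = -(α * σ / r) * ω j)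
    (h2 : ∀ j k, pd j (pd k ψ) x
      = α * σ / r ^ 2 * ((α + 2) * (ω j * ω k) - if j = k then 1 else 0))
    (h3 : γ x = 2 * g₀ * (α * σ / r ^ 2)) (hω : ∑ j, ω j ^ 2 = 1)
    (cc1 : ∀ ξ : Fin 3 → ℝ, (∑ k, (∑ j, a k j x * ξ j) ^ 2) + κ * ∑ j, ξ j ^ 2
      ≤ g₀ * ∑ k, (∑ j, a k j x * ξ j) * ξ k)
    (cc2 : ∀ ξ : Fin 3 → ℝ, ∑ j, ξ j ^ 2 = 1 → (∑ k, (∑ j, a k j x * ξ j) ^ 2)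
      + g₀ * (∑ k, (∑ j, a k j x * ξ j) * ξ k) + κ
      ≤ (α + 2) * (∑ k, (∑ j, a k j x * ξ j) * ξ k) ^ 2) :
    4 * α * κ * (σ / r ^ 2 * gsq w x) + 4 * α ^ 3 * κ * (σ ^ 3 / r ^ 4 * w x ^ 2) ≤
      4 * (∑ j, ∑ m, conormal a w j x * pd j (pd m ψ) x * conormal a w m x)
        + 2 * γ x * (energy a w x - energy a ψ x * w x ^ 2)
        + 4 * (∑ l, ∑ k, conormal a ψ l x * conormal a ψ k x * pd l (pd k ψ) x) * w x ^ 2 := by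
  have c1 := cc1 (fun j => pd j w x)
  have c2 := cc2 ω hω
  have hX : ∀ k, conormal a ψ k x = -(α * σ / r) * ∑ j, a k j x * ω j := by
    intro k
    simp only [conormal, h1, Fin.sum_univ_three]
    ring
  set y : Fin 3 → ℝ := fun k => ∑ j, a k j x * ω j with hy
  have hXX : ∑ l, ∑ k, conormal a ψ l x * conormal a ψ k x * pd l (pd k ψ) x
      = (α * σ / r) ^ 2 * ∑ l, ∑ k, y l * pd l (pd k ψ) x * y k := by
    simp only [hX, Fin.sum_univ_three, hy]
    ring
  have hE : energy a ψ x = (α * σ / r) ^ 2 * ∑ k, y k * ω k := by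
    simp only [energy, hX, h1, Fin.sum_univ_three, hy]
    ring
  rw [hXX, hE, h3]
  simp only [h2, sum_mul_hessian_weight]
  set m := ∑ k, y k * ω k with hm
  set pω := ∑ j, conormal a w j x * ω j
  have hP : 0 ≤ α * σ / r ^ 2 := by positivity
  have hQ : 0 ≤ (α * σ / r) ^ 2 * (α * σ / r ^ 2) * w x ^ 2 := by positivity
  have k1 := mul_le_mul_of_nonneg_left c1 hP
  have k2 := mul_le_mul_of_nonneg_left c2 hQ
  have hg : gsq w x = ∑ j, pd j w x ^ 2 := rfl
  have he : energy a w x = ∑ k, (∑ j, a k j x * pd j w x) * pd k w x := rfl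
  have hcw : ∑ k, conormal a w k x ^ 2 = ∑ k, (∑ j, a k j x * pd j w x) ^ 2 := rfl
  rw [← hg, ← he, ← hcw] at k1
  have hpω : 0 ≤ α * σ / r ^ 2 * ((α + 2) * pω ^ 2) := by positivity
  have e1 : 4 * α * κ * (σ / r ^ 2 * gsq w x) = 4 * (α * σ / r ^ 2 * (κ * gsq w x)) := by ring
  have e2 : 4 * α ^ 3 * κ * (σ ^ 3 / r ^ 4 * w x ^ 2)
      = 4 * ((α * σ / r) ^ 2 * (α * σ / r ^ 2) * w x ^ 2 * κ) := by field_simp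
  rw [e1, e2]
  clear_value m pω
  nlinarith

/-- The remainder in the conjugated operator. -/
def carlemanRem (a : Fin 3 → Fin 3 → E3 → ℝ) (ψ γ w : E3 → ℝ) (x : E3) : ℝ :=
  -(∑ j, ∑ k, pd j (a j k) x * pd k w x)
    + ((∑ j, ∑ k, pd j (a j k) x * pd k ψ x) + γ x) * w x

theorem carlemanRem_sq_le {a : Fin 3 → Fin 3 → E3 → ℝ} {ψ γ w : E3 → ℝ} {x : E3}
    {K r σ : ℝ} (h : WeightBounds a ψ γ x K r σ) :
    carlemanRem a ψ γ w x ^ 2 ≤ 200 * K ^ 5 * (gsq w x + σ ^ 2 / r ^ 4 * w x ^ 2) := by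
  obtain ⟨hK, hr, hr1, hσ, a0, a1, a2, ψ1, ψ2, ψ3, γ0, γ1⟩ := h
  set s := √(gsq w x) with hs
  have hgs : gsq w x = s ^ 2 := (Real.sq_sqrt (gsq_nonneg w x)).symm
  have b1 : ∀ j, |pd j w x| ≤ s := abs_pd_le_sqrt_gsq w x
  have hs0 : 0 ≤ s := Real.sqrt_nonneg _
  have e1 : |∑ j, ∑ k, pd j (a j k) x * pd k w x| ≤ 3 * (3 * (K * s)) :=
    abs_sum_three_le fun j => abs_sum_three_le fun k => abs_mul_le_mul (a1 _ _ _) (b1 _)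
  have e2 : |∑ j, ∑ k, pd j (a j k) x * pd k ψ x| ≤ 3 * (3 * (K * (K * (σ / r)))) :=
    abs_sum_three_le fun j => abs_sum_three_le fun k => abs_mul_le_mul (a1 _ _ _) (ψ1 _)
  have e3 := abs_mul_le_mul (abs_add_le_of_le e2 γ0) (le_refl |w x|)
  have e4 := abs_add_le_of_le ((abs_neg _).trans_le e1) e3
  have hr2 : σ / r ≤ σ / r ^ 2 := by
    apply div_le_div_of_nonneg_left (by linarith) (by positivity)
    nlinarith
  have hS : 0 ≤ σ / r ^ 2 := by positivity
  have hy := abs_nonneg (w x)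
  have e5 : |carlemanRem a ψ γ w x| ≤ 10 * K ^ 2 * (s + σ / r ^ 2 * |w x|) := by
    refine e4.trans ?_
    have h1 : K * (K * (σ / r)) ≤ K * (K * (σ / r ^ 2)) := by gcongr
    have h3 : K * (σ / r ^ 2) ≤ K * (K * (σ / r ^ 2)) := by
      have := mul_nonneg (by linarith : 0 ≤ K) hS
      nlinarith
    have h4 : K * s ≤ K ^ 2 * s := by
      have : K ≤ K ^ 2 := by nlinarith
      gcongr
    have h5 : 0 ≤ K ^ 2 * s := by positivity
    calc _ ≤ 10 * (K ^ 2 * s) + 10 * (K * (K * (σ / r ^ 2))) * |w x| := by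
          refine add_le_add (by linarith) (mul_le_mul_of_nonneg_right (by linarith) hy)
      _ = _ := by ring
  calc carlemanRem a ψ γ w x ^ 2 = |carlemanRem a ψ γ w x| ^ 2 := (sq_abs _).symm
    _ ≤ (10 * K ^ 2 * (s + σ / r ^ 2 * |w x|)) ^ 2 := by gcongr
    _ = 100 * K ^ 4 * (s + σ / r ^ 2 * |w x|) ^ 2 := by ring
    _ ≤ 100 * K ^ 4 * (2 * (s ^ 2 + (σ / r ^ 2 * |w x|) ^ 2)) := by
        gcongr
        nlinarith [sq_nonneg (s - σ / r ^ 2 * |w x|)]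
    _ = 200 * K ^ 4 * (gsq w x + σ ^ 2 / r ^ 4 * w x ^ 2) := by
        rw [hgs, mul_pow, sq_abs]; ring
    _ ≤ _ := by
        have : K ^ 4 ≤ K ^ 5 := pow_le_pow_right₀ hK (by norm_num)
        have := gsq_nonneg w x
        gcongr

theorem carleman_absorb {K κ' r σ s2 y2 e M E2 : ℝ} (hK : 1 ≤ K) (hκ : 0 < κ') (hr : 0 < r)
    (hs2 : 0 ≤ s2) (hy2 : 0 ≤ y2) (hσ : 1 ≤ σ)
    (hrs : 4000 * K ^ 5 * r ≤ κ') (hrs' : 4000 * K ^ 5 ≤ κ' * σ) (hr1 : r ≤ 1)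
    (hM : 4 * κ' * (σ / r ^ 2 * s2 + σ ^ 3 / r ^ 4 * y2) ≤ M)
    (he : |e| ≤ 700 * K ^ 5 * (σ / r * s2 + σ ^ 3 / r ^ 3 * y2 + σ / r ^ 3 * (√s2 * √y2)))
    (hE2 : E2 ≤ 200 * K ^ 5 * (s2 + σ ^ 2 / r ^ 4 * y2)) :
    κ' * (σ / r ^ 2 * s2 + σ ^ 3 / r ^ 4 * y2) ≤ M + e - E2 := by
  set P := σ / r ^ 2 * s2 with hP
  set Q := σ ^ 3 / r ^ 4 * y2 with hQ
  have hP0 : 0 ≤ P := by positivity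
  have hQ0 : 0 ≤ Q := by positivity
  have hK5 : 0 < K ^ 5 := by positivity
  have i1 : σ / r * s2 = r * P := by rw [hP]; field_simp
  have i2 : σ ^ 3 / r ^ 3 * y2 = r * Q := by rw [hQ]; field_simp
  have i3 : σ * (σ / r ^ 3 * (√s2 * √y2)) ≤ P + Q := by
    have e1 : P = (√σ / r * √s2) ^ 2 := by
      rw [mul_pow, div_pow, Real.sq_sqrt hs2, Real.sq_sqrt (by linarith)]
    have e2 : Q = (√σ * σ / r ^ 2 * √y2) ^ 2 := by
      rw [mul_pow, div_pow, mul_pow, Real.sq_sqrt hy2, Real.sq_sqrt (by linarith), hQ]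
      ring
    have e3 : σ * (σ / r ^ 3 * (√s2 * √y2)) = (√σ / r * √s2) * (√σ * σ / r ^ 2 * √y2) := by
      have := Real.mul_self_sqrt (by linarith : 0 ≤ σ)
      field_simp
      linear_combination (-(√s2 * √y2)) * this
    rw [e1, e2, e3]
    nlinarith [sq_nonneg (√σ / r * √s2 - √σ * σ / r ^ 2 * √y2),
      sq_nonneg (√σ / r * √s2 + √σ * σ / r ^ 2 * √y2)]
  have i4 : s2 ≤ r * P := by
    have : r * P = σ / r * s2 := i1.symm
    rw [this]
    have : 1 ≤ σ / r := by rw [le_div_iff₀ hr]; linarith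
    nlinarith
  have i5 : σ * (σ ^ 2 / r ^ 4 * y2) = Q := by rw [hQ]; ring
  set T := σ / r ^ 3 * (√s2 * √y2)
  set U := σ ^ 2 / r ^ 4 * y2
  have hT : 0 ≤ T := by positivity
  have hU : 0 ≤ U := by positivity
  rw [i1, i2] at he
  have j1 : 4000 * K ^ 5 * T ≤ κ' * (P + Q) :=
    (mul_le_mul_of_nonneg_right hrs' hT).trans (by nlinarith)
  have j2 : 4000 * K ^ 5 * U ≤ κ' * Q :=
    (mul_le_mul_of_nonneg_right hrs' hU).trans (by nlinarith)
  have j3 : 4000 * K ^ 5 * (r * P) ≤ κ' * P := by nlinarith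
  have j4 : 4000 * K ^ 5 * (r * Q) ≤ κ' * Q := by nlinarith
  have j5 : 4000 * K ^ 5 * s2 ≤ κ' * P := by nlinarith
  have he' := (abs_le.1 he).1
  nlinarith

theorem op2_exp_mul {a : Fin 3 → Fin 3 → E3 → ℝ} {ψ u : E3 → ℝ} (hsym : ∀ j k, a j k = a k j)
    (hψ : Sm ψ) (hu : Sm u) (x : E3) :
    op2 a (fun x => Real.exp (ψ x) * u x) x + energy a ψ x * (Real.exp (ψ x) * u x)
      - 2 * (∑ k, conormal a ψ k x * pd k (fun x => Real.exp (ψ x) * u x) x)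
      - op2 a ψ x * (Real.exp (ψ x) * u x) = Real.exp (ψ x) * op2 a u x := by
  have h10 := hsym 1 0
  have h20 := hsym 2 0
  have h21 := hsym 2 1
  unfold op2 conormal energy conormal
  simp (disch := fun_prop) only [pd_add, pd_mul, pd_exp, pd_one_zero, pd_two_zero, pd_two_one, h10,
    h20, h21, Fin.sum_univ_three]
  ring

theorem tsupport_mul_subset {φ u : E3 → ℝ} : tsupport (fun x => φ x * u x) ⊆ tsupport u :=
  tsupport_mul_subset_right

theorem integral_carlemanForm_exp_le {a : Fin 3 → Fin 3 → E3 → ℝ} {ψ γ u : E3 → ℝ}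
    (ha : ∀ j k, Sm (a j k)) (hsym : ∀ j k, a j k = a k j) (hψ : Sm ψ) (hγ : Sm γ) (hu : Sm u)
    (hcu : HasCompactSupport u) :
    ∫ x, carlemanForm a (conormal a ψ) (energy a ψ) (carlemanMult a ψ γ)
        (fun x => Real.exp (ψ x) * u x) x
      ≤ (∫ x, (Real.exp (ψ x) * op2 a u x) ^ 2)
        + ∫ x, carlemanRem a ψ γ (fun x => Real.exp (ψ x) * u x) x ^ 2 := by
  set w := fun x => Real.exp (ψ x) * u x with hw
  have hws : Sm w := by fun_prop
  have hcw : HasCompactSupport w := hcu.mul_left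
  refine integral_carlemanForm_le ha hsym (by fun_prop) (by fun_prop) (by fun_prop) hws hcw
    (by fun_prop) (by unfold carlemanRem; fun_prop) (fun x hx => ?_) (fun x hx => ?_) fun x => ?_
  · rw [← op2_exp_mul hsym hψ hu]
    simp only [← hw, op2_eq_zero_of_notMem hx, pd_eq_zero_of_notMem hx]
    have : Real.exp (ψ x) * u x = 0 := image_eq_zero_of_notMem_tsupport (f := w) hx
    simp [this]
  · simp [carlemanRem, pd_eq_zero_of_notMem hx, image_eq_zero_of_notMem_tsupport hx]
  · have h := op2_exp_mul (u := u) hsym hψ hu x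
    simp only [← hw] at h
    rw [← h]
    have e1 : ∀ f : E3 → ℝ, Sm f → ∑ j, pd j (conormal a f j) x
        = (∑ j, ∑ k, pd j (a j k) x * pd k f x) + op2 a f x := by
      intro f hf
      simp only [pd_conormal ha hf, op2, Finset.sum_add_distrib]
    rw [carlemanMult, carlemanRem, e1 w hws, e1 ψ hψ]
    simp only [hw]
    ring

/-- Coefficients for which the Carleman estimate with weight `exp (τ r ^ (-α))` holds on `B`. -/
structure CarlemanCoeff (a : Fin 3 → Fin 3 → E3 → ℝ) (B : Set E3) (α κ g₀ K : ℝ) : Prop where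
  smooth : ∀ j k, Sm (a j k)
  symm : ∀ j k, a j k = a k j
  one_le : 1 ≤ K
  κ_pos : 0 < κ
  g₀_pos : 0 < g₀
  elliptic : ∀ x ∈ B, ∀ ξ : Fin 3 → ℝ, κ * (∑ i, ξ i ^ 2) ≤ ∑ j, ∑ k, a j k x * ξ j * ξ k
  a0 : ∀ x ∈ B, ∀ j k, |a j k x| ≤ K
  a1 : ∀ x ∈ B, ∀ i j k, |pd i (a j k) x| ≤ K
  a2 : ∀ x ∈ B, ∀ l i j k, |pd l (pd i (a j k)) x| ≤ K
  cc1 : ∀ x ∈ B, ∀ ξ : Fin 3 → ℝ, (∑ k, (∑ j, a k j x * ξ j) ^ 2) + κ * ∑ j, ξ j ^ 2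
      ≤ g₀ * ∑ k, (∑ j, a k j x * ξ j) * ξ k
  cc2 : ∀ x ∈ B, ∀ ξ : Fin 3 → ℝ, ∑ j, ξ j ^ 2 = 1 → (∑ k, (∑ j, a k j x * ξ j) ^ 2)
      + g₀ * (∑ k, (∑ j, a k j x * ξ j) * ξ k) + κ
      ≤ (α + 2) * (∑ k, (∑ j, a k j x * ξ j) * ξ k) ^ 2

section Weights

variable {c x : E3} {ε p : ℝ}

theorem pd_pd_rpw (hε : 0 < ε) (h : ε < dist x c) (j k : Fin 3) :
    pd j (pd k (rpw c ε p)) x = p * (if j = k then 1 else 0) * rpw c ε (p - 2) x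
      + p * (p - 2) * (x k - c k) * (x j - c j) * rpw c ε (p - 4) x := by
  have h1 : pd j (pd k (rpw c ε p)) x
      = pd j (fun x => p * (x k - c k) * rpw c ε (p - 2) x) x :=
    pd_congr (isOpen_lt_dist c ε) (fun y hy => pd_rpw hε hy k) x h
  have hs : Sm (rpw c ε (p - 2)) := sm_rpw hε
  rw [h1]
  simp (disch := fun_prop) only [pd_mul, pd_const, pd_sub, pd_coord]
  rw [pd_rpw hε h, show p - 2 - 2 = p - 4 by ring]
  ring

theorem pd_pd_pd_rpw (hε : 0 < ε) (h : ε < dist x c) (i j k : Fin 3) :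
    pd i (pd j (pd k (rpw c ε p))) x =
      p * (p - 2) * ((if j = k then 1 else 0) * (x i - c i) + (if i = k then 1 else 0) * (x j - c j)
        + (if i = j then 1 else 0) * (x k - c k)) * rpw c ε (p - 4) x
      + p * (p - 2) * (p - 4) * (x k - c k) * (x j - c j) * (x i - c i) * rpw c ε (p - 6) x := by
  have h1 : pd i (pd j (pd k (rpw c ε p))) x
      = pd i (fun x => p * (if j = k then 1 else 0) * rpw c ε (p - 2) x
      + p * (p - 2) * (x k - c k) * (x j - c j) * rpw c ε (p - 4) x) x :=
    pd_congr (isOpen_lt_dist c ε) (fun y hy => pd_pd_rpw hε hy j k) x h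
  have hs : Sm (rpw c ε (p - 2)) := sm_rpw hε
  have hs : Sm (rpw c ε (p - 4)) := sm_rpw hε
  rw [h1]
  simp (disch := fun_prop) only [pd_add, pd_mul, pd_const, pd_sub, pd_coord]
  rw [pd_rpw hε h, pd_rpw hε h, show p - 2 - 2 = p - 4 by ring, show p - 4 - 2 = p - 6 by ring]
  ring

theorem abs_sub_coord_le (c x : E3) (j : Fin 3) : |x j - c j| ≤ dist x c := by
  rw [dist_eq_norm]
  exact PiLp.norm_apply_le (x - c) j

theorem abs_ite_le_one (P : Prop) [Decidable P] : |(if P then (1 : ℝ) else 0)| ≤ 1 := by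
  split_ifs <;> simp

theorem rpow_sub_nat {r : ℝ} (hr : 0 < r) (p : ℝ) (n : ℕ) :
    r ^ (p - n) = r ^ p / r ^ n := by
  rw [Real.rpow_sub hr, Real.rpow_natCast]

theorem abs_pd_rpw_le (hε : 0 < ε) (h : ε < dist x c) (j : Fin 3) :
    |pd j (rpw c ε p) x| ≤ |p| * (dist x c ^ p / dist x c) := by
  have hr : 0 < dist x c := hε.trans h
  rw [pd_rpw hε h, rpw_eq hε h.le, show p - 2 = p - (2 : ℕ) by norm_num, rpow_sub_nat hr]
  have h1 := abs_sub_coord_le c x j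
  have h2 : 0 ≤ dist x c ^ p := Real.rpow_nonneg hr.le _
  refine (abs_mul_le_mul (abs_mul_le_mul (le_refl |p|) h1)
    (abs_of_nonneg (by positivity)).le).trans_eq ?_
  field_simp

theorem abs_pd_pd_rpw_le (hε : 0 < ε) (h : ε < dist x c) (j k : Fin 3) :
    |pd j (pd k (rpw c ε p)) x| ≤ (|p| + |p| * |p - 2|) * (dist x c ^ p / dist x c ^ 2) := by
  have hr : 0 < dist x c := hε.trans h
  rw [pd_pd_rpw hε h, rpw_eq hε h.le, rpw_eq hε h.le, show p - 2 = p - (2 : ℕ) by norm_num,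
    show p - 4 = p - (4 : ℕ) by norm_num, rpow_sub_nat hr, rpow_sub_nat hr]
  have h1 := abs_sub_coord_le c x
  have h2 : 0 ≤ dist x c ^ p := Real.rpow_nonneg hr.le _
  refine (abs_add_le_of_le (abs_mul_le_mul (abs_mul_le_mul (le_refl |p|) (abs_ite_le_one _))
    (abs_of_nonneg (by positivity)).le) (abs_mul_le_mul (abs_mul_le_mul (abs_mul_le_mul
      (abs_mul_le_mul (le_refl |p|) (le_refl |p - _|)) (h1 k)) (h1 j))
    (abs_of_nonneg (by positivity)).le)).trans_eq ?_
  field_simp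

theorem abs_pd_pd_pd_rpw_le (hε : 0 < ε) (h : ε < dist x c) (i j k : Fin 3) :
    |pd i (pd j (pd k (rpw c ε p))) x| ≤
      (|p| * |p - 2| * 3 + |p| * |p - 2| * |p - 4|) * (dist x c ^ p / dist x c ^ 3) := by
  have hr : 0 < dist x c := hε.trans h
  rw [pd_pd_pd_rpw hε h, rpw_eq hε h.le, rpw_eq hε h.le, show p - 6 = p - (6 : ℕ) by norm_num,
    show p - 4 = p - (4 : ℕ) by norm_num, rpow_sub_nat hr, rpow_sub_nat hr]
  have h1 := abs_sub_coord_le c x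
  have h2 : 0 ≤ dist x c ^ p := Real.rpow_nonneg hr.le _
  refine (abs_add_le_of_le (abs_mul_le_mul (abs_mul_le_mul (abs_mul_le_mul (le_refl |p|)
    (le_refl |p - 2|)) (abs_add_le_of_le (abs_add_le_of_le
      (abs_mul_le_mul (abs_ite_le_one _) (h1 _)) (abs_mul_le_mul (abs_ite_le_one _) (h1 _)))
      (abs_mul_le_mul (abs_ite_le_one _) (h1 _)))) (abs_of_nonneg (by positivity)).le)
    (abs_mul_le_mul (abs_mul_le_mul (abs_mul_le_mul (abs_mul_le_mul
      (abs_mul_le_mul (le_refl |p|) (le_refl |p - 2|)) (le_refl |p - _|)) (h1 _)) (h1 _)) (h1 _)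
    |> fun h => abs_mul_le_mul h (abs_of_nonneg (by positivity)).le)).trans_eq ?_
  field_simp
  ring

end Weights

/-- The Carleman weight `τ |x - c| ^ (-α)`, smoothed inside the ball of radius `ε`. -/
def cwt (c : E3) (ε α τ : ℝ) (x : E3) : ℝ := τ * rpw c ε (-α) x

theorem sm_cwt {c : E3} {ε α τ : ℝ} (hε : 0 < ε) : Sm (cwt c ε α τ) := by
  have : Sm (rpw c ε (-α)) := sm_rpw hε
  unfold cwt; fun_prop

theorem weightBounds {a : Fin 3 → Fin 3 → E3 → ℝ} {B : Set E3} {α κ g₀ K ε τ : ℝ} {c x : E3}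
    (h : CarlemanCoeff a B α κ g₀ K) (hα : 0 < α) (hε : 0 < ε) (hx : x ∈ B)
    (hd : ε < dist x c) (hd1 : dist x c ≤ 1) (hτ : 1 ≤ τ) :
    WeightBounds a (cwt c ε α τ) (fun x => 2 * g₀ * α * τ * rpw c ε (-α - 2) x) x
      (K * (1 + g₀) * (α + 7) ^ 3) (dist x c) (τ * dist x c ^ (-α)) := by
  have hr : 0 < dist x c := hε.trans hd
  have hK := h.one_le
  have hg := h.g₀_pos
  have hA : 1 ≤ (1 + g₀) * (α + 7) ^ 3 := by
    have : 1 ≤ (α + 7) ^ 3 := one_le_pow₀ (by linarith)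
    nlinarith
  have hKA : K ≤ K * (1 + g₀) * (α + 7) ^ 3 := by
    rw [mul_assoc]; nlinarith
  have hpos : 0 ≤ τ * dist x c ^ (-α) := mul_nonneg (by linarith) (Real.rpow_nonneg hr.le _)
  have habs : |-α| = α := by rw [abs_neg, abs_of_pos hα]
  have habs2 : |-α - 2| = α + 2 := by rw [abs_of_neg (by linarith)]; ring
  have habs4 : |-α - 4| = α + 4 := by rw [abs_of_neg (by linarith)]; ring
  have cube : (α + 7) ^ 3 = α ^ 3 + 21 * α ^ 2 + 147 * α + 343 := by ring
  have sq2 : 0 < α ^ 2 := by positivity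
  have sq3 : 0 < α ^ 3 := by positivity
  have big : ∀ y, y ≤ (α + 7) ^ 3 → y ≤ K * (1 + g₀) * (α + 7) ^ 3 := fun y hy => by
    have : 1 ≤ K * (1 + g₀) := by nlinarith
    nlinarith [pow_pos (by linarith : 0 < α + 7) 3]
  have bigg : ∀ y, y ≤ (α + 7) ^ 3 → g₀ * y ≤ K * (1 + g₀) * (α + 7) ^ 3 := fun y hy => by
    have h1 : g₀ ≤ K * (1 + g₀) := by nlinarith
    calc g₀ * y ≤ g₀ * (α + 7) ^ 3 := by gcongr
      _ ≤ _ := by gcongr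
  have hτ' : |τ| = τ := abs_of_pos (by linarith)
  have hpow : dist x c ^ (-α - 2) = dist x c ^ (-α) / dist x c ^ 2 := by
    simpa using rpow_sub_nat hr (-α) 2
  have hcwt : cwt c ε α τ = fun x => τ * rpw c ε (-α) x := rfl
  refine ⟨hK.trans hKA, hr, hd1, ?_, fun j k => (h.a0 x hx j k).trans hKA,
    fun i j k => (h.a1 x hx i j k).trans hKA, fun l i j k => (h.a2 x hx l i j k).trans hKA,
    fun j => ?_, fun j k => ?_, fun i j k => ?_, ?_, fun j => ?_⟩
  · have : 1 ≤ dist x c ^ (-α) := Real.one_le_rpow_of_pos_of_le_one_of_nonpos hr hd1 (by linarith)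
    nlinarith
  · rw [hcwt]
    simp only [pd_const_mul]
    rw [abs_mul, hτ']
    have := abs_pd_rpw_le (p := -α) hε hd j
    rw [habs] at this
    calc τ * |pd j (rpw c ε (-α)) x| ≤ τ * (α * (dist x c ^ (-α) / dist x c)) := by gcongr
      _ = α * (τ * dist x c ^ (-α) / dist x c) := by ring
      _ ≤ _ := by gcongr; exact big _ (by nlinarith)
  · rw [hcwt]
    simp only [pd_const_mul]
    rw [abs_mul, hτ']
    have := abs_pd_pd_rpw_le (p := -α) hε hd j k
    rw [habs, habs2] at this
    calc τ * |pd j (pd k (rpw c ε (-α))) x|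
        ≤ τ * ((α + α * (α + 2)) * (dist x c ^ (-α) / dist x c ^ 2)) := by gcongr
      _ = (α + α * (α + 2)) * (τ * dist x c ^ (-α) / dist x c ^ 2) := by ring
      _ ≤ _ := by gcongr; exact big _ (by nlinarith)
  · rw [hcwt]
    simp only [pd_const_mul]
    rw [abs_mul, hτ']
    have := abs_pd_pd_pd_rpw_le (p := -α) hε hd i j k
    rw [habs, habs2, habs4] at this
    calc τ * |pd i (pd j (pd k (rpw c ε (-α)))) x|
        ≤ τ * ((α * (α + 2) * 3 + α * (α + 2) * (α + 4))
          * (dist x c ^ (-α) / dist x c ^ 3)) := by gcongr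
      _ = (α * (α + 2) * 3 + α * (α + 2) * (α + 4)) * (τ * dist x c ^ (-α) / dist x c ^ 3) := by
        ring
      _ ≤ _ := by gcongr; exact big _ (by nlinarith)
  · rw [rpw_eq hε hd.le, hpow, abs_of_nonneg (by positivity)]
    calc 2 * g₀ * α * τ * (dist x c ^ (-α) / dist x c ^ 2)
        = g₀ * (2 * α) * (τ * dist x c ^ (-α) / dist x c ^ 2) := by ring
      _ ≤ _ := mul_le_mul_of_nonneg_right (bigg (2 * α) (by nlinarith)) (by positivity)
  · simp only [pd_const_mul]
    have := abs_pd_rpw_le (p := -α - 2) hε hd j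
    rw [habs2, hpow] at this
    rw [abs_mul, abs_of_nonneg (by positivity : 0 ≤ 2 * g₀ * α * τ)]
    calc 2 * g₀ * α * τ * |pd j (rpw c ε (-α - 2)) x|
        ≤ 2 * g₀ * α * τ * ((α + 2) * (dist x c ^ (-α) / dist x c ^ 2 / dist x c)) := by gcongr
      _ = g₀ * (2 * α * (α + 2)) * (τ * dist x c ^ (-α) / dist x c ^ 3) := by
        field_simp
      _ ≤ _ := mul_le_mul_of_nonneg_right (bigg (2 * α * (α + 2)) (by nlinarith)) (by positivity)

theorem carlemanForm_sub_ge {a : Fin 3 → Fin 3 → E3 → ℝ} {B : Set E3} {α κ g₀ K ε τ κ' K' : ℝ}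
    {c x : E3} {w : E3 → ℝ}
    (h : CarlemanCoeff a B α κ g₀ K) (hα : 0 < α) (hε : 0 < ε) (hx : x ∈ B)
    (hd : ε < dist x c) (hd1 : dist x c ≤ 1) (hτ : 1 ≤ τ)
    (hK' : K' = K * (1 + g₀) * (α + 7) ^ 3) (hκ0 : 0 < κ') (hκ1 : κ' ≤ α * κ)
    (hκ3 : κ' ≤ α ^ 3 * κ) (hR : 4000 * K' ^ 5 * dist x c ≤ κ') (hT : 4000 * K' ^ 5 ≤ κ' * τ) :
    κ' * (τ * dist x c ^ (-α) / dist x c ^ 2 * gsq w x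
        + (τ * dist x c ^ (-α)) ^ 3 / dist x c ^ 4 * w x ^ 2) ≤
      carlemanForm a (conormal a (cwt c ε α τ)) (energy a (cwt c ε α τ))
        (carlemanMult a (cwt c ε α τ) (fun x => 2 * g₀ * α * τ * rpw c ε (-α - 2) x)) w x
      - carlemanRem a (cwt c ε α τ) (fun x => 2 * g₀ * α * τ * rpw c ε (-α - 2) x) w x ^ 2 := by
  have hr : 0 < dist x c := hε.trans hd
  have hW := weightBounds h hα hε hx hd hd1 hτ
  rw [← hK'] at hW
  have hσ := hW.one_le_σ
  have hψ : Sm (cwt c ε α τ) := sm_cwt hε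
  have hγ : Sm (fun x => 2 * g₀ * α * τ * rpw c ε (-α - 2) x) := by
    have : Sm (rpw c ε (-α - 2)) := sm_rpw hε
    fun_prop
  have hτσ : τ ≤ τ * dist x c ^ (-α) := by
    have : 1 ≤ dist x c ^ (-α) := Real.one_le_rpow_of_pos_of_le_one_of_nonpos hr hd1 (by linarith)
    nlinarith
  have hcwt : cwt c ε α τ = fun x => τ * rpw c ε (-α) x := rfl
  have hpow2 : dist x c ^ (-α - 2) = dist x c ^ (-α) / dist x c ^ 2 := by
    simpa using rpow_sub_nat hr (-α) 2
  have hpow4 : dist x c ^ (-α - 4) = dist x c ^ (-α) / dist x c ^ 4 := by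
    simpa using rpow_sub_nat hr (-α) 4
  have hmain := carleman_main_ge (a := a) (ψ := cwt c ε α τ) (w := w) (x := x)
    (γ := fun x => 2 * g₀ * α * τ * rpw c ε (-α - 2) x)
    (α := α) (σ := τ * dist x c ^ (-α)) (r := dist x c) (κ := κ) (g₀ := g₀)
    (ω := fun j => (x j - c j) / dist x c) hα (by linarith) hr
    (fun j => by
      rw [hcwt]
      simp only [pd_const_mul]
      rw [pd_rpw hε hd, rpw_eq hε hd.le, hpow2]
      field_simp)
    (fun j k => by
      rw [hcwt]
      simp only [pd_const_mul]
      rw [pd_pd_rpw hε hd, rpw_eq hε hd.le, rpw_eq hε hd.le, hpow2, hpow4]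
      field_simp
      ring)
    (by rw [rpw_eq hε hd.le, hpow2]; ring)
    (by
      simp only [div_pow, ← Finset.sum_div]
      rw [← nsq_eq, nsq, div_self]
      have := nsq_eq c x
      rw [nsq] at this
      rw [this]
      positivity)
    (h.cc1 x hx) (h.cc2 x hx)
  rw [carlemanForm_eq h.smooth h.symm hψ]
  have herr := abs_carlemanErr_le (w := w) h.smooth hψ hγ hW
  have hrem := carlemanRem_sq_le (w := w) hW
  refine carleman_absorb hW.one_le hκ0 hr (gsq_nonneg w x) (sq_nonneg (w x)) hσ hR
    (hT.trans (by gcongr)) hd1 (le_trans ?_ hmain) ?_ hrem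
  · have p1 : 0 ≤ τ * dist x c ^ (-α) / dist x c ^ 2 * gsq w x :=
      mul_nonneg (div_nonneg (by linarith) (by positivity)) (gsq_nonneg w x)
    have p2 : 0 ≤ (τ * dist x c ^ (-α)) ^ 3 / dist x c ^ 4 * w x ^ 2 := by positivity
    nlinarith
  · rwa [Real.sqrt_sq_eq_abs]

section Multiplier

variable {a : Fin 3 → Fin 3 → E3 → ℝ} {φ u : E3 → ℝ} {x : E3} {P₁ P₂ Λ : ℝ}

theorem sq_le_sq_of_abs_le {a b : ℝ} (h : |a| ≤ b) : a ^ 2 ≤ b ^ 2 :=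
  sq_le_sq' (neg_le_of_abs_le h) (le_of_abs_le h)

theorem sq_mul_gsq_le (hφ : Sm φ) (hu : Sm u) (h1 : ∀ j, |pd j φ x| ≤ P₁) :
    φ x ^ 2 * gsq u x ≤ 2 * gsq (fun x => φ x * u x) x + 6 * (P₁ ^ 2 * u x ^ 2) := by
  have h : ∀ j, (φ x * pd j u x) ^ 2
      ≤ 2 * pd j (fun x => φ x * u x) x ^ 2 + 2 * (P₁ ^ 2 * u x ^ 2) := fun j => by
    simp (disch := fun_prop) only [pd_mul]
    have := mul_le_mul_of_nonneg_right (sq_le_sq_of_abs_le (h1 j)) (sq_nonneg (u x))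
    nlinarith [sq_nonneg (φ x * pd j u x + 2 * (pd j φ x * u x))]
  simp only [gsq, Fin.sum_univ_three]
  nlinarith [h 0, h 1, h 2]

theorem gsq_mul_le (hφ : Sm φ) (hu : Sm u) (h1 : ∀ j, |pd j φ x| ≤ P₁) :
    gsq (fun x => φ x * u x) x ≤ 2 * (φ x ^ 2 * gsq u x) + 6 * (P₁ ^ 2 * u x ^ 2) := by
  have h : ∀ j, pd j (fun x => φ x * u x) x ^ 2
      ≤ 2 * (φ x * pd j u x) ^ 2 + 2 * (P₁ ^ 2 * u x ^ 2) := fun j => by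
    simp (disch := fun_prop) only [pd_mul]
    have := mul_le_mul_of_nonneg_right (sq_le_sq_of_abs_le (h1 j)) (sq_nonneg (u x))
    nlinarith [sq_nonneg (φ x * pd j u x - (pd j φ x * u x))]
  simp only [gsq, Fin.sum_univ_three]
  nlinarith [h 0, h 1, h 2]

theorem pd_pd_mul (hφ : Sm φ) (hu : Sm u) (j k : Fin 3) :
    pd j (pd k (fun x => φ x * u x)) x = φ x * pd j (pd k u) x
      + (pd j φ x * pd k u x + pd k φ x * pd j u x + pd j (pd k φ) x * u x) := by
  simp (disch := fun_prop) only [pd_mul, pd_add]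
  ring

theorem sq_pd_pd_rest_le (h1 : ∀ j, |pd j φ x| ≤ P₁) (h2 : ∀ j k, |pd j (pd k φ) x| ≤ P₂)
    (j k : Fin 3) :
    (pd j φ x * pd k u x + pd k φ x * pd j u x + pd j (pd k φ) x * u x) ^ 2
      ≤ 6 * (P₁ ^ 2 * gsq u x) + 3 * (P₂ ^ 2 * u x ^ 2) := by
  have e : ∀ p q r : ℝ, (p + q + r) ^ 2 ≤ 3 * (p ^ 2 + q ^ 2 + r ^ 2) := fun p q r => by
    nlinarith [sq_nonneg (p - q), sq_nonneg (q - r), sq_nonneg (p - r)]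
  have i1 : ∀ j k, (pd j φ x * pd k u x) ^ 2 ≤ P₁ ^ 2 * gsq u x := fun j k => by
    rw [mul_pow]
    exact mul_le_mul (sq_le_sq_of_abs_le (h1 j)) (sq_pd_le_gsq u x k) (sq_nonneg _) (sq_nonneg _)
  have i2 : (pd j (pd k φ) x * u x) ^ 2 ≤ P₂ ^ 2 * u x ^ 2 := by
    rw [mul_pow]
    exact mul_le_mul_of_nonneg_right (sq_le_sq_of_abs_le (h2 j k)) (sq_nonneg _)
  linarith [e (pd j φ x * pd k u x) (pd k φ x * pd j u x) (pd j (pd k φ) x * u x), i1 j k, i1 k j]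

theorem sq_mul_hsq_le (hφ : Sm φ) (hu : Sm u) (h1 : ∀ j, |pd j φ x| ≤ P₁)
    (h2 : ∀ j k, |pd j (pd k φ) x| ≤ P₂) :
    φ x ^ 2 * hsq u x ≤ 2 * hsq (fun x => φ x * u x) x
      + 108 * (P₁ ^ 2 * gsq u x) + 54 * (P₂ ^ 2 * u x ^ 2) := by
  have h : ∀ j k, (φ x * pd j (pd k u) x) ^ 2 ≤ 2 * pd j (pd k (fun x => φ x * u x)) x ^ 2
      + 12 * (P₁ ^ 2 * gsq u x) + 6 * (P₂ ^ 2 * u x ^ 2) := fun j k => by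
    rw [pd_pd_mul hφ hu]
    have := sq_pd_pd_rest_le (u := u) h1 h2 j k
    set q := pd j φ x * pd k u x + pd k φ x * pd j u x + pd j (pd k φ) x * u x
    nlinarith [sq_nonneg (φ x * pd j (pd k u) x + 2 * q)]
  simp only [hsq, Fin.sum_univ_three]
  nlinarith [h 0 0, h 0 1, h 0 2, h 1 0, h 1 1, h 1 2, h 2 0, h 2 1, h 2 2]

theorem abs_op2_mul_sub_le (hΛ : ∀ j k, |a j k x| ≤ Λ) (hφ : Sm φ) (hu : Sm u)
    (h1 : ∀ j, |pd j φ x| ≤ P₁) (h2 : ∀ j k, |pd j (pd k φ) x| ≤ P₂) :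
    (op2 a (fun x => φ x * u x) x - φ x * op2 a u x) ^ 2
      ≤ 81 * Λ ^ 2 * (6 * (P₁ ^ 2 * gsq u x) + 3 * (P₂ ^ 2 * u x ^ 2)) := by
  have e : op2 a (fun x => φ x * u x) x - φ x * op2 a u x = ∑ j, ∑ k, a j k x *
      (pd j φ x * pd k u x + pd k φ x * pd j u x + pd j (pd k φ) x * u x) := by
    simp only [op2, pd_pd_mul hφ hu, Finset.mul_sum, ← Finset.sum_sub_distrib]
    refine Finset.sum_congr rfl fun j _ => Finset.sum_congr rfl fun k _ => ?_
    ring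
  set S := 6 * (P₁ ^ 2 * gsq u x) + 3 * (P₂ ^ 2 * u x ^ 2) with hS
  have hS0 : 0 ≤ S := by
    have := gsq_nonneg u x
    positivity
  have hb : |op2 a (fun x => φ x * u x) x - φ x * op2 a u x| ≤ 3 * (3 * (Λ * √S)) := by
    rw [e]
    exact abs_sum_three_le fun j => abs_sum_three_le fun k =>
      abs_mul_le_mul (hΛ j k) (Real.abs_le_sqrt (sq_pd_pd_rest_le h1 h2 j k))
  refine (sq_le_sq_of_abs_le hb).trans (le_of_eq ?_)
  rw [mul_pow, mul_pow, mul_pow, Real.sq_sqrt hS0]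
  ring

theorem sq_op2_mul_le (hΛ : ∀ j k, |a j k x| ≤ Λ) (hφ : Sm φ) (hu : Sm u)
    (h1 : ∀ j, |pd j φ x| ≤ P₁) (h2 : ∀ j k, |pd j (pd k φ) x| ≤ P₂) :
    op2 a (fun x => φ x * u x) x ^ 2 ≤ 2 * (φ x ^ 2 * op2 a u x ^ 2)
      + 162 * Λ ^ 2 * (6 * (P₁ ^ 2 * gsq u x) + 3 * (P₂ ^ 2 * u x ^ 2)) := by
  have := abs_op2_mul_sub_le (a := a) hΛ hφ hu h1 h2
  nlinarith [sq_nonneg (op2 a (fun x => φ x * u x) x - 2 * (φ x * op2 a u x))]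

end Multiplier

theorem integral_le_of_le_on_tsupport {f g w : E3 → ℝ} (hf : Sm f) (hg : Sm g)
    (hw : HasCompactSupport w) (hf0 : ∀ x, x ∉ tsupport w → f x = 0)
    (hg0 : ∀ x, x ∉ tsupport w → g x = 0) (h : ∀ x ∈ tsupport w, f x ≤ g x) :
    ∫ x, f x ≤ ∫ x, g x := by
  refine integral_mono (sm_integrable_of_forall hf hw hf0) (sm_integrable_of_forall hg hw hg0)
    fun x => ?_
  by_cases hx : x ∈ tsupport w
  · exact h x hx
  · rw [hf0 x hx, hg0 x hx]

/-- The weighted first-order density controlled by the Carleman estimate. -/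
def cdens (c : E3) (ε α τ : ℝ) (u : E3 → ℝ) (x : E3) : ℝ :=
  τ * rpw c ε (-α - 2) x * gsq u x + τ ^ 3 * rpw c ε (-(3 * α) - 4) x * u x ^ 2

section Density

variable {c x : E3} {ε α τ p : ℝ} {u : E3 → ℝ}

theorem sm_cdens (hε : 0 < ε) (hu : Sm u) : Sm (cdens c ε α τ u) := by
  have h1 : Sm (rpw c ε (-α - 2)) := sm_rpw hε
  have h2 : Sm (rpw c ε (-(3 * α) - 4)) := sm_rpw hε
  unfold cdens; fun_prop

theorem cdens_eq (hε : 0 < ε) (hd : ε < dist x c) :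
    cdens c ε α τ u x = τ * dist x c ^ (-α) / dist x c ^ 2 * gsq u x
      + (τ * dist x c ^ (-α)) ^ 3 / dist x c ^ 4 * u x ^ 2 := by
  have hr : 0 < dist x c := hε.trans hd
  have e1 : dist x c ^ (-α - 2) = dist x c ^ (-α) / dist x c ^ 2 := by
    simpa using rpow_sub_nat hr (-α) 2
  have e2 : dist x c ^ (-(3 * α) - 4) = (dist x c ^ (-α)) ^ 3 / dist x c ^ 4 := by
    have : dist x c ^ (-(3 * α) - 4) = dist x c ^ (-(3 * α)) / dist x c ^ 4 := by
      simpa using rpow_sub_nat hr (-(3 * α)) 4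
    rw [this, ← Real.rpow_natCast (dist x c ^ (-α)), ← Real.rpow_mul hr.le]
    congr 3
    push_cast; ring
  rw [cdens, rpw_eq hε hd.le, rpw_eq hε hd.le, e1, e2]
  ring

theorem cdens_eq_zero_of_notMem (hx : x ∉ tsupport u) : cdens c ε α τ u x = 0 := by
  simp [cdens, gsq_eq_zero_of_notMem hx, image_eq_zero_of_notMem_tsupport hx]

theorem le_weight (hα : 0 < α) (hr : 0 < dist x c) (hd1 : dist x c ≤ 1) (hτ : 0 ≤ τ) :
    τ ≤ τ * dist x c ^ (-α) := by
  have : 1 ≤ dist x c ^ (-α) := Real.one_le_rpow_of_pos_of_le_one_of_nonpos hr hd1 (by linarith)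
  nlinarith

/-- The lower-order terms are controlled by the density divided by `τ`. -/
theorem mul_lower_le_cdens (hα : 0 < α) (hε : 0 < ε) (hd : ε < dist x c) (hd1 : dist x c ≤ 1)
    (hτ : 1 ≤ τ) :
    τ * (gsq u x / dist x c ^ 2 + u x ^ 2 / dist x c ^ 4) ≤ cdens c ε α τ u x := by
  have hr : 0 < dist x c := hε.trans hd
  have h := le_weight hα hr hd1 (by linarith : 0 ≤ τ)
  rw [cdens_eq hε hd]
  set σ := τ * dist x c ^ (-α)
  have h3 : τ ≤ σ ^ 3 := by
    nlinarith [pow_le_pow_right₀ (by linarith : 1 ≤ σ) (by norm_num : 1 ≤ 3)]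
  have := gsq_nonneg u x
  calc τ * (gsq u x / dist x c ^ 2 + u x ^ 2 / dist x c ^ 4)
      = τ / dist x c ^ 2 * gsq u x + τ / dist x c ^ 4 * u x ^ 2 := by ring
    _ ≤ _ := by gcongr

end Density

/-- A function `u` supported in the part of `B` at distance between `ε` and `R` from `c`. -/
structure SuppIn (B : Set E3) (c : E3) (ε R : ℝ) (u : E3 → ℝ) : Prop where
  smooth : Sm u
  compact : HasCompactSupport u
  mem : ∀ x ∈ tsupport u, x ∈ B ∧ ε < dist x c ∧ dist x c < R

theorem SuppIn.mul {B : Set E3} {c : E3} {ε R : ℝ} {φ u : E3 → ℝ} (h : SuppIn B c ε R u)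
    (hφ : Sm φ) : SuppIn B c ε R (fun x => φ x * u x) := by
  have := h.smooth
  exact ⟨by fun_prop, h.compact.mul_left, fun x hx => h.mem x (tsupport_mul_subset hx)⟩

theorem abs_pd_exp_cwt_le {c x : E3} {ε α τ K : ℝ} (hε : 0 < ε)
    (hψ1 : ∀ j, |pd j (cwt c ε α τ) x| ≤ K * (τ * dist x c ^ (-α) / dist x c)) (j : Fin 3) :
    |pd j (fun x => Real.exp (cwt c ε α τ x)) x|
      ≤ Real.exp (cwt c ε α τ x) * (K * (τ * dist x c ^ (-α) / dist x c)) := by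
  have hψ : Sm (cwt c ε α τ) := sm_cwt hε
  rw [pd_exp hψ]
  exact abs_mul_le_mul (abs_of_pos (Real.exp_pos _)).le (hψ1 j)

theorem abs_pd_pd_exp_cwt_le {c x : E3} {ε α τ K : ℝ} (hε : 0 < ε) (hK : 0 ≤ K)
    (hσ : 1 ≤ τ * dist x c ^ (-α))
    (hψ1 : ∀ j, |pd j (cwt c ε α τ) x| ≤ K * (τ * dist x c ^ (-α) / dist x c))
    (hψ2 : ∀ j k, |pd j (pd k (cwt c ε α τ)) x| ≤ K * (τ * dist x c ^ (-α) / dist x c ^ 2))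
    (j k : Fin 3) :
    |pd j (pd k (fun x => Real.exp (cwt c ε α τ x))) x|
      ≤ Real.exp (cwt c ε α τ x) * ((K ^ 2 + K) * (τ * dist x c ^ (-α) / dist x c) ^ 2) := by
  have hψ : Sm (cwt c ε α τ) := sm_cwt hε
  simp (disch := fun_prop) only [pd_exp, pd_mul]
  rw [mul_assoc, ← mul_add]
  refine abs_mul_le_mul (abs_of_pos (Real.exp_pos _)).le
    ((abs_add_le_of_le (abs_mul_le_mul (hψ1 j) (hψ1 k)) (hψ2 j k)).trans ?_)
  have : τ * dist x c ^ (-α) / dist x c ^ 2 ≤ (τ * dist x c ^ (-α) / dist x c) ^ 2 := by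
    rw [div_pow]
    gcongr
    nlinarith
  nlinarith [mul_le_mul_of_nonneg_left this hK]

theorem carleman_basic {a : Fin 3 → Fin 3 → E3 → ℝ} {B : Set E3} {α κ g₀ K : ℝ}
    (h : CarlemanCoeff a B α κ g₀ K) (hα : 0 < α) :
    ∃ R > 0, R ≤ 1 ∧ ∃ τ₀ ≥ 1, ∃ C > 0, ∀ (c : E3) (ε τ : ℝ) (u : E3 → ℝ), 0 < ε → τ₀ ≤ τ →
      SuppIn B c ε R u →
      ∫ x, Real.exp (cwt c ε α τ x) ^ 2 * cdens c ε α τ u x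
        ≤ C * ∫ x, Real.exp (cwt c ε α τ x) ^ 2 * op2 a u x ^ 2 := by
  obtain ⟨K', hK'⟩ : ∃ K', K' = K * (1 + g₀) * (α + 7) ^ 3 := ⟨_, rfl⟩
  have hK1 := h.one_le
  have hκ := h.κ_pos
  have hg := h.g₀_pos
  have hK'0 : 0 < K' := by rw [hK']; positivity
  obtain ⟨κ', hκ'⟩ : ∃ κ', κ' = min (α * κ) (α ^ 3 * κ) := ⟨_, rfl⟩
  have hκ0 : 0 < κ' := by rw [hκ']; exact lt_min (by positivity) (by positivity)
  refine ⟨min 1 (κ' / (4000 * K' ^ 5)), lt_min one_pos (by positivity), min_le_left _ _,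
    max 1 (4000 * K' ^ 5 / κ'), le_max_left _ _, (3 + 6 * K' ^ 2) / κ', by positivity,
    fun c ε τ u hε hτ hu => ?_⟩
  have hτ1 : 1 ≤ τ := (le_max_left _ _).trans hτ
  have hT : 4000 * K' ^ 5 ≤ κ' * τ := by
    have := (le_max_right _ _).trans hτ
    rwa [div_le_iff₀ hκ0, mul_comm τ] at this
  set ψ := cwt c ε α τ with hψd
  have hψ : Sm ψ := sm_cwt hε
  have hus := hu.smooth
  set γ : E3 → ℝ := fun x => 2 * g₀ * α * τ * rpw c ε (-α - 2) x with hγd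
  have hγ : Sm γ := by
    have : Sm (rpw c ε (-α - 2)) := sm_rpw hε
    fun_prop
  have hE : Sm (fun x => Real.exp (ψ x)) := by fun_prop
  set w : E3 → ℝ := fun x => Real.exp (ψ x) * u x with hw
  have hws : SuppIn B c ε (min 1 (κ' / (4000 * K' ^ 5))) w := hu.mul hE
  have hwsm := hws.smooth
  have hform := integral_carlemanForm_exp_le h.smooth h.symm hψ hγ hus hu.compact
  have hsa := h.smooth
  have hFs : Sm (carlemanForm a (conormal a ψ) (energy a ψ) (carlemanMult a ψ γ) w) :=
    contDiff_carlemanForm h.smooth (by fun_prop) (by fun_prop) (by fun_prop) hwsm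
  have hRs : Sm (carlemanRem a ψ γ w) := by unfold carlemanRem; fun_prop
  have hF0 : ∀ x, x ∉ tsupport w → carlemanForm a (conormal a ψ) (energy a ψ)
      (carlemanMult a ψ γ) w x = 0 := fun x hx => carlemanForm_eq_zero_of_notMem hx
  have hR0 : ∀ x, x ∉ tsupport w → carlemanRem a ψ γ w x = 0 := fun x hx => by
    simp [carlemanRem, pd_eq_zero_of_notMem hx, image_eq_zero_of_notMem_tsupport hx]
  have hds : Sm (cdens c ε α τ w) := sm_cdens hε hwsm
  have hdu : Sm (cdens c ε α τ u) := sm_cdens hε hus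
  have hpt : ∀ x ∈ tsupport u, x ∈ B ∧ ε < dist x c ∧ dist x c ≤ 1
      ∧ 4000 * K' ^ 5 * dist x c ≤ κ' := fun x hx => by
    obtain ⟨h1, h2, h3⟩ := hu.mem x hx
    refine ⟨h1, h2, h3.le.trans (min_le_left _ _), ?_⟩
    have := h3.le.trans (min_le_right _ _)
    rwa [le_div_iff₀ (by positivity), mul_comm] at this
  have step1 : ∫ x, κ' * cdens c ε α τ w x ≤ ∫ x, (Real.exp (ψ x) * op2 a u x) ^ 2 := by
    have : ∫ x, κ' * cdens c ε α τ w x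
        ≤ ∫ x, (carlemanForm a (conormal a ψ) (energy a ψ) (carlemanMult a ψ γ) w x
          - carlemanRem a ψ γ w x ^ 2) := by
      refine integral_le_of_le_on_tsupport (by fun_prop) (by fun_prop) hws.compact
        (fun x hx => by simp [cdens_eq_zero_of_notMem hx])
        (fun x hx => by simp [hF0 x hx, hR0 x hx]) fun x hx => ?_
      obtain ⟨h1, h2, h3, h4⟩ := hpt x (tsupport_mul_subset hx)
      rw [cdens_eq hε h2]
      exact carlemanForm_sub_ge h hα hε h1 h2 h3 hτ1 hK' hκ0 (hκ'.le.trans (min_le_left _ _))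
        (hκ'.le.trans (min_le_right _ _)) h4 hT
    rw [integral_sub (sm_integrable_of_forall hFs hws.compact hF0)
      (sm_integrable_of_forall (by fun_prop) hws.compact fun x hx => by simp [hR0 x hx])] at this
    linarith
  have step2 : ∫ x, Real.exp (ψ x) ^ 2 * cdens c ε α τ u x
      ≤ ∫ x, (3 + 6 * K' ^ 2) * cdens c ε α τ w x := by
    refine integral_le_of_le_on_tsupport (by fun_prop) (by fun_prop) hu.compact
      (fun x hx => by simp [cdens_eq_zero_of_notMem hx])
      (fun x hx => mul_eq_zero_of_right _
        (cdens_eq_zero_of_notMem fun h => hx (tsupport_mul_subset h)))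
      fun x hx => ?_
    obtain ⟨h1, h2, h3, h4⟩ := hpt x hx
    have hW := weightBounds h hα hε h1 h2 h3 hτ1
    rw [← hK'] at hW
    have hr := hW.r_pos
    have hσ := hW.one_le_σ
    have := sq_mul_gsq_le hE hus (abs_pd_exp_cwt_le hε hW.ψ1)
    rw [cdens_eq hε h2, cdens_eq hε h2]
    set r := dist x c
    set σ := τ * r ^ (-α)
    have hw0 : w x ^ 2 = Real.exp (ψ x) ^ 2 * u x ^ 2 := by rw [hw]; ring
    have hg0 := gsq_nonneg w x
    have hA : 0 ≤ σ / r ^ 2 * gsq w x := by positivity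
    calc Real.exp (ψ x) ^ 2 * (σ / r ^ 2 * gsq u x + σ ^ 3 / r ^ 4 * u x ^ 2)
        = σ / r ^ 2 * (Real.exp (ψ x) ^ 2 * gsq u x) + σ ^ 3 / r ^ 4 * w x ^ 2 := by rw [hw0]; ring
      _ ≤ σ / r ^ 2 * (2 * gsq w x + 6 * ((Real.exp (ψ x) * (K' * (σ / r))) ^ 2 * u x ^ 2))
          + σ ^ 3 / r ^ 4 * w x ^ 2 := by gcongr
      _ = 2 * (σ / r ^ 2 * gsq w x) + (1 + 6 * K' ^ 2) * (σ ^ 3 / r ^ 4 * w x ^ 2) := by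
        rw [hw0]; field_simp; ring
      _ ≤ _ := by nlinarith [mul_nonneg (sq_nonneg K') hA,
        (by positivity : 0 ≤ σ ^ 3 / r ^ 4 * w x ^ 2)]
  rw [integral_const_mul] at step1 step2
  simp only [mul_pow] at step1
  calc _ ≤ _ := step2
    _ = (3 + 6 * K' ^ 2) / κ' * (κ' * ∫ x, cdens c ε α τ w x) := by field_simp
    _ ≤ _ := by gcongr

section PowerWeight

variable {c x : E3} {ε p : ℝ}

theorem abs_pd_rpw_le_mul (hε : 0 < ε) (hd : ε < dist x c) (j : Fin 3) :
    |pd j (rpw c ε p) x| ≤ rpw c ε p x * ((1 + |p| + |p| * |p - 2|) / dist x c) := by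
  have hr : 0 < dist x c := hε.trans hd
  refine (abs_pd_rpw_le hε hd j).trans ?_
  rw [rpw_eq hε hd.le]
  have := Real.rpow_nonneg hr.le p
  calc |p| * (dist x c ^ p / dist x c) = dist x c ^ p * (|p| / dist x c) := by ring
    _ ≤ _ := by
      gcongr
      nlinarith [abs_nonneg p, abs_nonneg (p - 2), mul_nonneg (abs_nonneg p) (abs_nonneg (p - 2))]

theorem abs_pd_pd_rpw_le_mul (hε : 0 < ε) (hd : ε < dist x c) (j k : Fin 3) :
    |pd j (pd k (rpw c ε p)) x|
      ≤ rpw c ε p x * ((1 + |p| + |p| * |p - 2|) / dist x c ^ 2) := by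
  have hr : 0 < dist x c := hε.trans hd
  refine (abs_pd_pd_rpw_le hε hd j k).trans ?_
  rw [rpw_eq hε hd.le]
  have := Real.rpow_nonneg hr.le p
  calc (|p| + |p| * |p - 2|) * (dist x c ^ p / dist x c ^ 2)
      = dist x c ^ p * ((|p| + |p| * |p - 2|) / dist x c ^ 2) := by ring
    _ ≤ _ := by
      gcongr
      linarith

theorem rpw_le_one (hε : 0 < ε) (hd : ε < dist x c) (hd1 : dist x c ≤ 1) (hp : 0 ≤ p) :
    rpw c ε p x ≤ 1 := by
  rw [rpw_eq hε hd.le]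
  exact Real.rpow_le_one dist_nonneg hd1 hp

theorem rpw_half_sq (hε : 0 < ε) (hd : ε < dist x c) {α τ : ℝ} :
    rpw c ε (α / 2) x ^ 2 * (τ * dist x c ^ (-α)) = τ := by
  have hr : 0 < dist x c := hε.trans hd
  rw [rpw_eq hε hd.le, ← Real.rpow_natCast, ← Real.rpow_mul hr.le, mul_left_comm,
    ← Real.rpow_add hr]
  norm_num

end PowerWeight

/-- The Carleman estimate with an additional power weight. -/
theorem carleman_rpw {a : Fin 3 → Fin 3 → E3 → ℝ} {B : Set E3} {α κ g₀ K : ℝ}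
    (h : CarlemanCoeff a B α κ g₀ K) (hα : 0 < α) (p : ℝ) :
    ∃ R > 0, R ≤ 1 ∧ ∃ τ₀ ≥ 1, ∃ C > 0, ∀ (c : E3) (ε τ : ℝ) (u : E3 → ℝ), 0 < ε → τ₀ ≤ τ →
      SuppIn B c ε R u →
      ∫ x, Real.exp (cwt c ε α τ x) ^ 2 * rpw c ε p x ^ 2 * cdens c ε α τ u x
        ≤ C * ∫ x, Real.exp (cwt c ε α τ x) ^ 2 * rpw c ε p x ^ 2 * op2 a u x ^ 2 := by
  obtain ⟨R, hR, hR1, τ₀, hτ₀, C, hC, hmain⟩ := carleman_basic h hα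
  obtain ⟨M, hM⟩ : ∃ M, M = 1 + |p| + |p| * |p - 2| := ⟨_, rfl⟩
  have hM0 : 0 < M := by rw [hM]; positivity
  have hK1 := h.one_le
  obtain ⟨L, hL⟩ : ∃ L, L = 162 * K ^ 2 * (6 * M ^ 2) := ⟨_, rfl⟩
  have hL0 : 0 < L := by rw [hL]; positivity
  obtain ⟨N, hN⟩ : ∃ N, N = 2 + 6 * M ^ 2 := ⟨_, rfl⟩
  have hN0 : 0 < N := by rw [hN]; positivity
  refine ⟨R, hR, hR1, max τ₀ (2 * N * C * L), hτ₀.trans (le_max_left _ _), 4 * N * C,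
    by positivity, fun c ε τ u hε hτ hu => ?_⟩
  have hττ := (le_max_left _ _).trans hτ
  have hτL := (le_max_right _ _).trans hτ
  have hτ1 : 1 ≤ τ := le_trans hτ₀ hττ
  have hρ : Sm (rpw c ε p) := sm_rpw hε
  have hψ : Sm (cwt c ε α τ) := sm_cwt hε
  have hus := hu.smooth
  have hsa := h.smooth
  have hdu : Sm (cdens c ε α τ u) := sm_cdens hε hus
  have hpt : ∀ x ∈ tsupport u, x ∈ B ∧ ε < dist x c ∧ dist x c ≤ 1 := fun x hx => by
    obtain ⟨h1, h2, h3⟩ := hu.mem x hx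
    exact ⟨h1, h2, h3.le.trans hR1⟩
  set w : E3 → ℝ := fun x => rpw c ε p x * u x with hw
  have hws : SuppIn B c ε R w := hu.mul hρ
  have hwsm := hws.smooth
  have hdw : Sm (cdens c ε α τ w) := sm_cdens hε hwsm
  have hnw : ∀ x, x ∉ tsupport u → x ∉ tsupport w := fun x hx h => hx (tsupport_mul_subset h)
  have key := hmain c ε τ w hε hττ hws
  have low : ∫ x, Real.exp (cwt c ε α τ x) ^ 2 * rpw c ε p x ^ 2 * cdens c ε α τ u x
      ≤ ∫ x, N * (Real.exp (cwt c ε α τ x) ^ 2 * cdens c ε α τ w x) := by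
    refine integral_le_of_le_on_tsupport (by fun_prop) (by fun_prop) hu.compact
      (fun x hx => by simp [cdens_eq_zero_of_notMem hx])
      (fun x hx => by rw [cdens_eq_zero_of_notMem (hnw x hx)]; ring) fun x hx => ?_
    obtain ⟨h1, h2, h3⟩ := hpt x hx
    have hr : 0 < dist x c := hε.trans h2
    have hσ : 1 ≤ τ * dist x c ^ (-α) := hτ1.trans (le_weight hα hr h3 (by linarith))
    have hq := sq_mul_gsq_le hρ hus (fun j => hM ▸ abs_pd_rpw_le_mul hε h2 j)
    rw [mul_assoc, mul_left_comm N]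
    refine mul_le_mul_of_nonneg_left ?_ (sq_nonneg _)
    rw [cdens_eq hε h2, cdens_eq hε h2]
    set r := dist x c
    set σ := τ * r ^ (-α)
    have hw0 : w x ^ 2 = rpw c ε p x ^ 2 * u x ^ 2 := by rw [hw]; ring
    have hσ3 : σ ≤ σ ^ 3 := le_self_pow₀ hσ (by norm_num)
    have hg0 := gsq_nonneg w x
    have hA : 0 ≤ σ / r ^ 2 * gsq w x := by positivity
    calc rpw c ε p x ^ 2 * (σ / r ^ 2 * gsq u x + σ ^ 3 / r ^ 4 * u x ^ 2)
        = σ / r ^ 2 * (rpw c ε p x ^ 2 * gsq u x) + σ ^ 3 / r ^ 4 * w x ^ 2 := by rw [hw0]; ring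
      _ ≤ σ / r ^ 2 * (2 * gsq w x + 6 * ((rpw c ε p x * (M / r)) ^ 2 * u x ^ 2))
          + σ ^ 3 / r ^ 4 * w x ^ 2 := by gcongr
      _ = 2 * (σ / r ^ 2 * gsq w x) + 6 * M ^ 2 * (σ / r ^ 4 * w x ^ 2)
          + σ ^ 3 / r ^ 4 * w x ^ 2 := by
        rw [hw0]; field_simp
      _ ≤ 2 * (σ / r ^ 2 * gsq w x) + 6 * M ^ 2 * (σ ^ 3 / r ^ 4 * w x ^ 2)
          + σ ^ 3 / r ^ 4 * w x ^ 2 := by gcongr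
      _ ≤ _ := by
        rw [hN]
        nlinarith [mul_nonneg (sq_nonneg M) hA, (by positivity : 0 ≤ σ ^ 3 / r ^ 4 * w x ^ 2)]
  have up : ∫ x, Real.exp (cwt c ε α τ x) ^ 2 * op2 a w x ^ 2
      ≤ ∫ x, (2 * (Real.exp (cwt c ε α τ x) ^ 2 * rpw c ε p x ^ 2 * op2 a u x ^ 2)
        + L / τ * (Real.exp (cwt c ε α τ x) ^ 2 * rpw c ε p x ^ 2 * cdens c ε α τ u x)) := by
    refine integral_le_of_le_on_tsupport (by fun_prop) (by fun_prop) hu.compact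
      (fun x hx => by rw [op2_eq_zero_of_notMem (hnw x hx)]; ring)
      (fun x hx => by rw [cdens_eq_zero_of_notMem hx, op2_eq_zero_of_notMem hx]; ring)
      fun x hx => ?_
    obtain ⟨h1, h2, h3⟩ := hpt x hx
    have hr : 0 < dist x c := hε.trans h2
    have hq := sq_op2_mul_le (a := a) (h.a0 x h1) hρ hus
      (fun j => hM ▸ abs_pd_rpw_le_mul hε h2 j) (fun j k => hM ▸ abs_pd_pd_rpw_le_mul hε h2 j k)
    have hlow := mul_lower_le_cdens (u := u) hα hε h2 h3 hτ1
    set r := dist x c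
    have hlow' : gsq u x / r ^ 2 + u x ^ 2 / r ^ 4 ≤ cdens c ε α τ u x / τ := by
      rw [le_div_iff₀ (by linarith)]; linarith
    have hg0 := gsq_nonneg u x
    calc Real.exp (cwt c ε α τ x) ^ 2 * op2 a w x ^ 2
        ≤ Real.exp (cwt c ε α τ x) ^ 2 * (2 * (rpw c ε p x ^ 2 * op2 a u x ^ 2)
          + 162 * K ^ 2 * (6 * ((rpw c ε p x * (M / r)) ^ 2 * gsq u x)
            + 3 * ((rpw c ε p x * (M / r ^ 2)) ^ 2 * u x ^ 2))) := by gcongr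
      _ = Real.exp (cwt c ε α τ x) ^ 2 * (rpw c ε p x ^ 2 * (2 * op2 a u x ^ 2
          + 162 * K ^ 2 * (6 * M ^ 2) * (gsq u x / r ^ 2 + (1 / 2) * (u x ^ 2 / r ^ 4)))) := by
        field_simp
        ring
      _ ≤ Real.exp (cwt c ε α τ x) ^ 2 * (rpw c ε p x ^ 2 * (2 * op2 a u x ^ 2
          + 162 * K ^ 2 * (6 * M ^ 2) * (cdens c ε α τ u x / τ))) := by
        gcongr
        have : 0 ≤ u x ^ 2 / r ^ 4 := by positivity
        linarith
      _ = _ := by rw [hL]; ring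
  have i1 : Integrable fun x => Real.exp (cwt c ε α τ x) ^ 2 * rpw c ε p x ^ 2 * op2 a u x ^ 2 :=
    sm_integrable_of_forall (by fun_prop) hu.compact
      fun x hx => by rw [op2_eq_zero_of_notMem hx]; ring
  have i2 : Integrable fun x =>
      Real.exp (cwt c ε α τ x) ^ 2 * rpw c ε p x ^ 2 * cdens c ε α τ u x :=
    sm_integrable_of_forall (by fun_prop) hu.compact
      fun x hx => by rw [cdens_eq_zero_of_notMem hx]; ring
  rw [integral_const_mul] at low
  rw [integral_add (i1.const_mul _) (i2.const_mul _), integral_const_mul, integral_const_mul] at up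
  set X := ∫ x, Real.exp (cwt c ε α τ x) ^ 2 * rpw c ε p x ^ 2 * cdens c ε α τ u x
  set Y := ∫ x, Real.exp (cwt c ε α τ x) ^ 2 * rpw c ε p x ^ 2 * op2 a u x ^ 2
  have hX0 : 0 ≤ X := by
    have : ∫ x : E3, (0 : ℝ) ≤ X := by
      refine integral_le_of_le_on_tsupport contDiff_const (by fun_prop) hu.compact
        (fun _ _ => rfl) (fun x hx => by rw [cdens_eq_zero_of_notMem hx]; ring) fun x hx => ?_
      obtain ⟨h1, h2, h3⟩ := hpt x hx
      have hr : 0 < dist x c := hε.trans h2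
      have := mul_lower_le_cdens (u := u) hα hε h2 h3 hτ1
      have hg0 := gsq_nonneg u x
      have : 0 ≤ cdens c ε α τ u x := le_trans (by positivity) this
      positivity
    simpa using this
  have e1 : X ≤ N * (C * (2 * Y + L / τ * X)) := low.trans (by gcongr; exact key.trans (by gcongr))
  have e2 : N * C * (L / τ) ≤ 1 / 2 := by
    rw [mul_div_assoc', div_le_iff₀ (by linarith)]
    linarith
  nlinarith [mul_le_mul_of_nonneg_right e2 hX0]

theorem cdens_nonneg {c x : E3} {ε α τ : ℝ} {u : E3 → ℝ} (hτ : 0 ≤ τ) :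
    0 ≤ cdens c ε α τ u x := by
  have h1 : 0 ≤ rpw c ε (-α - 2) x := rpw_nonneg
  have h2 : 0 ≤ rpw c ε (-(3 * α) - 4) x := rpw_nonneg
  have h3 := gsq_nonneg u x
  unfold cdens; positivity

/-- Pointwise comparison of second derivatives of `u` and of `e φ u` in terms of scaled lower-order
terms, for multipliers `e` and `φ` varying at rates `s` and `q ≤ s`. -/
theorem hess_multiplier_le {a : Fin 3 → Fin 3 → E3 → ℝ} {e φ u : E3 → ℝ} {x : E3} {s K M : ℝ}
    (he : Sm e) (hφ : Sm φ) (hu : Sm u) (hK : 1 ≤ K) (hM : 1 ≤ M) (hs : 1 ≤ s)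
    (ha : ∀ j k, |a j k x| ≤ K)
    (he1 : ∀ j, |pd j e x| ≤ e x * (K * s))
    (he2 : ∀ j k, |pd j (pd k e) x| ≤ e x * (2 * K ^ 2 * s ^ 2))
    (hφ1 : ∀ j, |pd j φ x| ≤ φ x * (M * s)) (hφ2 : ∀ j k, |pd j (pd k φ) x| ≤ φ x * (M * s ^ 2)) :
    e x ^ 2 * φ x ^ 2 * hsq u x ≤ 4 * hsq (fun x => e x * (φ x * u x)) x
        + 10000 * K ^ 4 * M ^ 2 * (e x ^ 2 * (φ x ^ 2 * (s ^ 2 * gsq u x + s ^ 4 * u x ^ 2))) ∧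
      op2 a (fun x => e x * (φ x * u x)) x ^ 2 + gsq (fun x => e x * (φ x * u x)) x
        ≤ 4 * (e x ^ 2 * φ x ^ 2 * op2 a u x ^ 2)
        + 100000 * K ^ 6 * M ^ 2 * (e x ^ 2 * (φ x ^ 2 * (s ^ 2 * gsq u x + s ^ 4 * u x ^ 2))) := by
  have hv : Sm (fun x => φ x * u x) := by fun_prop
  have a1 := sq_mul_hsq_le hφ hu hφ1 hφ2
  have a2 := gsq_mul_le hφ hu hφ1
  have a3 := sq_op2_mul_le ha hφ hu hφ1 hφ2
  have b1 := sq_mul_hsq_le he hv he1 he2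
  have b2 := gsq_mul_le he hv he1
  have b3 := sq_op2_mul_le ha he hv he1 he2
  have hg := gsq_nonneg u x
  obtain ⟨D, hD⟩ : ∃ D, D = φ x ^ 2 * (s ^ 2 * gsq u x + s ^ 4 * u x ^ 2) := ⟨_, rfl⟩
  obtain ⟨V, hV⟩ : ∃ V, V = gsq (fun x => φ x * u x) x := ⟨_, rfl⟩
  have hV0 : 0 ≤ V := hV ▸ gsq_nonneg _ x
  rw [← hV] at a2 b1 b2 b3
  have hs2 : 1 ≤ s ^ 2 := one_le_pow₀ hs
  have hM2 : 1 ≤ M ^ 2 := one_le_pow₀ hM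
  have hK2 : 1 ≤ K ^ 2 := one_le_pow₀ hK
  have hD1 : (φ x * (M * s)) ^ 2 * gsq u x ≤ M ^ 2 * D := by
    rw [hD]
    have : 0 ≤ M ^ 2 * (φ x ^ 2 * (s ^ 4 * u x ^ 2)) := by positivity
    linarith
  have hD2 : (φ x * (M * s ^ 2)) ^ 2 * u x ^ 2 ≤ M ^ 2 * D := by
    rw [hD]
    have : 0 ≤ M ^ 2 * (φ x ^ 2 * (s ^ 2 * gsq u x)) := by positivity
    linarith
  have hD3 : s ^ 2 * V ≤ 8 * M ^ 2 * D := by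
    have t1 : s ^ 2 * V
        ≤ s ^ 2 * (2 * (φ x ^ 2 * gsq u x) + 6 * ((φ x * (M * s)) ^ 2 * u x ^ 2)) := by
      gcongr
    have t2 : (0:ℝ) ≤ φ x ^ 2 * (s ^ 2 * gsq u x) := by positivity
    have t3 : (0:ℝ) ≤ φ x ^ 2 * (s ^ 4 * u x ^ 2) := by positivity
    have t4 := mul_le_mul_of_nonneg_right hM2 t2
    have t5 : (0:ℝ) ≤ M ^ 2 * (φ x ^ 2 * (s ^ 4 * u x ^ 2)) := by positivity
    have t6 : (0:ℝ) ≤ M ^ 2 * (φ x ^ 2 * (s ^ 2 * gsq u x)) := by positivity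
    rw [hD]
    linarith
  have hD4 : s ^ 4 * (φ x * u x) ^ 2 ≤ D := by
    rw [hD]
    have : 0 ≤ φ x ^ 2 * (s ^ 2 * gsq u x) := by positivity
    linarith
  have hD0 : 0 ≤ D := by rw [hD]; positivity
  have hMD : D ≤ M ^ 2 * D := le_mul_of_one_le_left hD0 hM2
  have hE : 0 ≤ e x ^ 2 := sq_nonneg _
  have c1 : (e x * (K * s)) ^ 2 * V ≤ e x ^ 2 * (K ^ 2 * (8 * M ^ 2 * D)) := by
    calc _ = e x ^ 2 * (K ^ 2 * (s ^ 2 * V)) := by ring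
      _ ≤ _ := by gcongr
  have c2 : (e x * (2 * K ^ 2 * s ^ 2)) ^ 2 * (φ x * u x) ^ 2
      ≤ e x ^ 2 * (4 * K ^ 4 * (M ^ 2 * D)) := by
    calc _ = e x ^ 2 * (4 * K ^ 4 * (s ^ 4 * (φ x * u x) ^ 2)) := by ring
      _ ≤ _ := mul_le_mul_of_nonneg_left
        (mul_le_mul_of_nonneg_left (hD4.trans hMD) (by positivity)) hE
  have c3 : (e x * (K * s)) ^ 2 * (φ x * u x) ^ 2 ≤ e x ^ 2 * (K ^ 2 * (M ^ 2 * D)) := by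
    calc _ = e x ^ 2 * (K ^ 2 * (s ^ 2 * (φ x * u x) ^ 2)) := by ring
      _ ≤ e x ^ 2 * (K ^ 2 * (s ^ 4 * (φ x * u x) ^ 2)) := by
        gcongr
        norm_num
      _ ≤ _ := mul_le_mul_of_nonneg_left
        (mul_le_mul_of_nonneg_left (hD4.trans hMD) (by positivity)) hE
  obtain ⟨T, hT⟩ : ∃ T, T = e x ^ 2 * (M ^ 2 * D) := ⟨_, rfl⟩
  have hT0 : 0 ≤ T := by rw [hT]; positivity
  have k1 : T ≤ K ^ 2 * T := le_mul_of_one_le_left hT0 hK2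
  have k2 : K ^ 2 * T ≤ K ^ 4 * T := by
    gcongr
    norm_num
  have k3 : K ^ 4 * T ≤ K ^ 6 * T := by
    gcongr
    norm_num
  have d1 := mul_le_mul_of_nonneg_left a1 hE
  have d3 := mul_le_mul_of_nonneg_left a3 hE
  have d2 : e x ^ 2 * V ≤ 8 * T := by
    have : V ≤ s ^ 2 * V := le_mul_of_one_le_left hV0 hs2
    calc e x ^ 2 * V ≤ e x ^ 2 * (8 * M ^ 2 * D) := by gcongr; linarith
      _ = _ := by rw [hT]; ring
  have f1 := mul_le_mul_of_nonneg_left hD1 hE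
  have f2 := mul_le_mul_of_nonneg_left hD2 hE
  have g3 : e x ^ 2 * (162 * K ^ 2 * (6 * ((φ x * (M * s)) ^ 2 * gsq u x)
      + 3 * ((φ x * (M * s ^ 2)) ^ 2 * u x ^ 2))) ≤ 1458 * (K ^ 2 * T) := by
    calc _ ≤ e x ^ 2 * (162 * K ^ 2 * (6 * (M ^ 2 * D) + 3 * (M ^ 2 * D))) := by gcongr
      _ = _ := by rw [hT]; ring
  have g4 : 162 * K ^ 2 * (6 * ((e x * (K * s)) ^ 2 * V)
      + 3 * ((e x * (2 * K ^ 2 * s ^ 2)) ^ 2 * (φ x * u x) ^ 2))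
      ≤ 162 * 48 * (K ^ 4 * T) + 162 * 12 * (K ^ 6 * T) := by
    calc _ ≤ 162 * K ^ 2 * (6 * (e x ^ 2 * (K ^ 2 * (8 * M ^ 2 * D)))
          + 3 * (e x ^ 2 * (4 * K ^ 4 * (M ^ 2 * D)))) := by gcongr
      _ = _ := by rw [hT]; ring
  have h1 : (e x * (K * s)) ^ 2 * V ≤ 8 * (K ^ 2 * T) := c1.trans (le_of_eq (by rw [hT]; ring))
  have h2 : (e x * (2 * K ^ 2 * s ^ 2)) ^ 2 * (φ x * u x) ^ 2 ≤ 4 * (K ^ 4 * T) :=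
    c2.trans (le_of_eq (by rw [hT]; ring))
  have h3 : (e x * (K * s)) ^ 2 * (φ x * u x) ^ 2 ≤ K ^ 2 * T :=
    c3.trans (le_of_eq (by rw [hT]; ring))
  have f1' : e x ^ 2 * ((φ x * (M * s)) ^ 2 * gsq u x) ≤ T := f1.trans (le_of_eq hT.symm)
  have f2' : e x ^ 2 * ((φ x * (M * s ^ 2)) ^ 2 * u x ^ 2) ≤ T := f2.trans (le_of_eq hT.symm)
  rw [← hD]
  have eT1 : 10000 * K ^ 4 * M ^ 2 * (e x ^ 2 * D) = 10000 * (K ^ 4 * T) := by rw [hT]; ring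
  have eT2 : 100000 * K ^ 6 * M ^ 2 * (e x ^ 2 * D) = 100000 * (K ^ 6 * T) := by rw [hT]; ring
  rw [eT1, eT2]
  constructor
  · linarith
  · linarith

/-- The Carleman estimate including second derivatives. -/
theorem carleman_second {a : Fin 3 → Fin 3 → E3 → ℝ} {B : Set E3} {α κ g₀ K : ℝ}
    (h : CarlemanCoeff a B α κ g₀ K) (hα : 0 < α) :
    ∃ R > 0, R ≤ 1 ∧ ∃ τ₀ ≥ 1, ∃ C > 0, ∀ (c : E3) (ε τ : ℝ) (u : E3 → ℝ), 0 < ε → τ₀ ≤ τ →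
      SuppIn B c ε R u →
      (∫ x, Real.exp (cwt c ε α τ x) ^ 2 * cdens c ε α τ u x)
        + (∫ x, Real.exp (cwt c ε α τ x) ^ 2 * rpw c ε (α / 2) x ^ 2 * hsq u x) / τ
        ≤ C * ∫ x, Real.exp (cwt c ε α τ x) ^ 2 * op2 a u x ^ 2 := by
  obtain ⟨R, hR, hR1, τ₀, hτ₀, C, hC, hmain⟩ := carleman_basic h hα
  have hsa := h.smooth
  have hK1 := h.one_le
  have hκ := h.κ_pos
  have hg := h.g₀_pos
  obtain ⟨C₂, hC₂, hell⟩ := elliptic_L2 h.smooth h.symm hκ h.elliptic h.a0 h.a1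
  obtain ⟨K', hK'⟩ : ∃ K', K' = K * (1 + g₀) * (α + 7) ^ 3 := ⟨_, rfl⟩
  obtain ⟨M, hM⟩ : ∃ M, M = 1 + |α / 2| + |α / 2| * |α / 2 - 2| := ⟨_, rfl⟩
  have hM1 : 1 ≤ M := by
    rw [hM]
    have : 0 ≤ |α / 2| + |α / 2| * |α / 2 - 2| := by positivity
    linarith
  have hK'0 : 0 < K' := by rw [hK']; positivity
  obtain ⟨L₁, hL₁⟩ : ∃ L, L = 10000 * K' ^ 4 * M ^ 2 := ⟨_, rfl⟩
  obtain ⟨L₂, hL₂⟩ : ∃ L, L = 100000 * K' ^ 6 * M ^ 2 := ⟨_, rfl⟩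
  have hL₁0 : 0 < L₁ := by rw [hL₁]; positivity
  have hL₂0 : 0 < L₂ := by rw [hL₂]; positivity
  refine ⟨R, hR, hR1, τ₀, hτ₀, C + (16 * C₂ + 4 * C₂ * L₂ * C + L₁ * C), by positivity,
    fun c ε τ u hε hτ hu => ?_⟩
  have hτ1 : 1 ≤ τ := le_trans hτ₀ hτ
  have hρ : Sm (rpw c ε (α / 2)) := sm_rpw hε
  have hψ : Sm (cwt c ε α τ) := sm_cwt hε
  have hus := hu.smooth
  have hdu : Sm (cdens c ε α τ u) := sm_cdens hε hus
  have hE : Sm (fun x => Real.exp (cwt c ε α τ x)) := by fun_prop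
  set w : E3 → ℝ := fun x => Real.exp (cwt c ε α τ x) * (rpw c ε (α / 2) x * u x) with hw
  have hws : SuppIn B c ε R w := (hu.mul hρ).mul hE
  have hwsm := hws.smooth
  have hnw : ∀ x, x ∉ tsupport u → x ∉ tsupport w :=
    fun x hx h => hx (tsupport_mul_subset (tsupport_mul_subset h))
  have hpt : ∀ x ∈ tsupport u,
      Real.exp (cwt c ε α τ x) ^ 2 * rpw c ε (α / 2) x ^ 2 * hsq u x ≤ 4 * hsq w x
        + L₁ * τ * (Real.exp (cwt c ε α τ x) ^ 2 * cdens c ε α τ u x) ∧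
      op2 a w x ^ 2 + gsq w x
        ≤ 4 * (Real.exp (cwt c ε α τ x) ^ 2 * op2 a u x ^ 2)
        + L₂ * τ * (Real.exp (cwt c ε α τ x) ^ 2 * cdens c ε α τ u x) := fun x hx => by
    obtain ⟨h1, h2, h3⟩ := hu.mem x hx
    have h3 := h3.le.trans hR1
    have hW := weightBounds h hα hε h1 h2 h3 hτ1
    rw [← hK'] at hW
    have hr := hW.r_pos
    have hσ := hW.one_le_σ
    have hK'1 := hW.one_le
    have hρσ := rpw_half_sq hε h2 (α := α) (τ := τ)
    have hρ1 := rpw_le_one hε h2 h3 (by linarith : 0 ≤ α / 2)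
    have hρ0 : 0 ≤ rpw c ε (α / 2) x := rpw_nonneg
    have p1 := abs_pd_exp_cwt_le hε hW.ψ1
    have p2 := abs_pd_pd_exp_cwt_le hε hK'0.le hσ hW.ψ1 hW.ψ2
    have q1 := abs_pd_rpw_le_mul (p := α / 2) hε h2
    have q2 := abs_pd_pd_rpw_le_mul (p := α / 2) hε h2
    rw [cdens_eq hε h2]
    set r := dist x c
    set σ := τ * r ^ (-α)
    have hs : 1 / r ≤ σ / r := by gcongr
    have hs1 : 1 ≤ σ / r := by
      rw [le_div_iff₀ hr]; linarith
    have := hess_multiplier_le (a := a) (s := σ / r) hE hρ hus hK'1 hM1 hs1 hW.a0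
      p1 (fun j k => (p2 j k).trans (by gcongr; nlinarith))
      (fun j => (q1 j).trans (by
        rw [← hM]
        gcongr
        calc M / r = M * (1 / r) := by ring
          _ ≤ _ := by gcongr))
      (fun j k => (q2 j k).trans (by
        rw [← hM]
        gcongr
        calc M / r ^ 2 = M * (1 / r) ^ 2 := by ring
          _ ≤ _ := by gcongr))
    have eD : rpw c ε (α / 2) x ^ 2 * ((σ / r) ^ 2 * gsq u x + (σ / r) ^ 4 * u x ^ 2)
        = τ * (σ / r ^ 2 * gsq u x + σ ^ 3 / r ^ 4 * u x ^ 2) := by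
      rw [← hρσ]; ring
    rw [eD, ← hL₁, ← hL₂] at this
    obtain ⟨t1, t2⟩ := this
    refine ⟨t1.trans (le_of_eq (by ring)), t2.trans ?_⟩
    have : Real.exp (cwt c ε α τ x) ^ 2 * rpw c ε (α / 2) x ^ 2 * op2 a u x ^ 2
        ≤ Real.exp (cwt c ε α τ x) ^ 2 * 1 * op2 a u x ^ 2 := by
      gcongr
      exact pow_le_one₀ hρ0 hρ1
    linarith
  have i1 : Integrable fun x => Real.exp (cwt c ε α τ x) ^ 2 * op2 a u x ^ 2 :=
    sm_integrable_of_forall (by fun_prop) hu.compact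
      fun x hx => by rw [op2_eq_zero_of_notMem hx]; ring
  have i2 : Integrable fun x => Real.exp (cwt c ε α τ x) ^ 2 * cdens c ε α τ u x :=
    sm_integrable_of_forall (by fun_prop) hu.compact
      fun x hx => by rw [cdens_eq_zero_of_notMem hx]; ring
  have i3 : Integrable (hsq w) := sm_integrable_of_forall (by fun_prop) hws.compact
    fun x hx => hsq_eq_zero_of_notMem hx
  have I1 : ∫ x, Real.exp (cwt c ε α τ x) ^ 2 * rpw c ε (α / 2) x ^ 2 * hsq u x
      ≤ ∫ x, (4 * hsq w x + L₁ * τ * (Real.exp (cwt c ε α τ x) ^ 2 * cdens c ε α τ u x)) :=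
    integral_le_of_le_on_tsupport (by fun_prop) (by fun_prop) hu.compact
      (fun x hx => by rw [hsq_eq_zero_of_notMem hx]; ring)
      (fun x hx => by
        rw [hsq_eq_zero_of_notMem (hnw x hx), cdens_eq_zero_of_notMem hx]; ring)
      fun x hx => (hpt x hx).1
  have I2 : ∫ x, (op2 a w x ^ 2 + gsq w x)
      ≤ ∫ x, (4 * (Real.exp (cwt c ε α τ x) ^ 2 * op2 a u x ^ 2)
        + L₂ * τ * (Real.exp (cwt c ε α τ x) ^ 2 * cdens c ε α τ u x)) :=
    integral_le_of_le_on_tsupport (by fun_prop) (by fun_prop) hu.compact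
      (fun x hx => by
        rw [op2_eq_zero_of_notMem (hnw x hx), gsq_eq_zero_of_notMem (hnw x hx)]; ring)
      (fun x hx => by
        rw [op2_eq_zero_of_notMem hx, cdens_eq_zero_of_notMem hx]; ring)
      fun x hx => (hpt x hx).2
  rw [integral_add (i3.const_mul _) (i2.const_mul _), integral_const_mul, integral_const_mul] at I1
  rw [integral_add (i1.const_mul _) (i2.const_mul _), integral_const_mul, integral_const_mul] at I2
  have I3 := hell w hwsm hws.compact fun x hx => (hws.mem x hx).1
  have I4 := hmain c ε τ u hε hτ hu
  have hY0 : 0 ≤ ∫ x, Real.exp (cwt c ε α τ x) ^ 2 * op2 a u x ^ 2 :=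
    integral_nonneg fun x => by positivity
  set X := ∫ x, Real.exp (cwt c ε α τ x) ^ 2 * cdens c ε α τ u x
  set Y := ∫ x, Real.exp (cwt c ε α τ x) ^ 2 * op2 a u x ^ 2
  have I5 : ∫ x, Real.exp (cwt c ε α τ x) ^ 2 * rpw c ε (α / 2) x ^ 2 * hsq u x
      ≤ (16 * C₂ + 4 * C₂ * L₂ * C + L₁ * C) * Y * τ := by
    calc _ ≤ 4 * (∫ x, hsq w x) + L₁ * τ * X := I1
      _ ≤ 4 * (C₂ * (4 * Y + L₂ * τ * (C * Y))) + L₁ * τ * (C * Y) := by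
        gcongr
        refine I3.trans ?_
        gcongr
        exact I2.trans (by gcongr)
      _ ≤ _ := by
        have : 16 * C₂ * Y ≤ 16 * C₂ * Y * τ := le_mul_of_one_le_right (by positivity) hτ1
        linarith
  have I6 := (div_le_iff₀ (by linarith : 0 < τ)).2 I5
  linarith

section SuppIn

variable {B : Set E3} {c : E3} {ε R α τ : ℝ} {u : E3 → ℝ}

theorem SuppIn.mono {R' : ℝ} (h : SuppIn B c ε R u) (hR : R ≤ R') : SuppIn B c ε R' u :=
  ⟨h.smooth, h.compact, fun x hx => by
    obtain ⟨h1, h2, h3⟩ := h.mem x hx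
    exact ⟨h1, h2, h3.trans_le hR⟩⟩

theorem SuppIn.mul_lower_le (h : SuppIn B c ε R u) (hα : 0 < α) (hε : 0 < ε) (hR : R ≤ 1)
    (hτ : 1 ≤ τ) (x : E3) : τ * (gsq u x + u x ^ 2) ≤ cdens c ε α τ u x := by
  by_cases hx : x ∈ tsupport u
  · obtain ⟨h1, h2, h3⟩ := h.mem x hx
    have hr : 0 < dist x c := hε.trans h2
    have h3 := h3.le.trans hR
    refine le_trans ?_ (mul_lower_le_cdens hα hε h2 h3 hτ)
    gcongr
    · exact le_div_self (gsq_nonneg u x) (by positivity) (pow_le_one₀ hr.le h3)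
    · exact le_div_self (sq_nonneg _) (by positivity) (pow_le_one₀ hr.le h3)
  · rw [cdens_eq_zero_of_notMem hx, gsq_eq_zero_of_notMem hx, image_eq_zero_of_notMem_tsupport hx]
    simp

theorem SuppIn.lower_le_rpw (h : SuppIn B c ε R u) (hα : 0 < α) (hε : 0 < ε) (hR : R ≤ 1)
    (hτ : 1 ≤ τ) (x : E3) :
    gsq u x + u x ^ 2 ≤ R ^ 2 / τ * (rpw c ε (α / 2) x ^ 2 * cdens c ε α τ u x) := by
  by_cases hx : x ∈ tsupport u
  · obtain ⟨h1, h2, h3⟩ := h.mem x hx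
    have hr : 0 < dist x c := hε.trans h2
    have h4 := h3.le.trans hR
    have hρσ := rpw_half_sq hε h2 (α := α) (τ := τ)
    have hσ : 1 ≤ τ * dist x c ^ (-α) := hτ.trans (le_weight hα hr h4 (by linarith))
    rw [cdens_eq hε h2]
    set r := dist x c
    set σ := τ * r ^ (-α)
    set ρ := rpw c ε (α / 2) x
    have hg := gsq_nonneg u x
    have hσ2 : 1 ≤ σ ^ 2 := one_le_pow₀ hσ
    calc gsq u x + u x ^ 2
        ≤ R ^ 2 / r ^ 2 * gsq u x + R ^ 2 / r ^ 2 * (σ ^ 2 / r ^ 2) * u x ^ 2 := by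
          have e1 : 1 ≤ R ^ 2 / r ^ 2 := by
            rw [le_div_iff₀ (by positivity), one_mul]; gcongr
          have e2 : 1 ≤ σ ^ 2 / r ^ 2 := by
            rw [le_div_iff₀ (by positivity), one_mul]
            exact (pow_le_one₀ hr.le h4).trans hσ2
          have e3 : 1 ≤ R ^ 2 / r ^ 2 * (σ ^ 2 / r ^ 2) := one_le_mul_of_one_le_of_one_le e1 e2
          nlinarith [sq_nonneg (u x)]
      _ = R ^ 2 / τ * (ρ ^ 2 * σ) * (gsq u x / r ^ 2 + σ ^ 2 / r ^ 4 * u x ^ 2) := by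
        rw [hρσ]; field_simp
      _ = _ := by ring
  · rw [cdens_eq_zero_of_notMem hx, gsq_eq_zero_of_notMem hx, image_eq_zero_of_notMem_tsupport hx]
    simp

end SuppIn

theorem absorb_triangular {X h Z Y H Φ C₁ C₂ M k S R T : ℝ} (hX : 0 ≤ X) (hH : 0 ≤ H)
    (hY : 0 ≤ Y) (hΦ : 0 ≤ Φ) (hC₁ : 0 < C₁) (hC₂ : 0 < C₂) (hM : 1 ≤ M) (hk0 : 0 < k)
    (hkC : k * C₂ * M = 1 / 2) (hSk : 3 * C₁ * M * S ≤ k / 4) (hRS : R ^ 2 ≤ S) (hR : R ^ 2 ≤ 1)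
    (hT : 0 ≤ T) (hT1 : 12 * C₁ * M * T ≤ 1) (hT2 : 2 * T ≤ 1) (hT3 : 2 * T ≤ k)
    (hh : h = T * H) (hZ : Z = T * Y)
    (e₁ : X + h ≤ 3 * (C₁ * (M * (T * X + R ^ 2 * Z) + Φ)))
    (e₂ : Y ≤ C₂ * (M * (H + T * X + R ^ 2 * Z) + Φ)) :
    X + Z ≤ 2 * (3 * C₁ + k * C₂) * (1 + 1 / k) * Φ := by
  have hZ0 : 0 ≤ Z := hZ ▸ mul_nonneg hT hY
  have hh0 : 0 ≤ h := hh ▸ mul_nonneg hT hH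
  have e₃ : k * Z ≤ (1 / 2) * (h + T * X + T * Z) + k * C₂ * Φ := by
    have : k * Z ≤ k * C₂ * M * (h + T * (T * X) + T * R ^ 2 * Z) + T * (k * C₂ * Φ) := by
      have := mul_le_mul_of_nonneg_left e₂ (mul_nonneg hk0.le hT)
      rw [hh, hZ] at *
      linarith
    rw [hkC] at this
    have t1 : T * (k * C₂ * Φ) ≤ k * C₂ * Φ := mul_le_of_le_one_left (by positivity) (by linarith)
    have t2 : T * (T * X) ≤ T * X := mul_le_of_le_one_left (by positivity) (by linarith)
    have t3 : T * R ^ 2 * Z ≤ T * Z := by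
      rw [mul_assoc]; exact mul_le_mul_of_nonneg_left (mul_le_of_le_one_left hZ0 hR) hT
    linarith
  have t1 : 12 * C₁ * M * T * X ≤ X := mul_le_of_le_one_left hX hT1
  have t2 : 2 * T * X ≤ X := mul_le_of_le_one_left hX hT2
  have t3 : 2 * T * Z ≤ k * Z := mul_le_mul_of_nonneg_right hT3 hZ0
  have t4 : 3 * C₁ * M * (R ^ 2 * Z) ≤ k / 4 * Z := by
    refine le_trans ?_ (mul_le_mul_of_nonneg_right hSk hZ0)
    rw [mul_assoc _ S]
    gcongr
  have e₄ : X + k * Z ≤ 2 * (3 * C₁ + k * C₂) * Φ := by linarith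
  have e₅ : X + Z ≤ (1 + 1 / k) * (X + k * Z) := by
    have : (1 + 1 / k) * (X + k * Z) = X + Z + (k * Z + X / k) := by field_simp; ring
    rw [this]
    have : 0 ≤ k * Z + X / k := by positivity
    linarith
  refine e₅.trans ((mul_le_mul_of_nonneg_left e₄ (by positivity)).trans (le_of_eq (by ring)))

/-- Carleman estimate for a triangular second-order system: the last equation may contain second
derivatives of the other unknowns. -/
theorem carleman_system {a₁ a₂ : Fin 3 → Fin 3 → E3 → ℝ} {B : Set E3}
    {α κ₁ g₁ K₁ κ₂ g₂ K₂ M : ℝ} (h₁ : CarlemanCoeff a₁ B α κ₁ g₁ K₁)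
    (h₂ : CarlemanCoeff a₂ B α κ₂ g₂ K₂) (hα : 0 < α) (hM : 1 ≤ M) :
    ∃ R > 0, R ≤ 1 ∧ ∃ τ₀ ≥ 1, ∃ C > 0, ∀ (c : E3) (ε τ : ℝ) (U : Fin 3 → E3 → ℝ)
      (V F : E3 → ℝ), 0 < ε → τ₀ ≤ τ → (∀ m, SuppIn B c ε R (U m)) → SuppIn B c ε R V →
      SuppIn B c ε R F → (∀ x, 0 ≤ F x) →
      (∀ i x, x ∈ B → op2 a₁ (U i) x ^ 2
        ≤ M * ((∑ m, (gsq (U m) x + U m x ^ 2)) + (gsq V x + V x ^ 2)) + F x) →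
      (∀ x ∈ B, op2 a₂ V x ^ 2 ≤ M * ((∑ m, (hsq (U m) x + (gsq (U m) x + U m x ^ 2)))
        + (gsq V x + V x ^ 2)) + F x) →
      ∫ x, Real.exp (cwt c ε α τ x) ^ 2 * ((∑ m, U m x ^ 2) + V x ^ 2)
        ≤ C * ∫ x, Real.exp (cwt c ε α τ x) ^ 2 * F x := by
  obtain ⟨R₁, hR₁, hR₁1, τ₁, hτ₁, C₁, hC₁, H₁⟩ := carleman_second h₁ hα
  obtain ⟨R₂, hR₂, hR₂1, τ₂, hτ₂, C₂, hC₂, H₂⟩ := carleman_rpw h₂ hα (α / 2)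
  obtain ⟨k, hk⟩ : ∃ k, k = 1 / (2 * C₂ * M) := ⟨_, rfl⟩
  have hk0 : 0 < k := by rw [hk]; positivity
  have hkC : k * C₂ * M = 1 / 2 := by rw [hk]; field_simp
  obtain ⟨S, hS⟩ : ∃ S, S = min 1 (k / (12 * C₁ * M)) := ⟨_, rfl⟩
  have hS0 : 0 < S := by rw [hS]; exact lt_min one_pos (by positivity)
  have hS1 : S ≤ 1 := hS.le.trans (min_le_left _ _)
  have hSk : 3 * C₁ * M * S ≤ k / 4 := by
    have := hS.le.trans (min_le_right _ _)
    rw [le_div_iff₀ (by positivity)] at this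
    linarith
  refine ⟨min S (min R₁ R₂), lt_min hS0 (lt_min hR₁ hR₂),
    (min_le_left _ _).trans hS1, max (max τ₁ τ₂) (12 * C₁ * M + 2 + 2 / k),
    hτ₁.trans ((le_max_left _ _).trans (le_max_left _ _)), 2 * (3 * C₁ + k * C₂) * (1 + 1 / k),
    by positivity, fun c ε τ U V F hε hτ hU hV hF hF0 E₁ E₂ => ?_⟩
  obtain ⟨R, hR⟩ : ∃ R, R = min S (min R₁ R₂) := ⟨_, rfl⟩
  rw [← hR] at hU hV hF
  have hRS : R ≤ S := hR.le.trans (min_le_left _ _)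
  have hR0 : 0 < R := hR ▸ lt_min hS0 (lt_min hR₁ hR₂)
  have hRR₁ : R ≤ R₁ := hR.le.trans ((min_le_right _ _).trans (min_le_left _ _))
  have hRR₂ : R ≤ R₂ := hR.le.trans ((min_le_right _ _).trans (min_le_right _ _))
  have hR1 : R ≤ 1 := hRS.trans hS1
  have hR2 : R ^ 2 ≤ S := by nlinarith
  have hττ₁ : τ₁ ≤ τ := ((le_max_left _ _).trans (le_max_left _ _)).trans hτ
  have hττ₂ : τ₂ ≤ τ := ((le_max_right _ _).trans (le_max_left _ _)).trans hτ
  have hτb : 12 * C₁ * M + 2 + 2 / k ≤ τ := (le_max_right _ _).trans hτ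
  have hτ1 : 1 ≤ τ := le_trans hτ₁ hττ₁
  have hρ : Sm (rpw c ε (α / 2)) := sm_rpw hε
  have hψ : Sm (cwt c ε α τ) := sm_cwt hε
  have hUs := fun m => (hU m).smooth
  have hVs := hV.smooth
  have hFs := hF.smooth
  have hdU : ∀ m, Sm (cdens c ε α τ (U m)) := fun m => sm_cdens hε (hUs m)
  have hdV : Sm (cdens c ε α τ V) := sm_cdens hε hVs
  have ha₁ := h₁.smooth
  have ha₂ := h₂.smooth
  set E : E3 → ℝ := fun x => Real.exp (cwt c ε α τ x) ^ 2 with hE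
  have hEs : Sm E := by fun_prop
  have hE0 : ∀ x, 0 ≤ E x := fun x => sq_nonneg _
  have iX : ∀ m, Integrable fun x => E x * cdens c ε α τ (U m) x := fun m =>
    sm_integrable_of_forall (by fun_prop) (hU m).compact
      fun x hx => by rw [cdens_eq_zero_of_notMem hx, mul_zero]
  have iH : ∀ m, Integrable fun x => E x * rpw c ε (α / 2) x ^ 2 * hsq (U m) x := fun m =>
    sm_integrable_of_forall (by fun_prop) (hU m).compact
      fun x hx => by rw [hsq_eq_zero_of_notMem hx, mul_zero]
  have iY : Integrable fun x => E x * rpw c ε (α / 2) x ^ 2 * cdens c ε α τ V x :=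
    sm_integrable_of_forall (by fun_prop) hV.compact
      fun x hx => by rw [cdens_eq_zero_of_notMem hx, mul_zero]
  have iF : Integrable fun x => E x * F x :=
    sm_integrable_of_forall (by fun_prop) hF.compact
      fun x hx => by rw [image_eq_zero_of_notMem_tsupport hx, mul_zero]
  have io1 : ∀ m, Integrable fun x => E x * op2 a₁ (U m) x ^ 2 := fun m =>
    sm_integrable_of_forall (by fun_prop) (hU m).compact
      fun x hx => by rw [op2_eq_zero_of_notMem hx]; ring
  have io2 : Integrable fun x => E x * rpw c ε (α / 2) x ^ 2 * op2 a₂ V x ^ 2 :=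
    sm_integrable_of_forall (by fun_prop) hV.compact
      fun x hx => by rw [op2_eq_zero_of_notMem hx]; ring
  have iU : ∀ m, Integrable fun x => E x * U m x ^ 2 := fun m =>
    sm_integrable_of_forall (by fun_prop) (hU m).compact
      fun x hx => by rw [image_eq_zero_of_notMem_tsupport hx]; ring
  have iV : Integrable fun x => E x * V x ^ 2 :=
    sm_integrable_of_forall (by fun_prop) hV.compact
      fun x hx => by rw [image_eq_zero_of_notMem_tsupport hx]; ring
  have lU : ∀ m x, gsq (U m) x + U m x ^ 2 ≤ 1 / τ * cdens c ε α τ (U m) x := fun m x => by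
    rw [one_div_mul_eq_div, le_div_iff₀ (by linarith), mul_comm]
    exact (hU m).mul_lower_le hα hε hR1 hτ1 x
  have lV := hV.lower_le_rpw hα hε hR1 hτ1
  have dV0 : ∀ x, 0 ≤ cdens c ε α τ V x := fun x => cdens_nonneg (by linarith)
  have dU0 : ∀ m x, 0 ≤ cdens c ε α τ (U m) x := fun m x => cdens_nonneg (by linarith)
  have B₁ : ∀ i, ∫ x, E x * op2 a₁ (U i) x ^ 2
      ≤ M * (1 / τ * (∑ m, ∫ x, E x * cdens c ε α τ (U m) x)
        + R ^ 2 / τ * ∫ x, E x * rpw c ε (α / 2) x ^ 2 * cdens c ε α τ V x)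
        + ∫ x, E x * F x := fun i => by
    have iW : Integrable fun x => 1 / τ * (∑ m, E x * cdens c ε α τ (U m) x)
        + R ^ 2 / τ * (E x * rpw c ε (α / 2) x ^ 2 * cdens c ε α τ V x) :=
      ((integrable_finsetSum _ fun m _ => iX m).const_mul _).add (iY.const_mul _)
    rw [← integral_finsetSum _ fun m _ => iX m, ← integral_const_mul, ← integral_const_mul,
      ← integral_add ((integrable_finsetSum _ fun m _ => iX m).const_mul _) (iY.const_mul _),
      ← integral_const_mul, ← integral_add (iW.const_mul _) iF]
    refine integral_mono (io1 i) ((iW.const_mul _).add iF) fun x => ?_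
    by_cases hx : x ∈ tsupport (U i)
    · calc E x * op2 a₁ (U i) x ^ 2 ≤ E x * (M * ((∑ m, 1 / τ * cdens c ε α τ (U m) x)
            + R ^ 2 / τ * (rpw c ε (α / 2) x ^ 2 * cdens c ε α τ V x)) + F x) := by
            refine mul_le_mul_of_nonneg_left ((E₁ i x ((hU i).mem x hx).1).trans ?_) (hE0 x)
            gcongr
            · exact lU _ x
            · exact lV x
        _ = _ := by rw [← Finset.mul_sum, ← Finset.mul_sum]; ring
    · simp only [op2_eq_zero_of_notMem hx]
      have : ∀ m, 0 ≤ E x * cdens c ε α τ (U m) x := fun m => mul_nonneg (hE0 x) (dU0 m x)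
      have t1 := Finset.sum_nonneg fun m (_ : m ∈ Finset.univ) => this m
      have t2 := hE0 x
      have t3 := hF0 x
      have t4 := dV0 x
      have t5 : 0 ≤ τ := by linarith
      rw [zero_pow two_ne_zero, mul_zero]
      refine add_nonneg (mul_nonneg (by linarith) (add_nonneg (mul_nonneg (by positivity) t1)
        (by positivity))) (by positivity)
  have B₂ : ∫ x, E x * rpw c ε (α / 2) x ^ 2 * op2 a₂ V x ^ 2
      ≤ M * ((∑ m, ((∫ x, E x * rpw c ε (α / 2) x ^ 2 * hsq (U m) x)
          + 1 / τ * ∫ x, E x * cdens c ε α τ (U m) x))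
        + R ^ 2 / τ * ∫ x, E x * rpw c ε (α / 2) x ^ 2 * cdens c ε α τ V x)
        + ∫ x, E x * F x := by
    have iHX : ∀ m, Integrable fun x => E x * rpw c ε (α / 2) x ^ 2 * hsq (U m) x
        + 1 / τ * (E x * cdens c ε α τ (U m) x) := fun m => (iH m).add ((iX m).const_mul _)
    have e : ∀ m, (∫ x, E x * rpw c ε (α / 2) x ^ 2 * hsq (U m) x)
          + 1 / τ * ∫ x, E x * cdens c ε α τ (U m) x
        = ∫ x, (E x * rpw c ε (α / 2) x ^ 2 * hsq (U m) x
        + 1 / τ * (E x * cdens c ε α τ (U m) x)) := fun m => by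
      rw [← integral_const_mul, ← integral_add (iH m) ((iX m).const_mul _)]
    simp only [e]
    have iW : Integrable fun x => (∑ m, (E x * rpw c ε (α / 2) x ^ 2 * hsq (U m) x
          + 1 / τ * (E x * cdens c ε α τ (U m) x)))
        + R ^ 2 / τ * (E x * rpw c ε (α / 2) x ^ 2 * cdens c ε α τ V x) :=
      (integrable_finsetSum _ fun m _ => iHX m).add (iY.const_mul _)
    rw [← integral_finsetSum _ fun m _ => iHX m, ← integral_const_mul,
      ← integral_add (integrable_finsetSum _ fun m _ => iHX m) (iY.const_mul _),
      ← integral_const_mul, ← integral_add (iW.const_mul _) iF]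
    refine integral_mono io2 ((iW.const_mul _).add iF) fun x => ?_
    by_cases hx : x ∈ tsupport V
    · obtain ⟨x1, x2, x3⟩ := hV.mem x hx
      have hρ1 : rpw c ε (α / 2) x ^ 2 ≤ 1 :=
        pow_le_one₀ rpw_nonneg (rpw_le_one hε x2 (x3.le.trans hR1) (by linarith))
      set ρ2 := rpw c ε (α / 2) x ^ 2
      have hρ2 : 0 ≤ ρ2 := sq_nonneg _
      have n1 : ∀ m, 0 ≤ gsq (U m) x + U m x ^ 2 := fun m =>
        add_nonneg (gsq_nonneg _ _) (sq_nonneg _)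
      have n2 : 0 ≤ gsq V x + V x ^ 2 := add_nonneg (gsq_nonneg _ _) (sq_nonneg _)
      calc E x * ρ2 * op2 a₂ V x ^ 2
          ≤ E x * ρ2 * (M * ((∑ m, (hsq (U m) x + (gsq (U m) x + U m x ^ 2)))
            + (gsq V x + V x ^ 2)) + F x) :=
            mul_le_mul_of_nonneg_left (E₂ x x1) (mul_nonneg (hE0 x) hρ2)
        _ = E x * (M * ((∑ m, (ρ2 * hsq (U m) x + ρ2 * (gsq (U m) x + U m x ^ 2)))
            + ρ2 * (gsq V x + V x ^ 2)) + ρ2 * F x) := by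
            simp only [← mul_add, ← Finset.mul_sum]; ring
        _ ≤ E x * (M * ((∑ m, (ρ2 * hsq (U m) x + 1 / τ * cdens c ε α τ (U m) x))
            + R ^ 2 / τ * (ρ2 * cdens c ε α τ V x)) + F x) := by
            refine mul_le_mul_of_nonneg_left (add_le_add (mul_le_mul_of_nonneg_left (add_le_add
              (Finset.sum_le_sum fun m _ => add_le_add le_rfl ?_) ?_) (by linarith)) ?_) (hE0 x)
            · exact (mul_le_of_le_one_left (n1 _) hρ1).trans (lU _ x)
            · exact (mul_le_of_le_one_left n2 hρ1).trans (lV x)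
            · exact mul_le_of_le_one_left (hF0 x) hρ1
        _ = _ := by
            simp only [Fin.sum_univ_three]; ring
    · simp only [op2_eq_zero_of_notMem hx]
      have : ∀ m, 0 ≤ E x * rpw c ε (α / 2) x ^ 2 * hsq (U m) x
          + 1 / τ * (E x * cdens c ε α τ (U m) x) := fun m => by
        have := hE0 x
        have := hsq_nonneg (U m) x
        have := dU0 m x
        positivity
      have t1 := Finset.sum_nonneg fun m (_ : m ∈ Finset.univ) => this m
      have t2 := hE0 x
      have t3 := hF0 x
      have t4 := dV0 x
      have t5 : 0 ≤ τ := by linarith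
      rw [zero_pow two_ne_zero, mul_zero]
      refine add_nonneg (mul_nonneg (by linarith) (add_nonneg t1 (by positivity)))
        (by positivity)
  have A₁ := fun i => H₁ c ε τ (U i) hε hττ₁ ((hU i).mono hRR₁)
  have A₂ := H₂ c ε τ V hε hττ₂ (hV.mono hRR₂)
  have Fin' : ∫ x, E x * ((∑ m, U m x ^ 2) + V x ^ 2)
      ≤ (∑ m, ∫ x, E x * cdens c ε α τ (U m) x)
        + 1 / τ * ∫ x, E x * rpw c ε (α / 2) x ^ 2 * cdens c ε α τ V x := by
    rw [← integral_finsetSum _ fun m _ => iX m, ← integral_const_mul,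
      ← integral_add (integrable_finsetSum _ fun m _ => iX m) (iY.const_mul _)]
    have e : ∀ x, E x * ((∑ m, U m x ^ 2) + V x ^ 2)
        = (∑ m, E x * U m x ^ 2) + E x * V x ^ 2 := fun x => by
      rw [mul_add, Finset.mul_sum]
    simp only [e]
    refine integral_mono ((integrable_finsetSum _ fun m _ => iU m).add iV)
      ((integrable_finsetSum _ fun m _ => iX m).add (iY.const_mul _)) fun x => ?_
    have p0 := hE0 x
    refine add_le_add (Finset.sum_le_sum fun m _ => mul_le_mul_of_nonneg_left ?_ p0) ?_
    · have := (hU m).mul_lower_le hα hε hR1 hτ1 x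
      have := gsq_nonneg (U m) x
      nlinarith [sq_nonneg (U m x)]
    · have p1 := lV x
      have p2 := gsq_nonneg V x
      have p3 := dV0 x
      have p5 : 0 ≤ rpw c ε (α / 2) x ^ 2 * cdens c ε α τ V x := by positivity
      have p4 : R ^ 2 / τ * (rpw c ε (α / 2) x ^ 2 * cdens c ε α τ V x)
          ≤ 1 / τ * (rpw c ε (α / 2) x ^ 2 * cdens c ε α τ V x) := by
        gcongr
        exact pow_le_one₀ hR0.le hR1
      calc E x * V x ^ 2 ≤ E x * (1 / τ * (rpw c ε (α / 2) x ^ 2 * cdens c ε α τ V x)) := by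
            gcongr; linarith
        _ = _ := by ring
  have hH0 : ∀ m, 0 ≤ ∫ x, E x * rpw c ε (α / 2) x ^ 2 * hsq (U m) x := fun m =>
    integral_nonneg fun x => mul_nonneg (mul_nonneg (hE0 x) (sq_nonneg _)) (hsq_nonneg _ _)
  have hX0 : ∀ m, 0 ≤ ∫ x, E x * cdens c ε α τ (U m) x := fun m =>
    integral_nonneg fun x => mul_nonneg (hE0 x) (dU0 m x)
  have hY0 : 0 ≤ ∫ x, E x * rpw c ε (α / 2) x ^ 2 * cdens c ε α τ V x :=
    integral_nonneg fun x => mul_nonneg (mul_nonneg (hE0 x) (sq_nonneg _)) (dV0 x)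
  have hΦ0 : 0 ≤ ∫ x, E x * F x := integral_nonneg fun x => mul_nonneg (hE0 x) (hF0 x)
  simp only [Fin.sum_univ_three] at B₁ B₂ Fin' ⊢
  have a0 := A₁ 0
  have a1 := A₁ 1
  have a2 := A₁ 2
  have b0 := B₁ 0
  have b1 := B₁ 1
  have b2 := B₁ 2
  have x0 := hX0 0
  have x1 := hX0 1
  have x2 := hX0 2
  have y0 := hH0 0
  have y1 := hH0 1
  have y2 := hH0 2
  have a0 : _ ≤ C₁ * ∫ x, E x * op2 a₁ (U 0) x ^ 2 := a0
  have a1 : _ ≤ C₁ * ∫ x, E x * op2 a₁ (U 1) x ^ 2 := a1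
  have a2 : _ ≤ C₁ * ∫ x, E x * op2 a₁ (U 2) x ^ 2 := a2
  have A₂ : _ ≤ C₂ * ∫ x, E x * rpw c ε (α / 2) x ^ 2 * op2 a₂ V x ^ 2 := A₂
  replace a0 := a0.trans (mul_le_mul_of_nonneg_left b0 hC₁.le)
  replace a1 := a1.trans (mul_le_mul_of_nonneg_left b1 hC₁.le)
  replace a2 := a2.trans (mul_le_mul_of_nonneg_left b2 hC₁.le)
  replace A₂ := A₂.trans (mul_le_mul_of_nonneg_left B₂ hC₂.le)
  have hτ0 : 0 < τ := by linarith
  have hk2 : 0 < 2 / k := by positivity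
  have hCM : 0 < C₁ * M := by positivity
  refine Fin'.trans (absorb_triangular (add_nonneg (add_nonneg x0 x1) x2)
    (add_nonneg (add_nonneg y0 y1) y2) hY0 hΦ0 hC₁ hC₂ hM hk0 hkC hSk hR2 (hR2.trans hS1)
    (one_div_nonneg.2 hτ0.le) ?_ ?_ ?_ rfl rfl ?_ ?_)
  · rw [mul_one_div, div_le_one hτ0]; linarith
  · rw [mul_one_div, div_le_one hτ0]; linarith
  · rw [mul_one_div, div_le_iff₀ hτ0]
    have : k * (2 / k) ≤ k * τ := by gcongr; linarith
    rwa [mul_div_cancel₀ _ hk0.ne'] at this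
  · refine (le_of_eq ?_).trans ((add_le_add (add_le_add a0 a1) a2).trans (le_of_eq ?_)) <;> ring
  · exact A₂.trans (le_of_eq (by ring))

section Spectral

variable {A : Matrix (Fin 3) (Fin 3) ℝ}

theorem exists_diagonalization (hA : A.IsHermitian) (ξ : Fin 3 → ℝ) :
    ∃ y : Fin 3 → ℝ, ∑ i, y i ^ 2 = ∑ i, ξ i ^ 2 ∧
      ∑ k, (∑ j, A k j * ξ j) * ξ k = ∑ i, hA.eigenvalues i * y i ^ 2 ∧
      ∑ k, (∑ j, A k j * ξ j) ^ 2 = ∑ i, hA.eigenvalues i ^ 2 * y i ^ 2 := by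
  set b := hA.eigenvectorBasis
  set v : E3 := WithLp.toLp 2 ξ
  set w : E3 := WithLp.toLp 2 (A.mulVec ξ)
  have hw : ∀ i, inner ℝ (b i) w = hA.eigenvalues i * inner ℝ (b i) v := fun i => by
    have h1 := hA.mulVec_eigenvectorBasis i
    have h2 : inner ℝ (b i) w = A.mulVec ξ ⬝ᵥ (WithLp.ofLp (b i)) := by
      simp [w, EuclideanSpace.inner_eq_star_dotProduct]
    have h3 : inner ℝ (b i) v = ξ ⬝ᵥ (WithLp.ofLp (b i)) := by
      simp [v, EuclideanSpace.inner_eq_star_dotProduct]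
    have h4 : A.mulVec ξ ⬝ᵥ (WithLp.ofLp (b i)) = ξ ⬝ᵥ A.mulVec (WithLp.ofLp (b i)) := by
      rw [dotProduct_comm, Matrix.dotProduct_mulVec, ← Matrix.mulVec_transpose,
        dotProduct_comm]
      congr 2
    rw [h2, h3, h4]
    erw [h1]
    rw [dotProduct_smul]
    rfl
  refine ⟨fun i => inner ℝ (b i) v, ?_, ?_, ?_⟩
  · have := b.sum_sq_norm_inner_right v
    simpa [EuclideanSpace.norm_sq_eq, v] using this
  · have := b.sum_inner_mul_inner w v
    have h2 : inner ℝ w v = ∑ k, (∑ j, A k j * ξ j) * ξ k := by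
      simp only [w, v, PiLp.inner_apply, Matrix.mulVec, dotProduct]
      exact Finset.sum_congr rfl fun i _ => by simp [mul_comm]
    rw [← h2, ← this]
    refine Finset.sum_congr rfl fun i _ => ?_
    rw [real_inner_comm, hw]; ring
  · have := b.sum_sq_norm_inner_right w
    rw [EuclideanSpace.norm_sq_eq] at this
    simp only [hw] at this
    simpa [w, Matrix.mulVec, dotProduct, mul_pow] using this.symm

/-- Kantorovich-type bounds giving the pointwise convexity conditions of the Carleman weight. -/
theorem exists_convexity_const (hA : A.IsHermitian) {α : ℝ}
    (hpos : ∀ i, 0 < hA.eigenvalues i)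
    (hα : ∀ i j, (hA.eigenvalues i - hA.eigenvalues j) / hA.eigenvalues j < α) :
    ∃ g > 0, ∀ ξ : Fin 3 → ℝ, ∑ j, ξ j ^ 2 = 1 →
      ∑ k, (∑ j, A k j * ξ j) ^ 2 < g * ∑ k, (∑ j, A k j * ξ j) * ξ k ∧
      ∑ k, (∑ j, A k j * ξ j) ^ 2 + g * ∑ k, (∑ j, A k j * ξ j) * ξ k
        < (α + 2) * (∑ k, (∑ j, A k j * ξ j) * ξ k) ^ 2 := by
  obtain ⟨i, hi⟩ := Finite.exists_max hA.eigenvalues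
  obtain ⟨j, hj⟩ := Finite.exists_min hA.eigenvalues
  have h := hα i j
  rw [div_lt_iff₀ (hpos j)] at h
  have hl := hpos j
  have hL := hpos i
  obtain ⟨l, hl'⟩ : ∃ l, l = hA.eigenvalues j := ⟨_, rfl⟩
  obtain ⟨L, hL'⟩ : ∃ L, L = hA.eigenvalues i := ⟨_, rfl⟩
  rw [← hl', ← hL'] at h
  rw [← hL'] at hi hL
  rw [← hl'] at hj hl
  obtain ⟨d, hd⟩ : ∃ d, d = (1 + α) * l - L := ⟨_, rfl⟩
  have hd0 : 0 < d := by rw [hd]; linarith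
  refine ⟨L + d / 2, by positivity, fun ξ hξ => ?_⟩
  obtain ⟨y, h1, h2, h3⟩ := exists_diagonalization hA ξ
  rw [h2, h3]
  rw [hξ] at h1
  have hn : ∑ i, hA.eigenvalues i ^ 2 * y i ^ 2
      ≤ (l + L) * (∑ i, hA.eigenvalues i * y i ^ 2) - l * L := by
    have : (l + L) * (∑ i, hA.eigenvalues i * y i ^ 2) - l * L
        - ∑ i, hA.eigenvalues i ^ 2 * y i ^ 2
        = ∑ i, (hA.eigenvalues i - l) * (L - hA.eigenvalues i) * y i ^ 2 := by
      rw [← mul_one (l * L), ← h1, Finset.mul_sum, Finset.mul_sum, ← Finset.sum_sub_distrib,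
        ← Finset.sum_sub_distrib]
      exact Finset.sum_congr rfl fun i _ => by ring
    have h4 : 0 ≤ ∑ i, (hA.eigenvalues i - l) * (L - hA.eigenvalues i) * y i ^ 2 :=
      Finset.sum_nonneg fun i _ => mul_nonneg (mul_nonneg (sub_nonneg.2 (hj i))
        (sub_nonneg.2 (hi i))) (sq_nonneg _)
    linarith
  have hq1 : l ≤ ∑ i, hA.eigenvalues i * y i ^ 2 := by
    calc l = ∑ i, l * y i ^ 2 := by rw [← Finset.mul_sum, h1, mul_one]
      _ ≤ _ := Finset.sum_le_sum fun i _ => mul_le_mul_of_nonneg_right (hj i) (sq_nonneg _)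
  have hq2 : ∑ i, hA.eigenvalues i * y i ^ 2 ≤ L := by
    calc _ ≤ ∑ i, L * y i ^ 2 :=
          Finset.sum_le_sum fun i _ => mul_le_mul_of_nonneg_right (hi i) (sq_nonneg _)
      _ = L := by rw [← Finset.mul_sum, h1, mul_one]
  generalize ∑ i, hA.eigenvalues i * y i ^ 2 = q at *
  generalize ∑ i, hA.eigenvalues i ^ 2 * y i ^ 2 = n at *
  have hq0 : 0 < q := hl.trans_le hq1
  have hα2 : α + 2 = (l + L) / l + d / l := by rw [hd]; field_simp; ring
  constructor
  · nlinarith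
  · have e1 : d * q ≤ d / l * q ^ 2 := by
      rw [div_mul_eq_mul_div, le_div_iff₀ hl]
      nlinarith [mul_nonneg (mul_nonneg hd0.le hq0.le) (sub_nonneg.2 hq1)]
    have e2 : 0 ≤ (l + L) / l * q ^ 2 - (l + 2 * L) * q + l * L := by
      have : (l + L) / l * q ^ 2 - (l + 2 * L) * q + l * L
          = (q - l) * ((l + L) * q - l * L) / l := by field_simp; ring
      rw [this]
      refine div_nonneg (mul_nonneg (sub_nonneg.2 hq1) ?_) hl.le
      nlinarith
    rw [hα2]
    nlinarith

theorem eigenvalues_pos (hA : A.IsHermitian) {c : ℝ} (hc : 0 < c)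
    (h : ∀ ξ : Fin 3 → ℝ, c * (∑ i, ξ i ^ 2) ≤ ∑ j, ∑ k, A j k * ξ j * ξ k) (i : Fin 3) :
    0 < hA.eigenvalues i := by
  refine Matrix.PosDef.eigenvalues_pos (Matrix.PosDef.of_dotProduct_mulVec_pos hA fun x hx => ?_) i
  have h1 := h x
  have h2 : 0 < ∑ i, x i ^ 2 := by
    obtain ⟨j, hj⟩ := Function.ne_iff.1 hx
    exact Finset.sum_pos' (fun _ _ => sq_nonneg _) ⟨j, Finset.mem_univ j, by
      have : x j ≠ 0 := hj
      positivity⟩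
  refine (mul_pos hc h2).trans_le (h1.trans (le_of_eq ?_))
  simp [dotProduct, Matrix.mulVec, Fin.sum_univ_three]
  ring

end Spectral

theorem isCompact_sum_sq_eq_one : IsCompact {ξ : Fin 3 → ℝ | ∑ j, ξ j ^ 2 = 1} := by
  refine Metric.isCompact_of_isClosed_isBounded
    (isClosed_eq (by fun_prop) continuous_const) ?_
  refine (Metric.isBounded_closedBall (x := (0 : Fin 3 → ℝ)) (r := 1)).subset fun ξ hξ => ?_
  rw [mem_closedBall_zero_iff, pi_norm_le_iff_of_nonneg zero_le_one]
  intro i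
  rw [Real.norm_eq_abs, ← sq_le_one_iff_abs_le_one, ← (show _ = _ from hξ)]
  exact Finset.single_le_sum (f := fun j => ξ j ^ 2) (fun _ _ => sq_nonneg _) (Finset.mem_univ i)

theorem exists_bound_closedBall {ι : Type*} [Finite ι] {f : ι → E3 → ℝ}
    (hf : ∀ i, Continuous (f i)) (x₀ : E3) (r : ℝ) :
    ∃ K, ∀ x ∈ closedBall x₀ r, ∀ i, |f i x| ≤ K := by
  cases nonempty_fintype ι
  obtain ⟨K, hK⟩ := (isCompact_closedBall x₀ r).exists_bound_of_continuousOn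
    (f := fun x i => f i x) (continuous_pi hf).continuousOn
  exact ⟨K, fun x hx i => (norm_le_pi_norm (fun i => f i x) i).trans (hK x hx)⟩

theorem exists_sum_sq_eq_one_smul {ξ : Fin 3 → ℝ} (hξ : ξ ≠ 0) :
    ∃ t > 0, ∃ η : Fin 3 → ℝ, ∑ j, η j ^ 2 = 1 ∧ ∀ j, ξ j = t * η j := by
  have h2 : 0 < ∑ i, ξ i ^ 2 := by
    obtain ⟨j, hj⟩ := Function.ne_iff.1 hξ
    exact Finset.sum_pos' (fun _ _ => sq_nonneg _) ⟨j, Finset.mem_univ j, by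
      have : ξ j ≠ 0 := hj
      positivity⟩
  have h3 : 0 < √(∑ i, ξ i ^ 2) := Real.sqrt_pos.2 h2
  refine ⟨√(∑ i, ξ i ^ 2), h3, fun j => ξ j / √(∑ i, ξ i ^ 2), ?_, fun j => ?_⟩
  · simp only [div_pow, Real.sq_sqrt h2.le, ← Finset.sum_div]
    exact div_self h2.ne'
  · field_simp

theorem exists_carlemanCoeff {a : Fin 3 → Fin 3 → E3 → ℝ} (ha : ∀ j k, Sm (a j k))
    (hsym : ∀ j k, a j k = a k j) {α g : ℝ} (hg : 0 < g) (x₀ : E3)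
    (h : ∀ ξ : Fin 3 → ℝ, ∑ j, ξ j ^ 2 = 1 →
      ∑ k, (∑ j, a k j x₀ * ξ j) ^ 2 < g * ∑ k, (∑ j, a k j x₀ * ξ j) * ξ k ∧
      ∑ k, (∑ j, a k j x₀ * ξ j) ^ 2 + g * ∑ k, (∑ j, a k j x₀ * ξ j) * ξ k
        < (α + 2) * (∑ k, (∑ j, a k j x₀ * ξ j) * ξ k) ^ 2) :
    ∃ r > 0, ∃ κ K, CarlemanCoeff a (ball x₀ r) α κ g K := by
  have hac : ∀ j k, Continuous (a j k) := fun j k => (ha j k).continuous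
  have key : ∀ᶠ p : E3 × ℝ in nhds (x₀, 0), ∀ ξ ∈ {ξ : Fin 3 → ℝ | ∑ j, ξ j ^ 2 = 1},
      (p.2 < ∑ k, (∑ j, a k j p.1 * ξ j) * ξ k) ∧
      (∑ k, (∑ j, a k j p.1 * ξ j) ^ 2 + p.2 < g * ∑ k, (∑ j, a k j p.1 * ξ j) * ξ k) ∧
      (∑ k, (∑ j, a k j p.1 * ξ j) ^ 2 + g * ∑ k, (∑ j, a k j p.1 * ξ j) * ξ k + p.2
        < (α + 2) * (∑ k, (∑ j, a k j p.1 * ξ j) * ξ k) ^ 2) := by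
    refine isCompact_sum_sq_eq_one.eventually_forall_of_forall_eventually fun ξ hξ => ?_
    obtain ⟨h1, h2⟩ := h ξ hξ
    have h0 : 0 < ∑ k, (∑ j, a k j x₀ * ξ j) * ξ k := by
      have : 0 ≤ ∑ k, (∑ j, a k j x₀ * ξ j) ^ 2 := Finset.sum_nonneg fun _ _ => sq_nonneg _
      exact pos_of_mul_pos_right (this.trans_lt h1) hg.le
    refine Filter.Eventually.and ?_ (Filter.Eventually.and ?_ ?_)
    · exact (isOpen_lt (f := fun z : (E3 × ℝ) × (Fin 3 → ℝ) => z.1.2)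
        (by fun_prop) (by fun_prop)).mem_nhds h0
    · exact (isOpen_lt (f := fun z : (E3 × ℝ) × (Fin 3 → ℝ) =>
        ∑ k, (∑ j, a k j z.1.1 * z.2 j) ^ 2 + z.1.2)
        (by fun_prop) (by fun_prop)).mem_nhds (by simpa using h1)
    · exact (isOpen_lt (f := fun z : (E3 × ℝ) × (Fin 3 → ℝ) =>
        ∑ k, (∑ j, a k j z.1.1 * z.2 j) ^ 2
          + g * ∑ k, (∑ j, a k j z.1.1 * z.2 j) * z.2 k + z.1.2)
        (by fun_prop) (by fun_prop)).mem_nhds (by simpa using h2)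
  rw [nhds_prod_eq, Filter.eventually_prod_iff] at key
  obtain ⟨p, hp, q, hq, hpq⟩ := key
  obtain ⟨r, hr, hrp⟩ := Metric.eventually_nhds_iff_ball.1 hp
  obtain ⟨κ', hκ', hκq⟩ := Metric.eventually_nhds_iff_ball.1 hq
  have hκ : q (κ' / 2) := hκq _ (by
    rw [mem_ball, dist_zero_right, Real.norm_eq_abs, abs_of_pos (by positivity)]; linarith)
  have hκ0 : 0 < κ' / 2 := by positivity
  generalize κ' / 2 = κ at hκ hκ0
  obtain ⟨K₀, hK₀⟩ := exists_bound_closedBall (f := fun i : Fin 3 × Fin 3 => a i.1 i.2)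
    (fun i => (ha i.1 i.2).continuous) x₀ r
  obtain ⟨K₁, hK₁⟩ := exists_bound_closedBall (f := fun i : Fin 3 × Fin 3 × Fin 3 =>
    pd i.1 (a i.2.1 i.2.2)) (fun i => (contDiff_pd (ha _ _)).continuous) x₀ r
  obtain ⟨K₂, hK₂⟩ := exists_bound_closedBall (f := fun i : Fin 3 × Fin 3 × Fin 3 × Fin 3 =>
    pd i.1 (pd i.2.1 (a i.2.2.1 i.2.2.2)))
    (fun i => (contDiff_pd (contDiff_pd (ha _ _))).continuous) x₀ r
  refine ⟨r, hr, κ, max 1 (max K₀ (max K₁ K₂)), ⟨ha, hsym, le_max_left _ _, hκ0, hg, ?_, ?_, ?_,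
    ?_, ?_, ?_⟩⟩
  · intro x hx ξ
    have e : ∑ j, ∑ k, a j k x * ξ j * ξ k = ∑ k, (∑ j, a k j x * ξ j) * ξ k := by
      refine Finset.sum_congr rfl fun k _ => ?_
      rw [Finset.sum_mul]
      exact Finset.sum_congr rfl fun j _ => by ring
    rw [e]
    by_cases hξ : ξ = 0
    · simp [hξ]
    obtain ⟨t, ht, η, hη, hξη⟩ := exists_sum_sq_eq_one_smul hξ
    have := (hpq (hrp x hx) hκ η hη).1.le
    simp only [hξη]
    simp only [Fin.sum_univ_three] at this hη ⊢
    have := mul_le_mul_of_nonneg_left this (sq_nonneg t)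
    rw [← mul_one κ, ← hη] at this
    refine le_trans (le_of_eq ?_) (this.trans (le_of_eq ?_)) <;> ring
  · exact fun x hx j k => (hK₀ x (ball_subset_closedBall hx) (j, k)).trans
      ((le_max_left _ _).trans (le_max_right _ _))
  · exact fun x hx i j k => (hK₁ x (ball_subset_closedBall hx) (i, j, k)).trans
      ((le_max_left _ _).trans ((le_max_right _ _).trans (le_max_right _ _)))
  · exact fun x hx l i j k => (hK₂ x (ball_subset_closedBall hx) (l, i, j, k)).trans
      ((le_max_right _ _).trans ((le_max_right _ _).trans (le_max_right _ _)))
  · intro x hx ξ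
    by_cases hξ : ξ = 0
    · simp [hξ]
    obtain ⟨t, ht, η, hη, hξη⟩ := exists_sum_sq_eq_one_smul hξ
    have := (hpq (hrp x hx) hκ η hη).2.1.le
    simp only [hξη]
    simp only [Fin.sum_univ_three] at this hη ⊢
    have := mul_le_mul_of_nonneg_left this (sq_nonneg t)
    rw [← mul_one κ, ← hη] at this
    refine le_trans (le_of_eq ?_) (this.trans (le_of_eq ?_)) <;> ring
  · exact fun x hx ξ hξ => (hpq (hrp x hx) hκ ξ hξ).2.2.le

/-- Iterated partial derivatives along a word. -/
def pdl : List (Fin 3) → (E3 → ℝ) → E3 → ℝ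
  | [], f => f
  | i :: l, f => pdl l (pd i f)

@[simp] theorem pdl_nil (f : E3 → ℝ) : pdl [] f = f := rfl

theorem pdl_cons (i : Fin 3) (l : List (Fin 3)) (f : E3 → ℝ) :
    pdl (i :: l) f = pdl l (pd i f) := rfl

@[fun_prop]
theorem contDiff_pdl {f : E3 → ℝ} (hf : Sm f) (l : List (Fin 3)) : Sm (pdl l f) := by
  induction l generalizing f with
  | nil => exact hf
  | cons i l ih => exact ih (contDiff_pd hf)

theorem pd_pdl {f : E3 → ℝ} (hf : Sm f) (i : Fin 3) (l : List (Fin 3)) :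
    pd i (pdl l f) = pdl l (pd i f) := by
  induction l generalizing f with
  | nil => rfl
  | cons j l ih => rw [pdl_cons, ih (contDiff_pd hf), pd_comm hf, pdl_cons]

theorem pdl_add {f g : E3 → ℝ} (hf : Sm f) (hg : Sm g) (l : List (Fin 3)) :
    pdl l (fun x => f x + g x) = fun x => pdl l f x + pdl l g x := by
  induction l generalizing f g with
  | nil => rfl
  | cons i l ih => rw [pdl_cons, pd_add hf hg, ih (contDiff_pd hf) (contDiff_pd hg)]; rfl

theorem pdl_sum {ι : Type*} {t : Finset ι} {f : ι → E3 → ℝ} (hf : ∀ i, Sm (f i))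
    (l : List (Fin 3)) :
    pdl l (fun x => ∑ i ∈ t, f i x) = fun x => ∑ i ∈ t, pdl l (f i) x := by
  induction l generalizing f with
  | nil => rfl
  | cons i l ih =>
    rw [pdl_cons, pd_sum _ (fun i _ => hf i), ih fun j => contDiff_pd (hf j)]; rfl

theorem pdl_const_mul (c : ℝ) {f : E3 → ℝ} (hf : Sm f) (l : List (Fin 3)) :
    pdl l (fun x => c * f x) = fun x => c * pdl l f x := by
  induction l generalizing f with
  | nil => rfl
  | cons i l ih => rw [pdl_cons, pd_const_mul c, ih (contDiff_pd hf)]; rfl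

theorem pdl_congr {U : Set E3} (hU : IsOpen U) {f g : E3 → ℝ} (h : ∀ x ∈ U, f x = g x)
    (l : List (Fin 3)) : ∀ x ∈ U, pdl l f x = pdl l g x := by
  induction l generalizing f g with
  | nil => exact h
  | cons i l ih => exact ih (pd_congr hU h)

theorem iterate_pd_comm {f : E3 → ℝ} (hf : Sm f) (i j : Fin 3) (n : ℕ) :
    (pd i)^[n] (pd j f) = pd j ((pd i)^[n] f) ∧ Sm ((pd i)^[n] f) := by
  induction n generalizing f with
  | zero => exact ⟨rfl, hf⟩
  | succ n ih =>
    have := ih (contDiff_pd hf (i := i))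
    exact ⟨by rw [Function.iterate_succ_apply, pd_comm hf, this.1, Function.iterate_succ_apply],
      by rw [Function.iterate_succ_apply]; exact this.2⟩

theorem iterate_pd_congr {U : Set E3} (hU : IsOpen U) {f g : E3 → ℝ} (h : ∀ x ∈ U, f x = g x)
    (i : Fin 3) (n : ℕ) : ∀ x ∈ U, (pd i)^[n] f x = (pd i)^[n] g x := by
  induction n generalizing f g with
  | zero => exact h
  | succ n ih =>
    intro x hx
    rw [Function.iterate_succ_apply, Function.iterate_succ_apply]
    exact ih (pd_congr hU h) x hx

theorem mpd_congr {U : Set E3} (hU : IsOpen U) {f g : E3 → ℝ} (h : ∀ x ∈ U, f x = g x)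
    (β : Fin 3 → ℕ) : ∀ x ∈ U, mpd β f x = mpd β g x :=
  iterate_pd_congr hU (iterate_pd_congr hU (iterate_pd_congr hU h 2 _) 1 _) 0 _

theorem exists_mpd_eq_pdl {f : E3 → ℝ} (hf : Sm f) (l : List (Fin 3)) :
    ∃ β : Fin 3 → ℕ, mdeg β = l.length ∧ pdl l f = mpd β f := by
  induction l generalizing f with
  | nil => exact ⟨0, rfl, rfl⟩
  | cons i l ih =>
    obtain ⟨β, hβ, e⟩ := ih (contDiff_pd hf (i := i))
    refine ⟨Function.update β i (β i + 1), ?_, ?_⟩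
    · rw [List.length_cons, ← hβ]
      fin_cases i <;> simp [mdeg, Function.update] <;> ring
    · rw [pdl_cons, e]
      have h2 := iterate_pd_comm hf 2
      have h1 := fun j => iterate_pd_comm (h2 0 (β 2)).2 1 j (β 1)
      fin_cases i
      · simp [mpd, Function.update, Function.iterate_succ_apply, (h2 0 _).1, (h1 0).1]
      · simp [mpd, Function.update, Function.iterate_succ_apply, (h2 1 _).1]
      · simp [mpd, Function.update, Function.iterate_succ_apply]

/-- Smooth functions on `ℝ³` with Gevrey bounds on `B`. -/
def Gev (s : ℝ) (B : Set E3) (f : E3 → ℝ) : Prop :=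
  Sm f ∧ ∃ C ≥ 0, ∃ A ≥ 1, ∀ l : List (Fin 3), ∀ x ∈ B,
    |pdl l f x| ≤ C * A ^ l.length * (l.length.factorial : ℝ) ^ s

section Gev

variable {s : ℝ} {B : Set E3} {f g : E3 → ℝ}

theorem GevreyOn.gev {Ω : Set E3} (h : GevreyOn s Ω f) (hB : IsOpen B) (hBΩ : B ⊆ Ω) (hg : Sm g)
    (hfg : ∀ x ∈ B, g x = f x) : Gev s B g := by
  obtain ⟨-, C, hC, A, hA, H⟩ := h
  refine ⟨hg, C, hC.le, max 1 A, le_max_left _ _, fun l x hx => ?_⟩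
  obtain ⟨β, hβ, e⟩ := exists_mpd_eq_pdl hg l
  rw [e, mpd_congr hB hfg β x hx, ← hβ]
  refine (H β x (hBΩ hx)).trans ?_
  gcongr
  exact le_max_right _ _

theorem Gev.smooth (h : Gev s B f) : Sm f := h.1

theorem Gev.pd (h : Gev s B f) (hs : 0 ≤ s) (i : Fin 3) : Gev s B (pd i f) := by
  obtain ⟨h1, C, hC, A, hA, H⟩ := h
  have h2 : (1 : ℝ) ≤ 2 ^ s := Real.one_le_rpow (by norm_num) hs
  refine ⟨contDiff_pd h1, C * A, by positivity, A * 2 ^ s, one_le_mul_of_one_le_of_one_le hA h2,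
    fun l x hx => ?_⟩
  refine (H (i :: l) x hx).trans ?_
  rw [List.length_cons, Nat.factorial_succ]
  push_cast
  rw [Real.mul_rpow (by positivity) (by positivity), mul_pow, pow_succ]
  have : ((l.length : ℝ) + 1) ^ s ≤ (2 ^ s) ^ l.length := by
    rw [← Real.rpow_natCast, ← Real.rpow_mul (by norm_num), mul_comm s, Real.rpow_mul (by norm_num),
      Real.rpow_natCast]
    refine Real.rpow_le_rpow (by positivity) ?_ hs
    exact_mod_cast Nat.lt_two_pow_self (n := l.length)
  calc _ = C * A * A ^ l.length * ((l.length : ℝ) + 1) ^ s * (l.length.factorial : ℝ) ^ s := by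
        ring
    _ ≤ C * A * A ^ l.length * (2 ^ s) ^ l.length * (l.length.factorial : ℝ) ^ s := by gcongr
    _ = _ := by ring

theorem Gev.add (hf : Gev s B f) (hg : Gev s B g) : Gev s B fun x => f x + g x := by
  obtain ⟨h1, C, hC, A, hA, H⟩ := hf
  obtain ⟨h1', C', hC', A', hA', H'⟩ := hg
  refine ⟨by fun_prop, C + C', by positivity, max A A', hA.trans (le_max_left _ _),
    fun l x hx => ?_⟩
  rw [pdl_add h1 h1']
  refine (abs_add_le _ _).trans ?_
  calc _ ≤ _ := add_le_add (H l x hx) (H' l x hx)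
    _ ≤ C * max A A' ^ l.length * (l.length.factorial : ℝ) ^ s
        + C' * max A A' ^ l.length * (l.length.factorial : ℝ) ^ s := by
        gcongr
        · exact le_max_left _ _
        · exact le_max_right _ _
    _ = _ := by ring

theorem Gev.const_mul (c : ℝ) (hf : Gev s B f) : Gev s B fun x => c * f x := by
  obtain ⟨h1, C, hC, A, hA, H⟩ := hf
  refine ⟨by fun_prop, |c| * C, by positivity, A, hA, fun l x hx => ?_⟩
  rw [pdl_const_mul c h1, abs_mul]
  calc _ ≤ |c| * (C * A ^ l.length * (l.length.factorial : ℝ) ^ s) := by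
        gcongr; exact H l x hx
    _ = _ := by ring

theorem Gev.mul_const (c : ℝ) (hf : Gev s B f) : Gev s B fun x => f x * c := by
  simpa only [mul_comm] using hf.const_mul c

end Gev

/-- A second-order system for `(u, v)` with diagonal principal part, except that second
derivatives of `u` enter the equation for `v`. -/
structure TriSystem (s : ℝ) (B : Set E3) (a₁ a₂ : Fin 3 → Fin 3 → E3 → ℝ)
    (p : Fin 3 → Fin 3 → E3 → ℝ) (q : Fin 3 → E3 → ℝ) (c : Fin 3 → Fin 3 → Fin 3 → E3 → ℝ)
    (d : Fin 3 → Fin 3 → E3 → ℝ) (h₂ : Fin 3 → Fin 3 → Fin 3 → E3 → ℝ)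
    (h₁ : Fin 3 → Fin 3 → E3 → ℝ) (h₀ : Fin 3 → E3 → ℝ) (b₁ : Fin 3 → E3 → ℝ) (b₀ : E3 → ℝ)
    (u : Fin 3 → E3 → ℝ) (v : E3 → ℝ) : Prop where
  ga₁ : ∀ j k, Gev s B (a₁ j k)
  ga₂ : ∀ j k, Gev s B (a₂ j k)
  gp : ∀ i k, Gev s B (p i k)
  gq : ∀ i, Gev s B (q i)
  gc : ∀ i m k, Gev s B (c i m k)
  gd : ∀ i m, Gev s B (d i m)
  gh₂ : ∀ m j k, Gev s B (h₂ m j k)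
  gh₁ : ∀ m k, Gev s B (h₁ m k)
  gh₀ : ∀ m, Gev s B (h₀ m)
  gb₁ : ∀ k, Gev s B (b₁ k)
  gb₀ : Gev s B b₀
  su : ∀ m, Sm (u m)
  sv : Sm v
  equ : ∀ i, ∀ x ∈ B, op2 a₁ (u i) x = (∑ k, p i k x * pd k v x) + q i x * v x
    + (∑ m, ∑ k, c i m k x * pd k (u m) x) + ∑ m, d i m x * u m x
  eqv : ∀ x ∈ B, op2 a₂ v x = (∑ m, ∑ j, ∑ k, h₂ m j k x * pd j (pd k (u m)) x)
    + (∑ m, ∑ k, h₁ m k x * pd k (u m) x) + (∑ m, h₀ m x * u m x)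
    + (∑ k, b₁ k x * pd k v x) + b₀ x * v x

/-- The residual stress equations in the form `P₁u = …`. -/
theorem op2_a1coef_eq {B : Set E3} {t : Fin 3 → Fin 3 → E3 → ℝ}
    {lam mu rho : E3 → ℝ} {κ : ℝ} {u : E3 → Fin 3 → ℝ}
    (ht : ∀ j k, Sm (t j k)) (hsym : ∀ j k, t j k = t k j) (hlam : Sm lam) (hmu : Sm mu)
    (hu : ∀ m, Sm fun x => u x m)
    (hdiv : ∀ x ∈ B, ∀ i, ∑ j, pd j (t i j) x = 0)
    (hsol : ResSystem t lam mu rho κ u B) (i : Fin 3) (x : E3) (hx : x ∈ B) :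
    op2 (a1coef t mu) (fun x => u x i) x = -((lam x + mu x) * pd i (divg u) x)
      - pd i lam x * divg u x
      - (∑ j, pd j mu x * (pd j (fun x => u x i) x + pd i (fun x => u x j) x))
      - κ ^ 2 * rho x * u x i := by
  have h := hsol x hx i
  have hd : Sm (divg u) := by unfold divg; fun_prop
  have h0 := hdiv x hx 0
  have h1 := hdiv x hx 1
  have h2 := hdiv x hx 2
  obtain ⟨w, hw⟩ : ∃ w : Fin 3 → E3 → ℝ, w = fun m x => u x m := ⟨_, rfl⟩
  have hws : ∀ m, Sm (w m) := by rw [hw]; exact hu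
  have e1 : ∀ m, (fun x => u x m) = w m := fun m => by rw [hw]
  have e2 : ∀ m x, u x m = w m x := fun m x => by rw [hw]
  have e3 : divg u = fun x => ∑ i, pd i (w i) x := by
    funext x; simp only [divg, e1]
  simp only [stress, strain, e2, e3, hsym 1 0, hsym 2 0, hsym 2 1, Fin.sum_univ_three] at *
  simp (disch := fun_prop) only [pd_add, pd_mul, pd_const, op2, a1coef,
    Fin.sum_univ_three, div_eq_mul_inv] at h ⊢
  fin_cases i
  · simp (disch := fun_prop) only [pd_one_zero, pd_two_zero, pd_two_one, hsym 1 0,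
      hsym 2 0, hsym 2 1, Fin.zero_eta, Fin.isValue,
      Fin.reduceEq, if_true, if_false] at h ⊢
    linear_combination h - h0 - pd 0 (w 0) x * h0 - pd 1 (w 0) x * h1 - pd 2 (w 0) x * h2
  · simp (disch := fun_prop) only [pd_one_zero, pd_two_zero, pd_two_one, hsym 1 0,
      hsym 2 0, hsym 2 1, Fin.mk_one, Fin.isValue,
      Fin.reduceEq, if_true, if_false] at h ⊢
    linear_combination h - h1 - pd 0 (w 1) x * h0 - pd 1 (w 1) x * h1 - pd 2 (w 1) x * h2
  · simp (disch := fun_prop) only [pd_one_zero, pd_two_zero, pd_two_one, hsym 1 0,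
      hsym 2 0, hsym 2 1, Fin.reduceFinMk,
      Fin.isValue, Fin.reduceEq, if_true, if_false] at h ⊢
    linear_combination h - h2 - pd 0 (w 2) x * h0 - pd 1 (w 2) x * h1 - pd 2 (w 2) x * h2

theorem op2_a2coef_divg_eq {B : Set E3} (hB : IsOpen B) {t : Fin 3 → Fin 3 → E3 → ℝ}
    {lam mu rho : E3 → ℝ} {κ : ℝ} {u : E3 → Fin 3 → ℝ}
    (ht : ∀ j k, Sm (t j k)) (hsym : ∀ j k, t j k = t k j) (hlam : Sm lam) (hmu : Sm mu)
    (hrho : Sm rho) (hu : ∀ m, Sm fun x => u x m)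
    (hdiv : ∀ x ∈ B, ∀ i, ∑ j, pd j (t i j) x = 0)
    (hsol : ResSystem t lam mu rho κ u B) (x : E3) (hx : x ∈ B) :
    op2 (a2coef t lam mu) (divg u) x
      = -(∑ m, ∑ j, ∑ k, pd m (a1coef t mu j k) x * pd j (pd k (fun x => u x m)) x)
        - (∑ m, ∑ j, pd j mu x * pd j (pd m (fun x => u x m)) x)
        - (∑ m, ∑ j, pd m mu x * pd j (pd j (fun x => u x m)) x)
        - (∑ m, ∑ k, (2 * pd m (pd k mu) x) * pd k (fun x => u x m) x)
        - κ ^ 2 * rho x * divg u x - κ ^ 2 * (∑ m, pd m rho x * u x m)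
        - (∑ k, (2 * pd k lam x + pd k mu x) * pd k (divg u) x)
        - (∑ k, pd k (pd k lam) x) * divg u x := by
  have key := fun i => pd_congr (i := i) hB
    (op2_a1coef_eq (i := i) ht hsym hlam hmu hu hdiv hsol) x hx
  have hd : Sm (divg u) := by unfold divg; fun_prop
  obtain ⟨w, hw⟩ : ∃ w : Fin 3 → E3 → ℝ, w = fun m x => u x m := ⟨_, rfl⟩
  have hws : ∀ m, Sm (w m) := by rw [hw]; exact hu
  have e1 : ∀ m, (fun x => u x m) = w m := fun m => by rw [hw]
  have e2 : ∀ m x, u x m = w m x := fun m x => by rw [hw]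
  have e3 : divg u = fun x => ∑ i, pd i (w i) x := by
    funext x; simp only [divg, e1]
  have k0 := key 0
  have k1 := key 1
  have k2 := key 2
  clear key hsol hdiv
  simp only [e1] at k0 k1 k2 ⊢
  simp only [e2] at k0 k1 k2 ⊢
  clear e1 e2 hw hu
  have hv0 : ∀ m j, pd j (pd m (divg u)) x = ∑ i, pd i (pd j (pd m (w i))) x := by
    intro m j
    rw [e3]
    simp (disch := fun_prop) only [pd_sum]
    refine Finset.sum_congr rfl fun i _ => ?_
    rw [pd_comm (hws i) (j := i), pd_comm (contDiff_pd (hws i)) (j := i)]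
  have hv1 : ∀ m, pd m (divg u) x = ∑ i, pd i (pd m (w i)) x := by
    intro m
    rw [e3]
    simp (disch := fun_prop) only [pd_sum]
    exact Finset.sum_congr rfl fun i _ => by rw [pd_comm (hws i) (j := i)]
  have ha : ∀ j k, Sm (a1coef t mu j k) := fun j k => by unfold a1coef; fun_prop
  have e : ∀ j k, a2coef t lam mu j k x
      = a1coef t mu j k x + (lam x + mu x) * (if j = k then 1 else 0) := fun j k => by
    simp only [a2coef, a1coef]; ring
  unfold op2 at k0 k1 k2 ⊢
  simp only [e]
  clear e
  generalize a1coef t mu = a at *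
  simp (disch := fun_prop) only [Fin.sum_univ_three, pd_add, pd_sub, pd_neg, pd_mul, pd_const]
    at k0 k1 k2
  simp only [Fin.sum_univ_three] at hv0 hv1
  simp only [Fin.sum_univ_three, Fin.isValue, Fin.reduceEq, if_true, if_false]
  simp only [hv0] at k0 k1 k2 ⊢
  simp only [hv1] at k0 k1 k2 ⊢
  rw [e3] at k0 k1 k2 ⊢
  simp only [Fin.sum_univ_three] at k0 k1 k2 ⊢
  simp (disch := fun_prop) only [pd_one_zero, pd_two_zero, pd_two_one] at k0 k1 k2 ⊢
  linear_combination k0 + k1 + k2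

theorem exists_triSystem {s : ℝ} (hs : 0 ≤ s) {B : Set E3} (hB : IsOpen B)
    {t : Fin 3 → Fin 3 → E3 → ℝ} {lam mu rho : E3 → ℝ} {κ : ℝ} {u : E3 → Fin 3 → ℝ}
    (ht : ∀ j k, Gev s B (t j k)) (hsym : ∀ j k, t j k = t k j) (hlam : Gev s B lam)
    (hmu : Gev s B mu) (hrho : Gev s B rho) (hu : ∀ m, Sm fun x => u x m)
    (hdiv : ∀ x ∈ B, ∀ i, ∑ j, pd j (t i j) x = 0)
    (hsol : ResSystem t lam mu rho κ u B) :
    ∃ p q c d h₂ h₁ h₀ b₁ b₀, TriSystem s B (a1coef t mu) (a2coef t lam mu) p q c d h₂ h₁ h₀ b₁ b₀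
      (fun m x => u x m) (divg u) := by
  have ga1 : ∀ j k, Gev s B (a1coef t mu j k) := fun j k => (hmu.mul_const _).add (ht j k)
  have ga2 : ∀ j k, Gev s B (a2coef t lam mu j k) := fun j k =>
    ((hlam.add (hmu.const_mul 2)).mul_const _).add (ht j k)
  refine ⟨fun i k x => (lam x + mu x) * (if i = k then -1 else 0), fun i x => -1 * pd i lam x,
    fun i m k x => pd k mu x * (if i = m then -1 else 0) + pd m mu x * (if i = k then -1 else 0),
    fun i m x => rho x * (if i = m then -κ ^ 2 else 0),
    fun m j k x => -1 * pd m (a1coef t mu j k) x + (pd j mu x * (if k = m then -1 else 0)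
      + pd m mu x * (if j = k then -1 else 0)),
    fun m k x => -2 * pd m (pd k mu) x + rho x * (if k = m then -κ ^ 2 else 0),
    fun m x => -κ ^ 2 * pd m rho x, fun k x => -2 * pd k lam x + -1 * pd k mu x,
    fun x => -1 * ((pd 0 (pd 0 lam) x + pd 1 (pd 1 lam) x) + pd 2 (pd 2 lam) x),
    { ga₁ := ga1
      ga₂ := ga2
      gp := fun i k => (hlam.add hmu).mul_const _
      gq := fun i => (hlam.pd hs i).const_mul _
      gc := fun i m k => ((hmu.pd hs k).mul_const _).add ((hmu.pd hs m).mul_const _)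
      gd := fun i m => hrho.mul_const _
      gh₂ := fun m j k => (((ga1 j k).pd hs m).const_mul _).add
        (((hmu.pd hs j).mul_const _).add ((hmu.pd hs m).mul_const _))
      gh₁ := fun m k => (((hmu.pd hs k).pd hs m).const_mul _).add (hrho.mul_const _)
      gh₀ := fun m => (hrho.pd hs m).const_mul _
      gb₁ := fun k => ((hlam.pd hs k).const_mul _).add ((hmu.pd hs k).const_mul _)
      gb₀ := ((((hlam.pd hs 0).pd hs 0).add ((hlam.pd hs 1).pd hs 1)).add
        ((hlam.pd hs 2).pd hs 2)).const_mul _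
      su := hu
      sv := by unfold divg; fun_prop
      equ := fun i x hx => ?_
      eqv := fun x hx => ?_ }⟩
  · rw [op2_a1coef_eq (fun j k => (ht j k).smooth) hsym hlam.smooth hmu.smooth hu hdiv hsol i x hx]
    simp only [Fin.sum_univ_three]
    fin_cases i <;> simp <;> ring
  · rw [op2_a2coef_divg_eq hB (fun j k => (ht j k).smooth) hsym hlam.smooth hmu.smooth hrho.smooth
      hu hdiv hsol x hx]
    have e : divg u x = ∑ i, pd i (fun y => u y i) x := rfl
    simp only [pd_one_zero (hu _), pd_two_zero (hu _), pd_two_one (hu _), Fin.sum_univ_three, e]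
    simp
    ring

/-- Gevrey bounds on `B` with a single constant. -/
def GevBound (s : ℝ) (B : Set E3) (K : ℝ) (f : E3 → ℝ) : Prop :=
  ∀ l : List (Fin 3), ∀ x ∈ B, |pdl l f x| ≤ K ^ (l.length + 1) * (l.length.factorial : ℝ) ^ s

theorem GevBound.mono {s : ℝ} {B : Set E3} {K K' : ℝ} {f : E3 → ℝ} (h : GevBound s B K f)
    (hK : 0 ≤ K) (hK' : K ≤ K') : GevBound s B K' f := fun l x hx => (h l x hx).trans (by gcongr)

theorem GevBound.abs_le {s : ℝ} {B : Set E3} {K : ℝ} {f : E3 → ℝ} (h : GevBound s B K f) {x : E3}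
    (hx : x ∈ B) : |f x| ≤ K := by
  simpa using h [] x hx

theorem Gev.exists_gevBound {s : ℝ} {B : Set E3} {f : E3 → ℝ} (h : Gev s B f) :
    ∃ K ≥ 1, GevBound s B K f := by
  obtain ⟨-, C, hC, A, hA, H⟩ := h
  refine ⟨max A C, hA.trans (le_max_left _ _), fun l x hx => (H l x hx).trans ?_⟩
  rw [pow_succ']
  gcongr
  · exact le_max_right _ _
  · exact le_max_left _ _

theorem exists_common_gevBound {ι : Type*} [Finite ι] {s : ℝ} {B : Set E3} {f : ι → E3 → ℝ}
    (h : ∀ i, Gev s B (f i)) : ∃ K ≥ 1, ∀ i, GevBound s B K (f i) := by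
  cases nonempty_fintype ι
  choose K hK H using fun i => (h i).exists_gevBound
  refine ⟨1 + ∑ i, K i, ?_, fun i => (H i).mono (zero_le_one.trans (hK i)) ?_⟩
  · have : 0 ≤ ∑ i, K i := Finset.sum_nonneg fun i _ => zero_le_one.trans (hK i)
    linarith
  · have := Finset.single_le_sum (f := K) (fun i _ => zero_le_one.trans (hK i)) (Finset.mem_univ i)
    linarith

section TriSystem

variable {s : ℝ} {B : Set E3} {a₁ a₂ : Fin 3 → Fin 3 → E3 → ℝ}
  {p : Fin 3 → Fin 3 → E3 → ℝ} {q : Fin 3 → E3 → ℝ} {c : Fin 3 → Fin 3 → Fin 3 → E3 → ℝ}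
  {d : Fin 3 → Fin 3 → E3 → ℝ} {h₂ : Fin 3 → Fin 3 → Fin 3 → E3 → ℝ}
  {h₁ : Fin 3 → Fin 3 → E3 → ℝ} {h₀ : Fin 3 → E3 → ℝ} {b₁ : Fin 3 → E3 → ℝ} {b₀ : E3 → ℝ}
  {u : Fin 3 → E3 → ℝ} {v : E3 → ℝ}

/-- Common Gevrey bounds for all coefficients of a system. -/
structure TriBound (s : ℝ) (B : Set E3) (a₁ a₂ : Fin 3 → Fin 3 → E3 → ℝ)
    (p : Fin 3 → Fin 3 → E3 → ℝ) (q : Fin 3 → E3 → ℝ) (c : Fin 3 → Fin 3 → Fin 3 → E3 → ℝ)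
    (d : Fin 3 → Fin 3 → E3 → ℝ) (h₂ : Fin 3 → Fin 3 → Fin 3 → E3 → ℝ)
    (h₁ : Fin 3 → Fin 3 → E3 → ℝ) (h₀ : Fin 3 → E3 → ℝ) (b₁ : Fin 3 → E3 → ℝ) (b₀ : E3 → ℝ)
    (K : ℝ) : Prop where
  one_le : 1 ≤ K
  ga₁ : ∀ j k, GevBound s B K (a₁ j k)
  ga₂ : ∀ j k, GevBound s B K (a₂ j k)
  gp : ∀ i k, GevBound s B K (p i k)
  gq : ∀ i, GevBound s B K (q i)
  gc : ∀ i m k, GevBound s B K (c i m k)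
  gd : ∀ i m, GevBound s B K (d i m)
  gh₂ : ∀ m j k, GevBound s B K (h₂ m j k)
  gh₁ : ∀ m k, GevBound s B K (h₁ m k)
  gh₀ : ∀ m, GevBound s B K (h₀ m)
  gb₁ : ∀ k, GevBound s B K (b₁ k)
  gb₀ : GevBound s B K b₀

theorem TriSystem.exists_triBound (S : TriSystem s B a₁ a₂ p q c d h₂ h₁ h₀ b₁ b₀ u v) :
    ∃ K, TriBound s B a₁ a₂ p q c d h₂ h₁ h₀ b₁ b₀ K := by
  obtain ⟨Ka₁, ka₁, ga₁⟩ := exists_common_gevBound (fun i : Fin 3 × Fin 3 => S.ga₁ i.1 i.2)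
  obtain ⟨Ka₂, ka₂, ga₂⟩ := exists_common_gevBound (fun i : Fin 3 × Fin 3 => S.ga₂ i.1 i.2)
  obtain ⟨Kp, kp, gp⟩ := exists_common_gevBound (fun i : Fin 3 × Fin 3 => S.gp i.1 i.2)
  obtain ⟨Kq, kq, gq⟩ := exists_common_gevBound S.gq
  obtain ⟨Kc, kc, gc⟩ :=
    exists_common_gevBound (fun i : Fin 3 × Fin 3 × Fin 3 => S.gc i.1 i.2.1 i.2.2)
  obtain ⟨Kd, kd, gd⟩ := exists_common_gevBound (fun i : Fin 3 × Fin 3 => S.gd i.1 i.2)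
  obtain ⟨Kh₂, kh₂, gh₂⟩ :=
    exists_common_gevBound (fun i : Fin 3 × Fin 3 × Fin 3 => S.gh₂ i.1 i.2.1 i.2.2)
  obtain ⟨Kh₁, kh₁, gh₁⟩ := exists_common_gevBound (fun i : Fin 3 × Fin 3 => S.gh₁ i.1 i.2)
  obtain ⟨Kh₀, kh₀, gh₀⟩ := exists_common_gevBound S.gh₀
  obtain ⟨Kb₁, kb₁, gb₁⟩ := exists_common_gevBound S.gb₁
  obtain ⟨Kb₀, kb₀, gb₀⟩ := S.gb₀.exists_gevBound
  exact ⟨Ka₁ + Ka₂ + Kp + Kq + Kc + Kd + Kh₂ + Kh₁ + Kh₀ + Kb₁ + Kb₀,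
    { one_le := by linarith
      ga₁ := fun j k => (ga₁ (j, k)).mono (by linarith) (by linarith)
      ga₂ := fun j k => (ga₂ (j, k)).mono (by linarith) (by linarith)
      gp := fun j k => (gp (j, k)).mono (by linarith) (by linarith)
      gq := fun j => (gq j).mono (by linarith) (by linarith)
      gc := fun i j k => (gc (i, j, k)).mono (by linarith) (by linarith)
      gd := fun j k => (gd (j, k)).mono (by linarith) (by linarith)
      gh₂ := fun i j k => (gh₂ (i, j, k)).mono (by linarith) (by linarith)
      gh₁ := fun j k => (gh₁ (j, k)).mono (by linarith) (by linarith)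
      gh₀ := fun j => (gh₀ j).mono (by linarith) (by linarith)
      gb₁ := fun j => (gb₁ j).mono (by linarith) (by linarith)
      gb₀ := gb₀.mono (by linarith) (by linarith) }⟩

section Cutoff

variable {χ f : E3 → ℝ} {x : E3} {N K : ℝ}

theorem abs_mul_pd_le (hχ : Sm χ) (hf : Sm f) {k : Fin 3}
    (e1 : |pd k (fun x => χ x * f x) x| ≤ N) (e2 : |pd k χ x * f x| ≤ N) :
    |χ x * pd k f x| ≤ 2 * N := by
  rw [pd_mul hχ hf] at e1
  rw [abs_le] at *
  constructor <;> linarith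

theorem abs_mul_pd_pd_le (hχ : Sm χ) (hf : Sm f) {j k : Fin 3}
    (e1 : |pd j (pd k (fun x => χ x * f x)) x| ≤ N) (e2 : ∀ j k, |pd k χ x * pd j f x| ≤ N)
    (e3 : |pd j (pd k χ) x * f x| ≤ N) : |χ x * pd j (pd k f) x| ≤ 4 * N := by
  rw [pd_pd_mul hχ hf] at e1
  have e2' := e2 k j
  have e2 := e2 j k
  rw [abs_le] at *
  constructor <;> linarith

theorem abs_op2_mul_le {a : Fin 3 → Fin 3 → E3 → ℝ} {Q : ℝ} (hχ : Sm χ) (hf : Sm f)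
    (ha : ∀ j k, |a j k x| ≤ K) (hQ : |χ x * op2 a f x| ≤ Q)
    (e2 : ∀ j k, |pd k χ x * pd j f x| ≤ N)
    (e3 : ∀ j k, |pd j (pd k χ) x * f x| ≤ N) :
    |op2 a (fun x => χ x * f x) x| ≤ Q + 27 * (K * N) := by
  have e : op2 a (fun x => χ x * f x) x = χ x * op2 a f x + ∑ j, ∑ k, a j k x *
      (pd j χ x * pd k f x + pd k χ x * pd j f x + pd j (pd k χ) x * f x) := by
    simp only [op2, pd_pd_mul hχ hf, Fin.sum_univ_three]
    ring
  rw [e]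
  refine (abs_add_le_of_le hQ (abs_sum_three_le fun j => abs_sum_three_le fun k =>
    abs_mul_le_mul (ha j k) (abs_add_le_of_le (abs_add_le_of_le (e2 _ _) (e2 _ _)) (e3 _ _)))).trans
    (le_of_eq ?_)
  ring

end Cutoff

/-- The size of the cutoff errors. -/
def cutErr (χ : E3 → ℝ) (u : Fin 3 → E3 → ℝ) (v : E3 → ℝ) (x : E3) : ℝ :=
  (gsq χ x + hsq χ x) * ((∑ m, (gsq (u m) x + u m x ^ 2)) + (gsq v x + v x ^ 2))

theorem cutErr_nonneg (χ : E3 → ℝ) (x : E3) : 0 ≤ cutErr χ u v x :=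
  mul_nonneg (add_nonneg (gsq_nonneg _ _) (hsq_nonneg _ _))
    (add_nonneg (Finset.sum_nonneg fun _ _ =>
    add_nonneg (gsq_nonneg _ _) (sq_nonneg _)) (add_nonneg (gsq_nonneg _ _) (sq_nonneg _)))

variable {K : ℝ}

theorem TriSystem.cutoff_bound (S : TriSystem s B a₁ a₂ p q c d h₂ h₁ h₀ b₁ b₀ u v)
    (T : TriBound s B a₁ a₂ p q c d h₂ h₁ h₀ b₁ b₀ K) {χ : E3 → ℝ} (hχ : Sm χ) {x : E3}
    (hx : x ∈ B) :
    (∀ i, op2 a₁ (fun x => χ x * u i x) x ^ 2 ≤ (200 * K) ^ 2 * ((∑ m,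
      (gsq (fun x => χ x * u m x) x + (χ x * u m x) ^ 2)) + (gsq (fun x => χ x * v x) x
        + (χ x * v x) ^ 2)) + (200 * K) ^ 2 * cutErr χ u v x) ∧
    op2 a₂ (fun x => χ x * v x) x ^ 2 ≤ (200 * K) ^ 2 * ((∑ m, (hsq (fun x => χ x * u m x) x +
      (gsq (fun x => χ x * u m x) x + (χ x * u m x) ^ 2))) + (gsq (fun x => χ x * v x) x
        + (χ x * v x) ^ 2)) + (200 * K) ^ 2 * cutErr χ u v x := by
  have hK := T.one_le
  have hu := S.su
  have hv := S.sv
  have n1 := fun m => gsq_nonneg (fun x => χ x * u m x) x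
  have n2 := gsq_nonneg (fun x => χ x * v x) x
  have n3 := fun m => gsq_nonneg (u m) x
  have n4 := gsq_nonneg v x
  have n5 := fun m => hsq_nonneg (fun x => χ x * u m x) x
  have n6 := fun m => sq_nonneg (χ x * u m x)
  have n7 := gsq_nonneg χ x
  have n8 := hsq_nonneg χ x
  have n9 := fun m => sq_nonneg (u m x)
  have hG : 0 ≤ gsq χ x + hsq χ x := add_nonneg n7 n8
  have l1 : ∀ m, gsq (fun x => χ x * u m x) x + (χ x * u m x) ^ 2
      ≤ ∑ m, (gsq (fun x => χ x * u m x) x + (χ x * u m x) ^ 2) := fun m =>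
    Finset.single_le_sum (f := fun m => gsq (fun x => χ x * u m x) x + (χ x * u m x) ^ 2)
      (fun m _ => add_nonneg (n1 m) (n6 m)) (Finset.mem_univ m)
  have l2 : ∀ m, gsq (u m) x + u m x ^ 2 ≤ ∑ m, (gsq (u m) x + u m x ^ 2) := fun m =>
    Finset.single_le_sum (f := fun m => gsq (u m) x + u m x ^ 2)
      (fun m _ => add_nonneg (n3 m) (n9 m)) (Finset.mem_univ m)
  have lp : ∀ {A B a b : ℝ}, 0 ≤ A → 0 ≤ B → a ^ 2 ≤ A → b ^ 2 ≤ B → (a * b) ^ 2 ≤ A * B :=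
    fun hA _ ha hb => by rw [mul_pow]; exact mul_le_mul ha hb (sq_nonneg _) hA
  have key : ∀ N : ℝ, (∑ m, (gsq (fun x => χ x * u m x) x + (χ x * u m x) ^ 2))
        + (gsq (fun x => χ x * v x) x + (χ x * v x) ^ 2) + cutErr χ u v x ≤ N →
      (∀ m k, |χ x * pd k (u m) x| ≤ 2 * √N) ∧ (∀ m, |χ x * u m x| ≤ √N) ∧
      (∀ k, |χ x * pd k v x| ≤ 2 * √N) ∧ (|χ x * v x| ≤ √N) ∧
      (∀ m j k, |pd k χ x * pd j (u m) x| ≤ √N) ∧ (∀ m j k, |pd j (pd k χ) x * u m x| ≤ √N) ∧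
      (∀ j k, |pd k χ x * pd j v x| ≤ √N) ∧ (∀ j k, |pd j (pd k χ) x * v x| ≤ √N) := by
    intro N hN
    have c0 : ∀ {a b : ℝ}, a ^ 2 ≤ gsq χ x + hsq χ x →
        b ^ 2 ≤ (∑ m, (gsq (u m) x + u m x ^ 2)) + (gsq v x + v x ^ 2) → |a * b| ≤ √N :=
      fun ha hb => by
        refine Real.abs_le_sqrt (le_trans ?_ (hN.trans' (le_add_of_nonneg_left ?_)))
        · exact lp hG ((sq_nonneg _).trans hb) ha hb
        · exact add_nonneg ((add_nonneg (n1 0) (n6 0)).trans (l1 0)) (add_nonneg n2 (sq_nonneg _))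
    have cE := cutErr_nonneg (u := u) (v := v) χ x
    have d1 : ∀ k, pd k χ x ^ 2 ≤ gsq χ x + hsq χ x := fun k =>
      (sq_pd_le_gsq χ x k).trans (le_add_of_nonneg_right n8)
    have d2 : ∀ j k, pd j (pd k χ) x ^ 2 ≤ gsq χ x + hsq χ x := fun j k =>
      (sq_pd_pd_le_hsq χ x j k).trans (le_add_of_nonneg_left n7)
    have s1 : ∀ m, u m x ^ 2 ≤ (∑ m, (gsq (u m) x + u m x ^ 2)) + (gsq v x + v x ^ 2) :=
      fun m => by linarith [l2 m, n3 m, n4, sq_nonneg (v x)]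
    have s2 : ∀ m k, pd k (u m) x ^ 2 ≤ (∑ m, (gsq (u m) x + u m x ^ 2)) + (gsq v x + v x ^ 2) :=
      fun m k => by linarith [l2 m, n9 m, n4, sq_nonneg (v x), sq_pd_le_gsq (u m) x k]
    have s0 : 0 ≤ ∑ m, (gsq (u m) x + u m x ^ 2) := (add_nonneg (n3 0) (n9 0)).trans (l2 0)
    have s3 : v x ^ 2 ≤ (∑ m, (gsq (u m) x + u m x ^ 2)) + (gsq v x + v x ^ 2) := by linarith
    have s4 : ∀ k, pd k v x ^ 2 ≤ (∑ m, (gsq (u m) x + u m x ^ 2)) + (gsq v x + v x ^ 2) :=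
      fun k => by linarith [sq_nonneg (v x), sq_pd_le_gsq v x k]
    have t0 := (add_nonneg (n1 0) (n6 0)).trans (l1 0)
    refine ⟨fun m k => abs_mul_pd_le hχ (hu m) (Real.abs_le_sqrt ?_) (c0 (d1 k) (s1 m)),
      fun m => Real.abs_le_sqrt ?_, fun k => abs_mul_pd_le hχ hv (Real.abs_le_sqrt ?_)
      (c0 (d1 k) s3), Real.abs_le_sqrt ?_, fun m j k => c0 (d1 k) (s2 m j),
      fun m j k => c0 (d2 j k) (s1 m), fun j k => c0 (d1 k) (s4 j), fun j k => c0 (d2 j k) s3⟩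
    · linarith [l1 m, n6 m, sq_nonneg (χ x * v x), sq_pd_le_gsq (fun x => χ x * u m x) x k]
    · linarith [l1 m, n1 m, sq_nonneg (χ x * v x)]
    · linarith [sq_nonneg (χ x * v x), sq_pd_le_gsq (fun x => χ x * v x) x k]
    · linarith [sq_nonneg (χ x * v x)]
  constructor
  · intro i
    obtain ⟨k1, k2, k3, k4, k5, k6, k7, k8⟩ := key _ le_rfl
    rw [← mul_add, ← Real.sq_sqrt (x := _ + cutErr χ u v x) (add_nonneg (add_nonneg
      ((add_nonneg (n1 0) (n6 0)).trans (l1 0)) (add_nonneg n2 (sq_nonneg _))) (cutErr_nonneg _ _)),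
      ← mul_pow]
    refine sq_le_sq_of_abs_le ?_
    generalize √_ = N at *
    have hN : 0 ≤ N := (abs_nonneg _).trans k4
    refine (abs_op2_mul_le (K := K) (N := N) (Q := 28 * (K * N)) hχ (hu i)
      (fun j k => (T.ga₁ j k).abs_le hx) ?_ (k5 i) (k6 i)).trans ?_
    · have e : χ x * op2 a₁ (u i) x = (∑ k, p i k x * (χ x * pd k v x)) + q i x * (χ x * v x)
          + (∑ m, ∑ k, c i m k x * (χ x * pd k (u m) x)) + ∑ m, d i m x * (χ x * u m x) := by
        rw [S.equ i x hx]; simp only [Fin.sum_univ_three]; ring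
      rw [e]
      refine (abs_add_le_of_le (abs_add_le_of_le (abs_add_le_of_le
        (abs_sum_three_le fun k => abs_mul_le_mul ((T.gp i k).abs_le hx) (k3 k))
        (abs_mul_le_mul ((T.gq i).abs_le hx) k4))
        (abs_sum_three_le fun m => abs_sum_three_le fun k => abs_mul_le_mul
          ((T.gc i m k).abs_le hx) (k1 m k)))
        (abs_sum_three_le fun m => abs_mul_le_mul ((T.gd i m).abs_le hx) (k2 m))).trans ?_
      linarith
    · have := mul_nonneg (zero_le_one.trans hK) hN
      linarith
  · have l3 : ∑ m, (gsq (fun x => χ x * u m x) x + (χ x * u m x) ^ 2)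
        ≤ ∑ m, (hsq (fun x => χ x * u m x) x
          + (gsq (fun x => χ x * u m x) x + (χ x * u m x) ^ 2)) :=
      Finset.sum_le_sum fun m _ => le_add_of_nonneg_left (n5 m)
    have l4 : ∀ m, hsq (fun x => χ x * u m x) x ≤ ∑ m, (hsq (fun x => χ x * u m x) x
          + (gsq (fun x => χ x * u m x) x + (χ x * u m x) ^ 2)) := fun m =>
      (le_add_of_nonneg_right (add_nonneg (n1 m) (n6 m))).trans (Finset.single_le_sum
        (f := fun m => hsq (fun x => χ x * u m x) x
          + (gsq (fun x => χ x * u m x) x + (χ x * u m x) ^ 2))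
        (fun m _ => add_nonneg (n5 m) (add_nonneg (n1 m) (n6 m))) (Finset.mem_univ m))
    rw [← mul_add]
    obtain ⟨N, hN⟩ : ∃ N, N = (∑ m, (hsq (fun x => χ x * u m x) x +
      (gsq (fun x => χ x * u m x) x + (χ x * u m x) ^ 2))) + (gsq (fun x => χ x * v x) x
        + (χ x * v x) ^ 2) + cutErr χ u v x := ⟨_, rfl⟩
    rw [← hN]
    have cE := cutErr_nonneg (u := u) (v := v) χ x
    obtain ⟨k1, k2, k3, k4, k5, k6, k7, k8⟩ := key N (by rw [hN]; gcongr)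
    have k9 : ∀ m j k, |χ x * pd j (pd k (u m)) x| ≤ 4 * √N := fun m j k =>
      abs_mul_pd_pd_le hχ (hu m) (Real.abs_le_sqrt (by
        rw [hN]
        linarith [l4 m, sq_pd_pd_le_hsq (fun x => χ x * u m x) x j k, sq_nonneg (χ x * v x)]))
        (k5 m) (k6 m j k)
    have hN0 : 0 ≤ N := by
      rw [hN]
      linarith [(n5 0).trans (l4 0), sq_nonneg (χ x * v x)]
    rw [← Real.sq_sqrt hN0, ← mul_pow]
    refine sq_le_sq_of_abs_le ?_
    generalize √N = N at *
    have hN : 0 ≤ N := (abs_nonneg _).trans k4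
    refine (abs_op2_mul_le (K := K) (N := N) (Q := 136 * (K * N)) hχ hv
      (fun j k => (T.ga₂ j k).abs_le hx) ?_ k7 k8).trans ?_
    · have e : χ x * op2 a₂ v x = (∑ m, ∑ j, ∑ k, h₂ m j k x * (χ x * pd j (pd k (u m)) x))
          + (∑ m, ∑ k, h₁ m k x * (χ x * pd k (u m) x)) + (∑ m, h₀ m x * (χ x * u m x))
          + (∑ k, b₁ k x * (χ x * pd k v x)) + b₀ x * (χ x * v x) := by
        rw [S.eqv x hx]; simp only [Fin.sum_univ_three]; ring
      rw [e]
      refine (abs_add_le_of_le (abs_add_le_of_le (abs_add_le_of_le (abs_add_le_of_le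
        (abs_sum_three_le fun m => abs_sum_three_le fun j => abs_sum_three_le fun k =>
          abs_mul_le_mul ((T.gh₂ m j k).abs_le hx) (k9 m j k))
        (abs_sum_three_le fun m => abs_sum_three_le fun k =>
          abs_mul_le_mul ((T.gh₁ m k).abs_le hx) (k1 m k)))
        (abs_sum_three_le fun m => abs_mul_le_mul ((T.gh₀ m).abs_le hx) (k2 m)))
        (abs_sum_three_le fun k => abs_mul_le_mul ((T.gb₁ k).abs_le hx) (k3 k)))
        (abs_mul_le_mul (T.gb₀.abs_le hx) k4)).trans ?_
      linarith
    · have := mul_nonneg (zero_le_one.trans hK) hN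
      linarith

end TriSystem

theorem pd_comp_dilation {g : E3 → ℝ} (hg : Sm g) (c : E3) (s : ℝ) (i : Fin 3) :
    pd i (fun x => g (s • (x - c))) = fun x => s * pd i g (s • (x - c)) := by
  funext x
  have h1 : HasFDerivAt (fun x : E3 => s • (x - c)) (s • ContinuousLinearMap.id ℝ E3) x :=
    ((hasFDerivAt_id x).sub_const c).const_smul s
  have h2 : HasFDerivAt g (fderiv ℝ g (s • (x - c))) (s • (x - c)) :=
    (hg.differentiable (by simp) _).hasFDerivAt
  have h3 := (h2.comp x h1).fderiv
  simp only [pd, Function.comp_def] at h3 ⊢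
  rw [h3]
  simp

theorem gsq_comp_dilation {g : E3 → ℝ} (hg : Sm g) (c : E3) (s : ℝ) (x : E3) :
    gsq (fun x => g (s • (x - c))) x = s ^ 2 * gsq g (s • (x - c)) := by
  simp only [gsq, pd_comp_dilation hg, mul_pow, Finset.mul_sum]

theorem hsq_comp_dilation {g : E3 → ℝ} (hg : Sm g) (c : E3) (s : ℝ) (x : E3) :
    hsq (fun x => g (s • (x - c))) x = s ^ 4 * hsq g (s • (x - c)) := by
  have h : ∀ k j, pd k (fun x => s * pd j g (s • (x - c)))
      = fun x => s * (s * pd k (pd j g) (s • (x - c))) := fun k j => by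
    rw [pd_const_mul, pd_comp_dilation (by fun_prop)]
  simp only [hsq, pd_comp_dilation hg, h, Finset.mul_sum]
  refine Finset.sum_congr rfl fun _ _ => Finset.sum_congr rfl fun _ _ => by ring

theorem gsq_one_sub {g : E3 → ℝ} (hg : Sm g) (x : E3) : gsq (fun x => 1 - g x) x = gsq g x := by
  simp (disch := fun_prop) only [gsq, pd_sub, pd_const]
  simp

theorem hsq_one_sub {g : E3 → ℝ} (hg : Sm g) (x : E3) : hsq (fun x => 1 - g x) x = hsq g x := by
  simp (disch := fun_prop) only [hsq, pd_sub, pd_const]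
  simp only [zero_sub, neg_sq]

theorem exists_bound_gsq_add_hsq {g : E3 → ℝ} (hg : Sm g) (hc : HasCompactSupport g) :
    ∃ K > 0, ∀ x, gsq g x + hsq g x ≤ K := by
  have hcont : Continuous fun x => gsq g x + hsq g x :=
    ContDiff.continuous (𝕜 := ℝ) (n := (⊤ : ℕ∞)) (by fun_prop)
  have hcs : HasCompactSupport fun x => gsq g x + hsq g x :=
    hasCompactSupport_of_forall hc fun x hx => by
      rw [gsq_eq_zero_of_notMem hx, hsq_eq_zero_of_notMem hx, add_zero]
  obtain ⟨C, hC⟩ := hcs.exists_bound_of_continuous hcont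
  exact ⟨|C| + 1, by positivity, fun x => (le_abs_self _).trans ((hC x).trans
    (by linarith [le_abs_self C]))⟩

/-- Cutoffs vanishing near a point, with derivatives controlled by the scale. -/
theorem exists_inner_cutoff : ∃ K > 0, ∀ (c : E3) (ε : ℝ), 0 < ε → ε ≤ 1 → ∃ χ : E3 → ℝ, Sm χ ∧
    (∀ x, dist x c < 5 / 4 * ε → χ x = 0) ∧ (∀ x, 3 / 2 * ε < dist x c → χ x = 1) ∧
    ∀ x, gsq χ x + hsq χ x ≤ K / ε ^ 4 := by
  let g : ContDiffBump (0 : E3) := ⟨5 / 4, 3 / 2, by norm_num, by norm_num⟩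
  have hg : Sm g := g.contDiff
  obtain ⟨K, hK, H⟩ := exists_bound_gsq_add_hsq hg g.hasCompactSupport
  refine ⟨K, hK, fun c ε hε hε1 => ⟨fun x => 1 - g (ε⁻¹ • (x - c)), by fun_prop,
    fun x hx => ?_, fun x hx => ?_, fun x => ?_⟩⟩
  · show 1 - g _ = 0
    rw [g.one_of_mem_closedBall, sub_self]
    rw [mem_closedBall_zero_iff, norm_smul, Real.norm_of_nonneg (by positivity), ← dist_eq_norm,
      inv_mul_le_iff₀ hε]
    show _ ≤ ε * (5 / 4)
    linarith
  · show 1 - g _ = 1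
    rw [g.zero_of_le_dist, sub_zero]
    rw [dist_zero_right, norm_smul, Real.norm_of_nonneg (by positivity), ← dist_eq_norm,
      le_inv_mul_iff₀ hε]
    show ε * (3 / 2) ≤ _
    linarith
  · have hG : Sm fun x => g (ε⁻¹ • (x - c)) := by fun_prop
    rw [gsq_one_sub hG, hsq_one_sub hG, gsq_comp_dilation hg, hsq_comp_dilation hg]
    have h1 : 1 ≤ ε⁻¹ := (one_le_inv₀ hε).2 hε1
    have h2 : ε⁻¹ ^ 2 ≤ ε⁻¹ ^ 4 := pow_le_pow_right₀ h1 (by norm_num)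
    calc _ ≤ ε⁻¹ ^ 4 * gsq g (ε⁻¹ • (x - c)) + ε⁻¹ ^ 4 * hsq g (ε⁻¹ • (x - c)) :=
          add_le_add_left (mul_le_mul_of_nonneg_right h2 (gsq_nonneg _ _)) _
      _ = ε⁻¹ ^ 4 * (gsq g (ε⁻¹ • (x - c)) + hsq g (ε⁻¹ • (x - c))) := by ring
      _ ≤ ε⁻¹ ^ 4 * K := mul_le_mul_of_nonneg_left (H _) (by positivity)
      _ = K / ε ^ 4 := by rw [inv_pow]; field_simp

theorem gsq_congr {U : Set E3} (hU : IsOpen U) {f g : E3 → ℝ} (h : ∀ x ∈ U, f x = g x) :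
    ∀ x ∈ U, gsq f x = gsq g x := fun x hx => by
  simp only [gsq, pd_congr hU h x hx]

theorem hsq_congr {U : Set E3} (hU : IsOpen U) {f g : E3 → ℝ} (h : ∀ x ∈ U, f x = g x) :
    ∀ x ∈ U, hsq f x = hsq g x := fun x hx => by
  simp only [hsq, pd_congr hU (pd_congr hU h) x hx]

theorem gsq_add_hsq_const (a : ℝ) (x : E3) :
    gsq (fun _ => a) x + hsq (fun _ => a) x = 0 := by
  simp [gsq, hsq, pd_const]

/-- The first-order energy density of the pair `(u, v)`. -/
def jetSq (u : Fin 3 → E3 → ℝ) (v : E3 → ℝ) (x : E3) : ℝ :=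
  (∑ m, (gsq (u m) x + u m x ^ 2)) + (gsq v x + v x ^ 2)

/-- Decay of the mass of `G` on balls about `c` faster than every `exp (-τ ρ ^ (-α))`. -/
def DecayAt (c : E3) (α : ℝ) (G : E3 → ℝ) : Prop :=
  ∀ τ : ℝ, ∃ C, ∃ ρ₀ > 0, ∀ ρ, 0 < ρ → ρ < ρ₀ →
    ∫ x in ball c ρ, G x ≤ C * Real.exp (-(τ * ρ ^ (-α)))

section Energy

variable {u : Fin 3 → E3 → ℝ} {v : E3 → ℝ}

theorem jetSq_nonneg (x : E3) : 0 ≤ jetSq u v x := by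
  have h1 : ∀ m, 0 ≤ gsq (u m) x + u m x ^ 2 := fun m =>
    add_nonneg (gsq_nonneg _ _) (sq_nonneg _)
  exact add_nonneg (Finset.sum_nonneg fun m _ => h1 m)
    (add_nonneg (gsq_nonneg _ _) (sq_nonneg _))

@[fun_prop]
theorem contDiff_jetSq (hu : ∀ m, Sm (u m)) (hv : Sm v) : Sm (jetSq u v) := by
  have := fun m => contDiff_gsq (hu m)
  unfold jetSq
  fun_prop

end Energy

theorem tendsto_inv_pow_mul_exp {α : ℝ} (hα : 0 < α) (n : ℕ) :
    Filter.Tendsto (fun ε : ℝ => (ε ^ n)⁻¹ * Real.exp (-ε ^ (-α))) (nhdsWithin 0 (Set.Ioi 0))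
      (nhds 0) := by
  have h1 := (tendsto_rpow_mul_exp_neg_mul_atTop_nhds_zero (n / α) 1 one_pos).comp
    (tendsto_rpow_neg_nhdsGT_zero (neg_neg_of_pos hα))
  refine h1.congr' ?_
  filter_upwards [self_mem_nhdsWithin] with ε hε
  have hε : 0 < ε := hε
  simp only [Function.comp_apply]
  rw [← Real.rpow_mul hε.le, ← Real.rpow_natCast, ← Real.rpow_neg hε.le]
  congr 2
  · field_simp
  · ring

theorem integrableOn_ball_of_continuous {G : E3 → ℝ} (hG : Continuous G) (c : E3) (r : ℝ) :
    IntegrableOn G (ball c r) :=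
  (hG.continuousOn.integrableOn_compact (isCompact_closedBall c r)).mono_set ball_subset_closedBall

/-- A function bounded by multiples of `G` on two balls. -/
theorem integral_le_of_two_balls {f G : E3 → ℝ} (hf : Integrable f) (hG : Continuous G)
    {c : E3} {r₁ r₂ k₁ k₂ : ℝ} (h : ∀ x, f x ≤ (ball c r₁).indicator (fun x => k₁ * G x) x
      + (ball c r₂).indicator (fun x => k₂ * G x) x) :
    ∫ x, f x ≤ k₁ * (∫ x in ball c r₁, G x) + k₂ * ∫ x in ball c r₂, G x := by
  have i1 : ∀ r k : ℝ, Integrable fun x => (ball c r).indicator (fun x => k * G x) x := fun r k =>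
    (integrableOn_ball_of_continuous (hG.const_mul k) c r).integrable_indicator measurableSet_ball
  refine (integral_mono hf ((i1 r₁ k₁).add (i1 r₂ k₂)) h).trans (le_of_eq ?_)
  simp only [Pi.add_apply]
  rw [integral_add (i1 r₁ k₁) (i1 r₂ k₂), integral_indicator measurableSet_ball,
    integral_indicator measurableSet_ball, integral_const_mul, integral_const_mul]

theorem exp_cwt_sq_eq {c x : E3} {ε α τ : ℝ} (hε : 0 < ε) (h : ε ≤ dist x c) :
    Real.exp (cwt c ε α τ x) ^ 2 = Real.exp (τ * dist x c ^ (-α)) ^ 2 := by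
  rw [cwt, rpw_eq hε h]

theorem exp_sq_le_exp_sq {α τ r d : ℝ} (hα : 0 < α) (hτ : 0 ≤ τ) (hr : 0 < r) (hd : r ≤ d) :
    Real.exp (τ * d ^ (-α)) ^ 2 ≤ Real.exp (τ * r ^ (-α)) ^ 2 := by
  have : d ^ (-α) ≤ r ^ (-α) := Real.rpow_le_rpow_of_nonpos hr hd (by linarith)
  gcongr

section LocalUniqueness

variable {s : ℝ} {B : Set E3} {a₁ a₂ : Fin 3 → Fin 3 → E3 → ℝ}
  {p : Fin 3 → Fin 3 → E3 → ℝ} {q : Fin 3 → E3 → ℝ} {b : Fin 3 → Fin 3 → Fin 3 → E3 → ℝ}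
  {d : Fin 3 → Fin 3 → E3 → ℝ} {h₂ : Fin 3 → Fin 3 → Fin 3 → E3 → ℝ}
  {h₁ : Fin 3 → Fin 3 → E3 → ℝ} {h₀ : Fin 3 → E3 → ℝ} {b₁ : Fin 3 → E3 → ℝ} {b₀ : E3 → ℝ}
  {u : Fin 3 → E3 → ℝ} {v : E3 → ℝ}

/-- The weighted estimate for a solution after cutting off near the pole and near the boundary. -/
theorem TriSystem.weighted_estimate (S : TriSystem s B a₁ a₂ p q b d h₂ h₁ h₀ b₁ b₀ u v)
    {K : ℝ} (T : TriBound s B a₁ a₂ p q b d h₂ h₁ h₀ b₁ b₀ K) {α κ₁ g₁ K₁ κ₂ g₂ K₂ : ℝ}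
    (hc₁ : CarlemanCoeff a₁ B α κ₁ g₁ K₁) (hc₂ : CarlemanCoeff a₂ B α κ₂ g₂ K₂) (hα : 0 < α)
    {R₁ : ℝ} (hR₁ : 0 < R₁) :
    ∃ R > 0, R ≤ R₁ ∧ ∃ τ₀ ≥ 1, ∃ C > 0, ∀ c, ball c R ⊆ B → ∃ D > 0,
      ∀ τ ε, τ₀ ≤ τ → 0 < ε → ε ≤ 1 →
      8 * ε < R →
      Real.exp (τ * (R / 4) ^ (-α)) ^ 2 *
          ∫ x in {x | 2 * ε < dist x c ∧ dist x c < R / 4}, ((∑ m, u m x ^ 2) + v x ^ 2)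
        ≤ C / ε ^ 4 * Real.exp (τ * ε ^ (-α)) ^ 2 * (∫ x in ball c (2 * ε), jetSq u v x)
          + D * Real.exp (τ * (R / 2) ^ (-α)) ^ 2 * ∫ x in ball c R, jetSq u v x := by
  have hK := T.one_le
  have hM : 1 ≤ (200 * K) ^ 2 := one_le_pow₀ (by linarith)
  obtain ⟨M, hMdef⟩ : ∃ M, M = (200 * K) ^ 2 := ⟨_, rfl⟩
  rw [← hMdef] at hM
  obtain ⟨R₀, hR₀, hR1, τ₀, hτ₀, C, hC, H⟩ := carleman_system hc₁ hc₂ hα hM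
  obtain ⟨R, hRdef⟩ : ∃ R, R = min R₀ R₁ := ⟨_, rfl⟩
  have hR : 0 < R := by rw [hRdef]; exact lt_min hR₀ hR₁
  have hRR : R ≤ R₀ := by rw [hRdef]; exact min_le_left _ _
  obtain ⟨N, hN, HN⟩ := exists_inner_cutoff
  refine ⟨R, hR, by rw [hRdef]; exact min_le_right _ _, τ₀, hτ₀, C * (M * N),
    by positivity, fun c hcB => ?_⟩
  let g : ContDiffBump c := ⟨R / 2, 3 * R / 4, by linarith, by linarith⟩
  have hg : Sm g := g.contDiff
  obtain ⟨L, hL, HL⟩ := exists_bound_gsq_add_hsq hg g.hasCompactSupport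
  refine ⟨C * (M * L), by positivity, fun τ ε hτ hε hε1 hεR => ?_⟩
  obtain ⟨φ, hφ, hφ0, hφ1, hφK⟩ := HN c ε hε hε1
  have hu := S.su
  have hv := S.sv
  obtain ⟨χ, hχdef⟩ : ∃ χ : E3 → ℝ, χ = fun x => φ x * g x := ⟨_, rfl⟩
  have hχ : Sm χ := by rw [hχdef]; fun_prop
  have hτ0 : 0 ≤ τ := by linarith
  have hgone : ∀ x, dist x c ≤ R / 2 → g x = 1 := fun x hx => g.one_of_mem_closedBall hx
  have hχS : SuppIn B c ε R χ := by
    refine ⟨hχ, ?_, fun x hx => ?_⟩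
    · rw [hχdef]; exact g.hasCompactSupport.mul_left
    · have h1 : dist x c ≤ 3 * R / 4 := by
        have : x ∈ tsupport g := by
          rw [hχdef] at hx; exact tsupport_mul_subset_right hx
        rw [g.tsupport_eq] at this
        exact this
      have h2 : 5 / 4 * ε ≤ dist x c := by
        have : tsupport χ ⊆ {x | 5 / 4 * ε ≤ dist x c} := by
          refine closure_minimal (fun y hy => ?_)
            (isClosed_le continuous_const (continuous_id.dist continuous_const))
          by_contra hlt
          exact hy (by simp [hχdef, hφ0 y (not_le.1 hlt)])
        exact this hx
      exact ⟨hcB (mem_ball.2 (by linarith)), by linarith, by linarith⟩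
  have hχv : ∀ w : E3 → ℝ, Sm w → SuppIn B c ε R (fun x => χ x * w x) := fun w hw => by
    simpa only [mul_comm] using hχS.mul hw
  obtain ⟨F, hFdef⟩ : ∃ F : E3 → ℝ, F = fun x => M * cutErr χ u v x := ⟨_, rfl⟩
  have hFeq : ∀ x, F x = M * ((gsq χ x + hsq χ x) * jetSq u v x) := fun x => by
    rw [hFdef]; rfl
  have hFs : Sm F := by
    have : F = fun x => M * ((gsq χ x + hsq χ x) * jetSq u v x) := funext hFeq
    rw [this]; fun_prop
  have hF0 : ∀ x, x ∉ tsupport χ → F x = 0 := fun x hx => by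
    rw [hFeq, gsq_eq_zero_of_notMem hx, hsq_eq_zero_of_notMem hx]; ring
  have hFts : tsupport F ⊆ tsupport χ :=
    closure_minimal (fun y hy => by_contra fun h => hy (hF0 y h)) (isClosed_tsupport χ)
  have hFS : SuppIn B c ε R F :=
    ⟨hFs, hasCompactSupport_of_forall hχS.compact hF0, fun x hx => hχS.mem x (hFts hx)⟩
  have hFnn : ∀ x, 0 ≤ F x := fun x => by
    rw [hFeq]
    exact mul_nonneg (by linarith)
      (mul_nonneg (add_nonneg (gsq_nonneg _ _) (hsq_nonneg _ _)) (jetSq_nonneg x))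
  have key := H c ε τ (fun m x => χ x * u m x) (fun x => χ x * v x) F hε hτ
    (fun m => (hχv _ (hu m)).mono hRR) ((hχv _ hv).mono hRR) (hFS.mono hRR) hFnn
    (fun i x hx => by
      rw [hFdef, hMdef]; exact (S.cutoff_bound T hχ hx).1 i)
    (fun x hx => by
      rw [hFdef, hMdef]; exact (S.cutoff_bound T hχ hx).2)
  have hψ : Sm (cwt c ε α τ) := sm_cwt hε
  have hGc : Continuous (jetSq u v) := (contDiff_jetSq hu hv).continuous
  have iF : Integrable fun x => Real.exp (cwt c ε α τ x) ^ 2 * F x :=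
    sm_integrable_of_forall (by fun_prop) hχS.compact fun x hx => by rw [hF0 x hx, mul_zero]
  have upper : ∫ x, Real.exp (cwt c ε α τ x) ^ 2 * F x
      ≤ (Real.exp (τ * ε ^ (-α)) ^ 2 * (M * (N / ε ^ 4))) * (∫ x in ball c (2 * ε), jetSq u v x)
        + (Real.exp (τ * (R / 2) ^ (-α)) ^ 2 * (M * L)) * ∫ x in ball c R, jetSq u v x := by
    refine integral_le_of_two_balls iF hGc fun x => ?_
    have n1 : 0 ≤ (ball c (2 * ε)).indicator
        (fun x => Real.exp (τ * ε ^ (-α)) ^ 2 * (M * (N / ε ^ 4)) * jetSq u v x) x :=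
      Set.indicator_nonneg (fun x _ => mul_nonneg (by positivity) (jetSq_nonneg x)) x
    have n2 : 0 ≤ (ball c R).indicator
        (fun x => Real.exp (τ * (R / 2) ^ (-α)) ^ 2 * (M * L) * jetSq u v x) x :=
      Set.indicator_nonneg (fun x _ => mul_nonneg (by positivity) (jetSq_nonneg x)) x
    have hJ := jetSq_nonneg (u := u) (v := v) x
    by_cases hx : x ∈ tsupport χ
    swap
    · rw [hF0 x hx, mul_zero]; exact add_nonneg n1 n2
    obtain ⟨-, hx1, hx2⟩ := hχS.mem x hx
    rw [exp_cwt_sq_eq hε hx1.le]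
    by_cases hlt : dist x c < 2 * ε
    · refine le_trans ?_ (le_add_of_nonneg_right n2)
      rw [Set.indicator_of_mem (mem_ball.2 hlt), hFeq, mul_assoc, mul_assoc M]
      have hon : ∀ y ∈ ball c (2 * ε), χ y = φ y := fun y hy => by
        have hy : dist y c < 2 * ε := hy
        rw [hχdef]; show φ y * g y = φ y
        rw [hgone y (by linarith), mul_one]
      rw [gsq_congr isOpen_ball hon x hlt, hsq_congr isOpen_ball hon x hlt]
      exact mul_le_mul (exp_sq_le_exp_sq hα hτ0 hε hx1.le)
        (mul_le_mul_of_nonneg_left (mul_le_mul_of_nonneg_right (hφK x) hJ) (by linarith))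
        (mul_nonneg (by linarith) (mul_nonneg (add_nonneg (gsq_nonneg _ _) (hsq_nonneg _ _)) hJ))
        (by positivity)
    · have hge : 2 * ε ≤ dist x c := not_lt.1 hlt
      refine le_trans ?_ (le_add_of_nonneg_left n1)
      have hon : ∀ y ∈ {y | 3 / 2 * ε < dist y c}, χ y = g y := fun y hy => by
        rw [hχdef]; show φ y * g y = g y
        rw [hφ1 y hy, one_mul]
      have hop := isOpen_lt_dist c (3 / 2 * ε)
      have hxm : x ∈ {y | 3 / 2 * ε < dist y c} := by
        show 3 / 2 * ε < dist x c
        linarith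
      rw [Set.indicator_of_mem (mem_ball.2 hx2), hFeq, mul_assoc, mul_assoc M,
        gsq_congr hop hon x hxm, hsq_congr hop hon x hxm]
      by_cases hR2 : dist x c < R / 2
      · have hon' : ∀ y ∈ ball c (R / 2), g y = (fun _ => (1 : ℝ)) y := fun y hy =>
          hgone y (mem_ball.1 hy).le
        rw [gsq_congr isOpen_ball hon' x hR2, hsq_congr isOpen_ball hon' x hR2,
          gsq_add_hsq_const, zero_mul, mul_zero, mul_zero]
        positivity
      · exact mul_le_mul (exp_sq_le_exp_sq hα hτ0 (by linarith) (not_lt.1 hR2))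
          (mul_le_mul_of_nonneg_left (mul_le_mul_of_nonneg_right (HL x) hJ) (by linarith))
          (mul_nonneg (by linarith)
            (mul_nonneg (add_nonneg (gsq_nonneg _ _) (hsq_nonneg _ _)) hJ)) (by positivity)
  have lower : Real.exp (τ * (R / 4) ^ (-α)) ^ 2 *
          ∫ x in {x | 2 * ε < dist x c ∧ dist x c < R / 4}, ((∑ m, u m x ^ 2) + v x ^ 2)
      ≤ ∫ x, Real.exp (cwt c ε α τ x) ^ 2 * ((∑ m, (χ x * u m x) ^ 2) + (χ x * v x) ^ 2) := by
    have hWc : Continuous fun x => (∑ m, u m x ^ 2) + v x ^ 2 :=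
      ContDiff.continuous (𝕜 := ℝ) (n := (⊤ : ℕ∞)) (by fun_prop)
    have hA : MeasurableSet {x : E3 | 2 * ε < dist x c ∧ dist x c < R / 4} :=
      ((isOpen_lt_dist c (2 * ε)).inter (isOpen_ball (x := c) (ε := R / 4))).measurableSet
    rw [← integral_const_mul, ← integral_indicator hA]
    have iR : Integrable fun x => Real.exp (cwt c ε α τ x) ^ 2
        * ((∑ m, (χ x * u m x) ^ 2) + (χ x * v x) ^ 2) :=
      sm_integrable_of_forall (by fun_prop) hχS.compact fun x hx => by
        simp [image_eq_zero_of_notMem_tsupport hx]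
    refine integral_mono (((integrableOn_ball_of_continuous (hWc.const_mul _) c
      (R / 4)).mono_set fun x hx => hx.2).integrable_indicator hA) iR fun x => ?_
    have hnn : 0 ≤ Real.exp (cwt c ε α τ x) ^ 2
        * ((∑ m, (χ x * u m x) ^ 2) + (χ x * v x) ^ 2) := by positivity
    by_cases hx : x ∈ {x : E3 | 2 * ε < dist x c ∧ dist x c < R / 4}
    · rw [Set.indicator_of_mem hx]
      obtain ⟨hx1, hx2⟩ := hx
      have hχ1 : χ x = 1 := by
        rw [hχdef]; show φ x * g x = 1
        rw [hφ1 x (by linarith), hgone x (by linarith), mul_one]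
      simp only [hχ1, one_mul, exp_cwt_sq_eq hε (by linarith : ε ≤ dist x c)]
      exact mul_le_mul_of_nonneg_right (exp_sq_le_exp_sq hα hτ0 (by linarith) hx2.le)
        (by positivity)
    · rw [Set.indicator_of_notMem hx]; exact hnn
  calc _ ≤ _ := lower
    _ ≤ _ := key
    _ ≤ _ := mul_le_mul_of_nonneg_left upper hC.le
    _ = _ := by ring

/-- Solutions decaying fast enough at a point vanish nearby. -/
theorem TriSystem.eq_zero_of_decayAt (S : TriSystem s B a₁ a₂ p q b d h₂ h₁ h₀ b₁ b₀ u v)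
    {K : ℝ} (T : TriBound s B a₁ a₂ p q b d h₂ h₁ h₀ b₁ b₀ K) {α κ₁ g₁ K₁ κ₂ g₂ K₂ : ℝ}
    (hc₁ : CarlemanCoeff a₁ B α κ₁ g₁ K₁) (hc₂ : CarlemanCoeff a₂ B α κ₂ g₂ K₂) (hα : 0 < α)
    {R₁ : ℝ} (hR₁ : 0 < R₁) :
    ∃ R > 0, R ≤ R₁ ∧ ∃ r > 0, ∀ c, ball c R ⊆ B → DecayAt c α (jetSq u v) →
      ∀ x ∈ ball c r, ∀ m, u m x = 0 := by
  obtain ⟨R, hR, hRR, τ₀, hτ₀, C, hC, H⟩ := S.weighted_estimate T hc₁ hc₂ hα hR₁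
  have hu := S.su
  have hv := S.sv
  refine ⟨R, hR, hRR, R / 4, by positivity, fun c hcB hdec => ?_⟩
  obtain ⟨D, hD, H⟩ := H c hcB
  obtain ⟨J, hJ⟩ : ∃ J, J = ∫ x in ball c R, jetSq u v x := ⟨_, rfl⟩
  rw [← hJ] at H
  have hWc : Continuous fun x => (∑ m, u m x ^ 2) + v x ^ 2 :=
    ContDiff.continuous (𝕜 := ℝ) (n := (⊤ : ℕ∞)) (by fun_prop)
  have hWi : ∀ S ⊆ ball c (R / 4), IntegrableOn (fun x => (∑ m, u m x ^ 2) + v x ^ 2) S :=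
    fun S hS => (integrableOn_ball_of_continuous hWc c (R / 4)).mono_set hS
  have annulus : ∀ δ, 0 < δ →
      ∫ x in {x | δ < dist x c ∧ dist x c < R / 4}, ((∑ m, u m x ^ 2) + v x ^ 2) ≤ 0 := by
    intro δ hδ
    obtain ⟨I, hI⟩ : ∃ I, I = ∫ x in {x | δ < dist x c ∧ dist x c < R / 4},
      ((∑ m, u m x ^ 2) + v x ^ 2) := ⟨_, rfl⟩
    rw [← hI]
    have step : ∀ τ, τ₀ ≤ τ → Real.exp (τ * (R / 4) ^ (-α)) ^ 2 * I
        ≤ D * Real.exp (τ * (R / 2) ^ (-α)) ^ 2 * J := by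
      intro τ hτ
      obtain ⟨C', ρ₀, hρ₀, hdec⟩ := hdec ((2 * τ + 1) * 2 ^ α)
      have lim := ((tendsto_inv_pow_mul_exp hα 4).const_mul (C * C')).add_const
        (D * Real.exp (τ * (R / 2) ^ (-α)) ^ 2 * J)
      rw [mul_zero, zero_add] at lim
      refine ge_of_tendsto lim ?_
      have e1 : ∀ᶠ ε : ℝ in nhdsWithin 0 (Set.Ioi 0),
          ε < min (min (ρ₀ / 2) 1) (min (R / 8) (δ / 2)) :=
        nhdsWithin_le_nhds (Iio_mem_nhds (by positivity))
      filter_upwards [self_mem_nhdsWithin, e1] with ε hε hlt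
      have hε : 0 < ε := hε
      simp only [lt_min_iff] at hlt
      obtain ⟨⟨l1, l2⟩, l3, l4⟩ := hlt
      have h1 := H τ ε hτ hε l2.le (by linarith)
      have h2 := hdec (2 * ε) (by positivity) (by linarith)
      have h3 : I ≤ ∫ x in {x | 2 * ε < dist x c ∧ dist x c < R / 4},
          ((∑ m, u m x ^ 2) + v x ^ 2) := by
        rw [hI]
        refine setIntegral_mono_set (hWi _ fun x hx => hx.2)
          (Filter.Eventually.of_forall fun x => by positivity)
          (Filter.Eventually.of_forall fun x hx => ⟨?_, hx.2⟩)
        have : δ < dist x c := hx.1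
        linarith
      have h4 : Real.exp (τ * ε ^ (-α)) ^ 2
          * Real.exp (-((2 * τ + 1) * 2 ^ α * (2 * ε) ^ (-α))) = Real.exp (-ε ^ (-α)) := by
        rw [← Real.exp_nat_mul, ← Real.exp_add, Real.mul_rpow (by norm_num) hε.le,
          Real.rpow_neg (by norm_num : (0 : ℝ) ≤ 2)]
        have : (2 : ℝ) ^ α ≠ 0 := by positivity
        congr 1
        field_simp
        push_cast
        ring
      calc _ ≤ _ := mul_le_mul_of_nonneg_left h3 (by positivity)
        _ ≤ _ := h1
        _ ≤ C / ε ^ 4 * Real.exp (τ * ε ^ (-α)) ^ 2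
            * (C' * Real.exp (-((2 * τ + 1) * 2 ^ α * (2 * ε) ^ (-α))))
            + D * Real.exp (τ * (R / 2) ^ (-α)) ^ 2 * J :=
          add_le_add_left (mul_le_mul_of_nonneg_left h2 (by positivity)) _
        _ = _ := by rw [← h4]; ring
    have hgap : (R / 2) ^ (-α) < (R / 4) ^ (-α) :=
      Real.rpow_lt_rpow_of_neg (by positivity) (by linarith) (by linarith)
    have lim : Filter.Tendsto (fun τ : ℝ => D * J
        * Real.exp (-(τ * (2 * ((R / 4) ^ (-α) - (R / 2) ^ (-α)))))) Filter.atTop (nhds 0) := by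
      have := (Real.tendsto_exp_neg_atTop_nhds_zero.comp (Filter.tendsto_id.atTop_mul_const
        (by linarith : 0 < 2 * ((R / 4) ^ (-α) - (R / 2) ^ (-α))))).const_mul (D * J)
      simpa using this
    refine ge_of_tendsto lim ?_
    filter_upwards [Filter.eventually_ge_atTop τ₀] with τ hτ
    have h1 := step τ hτ
    have h2 : D * J * Real.exp (-(τ * (2 * ((R / 4) ^ (-α) - (R / 2) ^ (-α)))))
        = D * Real.exp (τ * (R / 2) ^ (-α)) ^ 2 * J / Real.exp (τ * (R / 4) ^ (-α)) ^ 2 := by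
      rw [← Real.exp_nat_mul, ← Real.exp_nat_mul, mul_div_right_comm, mul_div_assoc,
        ← Real.exp_sub, mul_right_comm]
      congr 3
      push_cast
      ring
    rw [h2, le_div_iff₀ (by positivity), mul_comm]
    exact h1
  have punct : ∀ x ∈ ball c (R / 4), x ≠ c → ∀ m, u m x = 0 := by
    intro x hx hxc
    have hpos : 0 < dist x c := dist_pos.2 hxc
    have hop : IsOpen {x : E3 | dist x c > 0 ∧ dist x c < R / 4} :=
      (isOpen_lt_dist c 0).inter isOpen_ball
    have hopδ : IsOpen {y : E3 | dist x c / 2 < dist y c ∧ dist y c < R / 4} :=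
      (isOpen_lt_dist c (dist x c / 2)).inter isOpen_ball
    have h0 : ∫ y in {y | dist x c / 2 < dist y c ∧ dist y c < R / 4},
        ((∑ m, u m y ^ 2) + v y ^ 2) = 0 :=
      le_antisymm (annulus _ (by positivity)) (integral_nonneg fun y => by positivity)
    rw [setIntegral_eq_zero_iff_of_nonneg_ae (Filter.Eventually.of_forall fun y => by positivity)
      (hWi _ fun y hy => hy.2)] at h0
    have h1 := Measure.eqOn_open_of_ae_eq h0 hopδ hWc.continuousOn continuousOn_const
    have h2 : (∑ m, u m x ^ 2) + v x ^ 2 = 0 :=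
      h1 (show x ∈ _ from ⟨by linarith, mem_ball.1 hx⟩)
    intro m
    have h3 : u m x ^ 2 ≤ ∑ m, u m x ^ 2 :=
      Finset.single_le_sum (f := fun m => u m x ^ 2) (fun _ _ => sq_nonneg _) (Finset.mem_univ m)
    exact pow_eq_zero_iff (two_ne_zero) |>.1
      (le_antisymm (by linarith [sq_nonneg (v x)]) (sq_nonneg _))
  intro x hx m
  by_cases hxc : x = c
  · have hcl : IsClosed {y | u m y = 0} := isClosed_eq (hu m).continuous continuous_const
    have hden : c ∈ closure ({c}ᶜ ∩ ball c (R / 4)) :=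
      (mem_closure_iff_nhdsWithin_neBot.2 (by
        rw [nhdsWithin_inter_of_mem' (nhdsWithin_le_nhds (ball_mem_nhds c (by positivity)))]
        infer_instance))
    rw [hxc]
    exact closure_minimal (fun y hy => punct y hy.2 hy.1 m) hcl hden
  · exact punct x hx hxc m

end LocalUniqueness

theorem CarlemanCoeff.mono {a : Fin 3 → Fin 3 → E3 → ℝ} {B B' : Set E3} {α κ g K : ℝ}
    (h : CarlemanCoeff a B α κ g K) (hB : B' ⊆ B) : CarlemanCoeff a B' α κ g K where
  smooth := h.smooth
  symm := h.symm
  one_le := h.one_le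
  κ_pos := h.κ_pos
  g₀_pos := h.g₀_pos
  elliptic := fun x hx => h.elliptic x (hB hx)
  a0 := fun x hx => h.a0 x (hB hx)
  a1 := fun x hx => h.a1 x (hB hx)
  a2 := fun x hx => h.a2 x (hB hx)
  cc1 := fun x hx => h.cc1 x (hB hx)
  cc2 := fun x hx => h.cc2 x (hB hx)

theorem sm_mul_of_contDiffOn {Ω : Set E3} (hΩ : IsOpen Ω) {η f : E3 → ℝ} (hη : Sm η)
    (hηs : tsupport η ⊆ Ω) (hf : ContDiffOn ℝ (⊤ : ℕ∞) f Ω) : Sm fun x => η x * f x := by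
  refine contDiff_iff_contDiffAt.2 fun x => ?_
  by_cases hx : x ∈ Ω
  · exact hη.contDiffAt.mul (hf.contDiffAt (hΩ.mem_nhds hx))
  · have h0 : (fun x => η x * f x) =ᶠ[nhds x] fun _ => 0 := by
      filter_upwards [(isClosed_tsupport η).isOpen_compl.mem_nhds fun h => hx (hηs h)] with y hy
      rw [image_eq_zero_of_notMem_tsupport hy, zero_mul]
    exact contDiffAt_const.congr_of_eventuallyEq h0

/-- The pair `(u, v)` solves a second-order triangular system with Gevrey coefficients on `B`
whose principal parts satisfy the convexity conditions for the weight with exponent `α`. -/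
def LocalModel (s α : ℝ) (B : Set E3) (u : Fin 3 → E3 → ℝ) (v : E3 → ℝ) : Prop :=
  ∃ a₁ a₂ p q c d h₂ h₁ h₀ b₁ b₀ K κ₁ g₁ K₁ κ₂ g₂ K₂,
    TriSystem s B a₁ a₂ p q c d h₂ h₁ h₀ b₁ b₀ u v ∧
    TriBound s B a₁ a₂ p q c d h₂ h₁ h₀ b₁ b₀ K ∧
    CarlemanCoeff a₁ B α κ₁ g₁ K₁ ∧ CarlemanCoeff a₂ B α κ₂ g₂ K₂

theorem LocalModel.eq_zero_of_decayAt {s α : ℝ} {B : Set E3} {u : Fin 3 → E3 → ℝ} {v : E3 → ℝ}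
    (h : LocalModel s α B u v) (hα : 0 < α) {R₁ : ℝ} (hR₁ : 0 < R₁) :
    ∃ R > 0, R ≤ R₁ ∧ ∃ r > 0, ∀ c, ball c R ⊆ B → DecayAt c α (jetSq u v) →
      ∀ x ∈ ball c r, ∀ m, u m x = 0 := by
  obtain ⟨a₁, a₂, p, q, c, d, h₂, h₁, h₀, b₁, b₀, K, κ₁, g₁, K₁, κ₂, g₂, K₂, S, T, hc₁, hc₂⟩ := h
  exact S.eq_zero_of_decayAt T hc₁ hc₂ hα hR₁

/-- The eigenvalue condition at an arbitrary point. -/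
def EigCondAt (a : Fin 3 → Fin 3 → E3 → ℝ) (α : ℝ) (x : E3) : Prop :=
  ∀ h : (coefMatrix a x).IsHermitian, ∀ i j : Fin 3,
    (h.eigenvalues i - h.eigenvalues j) / h.eigenvalues j < α

theorem exists_eigCondAt (a : Fin 3 → Fin 3 → E3 → ℝ) (x : E3) :
    ∃ α₀, ∀ α, α₀ ≤ α → EigCondAt a α x := by
  by_cases h : (coefMatrix a x).IsHermitian
  · obtain ⟨M, hM⟩ := Finite.exists_le fun i : Fin 3 × Fin 3 =>
      (h.eigenvalues i.1 - h.eigenvalues i.2) / h.eigenvalues i.2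
    exact ⟨M + 1, fun α hα _ i j => by linarith [hM (i, j)]⟩
  · exact ⟨0, fun _ _ h' => absurd h' h⟩

theorem exists_carlemanCoeff_of_eigCondAt {a : Fin 3 → Fin 3 → E3 → ℝ} (ha : ∀ j k, Sm (a j k))
    (hsym : ∀ j k, a j k = a k j) {α c₀ : ℝ} {x₀ : E3} (hc₀ : 0 < c₀)
    (hell : ∀ ξ : Fin 3 → ℝ, c₀ * (∑ i, ξ i ^ 2) ≤ ∑ j, ∑ k, a j k x₀ * ξ j * ξ k)
    (heig : EigCondAt a α x₀) : ∃ r > 0, ∃ κ g K, CarlemanCoeff a (ball x₀ r) α κ g K := by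
  have hA : (coefMatrix a x₀).IsHermitian := by
    ext j k
    simp [coefMatrix, hsym k j]
  obtain ⟨g, hg, h⟩ := exists_convexity_const hA (eigenvalues_pos hA hc₀ hell) (heig hA)
  obtain ⟨r, hr, κ, K, H⟩ := exists_carlemanCoeff ha hsym hg x₀ h
  exact ⟨r, hr, κ, g, K, H⟩

section Localization

variable {Ω : Set E3} {s α κ : ℝ} {t : Fin 3 → Fin 3 → E3 → ℝ} {lam mu rho : E3 → ℝ}
  {u : E3 → Fin 3 → ℝ}

theorem a1coef_congr {t' : Fin 3 → Fin 3 → E3 → ℝ} {mu' : E3 → ℝ} {x : E3}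
    (ht : ∀ j k, t' j k x = t j k x) (hmu : mu' x = mu x) (j k : Fin 3) :
    a1coef t' mu' j k x = a1coef t mu j k x := by
  simp only [a1coef, ht, hmu]

theorem a2coef_congr {t' : Fin 3 → Fin 3 → E3 → ℝ} {lam' mu' : E3 → ℝ} {x : E3}
    (ht : ∀ j k, t' j k x = t j k x) (hlam : lam' x = lam x) (hmu : mu' x = mu x)
    (j k : Fin 3) : a2coef t' lam' mu' j k x = a2coef t lam mu j k x := by
  simp only [a2coef, ht, hlam, hmu]

theorem stress_congr {t' : Fin 3 → Fin 3 → E3 → ℝ} {lam' mu' : E3 → ℝ} {u' : E3 → Fin 3 → ℝ}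
    {U : Set E3} (hU : IsOpen U) (ht : ∀ x ∈ U, ∀ j k, t' j k x = t j k x)
    (hlam : ∀ x ∈ U, lam' x = lam x) (hmu : ∀ x ∈ U, mu' x = mu x)
    (hu : ∀ x ∈ U, ∀ m, u' x m = u x m) (i j : Fin 3) :
    ∀ x ∈ U, stress t' lam' mu' u' x i j = stress t lam mu u x i j := fun x hx => by
  have h : ∀ k m, pd k (fun y => u' y m) x = pd k (fun y => u y m) x := fun k m =>
    pd_congr hU (fun y hy => hu y hy m) x hx
  simp only [stress, strain, divg, h, ht x hx, hlam x hx, hmu x hx]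

theorem coefMatrix_congr {a a' : Fin 3 → Fin 3 → E3 → ℝ} {x : E3}
    (h : ∀ j k, a' j k x = a j k x) : coefMatrix a' x = coefMatrix a x := by
  ext j k; exact h j k

theorem EigCondAt.congr {a a' : Fin 3 → Fin 3 → E3 → ℝ} {x : E3} (h : EigCondAt a α x)
    (ha : ∀ j k, a' j k x = a j k x) : EigCondAt a' α x := by
  unfold EigCondAt at h ⊢
  rwa [coefMatrix_congr ha]

/-- Near every point the residual stress system reduces to a local model. -/
theorem exists_localModel (hΩ : IsOpen Ω) (hs : 0 ≤ s)
    (htsym : ∀ j k : Fin 3, ∀ x ∈ Ω, t j k x = t k j x)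
    (hdivT : ∀ x ∈ Ω, ∀ i : Fin 3, (∑ j, pd j (t i j) x) = 0)
    (hGt : ∀ j k : Fin 3, GevreyOn s Ω (t j k))
    (hGlam : GevreyOn s Ω lam) (hGmu : GevreyOn s Ω mu) (hGrho : GevreyOn s Ω rho)
    (hell1 : UnifElliptic (a1coef t mu) Ω) (hell2 : UnifElliptic (a2coef t lam mu) Ω)
    (hu : ∀ i : Fin 3, ContDiffOn ℝ (⊤ : ℕ∞) (fun x => u x i) Ω)
    (hsol : ResSystem t lam mu rho κ u Ω) {x₀ : E3} (hx₀ : x₀ ∈ Ω)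
    (heig1 : EigCondAt (a1coef t mu) α x₀) (heig2 : EigCondAt (a2coef t lam mu) α x₀) :
    ∃ r > 0, ball x₀ r ⊆ Ω ∧ ∃ u' : E3 → Fin 3 → ℝ, (∀ x ∈ ball x₀ r, ∀ m, u' x m = u x m) ∧
      LocalModel s α (ball x₀ r) (fun m x => u' x m) (divg u') := by
  obtain ⟨ρ, hρ, hρΩ⟩ := Metric.nhds_basis_closedBall.mem_iff.1 (hΩ.mem_nhds hx₀)
  let η : ContDiffBump x₀ := ⟨ρ / 2, ρ, by positivity, by linarith⟩
  have hη : Sm η := η.contDiff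
  have hηs : tsupport η ⊆ Ω := by rw [η.tsupport_eq]; exact hρΩ
  have hη1 : ∀ x ∈ ball x₀ (ρ / 2), η x = 1 := fun x hx =>
    η.one_of_mem_closedBall (ball_subset_closedBall hx)
  have hcut : ∀ f : E3 → ℝ, ∀ x ∈ ball x₀ (ρ / 2), η x * f x = f x := fun f x hx => by
    rw [hη1 x hx, one_mul]
  have hsm : ∀ f : E3 → ℝ, ContDiffOn ℝ (⊤ : ℕ∞) f Ω → Sm fun x => η x * f x := fun f hf =>
    sm_mul_of_contDiffOn hΩ hη hηs hf
  have hB₀ : ball x₀ (ρ / 2) ⊆ Ω :=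
    (ball_subset_closedBall.trans (closedBall_subset_closedBall (by linarith))).trans hρΩ
  obtain ⟨t', ht'⟩ : ∃ t' : Fin 3 → Fin 3 → E3 → ℝ, t' = fun j k x => η x * t j k x := ⟨_, rfl⟩
  obtain ⟨lam', hlam'⟩ : ∃ f : E3 → ℝ, f = fun x => η x * lam x := ⟨_, rfl⟩
  obtain ⟨mu', hmu'⟩ : ∃ f : E3 → ℝ, f = fun x => η x * mu x := ⟨_, rfl⟩
  obtain ⟨rho', hrho'⟩ : ∃ f : E3 → ℝ, f = fun x => η x * rho x := ⟨_, rfl⟩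
  obtain ⟨u', hu'⟩ : ∃ u' : E3 → Fin 3 → ℝ, u' = fun x m => η x * u x m := ⟨_, rfl⟩
  have et : ∀ x ∈ ball x₀ (ρ / 2), ∀ j k, t' j k x = t j k x := fun x hx j k => by
    rw [ht']; exact hcut _ x hx
  have elam : ∀ x ∈ ball x₀ (ρ / 2), lam' x = lam x := by rw [hlam']; exact hcut _
  have emu : ∀ x ∈ ball x₀ (ρ / 2), mu' x = mu x := by rw [hmu']; exact hcut _
  have erho : ∀ x ∈ ball x₀ (ρ / 2), rho' x = rho x := by rw [hrho']; exact hcut _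
  have eu : ∀ x ∈ ball x₀ (ρ / 2), ∀ m, u' x m = u x m := fun x hx m => by
    rw [hu']; exact hcut (fun x => u x m) x hx
  have st : ∀ j k, Sm (t' j k) := fun j k => by rw [ht']; exact hsm _ (hGt j k).1
  have slam : Sm lam' := by rw [hlam']; exact hsm _ hGlam.1
  have smu : Sm mu' := by rw [hmu']; exact hsm _ hGmu.1
  have srho : Sm rho' := by rw [hrho']; exact hsm _ hGrho.1
  have su : ∀ m, Sm fun x => u' x m := fun m => by rw [hu']; exact hsm _ (hu m)
  have sym' : ∀ j k, t' j k = t' k j := fun j k => by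
    rw [ht']
    funext x
    by_cases hx : x ∈ Ω
    · simp only [htsym j k x hx]
    · simp only [image_eq_zero_of_notMem_tsupport fun h => hx (hηs h), zero_mul]
  have s1 : ∀ j k, Sm (a1coef t' mu' j k) := fun j k => by
    have := st j k
    unfold a1coef; fun_prop
  have s2 : ∀ j k, Sm (a2coef t' lam' mu' j k) := fun j k => by
    have := st j k
    unfold a2coef; fun_prop
  have sym1 : ∀ j k, a1coef t' mu' j k = a1coef t' mu' k j := fun j k => by
    funext x
    simp only [a1coef, sym' j k, eq_comm (a := j)]
  have sym2 : ∀ j k, a2coef t' lam' mu' j k = a2coef t' lam' mu' k j := fun j k => by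
    funext x
    simp only [a2coef, sym' j k, eq_comm (a := j)]
  have hmem : x₀ ∈ ball x₀ (ρ / 2) := mem_ball_self (by positivity)
  have c1 := a1coef_congr (et x₀ hmem) (emu x₀ hmem)
  have c2 := a2coef_congr (et x₀ hmem) (elam x₀ hmem) (emu x₀ hmem)
  obtain ⟨k₁, hk₁, hell1⟩ := hell1
  obtain ⟨k₂, hk₂, hell2⟩ := hell2
  obtain ⟨r₁, hr₁, κ₁, g₁, K₁, H₁⟩ := exists_carlemanCoeff_of_eigCondAt s1 sym1 hk₁
    (fun ξ => by simpa only [c1] using hell1 x₀ hx₀ ξ) (heig1.congr c1)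
  obtain ⟨r₂, hr₂, κ₂, g₂, K₂, H₂⟩ := exists_carlemanCoeff_of_eigCondAt s2 sym2 hk₂
    (fun ξ => by simpa only [c2] using hell2 x₀ hx₀ ξ) (heig2.congr c2)
  obtain ⟨r, hr⟩ : ∃ r, r = min (ρ / 2) (min r₁ r₂) := ⟨_, rfl⟩
  have l0 : ball x₀ r ⊆ ball x₀ (ρ / 2) := ball_subset_ball (by rw [hr]; exact min_le_left _ _)
  have l1 : ball x₀ r ⊆ ball x₀ r₁ :=
    ball_subset_ball (by rw [hr]; exact (min_le_right _ _).trans (min_le_left _ _))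
  have l2 : ball x₀ r ⊆ ball x₀ r₂ :=
    ball_subset_ball (by rw [hr]; exact (min_le_right _ _).trans (min_le_right _ _))
  have hBΩ := l0.trans hB₀
  obtain ⟨p, q, c, d, h₂, h₁, h₀, b₁, b₀, S⟩ := exists_triSystem hs (isOpen_ball (x := x₀) (ε := r))
    (κ := κ) (fun j k => (hGt j k).gev isOpen_ball hBΩ (st j k) fun x hx => et x (l0 hx) j k) sym'
    (hGlam.gev isOpen_ball hBΩ slam fun x hx => elam x (l0 hx))
    (hGmu.gev isOpen_ball hBΩ smu fun x hx => emu x (l0 hx))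
    (hGrho.gev isOpen_ball hBΩ srho fun x hx => erho x (l0 hx)) su
    (fun x hx i => by
      rw [Finset.sum_congr rfl fun j _ => pd_congr isOpen_ball (fun y hy => et y (l0 hy) i j) x hx]
      exact hdivT x (hBΩ hx) i)
    (fun x hx i => by
      rw [Finset.sum_congr rfl fun j _ => pd_congr isOpen_ball (stress_congr isOpen_ball
        (fun y hy => et y (l0 hy)) (fun y hy => elam y (l0 hy)) (fun y hy => emu y (l0 hy))
        (fun y hy => eu y (l0 hy)) i j) x hx, erho x (l0 hx), eu x (l0 hx)]
      exact hsol x (hBΩ hx) i)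
  obtain ⟨K, T⟩ := S.exists_triBound
  exact ⟨r, by rw [hr]; positivity, hBΩ, u', fun x hx => eu x (l0 hx), _, _, p, q, c, d, h₂, h₁, h₀,
    b₁, b₀, K, κ₁, g₁, K₁, κ₂, g₂, K₂, S, T, H₁.mono l1, H₂.mono l2⟩

end Localization

section WeightedNorm

/-- A cutoff function with support in `B`. -/
structure Cut (B : Set E3) (χ : E3 → ℝ) : Prop where
  sm : Sm χ
  cpt : HasCompactSupport χ
  nonneg : ∀ x, 0 ≤ χ x
  le_one : ∀ x, χ x ≤ 1
  sub : tsupport χ ⊆ B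

/-- The `L²` norm of `χ ^ (E + 1) f`. -/
def cn (χ : E3 → ℝ) (E : ℕ) (f : E3 → ℝ) : ℝ := lpNorm (fun x => χ x ^ (E + 1) * f x) 2 volume

variable {B : Set E3} {χ : E3 → ℝ} {f g : E3 → ℝ} {E : ℕ}

theorem cn_nonneg : 0 ≤ cn χ E f := lpNorm_nonneg

theorem Cut.eq_zero (h : Cut B χ) {x : E3} (hx : x ∉ B) : χ x = 0 :=
  image_eq_zero_of_notMem_tsupport fun h' => hx (h.sub h')

theorem Cut.smul_cpt (h : Cut B χ) (n : ℕ) (f : E3 → ℝ) :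
    HasCompactSupport fun x => χ x ^ (n + 1) * f x :=
  hasCompactSupport_of_forall h.cpt fun x hx => by simp [image_eq_zero_of_notMem_tsupport hx]

theorem Cut.memLp (h : Cut B χ) (hf : Sm f) :
    MemLp (fun x => χ x ^ (E + 1) * f x) 2 volume := by
  have := h.sm
  exact Continuous.memLp_of_hasCompactSupport
    (ContDiff.continuous (𝕜 := ℝ) (n := (⊤ : ℕ∞)) (by fun_prop)) (h.smul_cpt E f)

theorem Cut.integrable_sq (h : Cut B χ) (hf : Sm f) (E : ℕ) :
    Integrable fun x => (χ x ^ (E + 1) * f x) ^ 2 := by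
  have := h.sm
  exact sm_integrable_of_forall (by fun_prop) h.cpt
    fun x hx => by simp [image_eq_zero_of_notMem_tsupport hx]

theorem Cut.cn_sq (h : Cut B χ) (hf : Sm f) : cn χ E f ^ 2 = ∫ x, (χ x ^ (E + 1) * f x) ^ 2 := by
  have hm := h.memLp (E := E) hf
  rw [cn, lpNorm_eq_integral_norm_rpow_toReal (by norm_num) (by norm_num) hm.1]
  simp only [ENNReal.toReal_ofNat, Real.norm_eq_abs, Real.rpow_two, sq_abs]
  rw [← Real.rpow_mul_natCast (integral_nonneg fun x => sq_nonneg _)]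
  norm_num

theorem Cut.cn_add_le (h : Cut B χ) (hf : Sm f) (g : E3 → ℝ) :
    cn χ E (fun x => f x + g x) ≤ cn χ E f + cn χ E g := by
  have := lpNorm_add_le (g := fun x => χ x ^ (E + 1) * g x) (h.memLp (E := E) hf)
    (by norm_num : (1 : ENNReal) ≤ 2)
  refine le_trans (le_of_eq ?_) this
  unfold cn
  congr 1
  funext x
  simp only [Pi.add_apply]
  ring

theorem Cut.cn_sub_le (h : Cut B χ) (hf : Sm f) (g : E3 → ℝ) :
    cn χ E (fun x => f x - g x) ≤ cn χ E f + cn χ E g := by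
  have := lpNorm_sub_le (g := fun x => χ x ^ (E + 1) * g x) (h.memLp (E := E) hf)
    (by norm_num : (1 : ENNReal) ≤ 2)
  refine le_trans (le_of_eq ?_) this
  unfold cn
  congr 1
  funext x
  simp only [Pi.sub_apply]
  ring

theorem Cut.cn_sum_le (h : Cut B χ) {ι : Type*} (t : Finset ι) {f : ι → E3 → ℝ}
    (hf : ∀ i, Sm (f i)) : cn χ E (fun x => ∑ i ∈ t, f i x) ≤ ∑ i ∈ t, cn χ E (f i) := by
  have := lpNorm_sum_le (s := t) (fun i _ => h.memLp (E := E) (hf i))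
    (by norm_num : (1 : ENNReal) ≤ 2)
  refine le_trans (le_of_eq ?_) this
  unfold cn
  congr 1
  funext x
  simp only [Finset.sum_apply, Finset.mul_sum]

theorem Cut.cn_le_of_abs_le (h : Cut B χ) (hf : Sm f) (hg : Sm g) {k : ℝ} (hk : 0 ≤ k)
    (hfg : ∀ x ∈ B, |f x| ≤ k * |g x|) : cn χ E f ≤ k * cn χ E g := by
  refine abs_le_of_sq_le_sq' ?_ (mul_nonneg hk cn_nonneg) |>.2
  rw [mul_pow, h.cn_sq hf, h.cn_sq hg, ← integral_const_mul]
  refine integral_mono (h.integrable_sq hf E) ((h.integrable_sq hg E).const_mul _) fun x => ?_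
  by_cases hx : x ∈ B
  · have := sq_le_sq_of_abs_le (hfg x hx)
    rw [mul_pow, sq_abs] at this
    show (χ x ^ (E + 1) * f x) ^ 2 ≤ k ^ 2 * (χ x ^ (E + 1) * g x) ^ 2
    rw [mul_pow, mul_pow]
    nlinarith [sq_nonneg (χ x ^ (E + 1))]
  · simp [h.eq_zero hx]

theorem Cut.cn_congr (h : Cut B χ) (hfg : ∀ x ∈ B, f x = g x) : cn χ E f = cn χ E g := by
  unfold cn
  congr 1
  funext x
  by_cases hx : x ∈ B
  · rw [hfg x hx]
  · simp [h.eq_zero hx]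

theorem Cut.cn_anti (h : Cut B χ) (hf : Sm f) {E E' : ℕ} (hE : E ≤ E') :
    cn χ E' f ≤ cn χ E f := by
  refine abs_le_of_sq_le_sq' ?_ cn_nonneg |>.2
  rw [h.cn_sq hf, h.cn_sq hf]
  refine integral_mono (h.integrable_sq hf E') (h.integrable_sq hf E) fun x => ?_
  have : χ x ^ (E' + 1) ≤ χ x ^ (E + 1) :=
    pow_le_pow_of_le_one (h.nonneg x) (h.le_one x) (by omega)
  show (χ x ^ (E' + 1) * f x) ^ 2 ≤ (χ x ^ (E + 1) * f x) ^ 2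
  rw [mul_pow, mul_pow]
  have h0 := pow_nonneg (h.nonneg x) (E' + 1)
  exact mul_le_mul_of_nonneg_right (pow_le_pow_left₀ h0 this 2) (sq_nonneg _)

theorem Cut.exists_bound (h : Cut B χ) :
    ∃ X ≥ 1, (∀ j x, |pd j χ x| ≤ X) ∧ ∀ j k x, |pd j (pd k χ) x| ≤ X := by
  obtain ⟨K, hK, H⟩ := exists_bound_gsq_add_hsq h.sm h.cpt
  refine ⟨K + 1, by linarith, fun j x => ?_, fun j k x => ?_⟩ <;> rw [← sq_le_sq₀ (abs_nonneg _)
    (by linarith), sq_abs]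
  · nlinarith [H x, sq_pd_le_gsq χ x j, hsq_nonneg χ x]
  · nlinarith [H x, sq_pd_pd_le_hsq χ x j k, gsq_nonneg χ x]

theorem sq_gsq_pow_mul (χ g : E3 → ℝ) (n : ℕ) (x : E3) :
    χ x ^ n * χ x ^ n * gsq g x = ∑ j, (χ x ^ n * pd j g x) ^ 2 := by
  simp only [gsq, Fin.sum_univ_three]
  ring

theorem Cut.pd_pow_le (h : Cut B χ) {X : ℝ} (hX : 1 ≤ X) (h1 : ∀ j x, |pd j χ x| ≤ X)
    (h2 : ∀ j k x, |pd j (pd k χ) x| ≤ X) (n : ℕ) (x : E3) :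
    (∀ j, |pd j (fun x => χ x ^ (n + 3)) x| ≤ (n + 3) * X * χ x ^ (n + 2)) ∧
    ∀ j k, |pd j (pd k fun x => χ x ^ (n + 3)) x| ≤ (n + 3) ^ 2 * (2 * X ^ 2) * χ x ^ (n + 1) := by
  have hs := h.sm
  have h0 := h.nonneg x
  have hp : ∀ m, 0 ≤ χ x ^ m := fun m => pow_nonneg h0 m
  have hn : (0 : ℝ) ≤ n := Nat.cast_nonneg n
  refine ⟨fun j => ?_, fun j k => ?_⟩
  · have e : pd j (fun x => χ x ^ (n + 3)) x = (n + 3) * χ x ^ (n + 2) * pd j χ x := by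
      simp (disch := fun_prop) only [pd_pow]
      push_cast
      ring
    rw [e, abs_mul, abs_of_nonneg (by positivity)]
    nlinarith [mul_le_mul_of_nonneg_left (h1 j x) (by positivity : 0 ≤ (n + 3) * χ x ^ (n + 2))]
  · have e : pd j (pd k fun x => χ x ^ (n + 3)) x
        = χ x ^ (n + 1) * ((n + 3) * ((n + 2) * (pd j χ x * pd k χ x)
          + χ x * pd j (pd k χ) x)) := by
      simp (disch := fun_prop) only [pd_pow, pd_const_mul, pd_mul]
      push_cast
      ring
    have i1 : |pd j χ x * pd k χ x| ≤ X * X := abs_mul_le_mul (h1 j x) (h1 k x)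
    have i2 : |χ x * pd j (pd k χ) x| ≤ 1 * X :=
      abs_mul_le_mul (by rw [abs_of_nonneg h0]; exact h.le_one x) (h2 j k x)
    rw [e, abs_mul, abs_of_nonneg (hp _), abs_mul, abs_of_nonneg (by positivity), mul_comm]
    refine mul_le_mul_of_nonneg_right ?_ (hp _)
    have i3 : |(n + 2) * (pd j χ x * pd k χ x) + χ x * pd j (pd k χ) x|
        ≤ (n + 2) * (X * X) + 1 * X := by
      refine (abs_add_le _ _).trans (add_le_add ?_ i2)
      rw [abs_mul, abs_of_nonneg (by positivity)]
      exact mul_le_mul_of_nonneg_left i1 (by positivity)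
    calc _ ≤ ((n : ℝ) + 3) * ((n + 2) * (X * X) + 1 * X) :=
          mul_le_mul_of_nonneg_left i3 (by positivity)
      _ ≤ (n + 3) * ((n + 3) * (2 * X ^ 2)) := by
          refine mul_le_mul_of_nonneg_left ?_ (by positivity)
          nlinarith [mul_nonneg hn (sq_nonneg X)]
      _ = _ := by ring

/-- Interior elliptic regularity with cutoff powers. -/
theorem Cut.elliptic (h : Cut B χ) {a : Fin 3 → Fin 3 → E3 → ℝ} {c Λ : ℝ}
    (ha : ∀ j k, Sm (a j k)) (hsym : ∀ j k, a j k = a k j) (hc : 0 < c)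
    (hell : ∀ x ∈ B, ∀ ξ : Fin 3 → ℝ, c * (∑ i, ξ i ^ 2) ≤ ∑ j, ∑ k, a j k x * ξ j * ξ k)
    (hΛ : ∀ x ∈ B, ∀ j k, |a j k x| ≤ Λ) (hΛ' : ∀ x ∈ B, ∀ i j k, |pd i (a j k) x| ≤ Λ) :
    ∃ C ≥ 1, ∀ (n : ℕ) (g : E3 → ℝ), Sm g → ∀ i j,
      cn χ (n + 2) (pd i (pd j g)) ≤ C * (cn χ (n + 2) (op2 a g)
        + (n + 3) * (∑ i, cn χ (n + 1) (pd i g)) + (n + 3) ^ 2 * cn χ n g) := by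
  have hs := h.sm
  obtain ⟨C, hC, H⟩ := elliptic_L2 ha hsym hc hell hΛ hΛ'
  obtain ⟨X, hX, h1, h2⟩ := h.exists_bound
  obtain ⟨D, hD⟩ : ∃ D, D = 2 * C * (2 + 972 * Λ ^ 2 * X ^ 2 + 2 + 1944 * Λ ^ 2 * X ^ 4 + 6 * X ^ 2)
    + 108 * X ^ 2 + 216 * X ^ 4 + 1 := ⟨_, rfl⟩
  have hD1 : 1 ≤ D := by
    have : 0 ≤ 2 * C * (2 + 972 * Λ ^ 2 * X ^ 2 + 2 + 1944 * Λ ^ 2 * X ^ 4 + 6 * X ^ 2)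
      + 108 * X ^ 2 + 216 * X ^ 4 := by positivity
    linarith
  refine ⟨D, hD1, fun n g hg i j => ?_⟩
  obtain ⟨w, hw⟩ : ∃ w : E3 → ℝ, w = fun x => χ x ^ (n + 3) * g x := ⟨_, rfl⟩
  have hws : Sm w := by rw [hw]; fun_prop
  have hwc : HasCompactSupport w := by rw [hw]; exact h.smul_cpt (n + 2) g
  have hwt : tsupport w ⊆ tsupport χ := by
    refine closure_mono fun x hx => ?_
    rw [Function.mem_support] at hx ⊢
    intro h0
    exact hx (by rw [hw]; simp [h0])
  have Hw := H w hws hwc (hwt.trans h.sub)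
  obtain ⟨I, hI⟩ : ∃ I : E3 → ℝ, I = fun x => (χ x ^ (n + 3) * op2 a g x) ^ 2 := ⟨_, rfl⟩
  obtain ⟨J, hJ⟩ : ∃ J : E3 → ℝ, J = fun x => ∑ j, (χ x ^ (n + 2) * pd j g x) ^ 2 := ⟨_, rfl⟩
  obtain ⟨L, hL⟩ : ∃ L : E3 → ℝ, L = fun x => (χ x ^ (n + 1) * g x) ^ 2 := ⟨_, rfl⟩
  have iI : Integrable I := by rw [hI]; exact h.integrable_sq (by fun_prop) (n + 2)
  have iJ : Integrable J := by
    rw [hJ]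
    exact integrable_finsetSum _ fun j _ => h.integrable_sq (contDiff_pd hg) (n + 1)
  have iL : Integrable L := by rw [hL]; exact h.integrable_sq hg n
  have eI : ∫ x, I x = cn χ (n + 2) (op2 a g) ^ 2 := by
    rw [hI, h.cn_sq (by fun_prop)]
  have eJ : ∫ x, J x = ∑ j, cn χ (n + 1) (pd j g) ^ 2 := by
    rw [hJ, integral_finsetSum _ fun j _ => h.integrable_sq (contDiff_pd hg) (n + 1)]
    exact Finset.sum_congr rfl fun j _ => (h.cn_sq (contDiff_pd hg)).symm
  have eL : ∫ x, L x = cn χ n g ^ 2 := by rw [hL, h.cn_sq hg]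
  have hN : (1 : ℝ) ≤ n + 3 := by
    have : (0 : ℝ) ≤ n := Nat.cast_nonneg n
    linarith
  obtain ⟨N, hNe⟩ : ∃ N : ℝ, N = n + 3 := ⟨_, rfl⟩
  rw [← hNe] at hN ⊢
  have bJ : ∀ x, χ x ^ (n + 2) * χ x ^ (n + 2) * gsq g x = J x := fun x => by
    rw [hJ, sq_gsq_pow_mul]
  have bL : ∀ x, χ x ^ (n + 1) * χ x ^ (n + 1) * g x ^ 2 = L x := fun x => by
    rw [hL]; ring
  have b1 : ∀ x, op2 a w x ^ 2 + gsq w x ≤ 2 * I x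
      + (972 * Λ ^ 2 * X ^ 2 + 2) * (N ^ 2 * J x)
      + (1944 * Λ ^ 2 * X ^ 4 + 6 * X ^ 2) * (N ^ 4 * L x) := by
    intro x
    have hχ0 := h.nonneg x
    have hχ1 := h.le_one x
    have h0L : 0 ≤ L x := by rw [hL]; positivity
    have h0J : 0 ≤ J x := by rw [hJ]; positivity
    have h0I : 0 ≤ I x := by rw [hI]; positivity
    by_cases hx : x ∈ tsupport χ
    · obtain ⟨p1, p2⟩ := h.pd_pow_le hX h1 h2 n x
      rw [← hNe] at p1 p2
      have hφ : Sm fun x => χ x ^ (n + 3) := by fun_prop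
      have q1 := sq_op2_mul_le (fun j k => hΛ x (h.sub hx) j k) hφ hg p1 p2
      have q2 := gsq_mul_le hφ hg p1
      rw [← hw] at q1 q2
      have e1 : χ x ^ (n + 3) ^ 1 * χ x ^ (n + 3) ^ 1 * gsq g x ≤ J x := by
        rw [← bJ]
        have := pow_le_pow_of_le_one hχ0 hχ1 (show n + 2 ≤ n + 3 by omega)
        rw [pow_one]
        exact mul_le_mul_of_nonneg_right (mul_self_le_mul_self (pow_nonneg hχ0 _) this)
          (gsq_nonneg g x)
      have e2 : χ x ^ (n + 2) * χ x ^ (n + 2) * g x ^ 2 ≤ L x := by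
        rw [← bL]
        have := pow_le_pow_of_le_one hχ0 hχ1 (show n + 1 ≤ n + 2 by omega)
        exact mul_le_mul_of_nonneg_right (mul_self_le_mul_self (pow_nonneg hχ0 _) this)
          (sq_nonneg _)
      have e3 : (N * X * χ x ^ (n + 2)) ^ 2 * gsq g x = N ^ 2 * X ^ 2 * J x := by
        rw [← bJ]; ring
      have e4 : (N ^ 2 * (2 * X ^ 2) * χ x ^ (n + 1)) ^ 2 * g x ^ 2
          = 4 * (N ^ 4 * X ^ 4 * L x) := by
        rw [← bL]; ring
      have e5 : (χ x ^ (n + 3)) ^ 2 * op2 a g x ^ 2 = I x := by rw [hI]; ring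
      have e6 : (χ x ^ (n + 3)) ^ 2 * gsq g x ≤ N ^ 2 * J x := by
        rw [pow_one] at e1
        nlinarith [mul_le_mul_of_nonneg_right (one_le_pow₀ hN (n := 2)) h0J]
      have e7 : (N * X * χ x ^ (n + 2)) ^ 2 * g x ^ 2 ≤ X ^ 2 * (N ^ 4 * L x) := by
        have k1 : N ^ 2 ≤ N ^ 4 := pow_le_pow_right₀ hN (by norm_num)
        calc _ = X ^ 2 * (N ^ 2 * (χ x ^ (n + 2) * χ x ^ (n + 2) * g x ^ 2)) := by ring
          _ ≤ _ := by gcongr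
      rw [e3, e4, e5] at q1
      linarith
    · have : x ∉ tsupport w := fun h' => hx (hwt h')
      rw [op2_eq_zero_of_notMem this, gsq_eq_zero_of_notMem this]
      have : 0 ≤ 2 * I x + (972 * Λ ^ 2 * X ^ 2 + 2) * (N ^ 2 * J x)
        + (1944 * Λ ^ 2 * X ^ 4 + 6 * X ^ 2) * (N ^ 4 * L x) := by positivity
      linarith
  have b2 : ∀ x, (χ x ^ (n + 3) * pd i (pd j g) x) ^ 2 ≤ 2 * hsq w x
      + 108 * X ^ 2 * (N ^ 2 * J x) + 216 * X ^ 4 * (N ^ 4 * L x) := by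
    intro x
    obtain ⟨p1, p2⟩ := h.pd_pow_le hX h1 h2 n x
    rw [← hNe] at p1 p2
    have hφ : Sm fun x => χ x ^ (n + 3) := by fun_prop
    have q1 := sq_mul_hsq_le hφ hg p1 p2
    rw [← hw] at q1
    have q3 := mul_le_mul_of_nonneg_left (sq_pd_pd_le_hsq g x i j) (sq_nonneg (χ x ^ (n + 3)))
    have e3 : (N * X * χ x ^ (n + 2)) ^ 2 * gsq g x = X ^ 2 * (N ^ 2 * J x) := by
      rw [← bJ]; ring
    have e4 : (N ^ 2 * (2 * X ^ 2) * χ x ^ (n + 1)) ^ 2 * g x ^ 2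
        = 4 * (X ^ 4 * (N ^ 4 * L x)) := by
      rw [← bL]; ring
    rw [e3, e4] at q1
    rw [mul_pow]
    linarith
  have c1 := integral_mono (sm_integrable_of_forall (f := fun x => op2 a w x ^ 2 + gsq w x)
    (by fun_prop) hwc fun x hx => by
      rw [op2_eq_zero_of_notMem hx, gsq_eq_zero_of_notMem hx]; ring)
    (((iI.const_mul 2).add ((iJ.const_mul (N ^ 2)).const_mul
      (972 * Λ ^ 2 * X ^ 2 + 2))).add ((iL.const_mul (N ^ 4)).const_mul
      (1944 * Λ ^ 2 * X ^ 4 + 6 * X ^ 2))) b1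
  have c2 := integral_mono (h.integrable_sq (contDiff_pd (contDiff_pd hg)) (n + 2))
    ((((sm_integrable_of_forall (f := hsq w) (by fun_prop) hwc fun x hx =>
      hsq_eq_zero_of_notMem hx).const_mul 2).add ((iJ.const_mul (N ^ 2)).const_mul
      (108 * X ^ 2))).add ((iL.const_mul (N ^ 4)).const_mul (216 * X ^ 4))) b2
  rw [integral_add' (((iI.const_mul 2).add ((iJ.const_mul (N ^ 2)).const_mul
      (972 * Λ ^ 2 * X ^ 2 + 2)))) ((iL.const_mul (N ^ 4)).const_mul
      (1944 * Λ ^ 2 * X ^ 4 + 6 * X ^ 2)), integral_add' (iI.const_mul 2)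
      ((iJ.const_mul (N ^ 2)).const_mul (972 * Λ ^ 2 * X ^ 2 + 2))] at c1
  rw [integral_add' ((((sm_integrable_of_forall (f := hsq w) (by fun_prop) hwc fun x hx =>
      hsq_eq_zero_of_notMem hx).const_mul 2).add ((iJ.const_mul (N ^ 2)).const_mul
      (108 * X ^ 2)))) ((iL.const_mul (N ^ 4)).const_mul (216 * X ^ 4)),
      integral_add' ((sm_integrable_of_forall (f := hsq w) (by fun_prop) hwc fun x hx =>
      hsq_eq_zero_of_notMem hx).const_mul 2) ((iJ.const_mul (N ^ 2)).const_mul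
      (108 * X ^ 2)), ← h.cn_sq (contDiff_pd (contDiff_pd hg))] at c2
  simp only [integral_const_mul, eI, eJ, eL] at c1 c2
  obtain ⟨P, hP⟩ : ∃ P, P = cn χ (n + 2) (op2 a g) := ⟨_, rfl⟩
  obtain ⟨Q, hQ⟩ : ∃ Q : Fin 3 → ℝ, Q = fun i => cn χ (n + 1) (pd i g) := ⟨_, rfl⟩
  obtain ⟨R, hR⟩ : ∃ R, R = cn χ n g := ⟨_, rfl⟩
  have hQ' : ∀ i, cn χ (n + 1) (pd i g) = Q i := fun i => by rw [hQ]
  have P0 : 0 ≤ P := by rw [hP]; exact cn_nonneg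
  have Q0 : ∀ i, 0 ≤ Q i := fun i => by rw [hQ]; exact cn_nonneg
  have R0 : 0 ≤ R := by rw [hR]; exact cn_nonneg
  simp only [hQ', ← hP, ← hR] at c1 c2 ⊢
  have Qs : ∑ i, Q i ^ 2 ≤ (∑ i, Q i) ^ 2 := Finset.sum_sq_le_sq_sum_of_nonneg fun i _ => Q0 i
  have QS0 : 0 ≤ ∑ i, Q i := Finset.sum_nonneg fun i _ => Q0 i
  refine abs_le_of_sq_le_sq' ?_ (by positivity) |>.2
  have d1 : cn χ (n + 2) (pd i (pd j g)) ^ 2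
      ≤ D * (P ^ 2 + N ^ 2 * (∑ i, Q i ^ 2) + N ^ 4 * R ^ 2) := by
    have Ps : 0 ≤ P ^ 2 := sq_nonneg _
    have Js : 0 ≤ N ^ 2 * (∑ i, Q i ^ 2) :=
      mul_nonneg (sq_nonneg _) (Finset.sum_nonneg fun i _ => sq_nonneg _)
    have Ls : 0 ≤ N ^ 4 * R ^ 2 := by positivity
    have C1 := mul_le_mul_of_nonneg_left c1 hC.le
    obtain ⟨k₁, hk₁⟩ : ∃ k, k = 972 * Λ ^ 2 * X ^ 2 + 2 := ⟨_, rfl⟩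
    obtain ⟨k₂, hk₂⟩ : ∃ k, k = 1944 * Λ ^ 2 * X ^ 4 + 6 * X ^ 2 := ⟨_, rfl⟩
    have hk₁0 : 0 ≤ k₁ := by rw [hk₁]; positivity
    have hk₂0 : 0 ≤ k₂ := by rw [hk₂]; positivity
    have hD' : D = 2 * C * (2 + k₁ + k₂) + 108 * X ^ 2 + 216 * X ^ 4 + 1 := by
      rw [hD, hk₁, hk₂]; ring
    rw [← hk₁, ← hk₂] at C1
    have m0 : 0 ≤ 2 * C * (k₁ + k₂) + 108 * X ^ 2 + 216 * X ^ 4 + 1 := by positivity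
    have m1 : 0 ≤ 2 * C * (2 + k₂) + 216 * X ^ 4 + 1 := by positivity
    have m2 : 0 ≤ 2 * C * (2 + k₁) + 108 * X ^ 2 + 1 := by positivity
    rw [hD']
    linarith [mul_nonneg m0 Ps, mul_nonneg m1 Js, mul_nonneg m2 Ls]
  have d2 : P ^ 2 + N ^ 2 * (∑ i, Q i ^ 2) + N ^ 4 * R ^ 2
      ≤ (P + N * (∑ i, Q i) + N ^ 2 * R) ^ 2 := by
    have m0 : 0 ≤ P * (N * (∑ i, Q i)) := by positivity
    have m1 : 0 ≤ P * (N ^ 2 * R) := by positivity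
    have m2 : 0 ≤ (N * (∑ i, Q i)) * (N ^ 2 * R) := by positivity
    have m3 := mul_le_mul_of_nonneg_left Qs (sq_nonneg N)
    linarith
  rw [mul_pow]
  have d3 : D ≤ D ^ 2 := by nlinarith
  exact d1.trans (mul_le_mul d3 d2 (by positivity) (by positivity))

end WeightedNorm

section Leibniz

variable {B : Set E3} {χ : E3 → ℝ} {E : ℕ}

theorem sum_antidiagonal_choose_succ_mul' (f g : ℕ → ℝ) (n : ℕ) :
    ∑ ij ∈ antidiagonal (n + 1), ((n + 1).choose ij.1 : ℝ) * (f ij.1 * g ij.2)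
      = (∑ ij ∈ antidiagonal n, (n.choose ij.1 : ℝ) * (f (ij.1 + 1) * g ij.2))
        + ∑ ij ∈ antidiagonal n, (n.choose ij.1 : ℝ) * (f ij.1 * g (ij.2 + 1)) := by
  rw [sum_antidiagonal_choose_succ_mul (fun i j => f i * g j), add_comm]
  congr 1
  refine Finset.sum_congr rfl fun ij hij => ?_
  rw [HasAntidiagonal.mem_antidiagonal] at hij
  rw [Nat.choose_symm_of_eq_add hij.symm]

theorem Cut.cn_pdl_mul_le (h : Cut B χ) (l : List (Fin 3)) {a g : E3 → ℝ} (ha : Sm a) (hg : Sm g)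
    {α β : ℕ → ℝ} (hα0 : ∀ n, 0 ≤ α n)
    (hα : ∀ l' : List (Fin 3), l'.length ≤ l.length → ∀ x ∈ B, |pdl l' a x| ≤ α l'.length)
    (hβ : ∀ l' : List (Fin 3), l'.length ≤ l.length → cn χ E (pdl l' g) ≤ β l'.length) :
    cn χ E (pdl l fun x => a x * g x)
      ≤ ∑ ij ∈ antidiagonal l.length, (l.length.choose ij.1 : ℝ) * (α ij.1 * β ij.2) := by
  induction l generalizing a g α β with
  | nil =>
    simp only [List.length_nil, Finset.Nat.antidiagonal_zero, Finset.sum_singleton, Nat.choose_self,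
      Nat.cast_one, one_mul, pdl_nil]
    refine (h.cn_le_of_abs_le (k := α 0) (by fun_prop) hg (hα0 0) fun x hx => ?_).trans
      (mul_le_mul_of_nonneg_left (hβ [] le_rfl) (hα0 0))
    rw [abs_mul]
    exact mul_le_mul_of_nonneg_right (hα [] le_rfl x hx) (abs_nonneg _)
  | cons i l ih =>
    have e : pdl (i :: l) (fun x => a x * g x) = fun x => pdl l (fun x => pd i a x * g x) x
        + pdl l (fun x => a x * pd i g x) x := by
      rw [pdl_cons, ← pdl_add (by fun_prop) (by fun_prop)]
      congr 1
      simp (disch := fun_prop) only [pd_mul]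
    rw [e, List.length_cons, sum_antidiagonal_choose_succ_mul']
    refine (h.cn_add_le (by fun_prop) _).trans (add_le_add ?_ ?_)
    · exact ih (α := fun n => α (n + 1)) (contDiff_pd ha) hg (fun n => hα0 _)
        (fun l' hl' => hα (i :: l') (by simpa using hl'))
        (fun l' hl' => hβ l' (by simp only [List.length_cons]; omega))
    · exact ih (β := fun n => β (n + 1)) ha (contDiff_pd hg) hα0
        (fun l' hl' => hα l' (by simp only [List.length_cons]; omega))
        (fun l' hl' => hβ (i :: l') (by simpa using hl'))

theorem Cut.cn_commutator_le (h : Cut B χ) (l : List (Fin 3)) {a g : E3 → ℝ} (ha : Sm a)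
    (hg : Sm g) {α β : ℕ → ℝ} (hα0 : ∀ n, 0 ≤ α n) (hα00 : α 0 = 0)
    (hα : ∀ l' : List (Fin 3), l' ≠ [] → l'.length ≤ l.length → ∀ x ∈ B,
      |pdl l' a x| ≤ α l'.length)
    (hβ : ∀ l' : List (Fin 3), l'.length < l.length → cn χ E (pdl l' g) ≤ β l'.length) :
    cn χ E (fun x => pdl l (fun x => a x * g x) x - a x * pdl l g x)
      ≤ ∑ ij ∈ antidiagonal l.length, (l.length.choose ij.1 : ℝ) * (α ij.1 * β ij.2) := by
  induction l generalizing g β with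
  | nil => simp [hα00, cn]
  | cons i l ih =>
    have e : (fun x => pdl (i :: l) (fun x => a x * g x) x - a x * pdl (i :: l) g x)
        = fun x => pdl l (fun x => pd i a x * g x) x
        + (pdl l (fun x => a x * pd i g x) x - a x * pdl l (pd i g) x) := by
      funext x
      have : pdl (i :: l) (fun x => a x * g x) = fun x => pdl l (fun x => pd i a x * g x) x
        + pdl l (fun x => a x * pd i g x) x := by
        rw [pdl_cons, ← pdl_add (by fun_prop) (by fun_prop)]
        congr 1
        simp (disch := fun_prop) only [pd_mul]
      rw [this, pdl_cons]
      ring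
    rw [e, List.length_cons, sum_antidiagonal_choose_succ_mul']
    refine (h.cn_add_le (by fun_prop) _).trans (add_le_add ?_ ?_)
    · exact h.cn_pdl_mul_le l (α := fun n => α (n + 1)) (contDiff_pd ha) hg (fun n => hα0 _)
        (fun l' hl' => hα (i :: l') (by simp) (by simpa using hl'))
        (fun l' hl' => hβ l' (by simp only [List.length_cons]; omega))
    · exact ih (β := fun n => β (n + 1)) (contDiff_pd hg)
        (fun l' h0 hl' => hα l' h0 (by simp only [List.length_cons]; omega))
        (fun l' hl' => hβ (i :: l') (by simpa using hl'))

/-- The Gevrey weights `b ^ n n!^s`. -/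
def gw (s b : ℝ) (n : ℕ) : ℝ := b ^ n * (n.factorial : ℝ) ^ s

theorem gw_pos {s b : ℝ} (hb : 0 < b) (n : ℕ) : 0 < gw s b n := by
  have := Nat.factorial_pos n
  unfold gw
  positivity

theorem choose_mul_factorial_rpow_le {s : ℝ} (hs : 1 ≤ s) (i j q : ℕ) :
    ((i + j).choose i : ℝ) * ((i.factorial : ℝ) ^ s * ((j + q).factorial : ℝ) ^ s)
      ≤ ((i + j + q).factorial : ℝ) ^ s := by
  have h1 : (i + j).choose i * (i.factorial * (j + q).factorial) ≤ (i + j + q).factorial := by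
    have e : (i + j + q).choose i * i.factorial * (j + q).factorial = (i + j + q).factorial := by
      have := Nat.choose_mul_factorial_mul_factorial (show i ≤ i + j + q by omega)
      rwa [show i + j + q - i = j + q by omega] at this
    rw [← e, mul_assoc]
    exact Nat.mul_le_mul_right _ (Nat.choose_le_choose i (by omega))
  have h2 : (1 : ℝ) ≤ (i + j).choose i := by
    exact_mod_cast Nat.choose_pos (Nat.le_add_right i j)
  calc _ ≤ ((i + j).choose i : ℝ) ^ s * ((i.factorial : ℝ) ^ s * ((j + q).factorial : ℝ) ^ s) := by
        refine mul_le_mul_of_nonneg_right ?_ (by positivity)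
        nth_rewrite 1 [← Real.rpow_one ((i + j).choose i : ℝ)]
        exact Real.rpow_le_rpow_of_exponent_le h2 hs
    _ = (((i + j).choose i * (i.factorial * (j + q).factorial) : ℕ) : ℝ) ^ s := by
        push_cast
        rw [Real.mul_rpow (by positivity) (by positivity),
          Real.mul_rpow (by positivity) (by positivity)]
    _ ≤ _ := Real.rpow_le_rpow (by positivity) (by exact_mod_cast h1) (by linarith)

theorem gevrey_term_le {s K b H : ℝ} (hs : 1 ≤ s) (hK : 0 < K) (hb : 2 * K ≤ b) (hH : 0 ≤ H)
    (i j q : ℕ) :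
    ((i + j).choose i : ℝ) * (K ^ (i + 1) * (i.factorial : ℝ) ^ s * (H * gw s b (j + q)))
      ≤ K * H * gw s b (i + j + q) * (K / b) ^ i := by
  have hb0 : 0 < b := by linarith
  have h1 := choose_mul_factorial_rpow_le hs i j q
  have e1 : K * H * gw s b (i + j + q) * (K / b) ^ i
      = K ^ (i + 1) * H * b ^ (j + q) * ((i + j + q).factorial : ℝ) ^ s := by
    unfold gw
    rw [div_pow, show b ^ (i + j + q) = b ^ i * b ^ (j + q) by rw [← pow_add, add_assoc]]
    field_simp
    ring
  rw [e1, gw]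
  calc _ = K ^ (i + 1) * H * b ^ (j + q) * (((i + j).choose i : ℝ) * ((i.factorial : ℝ) ^ s
        * ((j + q).factorial : ℝ) ^ s)) := by ring
    _ ≤ _ := mul_le_mul_of_nonneg_left h1 (by positivity)

theorem sum_range_half_pow_le {x : ℝ} (hx0 : 0 ≤ x) (hx : x ≤ 1 / 2) (n : ℕ) :
    ∑ i ∈ range n, x ^ i ≤ 2 := by
  induction n with
  | zero => simp
  | succ n ih =>
    rw [Finset.sum_range_succ']
    simp only [pow_succ, ← Finset.sum_mul, pow_zero]
    nlinarith [Finset.sum_nonneg fun i (_ : i ∈ range n) => pow_nonneg hx0 i]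

theorem leibniz_sum_le {s K b H : ℝ} (hs : 1 ≤ s) (hK : 0 < K) (hb : 2 * K ≤ b) (hH : 0 ≤ H)
    (n q : ℕ) :
    ∑ ij ∈ antidiagonal n, (n.choose ij.1 : ℝ) * (K ^ (ij.1 + 1) * (ij.1.factorial : ℝ) ^ s
      * (H * gw s b (ij.2 + q))) ≤ 2 * K * (H * gw s b (n + q)) := by
  have hb0 : 0 < b := by linarith
  have hx : K / b ≤ 1 / 2 := by rw [div_le_div_iff₀ hb0 two_pos]; linarith
  have hw := gw_pos (s := s) hb0 (n + q)
  calc _ ≤ ∑ ij ∈ antidiagonal n, K * H * gw s b (n + q) * (K / b) ^ ij.1 := by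
        refine Finset.sum_le_sum fun ij hij => ?_
        rw [HasAntidiagonal.mem_antidiagonal] at hij
        rw [← hij]
        exact gevrey_term_le hs hK hb hH _ _ _
    _ = K * H * gw s b (n + q) * ∑ i ∈ range (n + 1), (K / b) ^ i := by
        rw [Finset.mul_sum, Finset.Nat.sum_antidiagonal_eq_sum_range_succ_mk]
    _ ≤ K * H * gw s b (n + q) * 2 :=
        mul_le_mul_of_nonneg_left (sum_range_half_pow_le (by positivity) hx _) (by positivity)
    _ = _ := by ring

theorem commutator_sum_le {s K b H : ℝ} (hs : 1 ≤ s) (hK : 0 < K) (hb : 2 * K ≤ b) (hH : 0 ≤ H)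
    (n q : ℕ) :
    ∑ ij ∈ antidiagonal n, (n.choose ij.1 : ℝ) * ((if ij.1 = 0 then 0 else
      K ^ (ij.1 + 1) * (ij.1.factorial : ℝ) ^ s) * (H * gw s b (ij.2 + q)))
      ≤ 2 * K ^ 2 / b * (H * gw s b (n + q)) := by
  have hb0 : 0 < b := by linarith
  have hx : K / b ≤ 1 / 2 := by rw [div_le_div_iff₀ hb0 two_pos]; linarith
  have hw := gw_pos (s := s) hb0 (n + q)
  calc _ ≤ ∑ ij ∈ antidiagonal n, K * H * gw s b (n + q) *
          (if ij.1 = 0 then 0 else (K / b) ^ ij.1) := by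
        refine Finset.sum_le_sum fun ij hij => ?_
        rw [HasAntidiagonal.mem_antidiagonal] at hij
        rw [← hij]
        split_ifs
        · simp
        · exact gevrey_term_le hs hK hb hH _ _ _
    _ = K * H * gw s b (n + q) * ∑ i ∈ range (n + 1), (if i = 0 then 0 else (K / b) ^ i) := by
        rw [Finset.mul_sum, Finset.Nat.sum_antidiagonal_eq_sum_range_succ_mk]
    _ = K * H * gw s b (n + q) * (K / b * ∑ i ∈ range n, (K / b) ^ i) := by
        rw [Finset.sum_range_succ', Finset.mul_sum]
        simp [pow_succ']
    _ ≤ K * H * gw s b (n + q) * (K / b * 2) :=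
        mul_le_mul_of_nonneg_left (mul_le_mul_of_nonneg_left
          (sum_range_half_pow_le (by positivity) hx _) (by positivity)) (by positivity)
    _ = _ := by ring

theorem gw_mono {s b : ℝ} (hs : 1 ≤ s) (hb : 1 ≤ b) {m n : ℕ} (hmn : m ≤ n) :
    gw s b m ≤ gw s b n := by
  unfold gw
  have h1 := pow_le_pow_right₀ hb hmn
  have h2 : (m.factorial : ℝ) ^ s ≤ (n.factorial : ℝ) ^ s :=
    Real.rpow_le_rpow (by positivity) (by exact_mod_cast Nat.factorial_le hmn) (by linarith)
  have : 0 ≤ b := by linarith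
  exact mul_le_mul h1 h2 (by positivity) (by positivity)

theorem succ_mul_gw_le {s b : ℝ} (hs : 1 ≤ s) (hb : 0 < b) (n : ℕ) :
    (n + 1) * gw s b n ≤ gw s b (n + 1) / b := by
  have h1 : (n + 1 : ℝ) ≤ (n + 1 : ℝ) ^ s := by
    nth_rewrite 1 [← Real.rpow_one (n + 1 : ℝ)]
    exact Real.rpow_le_rpow_of_exponent_le (by linarith [Nat.cast_nonneg (α := ℝ) n]) hs
  unfold gw
  rw [Nat.factorial_succ, Nat.cast_mul, Real.mul_rpow (by positivity) (by positivity), pow_succ]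
  push_cast
  calc _ ≤ (n + 1 : ℝ) ^ s * (b ^ n * (n.factorial : ℝ) ^ s) :=
        mul_le_mul_of_nonneg_right h1 (by positivity)
    _ = _ := by field_simp

end Leibniz

section GevreyRegularity

variable {B : Set E3} {χ : E3 → ℝ} {s b K : ℝ}

theorem pdl_append (m l : List (Fin 3)) (f : E3 → ℝ) : pdl (m ++ l) f = pdl l (pdl m f) := by
  induction m generalizing f with
  | nil => rfl
  | cons i m ih => exact ih (pd i f)

/-- Gevrey bounds up to order `M` in weighted `L²` norms. -/
def JetBound (χ : E3 → ℝ) (s b : ℝ) (M : ℕ) (H : ℝ) (f : E3 → ℝ) : Prop :=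
  ∀ l : List (Fin 3), l.length ≤ M → cn χ l.length (pdl l f) ≤ H * gw s b l.length

theorem JetBound.mono {M : ℕ} {H H' : ℝ} {f : E3 → ℝ} (h : JetBound χ s b M H f) (hb : 0 < b)
    (hH : H ≤ H') : JetBound χ s b M H' f := fun l hl =>
  (h l hl).trans (mul_le_mul_of_nonneg_right hH (gw_pos hb _).le)

theorem exists_jetBound_one (hb : 1 ≤ b) (f : E3 → ℝ) :
    ∃ H ≥ 0, JetBound χ s b 1 H f := by
  have h0 : ∀ i, 0 ≤ cn χ 1 (pd i f) := fun i => cn_nonneg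
  refine ⟨cn χ 0 f + ∑ i, cn χ 1 (pd i f), add_nonneg cn_nonneg (Finset.sum_nonneg fun i _ => h0 i),
    fun l hl => ?_⟩
  match l, hl with
  | [], _ =>
    have := Finset.sum_nonneg fun i (_ : i ∈ univ) => h0 i
    simp only [List.length_nil, pdl_nil, gw, pow_zero, Nat.factorial_zero, Nat.cast_one,
      Real.one_rpow, mul_one]
    linarith
  | [i], _ =>
    have h1 := Finset.single_le_sum (f := fun i => cn χ 1 (pd i f)) (fun i _ => h0 i)
      (Finset.mem_univ i)
    have h2 : 0 ≤ cn χ 0 f := cn_nonneg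
    have h3 : cn χ 1 (pd i f) ≤ cn χ 0 f + ∑ i, cn χ 1 (pd i f) := by linarith
    have h4 : 0 ≤ cn χ 0 f + ∑ i, cn χ 1 (pd i f) := (h0 i).trans h3
    simp only [List.length_cons, List.length_nil, zero_add, pdl_cons, pdl_nil, gw, pow_one,
      Nat.factorial_one, Nat.cast_one, Real.one_rpow, mul_one]
    exact h3.trans (le_mul_of_one_le_right h4 hb)
  | _ :: _ :: _, hl => simp at hl

theorem Cut.cn_pdl_add_le (h : Cut B χ) {E : ℕ} {l : List (Fin 3)} {f g : E3 → ℝ} {R R' : ℝ}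
    (hf : Sm f) (hg : Sm g) (h1 : cn χ E (pdl l f) ≤ R) (h2 : cn χ E (pdl l g) ≤ R') :
    cn χ E (pdl l fun x => f x + g x) ≤ R + R' := by
  rw [pdl_add hf hg]
  exact (h.cn_add_le (by fun_prop) _).trans (add_le_add h1 h2)

theorem Cut.cn_pdl_sum_le (h : Cut B χ) {E : ℕ} {l : List (Fin 3)} {f : Fin 3 → E3 → ℝ} {R : ℝ}
    (hf : ∀ i, Sm (f i)) (h1 : ∀ i, cn χ E (pdl l (f i)) ≤ R) :
    cn χ E (pdl l fun x => ∑ i, f i x) ≤ 3 * R := by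
  rw [pdl_sum hf]
  refine (h.cn_sum_le _ (fun i => by fun_prop)).trans ?_
  rw [Fin.sum_univ_three]
  linarith [h1 0, h1 1, h1 2]

theorem Cut.cn_pdl_mul_pdl_le (h : Cut B χ) (hs : 1 ≤ s) (hK : 0 < K) (hb : 2 * K ≤ b) {H : ℝ}
    (hH : 0 ≤ H) {a f : E3 → ℝ} (ha : Sm a) (hf : Sm f) (ga : GevBound s B K a)
    (l m : List (Fin 3)) (hm : m.length ≤ 2)
    (hj : JetBound χ s b (l.length + m.length) H f) :
    cn χ (l.length + 2) (pdl l fun x => a x * pdl m f x)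
      ≤ 2 * K * (H * gw s b (l.length + m.length)) := by
  refine (h.cn_pdl_mul_le l (α := fun n => K ^ (n + 1) * (n.factorial : ℝ) ^ s)
    (β := fun n => H * gw s b (n + m.length)) ha (by fun_prop) (fun n => by positivity)
    (fun l' _ => ga l') fun l' hl' => ?_).trans (leibniz_sum_le hs hK hb hH _ _)
  rw [← pdl_append]
  have e : (m ++ l').length = l'.length + m.length := by rw [List.length_append, add_comm]
  have := hj (m ++ l') (by omega)
  rw [e] at this
  exact (h.cn_anti (by fun_prop) (by omega)).trans this

theorem Cut.cn_commutator_pdl_le (h : Cut B χ) (hs : 1 ≤ s) (hK : 0 < K) (hb : 2 * K ≤ b) {H : ℝ}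
    (hH : 0 ≤ H) {a f : E3 → ℝ} (ha : Sm a) (hf : Sm f) (ga : GevBound s B K a)
    (l m : List (Fin 3)) (hm : m.length = 2) (hj : JetBound χ s b (l.length + 1) H f) :
    cn χ (l.length + 2) (fun x => pdl l (fun x => a x * pdl m f x) x - a x * pdl l (pdl m f) x)
      ≤ 2 * K ^ 2 / b * (H * gw s b (l.length + 2)) := by
  refine (h.cn_commutator_le l
    (α := fun n => if n = 0 then 0 else K ^ (n + 1) * (n.factorial : ℝ) ^ s)
    (β := fun n => H * gw s b (n + 2)) ha (by fun_prop)
    (fun n => by split_ifs <;> positivity) (by simp) (fun l' h0 _ x hx => ?_)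
    fun l' hl' => ?_).trans (commutator_sum_le hs hK hb hH _ _)
  · rw [if_neg (by simpa using h0)]
    exact ga l' x hx
  · rw [← pdl_append]
    have e : (m ++ l').length = l'.length + 2 := by rw [List.length_append, hm, add_comm]
    have := hj (m ++ l') (by omega)
    rw [e] at this
    exact (h.cn_anti (by fun_prop) (by omega)).trans this

/-- The elliptic step of the Gevrey induction. -/
theorem Cut.jetBound_succ (h : Cut B χ) (hB : IsOpen B) (hs : 1 ≤ s) (hK : 0 < K) (hb1 : 1 ≤ b)
    (hb : 2 * K ≤ b) {H C R : ℝ} (hH : 0 ≤ H) (hC : 1 ≤ C) {a : Fin 3 → Fin 3 → E3 → ℝ}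
    {F f : E3 → ℝ} (ha : ∀ j k, Sm (a j k)) (hF : Sm F) (hf : Sm f)
    (ga : ∀ j k, GevBound s B K (a j k))
    (hC' : ∀ (n : ℕ) (g : E3 → ℝ), Sm g → ∀ i j,
      cn χ (n + 2) (pd i (pd j g)) ≤ C * (cn χ (n + 2) (op2 a g)
        + (n + 3) * (∑ i, cn χ (n + 1) (pd i g)) + (n + 3) ^ 2 * cn χ n g))
    (heq : ∀ x ∈ B, op2 a f x = F x) (n : ℕ) (hj : JetBound χ s b (n + 1) H f)
    (hR : ∀ l : List (Fin 3), l.length = n → cn χ (n + 2) (pdl l F) ≤ R)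
    (hfin : C * (R + (18 * K ^ 2 + 23) / b * (H * gw s b (n + 2))) ≤ H * gw s b (n + 2)) :
    JetBound χ s b (n + 2) H f := by
  intro l hl
  by_cases hln : l.length ≤ n + 1
  · exact hj l hln
  have hb0 : 0 < b := by linarith
  match l, hl, hln with
  | [], _, hln => simp at hln
  | [i], _, hln => simp at hln
  | i :: j :: l, hl, hln =>
    have hlen : l.length = n := by simp only [List.length_cons] at hl hln; omega
    have e : pdl (i :: j :: l) f = pd j (pd i (pdl l f)) := by
      rw [pd_pdl hf, pd_pdl (contDiff_pd hf)]; rfl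
    rw [e, List.length_cons, List.length_cons, hlen]
    refine (hC' n (pdl l f) (by fun_prop) j i).trans (le_trans ?_ hfin)
    refine mul_le_mul_of_nonneg_left ?_ (by linarith)
    obtain ⟨G, hG⟩ : ∃ G, G = H * gw s b (n + 2) := ⟨_, rfl⟩
    rw [← hG]
    have hn0 : (0 : ℝ) ≤ n := Nat.cast_nonneg n
    have w1 := succ_mul_gw_le hs hb0 n
    have w2 := succ_mul_gw_le hs hb0 (n + 1)
    push_cast at w2
    have hw1 := (gw_pos (s := s) hb0 (n + 1)).le
    have hw0 := (gw_pos (s := s) hb0 n).le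
    have hG0 : 0 ≤ G / b := by
      rw [hG]
      have := (gw_pos (s := s) hb0 (n + 2)).le
      positivity
    have w3 : gw s b (n + 1) / b ≤ gw s b (n + 1) := div_le_self hw1 hb1
    have w4 : (n + 3) * (H * gw s b (n + 1)) ≤ 2 * (G / b) := by
      have := mul_le_mul_of_nonneg_left w2 hH
      rw [hG, mul_div_assoc]
      nlinarith [mul_nonneg hH hw1]
    have w5 : (n + 3) ^ 2 * (H * gw s b n) ≤ 6 * (G / b) := by
      have k1 : (n + 3) * (H * gw s b n) ≤ 3 * (H * gw s b (n + 1)) := by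
        have := mul_le_mul_of_nonneg_left (w1.trans w3) hH
        nlinarith [mul_nonneg hH hw0]
      have k2 := mul_le_mul_of_nonneg_left k1 (by positivity : (0 : ℝ) ≤ n + 3)
      nlinarith
    have t1 : cn χ (n + 2) (op2 a (pdl l f)) ≤ R + 18 * K ^ 2 * (G / b) := by
      have e1 : ∀ x ∈ B, op2 a (pdl l f) x = pdl l F x - ∑ j, ∑ k,
          (pdl l (fun x => a j k x * pdl [k, j] f x) x - a j k x * pdl l (pdl [k, j] f) x) := by
        intro x hx
        have e2 : pdl l F x = ∑ j, ∑ k, pdl l (fun x => a j k x * pdl [k, j] f x) x := by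
          rw [← pdl_congr hB heq l x hx]
          unfold op2
          rw [pdl_sum (fun j => by fun_prop)]
          refine Finset.sum_congr rfl fun j _ => ?_
          rw [pdl_sum (fun k => by fun_prop)]
          rfl
        rw [e2]
        simp only [Finset.sum_sub_distrib, sub_sub_cancel, op2]
        refine Finset.sum_congr rfl fun j _ => Finset.sum_congr rfl fun k _ => ?_
        rw [pd_pdl hf, pd_pdl (contDiff_pd hf)]
        rfl
      rw [h.cn_congr e1]
      refine (h.cn_sub_le (by fun_prop) _).trans (add_le_add (hR l hlen) ?_)
      have e3 : ∀ j k, cn χ (n + 2) (fun x => pdl l (fun x => a j k x * pdl [k, j] f x) x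
          - a j k x * pdl l (pdl [k, j] f) x) ≤ 2 * K ^ 2 / b * G := fun j k => by
        have := h.cn_commutator_pdl_le hs hK hb hH (ha j k) hf (ga j k) l [k, j] rfl
          (by rw [hlen]; exact hj)
        rw [hlen, ← hG] at this
        exact this
      refine (h.cn_sum_le _ fun j => by fun_prop).trans ?_
      refine (Finset.sum_le_sum fun j _ => (h.cn_sum_le _ fun k => by fun_prop).trans
        (Finset.sum_le_sum fun k _ => e3 j k)).trans (le_of_eq ?_)
      simp only [Fin.sum_univ_three]
      ring
    have t2 : (n + 3) * (∑ i, cn χ (n + 1) (pd i (pdl l f))) ≤ 6 * (G / b) := by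
      have : ∀ i, cn χ (n + 1) (pd i (pdl l f)) ≤ H * gw s b (n + 1) := fun i => by
        have := hj (i :: l) (by simp [hlen])
        rw [pdl_cons, ← pd_pdl hf, List.length_cons, hlen] at this
        exact this
      calc _ ≤ ((n : ℝ) + 3) * (3 * (H * gw s b (n + 1))) := by
            refine mul_le_mul_of_nonneg_left ?_ (by positivity)
            rw [Fin.sum_univ_three]
            linarith [this 0, this 1, this 2]
        _ ≤ _ := by linarith
    have t3 : (n + 3) ^ 2 * cn χ n (pdl l f) ≤ 6 * (G / b) := by
      have := hj l (by omega)
      rw [hlen] at this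
      exact (mul_le_mul_of_nonneg_left this (by positivity)).trans w5
    have e4 : (18 * K ^ 2 + 23) / b * G = 18 * K ^ 2 * (G / b) + 23 * (G / b) := by ring
    rw [e4]
    linarith

end GevreyRegularity

section GevreySystem

variable {s : ℝ} {B : Set E3} {a₁ a₂ : Fin 3 → Fin 3 → E3 → ℝ}
  {p : Fin 3 → Fin 3 → E3 → ℝ} {q : Fin 3 → E3 → ℝ} {c : Fin 3 → Fin 3 → Fin 3 → E3 → ℝ}
  {d : Fin 3 → Fin 3 → E3 → ℝ} {h₂ : Fin 3 → Fin 3 → Fin 3 → E3 → ℝ}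
  {h₁ : Fin 3 → Fin 3 → E3 → ℝ} {h₀ : Fin 3 → E3 → ℝ} {b₁ : Fin 3 → E3 → ℝ} {b₀ : E3 → ℝ}
  {u : Fin 3 → E3 → ℝ} {v : E3 → ℝ} {χ : E3 → ℝ} {b K : ℝ}

theorem gw_le_div {s b : ℝ} (hs : 1 ≤ s) (hb : 1 ≤ b) {m n : ℕ} (h : m ≤ n + 1) :
    gw s b m ≤ gw s b (n + 2) / b := by
  have hb0 : 0 < b := by linarith
  have h1 := succ_mul_gw_le hs hb0 (n + 1)
  have h2 := (gw_pos (s := s) hb0 (n + 1)).le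
  have h3 : (0 : ℝ) ≤ n := Nat.cast_nonneg n
  have h4 : gw s b (n + 1) ≤ gw s b (n + 1 + 1) / b := by
    push_cast at h1
    nlinarith
  exact (gw_mono hs hb h).trans h4

theorem Cut.cn_low_le (h : Cut B χ) (hs : 1 ≤ s) (hK : 0 < K) (hb1 : 1 ≤ b) (hb : 2 * K ≤ b)
    {H : ℝ} (hH : 0 ≤ H) {a f : E3 → ℝ} (ha : Gev s B a) (hf : Sm f) (ga : GevBound s B K a)
    {n : ℕ} (l m : List (Fin 3)) (hl : l.length = n) (hm : m.length ≤ 1)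
    (hj : JetBound χ s b (n + 1) H f) :
    cn χ (n + 2) (pdl l fun x => a x * pdl m f x) ≤ 2 * K * (H * (gw s b (n + 2) / b)) := by
  have := h.cn_pdl_mul_pdl_le hs hK hb hH ha.1 hf ga l m (by omega)
    (fun l' hl' => hj l' (by omega))
  rw [hl] at this
  refine this.trans (mul_le_mul_of_nonneg_left (mul_le_mul_of_nonneg_left ?_ hH) (by linarith))
  exact gw_le_div hs hb1 (by omega)

theorem TriSystem.gevrey_regularity (S : TriSystem s B a₁ a₂ p q c d h₂ h₁ h₀ b₁ b₀ u v)
    (T : TriBound s B a₁ a₂ p q c d h₂ h₁ h₀ b₁ b₀ K) {α κ₁ g₁ K₁ κ₂ g₂ K₂ : ℝ}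
    (hc₁ : CarlemanCoeff a₁ B α κ₁ g₁ K₁) (hc₂ : CarlemanCoeff a₂ B α κ₂ g₂ K₂)
    (hB : IsOpen B) (hs : 1 ≤ s) (h : Cut B χ) :
    ∃ H ≥ 0, ∃ b ≥ 1, ∀ l : List (Fin 3),
      (∀ m, cn χ l.length (pdl l (u m)) ≤ H * gw s b l.length) ∧
        cn χ l.length (pdl l v) ≤ H * gw s b l.length := by
  obtain ⟨C₁, hC₁, H₁⟩ := h.elliptic hc₁.smooth hc₁.symm hc₁.κ_pos hc₁.elliptic hc₁.a0 hc₁.a1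
  obtain ⟨C₂, hC₂, H₂⟩ := h.elliptic hc₂.smooth hc₂.symm hc₂.κ_pos hc₂.elliptic hc₂.a0 hc₂.a1
  obtain ⟨C, hC⟩ : ∃ C, C = max C₁ C₂ := ⟨_, rfl⟩
  have hC1 : 1 ≤ C := by rw [hC]; exact hC₁.trans (le_max_left _ _)
  have hK1 := T.one_le
  have hK : 0 < K := by linarith
  have hsu := S.su
  have hsv := S.sv
  obtain ⟨L, hL⟩ : ∃ L, L = 108 * C * K := ⟨_, rfl⟩
  have hL1 : 1 ≤ L := by rw [hL]; nlinarith
  obtain ⟨b, hb⟩ : ∃ b, b = 2 * C * (32 * K + 18 * K ^ 2 + 23) * L := ⟨_, rfl⟩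
  have hCL : 1 ≤ C * L := by nlinarith
  have hb' : b = 2 * (32 * K + 18 * K ^ 2 + 23) * (C * L) := by rw [hb]; ring
  have hb64 : 64 * K + 46 ≤ b := by
    rw [hb']
    nlinarith [sq_nonneg K]
  have hb1 : 1 ≤ b := by linarith
  have hb0 : 0 < b := by linarith
  have hb2 : 2 * K ≤ b := by linarith
  have H₁' : ∀ (n : ℕ) (g : E3 → ℝ), Sm g → ∀ i j,
      cn χ (n + 2) (pd i (pd j g)) ≤ C * (cn χ (n + 2) (op2 a₁ g)
        + (n + 3) * (∑ i, cn χ (n + 1) (pd i g)) + (n + 3) ^ 2 * cn χ n g) := fun n g hg i j => by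
    refine (H₁ n g hg i j).trans (mul_le_mul_of_nonneg_right (hC ▸ le_max_left _ _) ?_)
    have k1 : 0 ≤ cn χ (n + 2) (op2 a₁ g) := cn_nonneg
    have k2 : 0 ≤ ∑ i, cn χ (n + 1) (pd i g) := Finset.sum_nonneg fun i _ => cn_nonneg
    have k3 : 0 ≤ cn χ n g := cn_nonneg
    positivity
  have H₂' : ∀ (n : ℕ) (g : E3 → ℝ), Sm g → ∀ i j,
      cn χ (n + 2) (pd i (pd j g)) ≤ C * (cn χ (n + 2) (op2 a₂ g)
        + (n + 3) * (∑ i, cn χ (n + 1) (pd i g)) + (n + 3) ^ 2 * cn χ n g) := fun n g hg i j => by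
    refine (H₂ n g hg i j).trans (mul_le_mul_of_nonneg_right (hC ▸ le_max_right _ _) ?_)
    have k1 : 0 ≤ cn χ (n + 2) (op2 a₂ g) := cn_nonneg
    have k2 : 0 ≤ ∑ i, cn χ (n + 1) (pd i g) := Finset.sum_nonneg fun i _ => cn_nonneg
    have k3 : 0 ≤ cn χ n g := cn_nonneg
    positivity
  choose Hu hHu0 hHu using fun m => exists_jetBound_one (χ := χ) (s := s) hb1 (u m)
  obtain ⟨Hv, hHv0, hHv⟩ := exists_jetBound_one (χ := χ) (s := s) hb1 v
  obtain ⟨H, hH⟩ : ∃ H, H = (∑ m, Hu m) + Hv := ⟨_, rfl⟩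
  have hS0 : 0 ≤ ∑ m, Hu m := Finset.sum_nonneg fun m _ => hHu0 m
  have hH0 : 0 ≤ H := by rw [hH]; linarith
  have hLH0 : 0 ≤ L * H := by positivity
  have key : ∀ n, (∀ m, JetBound χ s b (n + 1) H (u m)) ∧ JetBound χ s b (n + 1) (L * H) v := by
    intro n
    induction n with
    | zero =>
      refine ⟨fun m => (hHu m).mono hb0 ?_, hHv.mono hb0 ?_⟩
      · have := Finset.single_le_sum (f := Hu) (fun m _ => hHu0 m) (Finset.mem_univ m)
        rw [hH]; linarith
      · have : Hv ≤ H := by rw [hH]; linarith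
        exact this.trans (le_mul_of_one_le_left hH0 hL1)
    | succ n ih =>
      obtain ⟨iu, iv⟩ := ih
      obtain ⟨G, hG⟩ : ∃ G, G = gw s b (n + 2) := ⟨_, rfl⟩
      have hG0 : 0 < G := by rw [hG]; exact gw_pos hb0 _
      have low_u : ∀ {a : E3 → ℝ} (m : Fin 3) (k : List (Fin 3)) (l : List (Fin 3)),
          Gev s B a → GevBound s B K a → k.length ≤ 1 → l.length = n →
          cn χ (n + 2) (pdl l fun x => a x * pdl k (u m) x) ≤ 2 * K * (H * (G / b)) :=
        fun m k l ha ga hk hl => by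
          rw [hG]
          exact h.cn_low_le hs hK hb1 hb2 hH0 ha (hsu m) ga l k hl hk (iu m)
      have low_v : ∀ {a : E3 → ℝ} (k : List (Fin 3)) (l : List (Fin 3)),
          Gev s B a → GevBound s B K a → k.length ≤ 1 → l.length = n →
          cn χ (n + 2) (pdl l fun x => a x * pdl k v x) ≤ 2 * K * (L * H * (G / b)) :=
        fun k l ha ga hk hl => by
          rw [hG]
          exact h.cn_low_le hs hK hb1 hb2 hLH0 ha hsv ga l k hl hk iv
      have sp := fun i k => (S.gp i k).1
      have sq := fun i => (S.gq i).1
      have sc := fun i m k => (S.gc i m k).1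
      have sd := fun i m => (S.gd i m).1
      have sh₂ := fun m j k => (S.gh₂ m j k).1
      have sh₁ := fun m k => (S.gh₁ m k).1
      have sh₀ := fun m => (S.gh₀ m).1
      have sb₁ := fun k => (S.gb₁ k).1
      have sb₀ := S.gb₀.1
      have ju : ∀ m, JetBound χ s b (n + 2) H (u m) := by
        intro i
        refine h.jetBound_succ hB hs hK hb1 hb2 hH0 hC1 hc₁.smooth (F := fun x =>
          (∑ k, p i k x * pd k v x) + q i x * v x + (∑ m, ∑ k, c i m k x * pd k (u m) x)
          + ∑ m, d i m x * u m x) (by fun_prop) (hsu i) T.ga₁ H₁' (S.equ i) n (iu i)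
          (R := 3 * (2 * K * (L * H * (G / b))) + 2 * K * (L * H * (G / b))
            + 3 * (3 * (2 * K * (H * (G / b)))) + 3 * (2 * K * (H * (G / b)))) ?_ ?_
        · intro l hl
          refine h.cn_pdl_add_le (by fun_prop) (by fun_prop) (h.cn_pdl_add_le (by fun_prop)
            (by fun_prop) (h.cn_pdl_add_le (by fun_prop) (by fun_prop) ?_ ?_) ?_) ?_
          · exact h.cn_pdl_sum_le (fun k => by fun_prop) fun k =>
              low_v [k] l (S.gp i k) (T.gp i k) le_rfl hl
          · exact low_v [] l (S.gq i) (T.gq i) (by simp) hl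
          · exact h.cn_pdl_sum_le (fun k => by fun_prop) fun m =>
              h.cn_pdl_sum_le (fun k => by fun_prop) fun k =>
              low_u m [k] l (S.gc i m k) (T.gc i m k) le_rfl hl
          · exact h.cn_pdl_sum_le (fun k => by fun_prop) fun m =>
              low_u m [] l (S.gd i m) (T.gd i m) (by simp) hl
        · rw [← hG]
          have e : C * (3 * (2 * K * (L * H * (G / b))) + 2 * K * (L * H * (G / b))
            + 3 * (3 * (2 * K * (H * (G / b)))) + 3 * (2 * K * (H * (G / b)))
            + (18 * K ^ 2 + 23) / b * (H * G))
            = C * (8 * K * L + 24 * K + 18 * K ^ 2 + 23) / b * (H * G) := by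
            field_simp
            ring
          rw [e]
          refine mul_le_of_le_one_left (by positivity) ((div_le_one hb0).2 ?_)
          rw [hb']
          have m1 : C * (8 * K * L) = 8 * K * (C * L) := by ring
          have m2 : C ≤ C * L := le_mul_of_one_le_right (by linarith) hL1
          have m3 := mul_le_mul_of_nonneg_right m2 (by positivity : 0 ≤ 24 * K + 18 * K ^ 2 + 23)
          have m4 : 0 ≤ C * L * (32 * K + 18 * K ^ 2 + 23) := by positivity
          linarith
      refine ⟨ju, ?_⟩
      refine h.jetBound_succ hB hs hK hb1 hb2 hLH0 hC1 hc₂.smooth (F := fun x =>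
        (∑ m, ∑ j, ∑ k, h₂ m j k x * pd j (pd k (u m)) x)
        + (∑ m, ∑ k, h₁ m k x * pd k (u m) x) + (∑ m, h₀ m x * u m x)
        + (∑ k, b₁ k x * pd k v x) + b₀ x * v x) (by fun_prop) hsv T.ga₂ H₂' S.eqv n iv
        (R := 3 * (3 * (3 * (2 * K * (H * G)))) + 3 * (3 * (2 * K * (H * (G / b))))
          + 3 * (2 * K * (H * (G / b)))
          + 3 * (2 * K * (L * H * (G / b))) + 2 * K * (L * H * (G / b))) ?_ ?_
      · intro l hl
        refine h.cn_pdl_add_le (by fun_prop) (by fun_prop) (h.cn_pdl_add_le (by fun_prop)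
          (by fun_prop) (h.cn_pdl_add_le (by fun_prop) (by fun_prop)
          (h.cn_pdl_add_le (by fun_prop) (by fun_prop) ?_ ?_) ?_) ?_) ?_
        · refine h.cn_pdl_sum_le (fun k => by fun_prop) fun m =>
            h.cn_pdl_sum_le (fun k => by fun_prop) fun j =>
            h.cn_pdl_sum_le (fun k => by fun_prop) fun k => ?_
          have := h.cn_pdl_mul_pdl_le hs hK hb2 hH0 (sh₂ m j k) (hsu m) (T.gh₂ m j k) l [k, j]
            le_rfl (by rw [hl]; exact ju m)
          rw [hl] at this
          rw [hG]
          exact this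
        · exact h.cn_pdl_sum_le (fun k => by fun_prop) fun m =>
            h.cn_pdl_sum_le (fun k => by fun_prop) fun k =>
            low_u m [k] l (S.gh₁ m k) (T.gh₁ m k) le_rfl hl
        · exact h.cn_pdl_sum_le (fun k => by fun_prop) fun m =>
            low_u m [] l (S.gh₀ m) (T.gh₀ m) (by simp) hl
        · exact h.cn_pdl_sum_le (fun k => by fun_prop) fun k =>
            low_v [k] l (S.gb₁ k) (T.gb₁ k) le_rfl hl
        · exact low_v [] l S.gb₀ T.gb₀ (by simp) hl
      · rw [← hG]
        have e : C * (3 * (3 * (3 * (2 * K * (H * G)))) + 3 * (3 * (2 * K * (H * (G / b))))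
          + 3 * (2 * K * (H * (G / b)))
          + 3 * (2 * K * (L * H * (G / b))) + 2 * K * (L * H * (G / b))
          + (18 * K ^ 2 + 23) / b * (L * H * G))
          = (54 * C * K + C * (24 * K + (8 * K + 18 * K ^ 2 + 23) * L) / b) * (H * G) := by
          field_simp
          ring
        rw [e, mul_assoc L]
        refine mul_le_mul_of_nonneg_right ?_ (by positivity)
        have m1 : C * (24 * K + (8 * K + 18 * K ^ 2 + 23) * L) / b ≤ 1 / 2 := by
          rw [div_le_div_iff₀ hb0 two_pos, hb']
          have m2 : C ≤ C * L := le_mul_of_one_le_right (by linarith) hL1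
          nlinarith
        linarith
  have hHL : H ≤ L * H := le_mul_of_one_le_left hH0 hL1
  refine ⟨L * H, hLH0, b, hb1, fun l => ?_⟩
  obtain ⟨k1, k2⟩ := key l.length
  exact ⟨fun m => ((k1 m).mono hb0 hHL) l (by omega), k2 l (by omega)⟩

end GevreySystem

section Flat

/-- `f` vanishes to infinite order at the origin. -/
def Flat (f : E3 → ℝ) : Prop :=
  ∀ N : ℕ, ∃ C, ∃ δ > 0, ∀ x : E3, x ≠ 0 → ‖x‖ < δ → |f x| ≤ C * ‖x‖ ^ N

variable {f : E3 → ℝ}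

theorem Flat.exists_bound (h : Flat f) (hf : Continuous f) (N : ℕ) (R : ℝ) :
    ∃ C ≥ 0, ∀ x : E3, ‖x‖ ≤ R → |f x| ≤ C * ‖x‖ ^ N := by
  obtain ⟨C, δ, hδ, H⟩ := h N
  obtain ⟨K, hK⟩ := exists_bound_closedBall (fun _ : Unit => hf) 0 R
  have hcl : IsClosed {x : E3 | |f x| ≤ max C (K / δ ^ N) * ‖x‖ ^ N} :=
    isClosed_le (by fun_prop) (by fun_prop)
  have main : ∀ x : E3, x ≠ 0 → ‖x‖ ≤ R → |f x| ≤ max C (K / δ ^ N) * ‖x‖ ^ N := by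
    intro x hx hxR
    by_cases hlt : ‖x‖ < δ
    · exact (H x hx hlt).trans (mul_le_mul_of_nonneg_right (le_max_left _ _) (by positivity))
    · have h1 := hK x (by simpa using hxR) ()
      have h2 : 0 ≤ K := (abs_nonneg _).trans h1
      refine (h1.trans ?_).trans
        (mul_le_mul_of_nonneg_right (le_max_right C (K / δ ^ N)) (by positivity))
      rw [div_mul_eq_mul_div, le_div_iff₀ (by positivity)]
      exact mul_le_mul_of_nonneg_left (pow_le_pow_left₀ hδ.le (not_lt.1 hlt) N) h2
  refine ⟨max 0 (max C (K / δ ^ N)), le_max_left _ _, fun x hxR => ?_⟩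
  refine le_trans ?_ (mul_le_mul_of_nonneg_right (le_max_right _ _) (by positivity))
  by_cases hx : x = 0
  · have hden : (0 : E3) ∈ closure ({0}ᶜ ∩ ball (0 : E3) δ) :=
      mem_closure_iff_nhdsWithin_neBot.2 (by
        rw [nhdsWithin_inter_of_mem' (nhdsWithin_le_nhds (ball_mem_nhds 0 hδ))]
        infer_instance)
    rw [hx]
    exact closure_minimal (fun y hy => (H y hy.1 (by simpa using hy.2)).trans
      (mul_le_mul_of_nonneg_right (le_max_left _ _) (by positivity))) hcl hden
  · exact main x hx hxR

theorem abs_sub_sub_pd_le (hf : Sm f) (i : Fin 3) (R : ℝ) : ∃ L ≥ 0, ∀ (x : E3) (t : ℝ), 0 < t →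
    ‖x‖ + t ≤ R → |f (x + t • EuclideanSpace.single i 1) - f x - t * pd i f x| ≤ L * t ^ 2 := by
  have hpp : Continuous (pd i (pd i f)) :=
    ContDiff.continuous (𝕜 := ℝ) (n := (⊤ : ℕ∞)) (by fun_prop)
  obtain ⟨K, hK⟩ := exists_bound_closedBall (fun _ : Unit => hpp) 0 R
  refine ⟨|K|, abs_nonneg K, fun x t ht hxt => ?_⟩
  obtain ⟨e, he⟩ : ∃ e : E3, e = EuclideanSpace.single i 1 := ⟨_, rfl⟩
  have hen : ‖e‖ = 1 := by rw [he]; simp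
  rw [← he]
  have line : ∀ {g : E3 → ℝ}, Sm g → ∀ τ : ℝ,
      HasDerivAt (fun τ : ℝ => g (x + τ • e)) (pd i g (x + τ • e)) τ := by
    intro g hg τ
    have h1 : HasFDerivAt g (fderiv ℝ g (x + τ • e)) (x + τ • e) :=
      (hg.differentiable (by simp)).differentiableAt.hasFDerivAt
    have h2 : HasDerivAt (fun τ : ℝ => x + τ • e) e τ := by
      simpa using ((hasDerivAt_id τ).smul_const e).const_add x
    have := h1.comp_hasDerivAt τ h2
    rwa [he] at this ⊢
  obtain ⟨ξ, ⟨hξ0, hξt⟩, hξ⟩ := exists_hasDerivAt_eq_slope (fun τ : ℝ => f (x + τ • e)) _ ht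
    (fun τ _ => (line hf τ).continuousAt.continuousWithinAt) fun τ _ => line hf τ
  obtain ⟨η, ⟨hη0, hηt⟩, hη⟩ := exists_hasDerivAt_eq_slope (fun τ : ℝ => pd i f (x + τ • e)) _ hξ0
    (fun τ _ => (line (g := pd i f) (by fun_prop) τ).continuousAt.continuousWithinAt)
    fun τ _ => line (g := pd i f) (by fun_prop) τ
  simp only [zero_smul, add_zero, sub_zero] at hξ hη
  rw [eq_div_iff ht.ne'] at hξ
  rw [eq_div_iff hξ0.ne'] at hη
  have hin : |pd i (pd i f) (x + η • e)| ≤ |K| := by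
    refine (hK _ ?_ ()).trans (le_abs_self K)
    rw [mem_closedBall_zero_iff]
    refine (norm_add_le _ _).trans ?_
    rw [norm_smul, hen, Real.norm_of_nonneg hη0.le]
    linarith
  have e1 : f (x + t • e) - f x - t * pd i f x
      = pd i (pd i f) (x + η • e) * (ξ * t) := by
    rw [← hξ]
    linear_combination -t * hη
  rw [e1, abs_mul, abs_of_pos (by positivity : 0 < ξ * t), sq]
  exact mul_le_mul hin (mul_le_mul_of_nonneg_right hξt.le ht.le) (by positivity) (abs_nonneg K)

theorem Flat.pd (h : Flat f) (hf : Sm f) (i : Fin 3) : Flat (pd i f) := by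
  intro N
  obtain ⟨L, hL, HL⟩ := abs_sub_sub_pd_le hf i 2
  obtain ⟨C, hC, H⟩ := h.exists_bound hf.continuous (2 * N + 2) 2
  refine ⟨C * (2 ^ (2 * N + 2) + 1) + L, 1, one_pos, fun x hx hx1 => ?_⟩
  obtain ⟨r, hr⟩ : ∃ r, r = ‖x‖ := ⟨_, rfl⟩
  have hr0 : 0 < r := by rw [hr]; exact norm_pos_iff.2 hx
  rw [← hr] at hx1 ⊢
  obtain ⟨t, ht⟩ : ∃ t, t = r ^ (N + 1) := ⟨_, rfl⟩
  have ht0 : 0 < t := by rw [ht]; positivity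
  have htr : t ≤ r := by
    rw [ht]; simpa using pow_le_pow_of_le_one hr0.le hx1.le (by omega : 1 ≤ N + 1)
  have h1 := HL x t ht0 (by rw [← hr]; linarith)
  have hn : ‖x + t • EuclideanSpace.single i (1 : ℝ)‖ ≤ 2 * r := by
    refine (norm_add_le _ _).trans ?_
    rw [norm_smul, Real.norm_of_nonneg ht0.le]
    simp only [PiLp.norm_single, norm_one, mul_one, ← hr]
    linarith
  have h2 := H (x + t • EuclideanSpace.single i 1) (by linarith)
  have h3 := H x (by rw [← hr]; linarith)
  have h4 : C * ‖x + t • EuclideanSpace.single i (1 : ℝ)‖ ^ (2 * N + 2)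
      ≤ C * (2 * r) ^ (2 * N + 2) :=
    mul_le_mul_of_nonneg_left (pow_le_pow_left₀ (norm_nonneg _) hn _) hC
  rw [mul_pow] at h4
  rw [← hr] at h3
  have e : r ^ (2 * N + 2) = t * t := by rw [ht]; ring
  rw [e] at h3 h4
  have h5 : t * |_root_.pd i f x| ≤ t * ((C * (2 ^ (2 * N + 2) + 1) + L) * t) := by
    rw [← abs_of_pos ht0, ← abs_mul, abs_of_pos ht0]
    obtain ⟨a1, a2⟩ := abs_le.1 h1
    obtain ⟨b1, b2⟩ := abs_le.1 (h2.trans h4)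
    obtain ⟨c1, c2⟩ := abs_le.1 h3
    rw [abs_le]
    constructor <;> nlinarith
  refine (le_of_mul_le_mul_left h5 ht0).trans ?_
  refine mul_le_mul_of_nonneg_left ?_ (by positivity)
  rw [ht]
  exact pow_le_pow_of_le_one hr0.le hx1.le (by omega)

theorem Flat.add {g : E3 → ℝ} (hf : Flat f) (hg : Flat g) : Flat fun x => f x + g x := by
  intro N
  obtain ⟨C, δ, hδ, H⟩ := hf N
  obtain ⟨C', δ', hδ', H'⟩ := hg N
  refine ⟨C + C', min δ δ', lt_min hδ hδ', fun x hx hlt => ?_⟩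
  rw [lt_min_iff] at hlt
  refine (abs_add_le _ _).trans ?_
  linarith [H x hx hlt.1, H' x hx hlt.2]

/-- Vanishing to infinite order in the mean over annuli. -/
theorem flat_of_annulus (hf : Sm f)
    (h : ∀ N : ℝ, 0 < N → ∃ C > 0, ∃ δ > 0, ∀ R : ℝ, 0 < R → R < δ →
      (∫ x in {y : E3 | R ≤ ‖y‖ ∧ ‖y‖ ≤ 2 * R}, f x ^ 2) ≤ C * R ^ N) : Flat f := by
  suffices H : ∀ N : ℕ, ∃ C, ∃ δ > 0, ∀ x : E3, x ≠ 0 → ‖x‖ < δ →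
      |f x| ≤ C * ‖x‖ ^ (N + 1) by
    intro N
    obtain ⟨C, δ, hδ, H⟩ := H N
    refine ⟨|C|, min δ 1, lt_min hδ one_pos, fun x hx hlt => ?_⟩
    rw [lt_min_iff] at hlt
    refine (H x hx hlt.1).trans (mul_le_mul (le_abs_self C) ?_ (by positivity) (abs_nonneg C))
    exact pow_le_pow_of_le_one (norm_nonneg x) hlt.2.le (by omega)
  intro N
  obtain ⟨C, hC, δ, hδ, H⟩ := h ((5 * (N + 1) : ℕ) : ℝ) (by positivity)
  have hlip : ∃ L ≥ 0, ∀ x ∈ closedBall (0 : E3) 2, ∀ y ∈ closedBall (0 : E3) 2,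
      |f y - f x| ≤ L * ‖y - x‖ := by
    have hd : Continuous fun x => ‖fderiv ℝ f x‖ := (hf.continuous_fderiv (by simp)).norm
    obtain ⟨K, hK⟩ := exists_bound_closedBall (fun _ : Unit => hd) 0 2
    refine ⟨|K|, abs_nonneg K, fun x hx y hy => ?_⟩
    refine (convex_closedBall (0 : E3) 2).norm_image_sub_le_of_norm_fderiv_le (𝕜 := ℝ) (f := f)
      (fun z _ => (hf.differentiable (by simp)).differentiableAt) (fun z hz => ?_) hx hy
    have := hK z hz ()
    rw [abs_norm] at this
    exact this.trans (le_abs_self K)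
  obtain ⟨L, hL, hlip⟩ := hlip
  obtain ⟨V, hV⟩ : ∃ V, V = volume.real (ball (0 : E3) 1) := ⟨_, rfl⟩
  have hV0 : 0 < V := by
    rw [hV]
    exact ENNReal.toReal_pos (measure_ball_pos _ _ one_pos).ne' measure_ball_lt_top.ne
  obtain ⟨D, hD⟩ : ∃ D, D = 2 * C * 27 / V + 2 * L ^ 2 := ⟨_, rfl⟩
  have hD0 : 0 ≤ D := by rw [hD]; positivity
  refine ⟨Real.sqrt D, min δ 1, lt_min hδ one_pos, fun x hx hlt => ?_⟩
  rw [lt_min_iff] at hlt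
  obtain ⟨r, hr⟩ : ∃ r, r = ‖x‖ := ⟨_, rfl⟩
  have hr0 : 0 < r := by rw [hr]; exact norm_pos_iff.2 hx
  rw [← hr] at hlt ⊢
  obtain ⟨t, ht⟩ : ∃ t, t = r ^ (N + 1) := ⟨_, rfl⟩
  have ht0 : 0 < t := by rw [ht]; positivity
  have htr : t ≤ r := by
    rw [ht]; simpa using pow_le_pow_of_le_one hr0.le hlt.2.le (by omega : 1 ≤ N + 1)
  have hvol : volume.real (ball x (t / 3)) = (t / 3) ^ 3 * V := by
    rw [hV, Measure.real, Measure.real, Measure.addHaar_ball volume x (by positivity),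
      ENNReal.toReal_mul, ENNReal.toReal_ofReal (by positivity), finrank_euclideanSpace]
    simp
  have hfi : ∀ y R, IntegrableOn (fun y => f y ^ 2) (ball y R) := fun y R =>
    integrableOn_ball_of_continuous (hf.continuous.pow 2) y R
  have hsub : ball x (t / 3) ⊆ {y : E3 | 2 * r / 3 ≤ ‖y‖ ∧ ‖y‖ ≤ 2 * (2 * r / 3)} := by
    intro y hy
    rw [mem_ball, dist_eq_norm] at hy
    have h1 := norm_sub_norm_le x y
    have h2 := norm_sub_norm_le y x
    rw [norm_sub_rev, ← hr] at h1
    rw [← hr] at h2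
    exact ⟨by linarith, by linarith⟩
  have hann : IntegrableOn (fun y => f y ^ 2)
      {y : E3 | 2 * r / 3 ≤ ‖y‖ ∧ ‖y‖ ≤ 2 * (2 * r / 3)} :=
    (hfi 0 (2 * r)).mono_set fun y hy => by
      have := hy.2
      rw [mem_ball_zero_iff]
      linarith
  have h1 : (t / 3) ^ 3 * V * f x ^ 2
      ≤ ∫ y in ball x (t / 3), (2 * f y ^ 2 + 2 * L ^ 2 * t ^ 2) := by
    rw [← hvol, ← smul_eq_mul, ← setIntegral_const]
    refine setIntegral_mono_on (integrableOn_const measure_ball_lt_top.ne)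
      (((hfi _ _).const_mul 2).add (integrableOn_const measure_ball_lt_top.ne))
      measurableSet_ball fun y hy => ?_
    have hyn := (hsub hy).2
    rw [mem_ball, dist_eq_norm] at hy
    have h1 := hlip x (by rw [mem_closedBall_zero_iff]; linarith) y
      (by rw [mem_closedBall_zero_iff]; linarith)
    have h2 : |f y - f x| ≤ L * t := h1.trans (mul_le_mul_of_nonneg_left (by linarith) hL)
    have h3 := sq_le_sq_of_abs_le h2
    nlinarith [sq_nonneg (f x - 2 * f y)]
  have h2 : ∫ y in ball x (t / 3), (2 * f y ^ 2 + 2 * L ^ 2 * t ^ 2)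
      = 2 * (∫ y in ball x (t / 3), f y ^ 2) + (t / 3) ^ 3 * V * (2 * L ^ 2 * t ^ 2) := by
    rw [integral_add ((hfi _ _).const_mul 2) (integrableOn_const measure_ball_lt_top.ne),
      integral_const_mul, setIntegral_const, hvol, smul_eq_mul]
  have h3 : ∫ y in ball x (t / 3), f y ^ 2 ≤ C * (2 * r / 3) ^ ((5 * (N + 1) : ℕ) : ℝ) :=
    (setIntegral_mono_set hann (Filter.Eventually.of_forall fun y => sq_nonneg _)
      (Filter.Eventually.of_forall hsub)).trans (H _ (by positivity) (by linarith))
  have h4 : (2 * r / 3) ^ ((5 * (N + 1) : ℕ) : ℝ) ≤ t ^ 5 := by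
    rw [Real.rpow_natCast, ht, ← pow_mul, mul_comm (N + 1)]
    exact pow_le_pow_left₀ (by positivity) (by linarith) _
  have h5 : (t / 3) ^ 3 * V * f x ^ 2 ≤ (t / 3) ^ 3 * V * (D * t ^ 2) := by
    refine h1.trans (h2.le.trans ?_)
    have e : (t / 3) ^ 3 * V * (D * t ^ 2)
        = 2 * (C * t ^ 5) + (t / 3) ^ 3 * V * (2 * L ^ 2 * t ^ 2) := by
      rw [hD]; field_simp; ring
    rw [e]
    linarith [mul_le_mul_of_nonneg_left h4 hC.le]
  have h6 := le_of_mul_le_mul_left h5 (by positivity)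
  rw [← ht]
  refine abs_le_of_sq_le_sq ?_ (by positivity)
  rwa [mul_pow, Real.sq_sqrt hD0]

end Flat

section Hardy

/-- A smooth cutoff around the origin decreasing along rays. -/
structure RadialCut (r : ℝ) (χ : E3 → ℝ) : Prop where
  sm : Sm χ
  nonneg : ∀ x, 0 ≤ χ x
  le_one : ∀ x, χ x ≤ 1
  one : ∀ x, ‖x‖ ≤ r → χ x = 1
  zero : ∀ x, 2 * r ≤ ‖x‖ → χ x = 0
  mono : ∀ x, ∑ i, x i * pd i χ x ≤ 0

theorem exists_radialCut {r : ℝ} (hr : 0 < r) : ∃ χ, RadialCut r χ := by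
  have hst : ContDiff ℝ (⊤ : ℕ∞) Real.smoothTransition := Real.smoothTransition.contDiff
  have hn := contDiff_nsq 0
  have hg : Sm fun x : E3 => 2 - r⁻¹ ^ 2 * nsq 0 x := by fun_prop
  have hnn : ∀ x : E3, nsq 0 x = ‖x‖ ^ 2 := fun x => by rw [nsq_eq, dist_zero_right]
  have hrr : r⁻¹ ^ 2 * r ^ 2 = 1 := by
    rw [← mul_pow, inv_mul_cancel₀ hr.ne', one_pow]
  refine ⟨fun x => Real.smoothTransition (2 - r⁻¹ ^ 2 * nsq 0 x), hst.comp hg,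
    fun x => Real.smoothTransition.nonneg _, fun x => Real.smoothTransition.le_one _,
    fun x hx => Real.smoothTransition.one_of_one_le ?_,
    fun x hx => Real.smoothTransition.zero_of_nonpos ?_, fun x => ?_⟩
  · have h1 : ‖x‖ ^ 2 ≤ r ^ 2 := pow_le_pow_left₀ (norm_nonneg x) hx 2
    rw [hnn]
    linarith [mul_le_mul_of_nonneg_left h1 (by positivity : 0 ≤ r⁻¹ ^ 2)]
  · have h1 : (2 * r) ^ 2 ≤ ‖x‖ ^ 2 := pow_le_pow_left₀ (by positivity) hx 2
    rw [hnn]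
    rw [mul_pow] at h1
    linarith [mul_le_mul_of_nonneg_left h1 (by positivity : 0 ≤ r⁻¹ ^ 2)]
  · have h1 : ∀ i, pd i (fun x => Real.smoothTransition (2 - r⁻¹ ^ 2 * nsq 0 x)) x
        = deriv Real.smoothTransition (2 - r⁻¹ ^ 2 * nsq 0 x) * -(r⁻¹ ^ 2 * (2 * x i)) := by
      intro i
      have h2 := (((hst.differentiable (by simp))
        (2 - r⁻¹ ^ 2 * nsq 0 x)).hasDerivAt.comp_hasFDerivAt
        x (hg.differentiable (by simp) x).hasFDerivAt).fderiv
      have h3 : pd i (fun x => 2 - r⁻¹ ^ 2 * nsq 0 x) x = -(r⁻¹ ^ 2 * (2 * x i)) := by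
        rw [pd_sub (by fun_prop) (by fun_prop), pd_const_mul]
        simp [pd_const, pd_nsq]
      rw [← h3]
      have h4 : (Real.smoothTransition ∘ fun x : E3 => 2 - r⁻¹ ^ 2 * nsq 0 x)
        = fun x => Real.smoothTransition (2 - r⁻¹ ^ 2 * nsq 0 x) := rfl
      rw [h4] at h2
      simp only [pd, h2]
      simp
    have h5 : 0 ≤ deriv Real.smoothTransition (2 - r⁻¹ ^ 2 * nsq 0 x) :=
      Real.smoothTransition.monotone.deriv_nonneg
    have h6 : ∑ i, x i * pd i (fun x => Real.smoothTransition (2 - r⁻¹ ^ 2 * nsq 0 x)) x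
        = -(deriv Real.smoothTransition (2 - r⁻¹ ^ 2 * nsq 0 x) * (2 * r⁻¹ ^ 2)
          * (x 0 ^ 2 + x 1 ^ 2 + x 2 ^ 2)) := by
      simp only [h1, Fin.sum_univ_three]
      ring
    rw [h6]
    have : 0 ≤ x 0 ^ 2 + x 1 ^ 2 + x 2 ^ 2 := by positivity
    have : 0 ≤ deriv Real.smoothTransition (2 - r⁻¹ ^ 2 * nsq 0 x) * (2 * r⁻¹ ^ 2)
        * (x 0 ^ 2 + x 1 ^ 2 + x 2 ^ 2) := by positivity
    linarith

variable {r ε : ℝ} {χ f : E3 → ℝ}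

theorem RadialCut.tsupport_subset (h : RadialCut r χ) : tsupport χ ⊆ closedBall 0 (2 * r) :=
  closure_minimal (fun x hx => by
    rw [mem_closedBall_zero_iff]
    by_contra hlt
    exact hx (h.zero x (not_le.1 hlt).le)) isClosed_closedBall

theorem RadialCut.compact (h : RadialCut r χ) : HasCompactSupport χ :=
  HasCompactSupport.of_support_subset_isCompact (isCompact_closedBall 0 (2 * r))
    ((subset_tsupport χ).trans h.tsupport_subset)

/-- The regularized inverse square `1 / (|x|² + ε)`. -/
def iw (ε : ℝ) (x : E3) : ℝ := (nsq 0 x + ε)⁻¹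

theorem nsq_zero_nonneg (x : E3) : 0 ≤ nsq 0 x := by rw [nsq_eq]; positivity

theorem iw_pos (hε : 0 < ε) (x : E3) : 0 < iw ε x :=
  inv_pos.2 (by linarith [nsq_zero_nonneg x])

theorem nsq_add_mul_iw (hε : 0 < ε) (x : E3) : (nsq 0 x + ε) * iw ε x = 1 :=
  mul_inv_cancel₀ (by linarith [nsq_zero_nonneg x])

theorem nsq_mul_iw_le (hε : 0 < ε) (x : E3) : nsq 0 x * iw ε x ≤ 1 := by
  have := nsq_add_mul_iw hε x
  have := mul_pos hε (iw_pos hε x)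
  linarith

theorem sm_iw (hε : 0 < ε) : Sm (iw ε) := by
  have := contDiff_nsq 0
  unfold iw
  exact ContDiff.inv (by fun_prop) fun x => by linarith [nsq_zero_nonneg x]

theorem pd_iw (hε : 0 < ε) (i : Fin 3) (x : E3) : pd i (iw ε) x = -(2 * x i * iw ε x ^ 2) := by
  have h1 := contDiff_nsq 0
  have h2 := sm_iw hε
  have h3 : pd i (fun x => (nsq 0 x + ε) * iw ε x) x = 0 := by
    simp only [nsq_add_mul_iw hε, pd_const]
  rw [pd_mul (by fun_prop) h2, pd_add h1 (by fun_prop), pd_const] at h3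
  simp only [pd_nsq, add_zero, PiLp.zero_apply, sub_zero] at h3
  linear_combination (iw ε x) * h3 - pd i (iw ε) x * nsq_add_mul_iw hε x

/-- The divergence of the radial field used in the Hardy inequality. -/
def hardyDiv (ε : ℝ) (χ f : E3 → ℝ) (n : ℕ) (x : E3) : ℝ :=
  ∑ i, pd i (fun x => x i * (iw ε x ^ (n + 1) * (χ x * f x ^ 2))) x

theorem hardyDiv_eq (hε : 0 < ε) (hχ : Sm χ) (hf : Sm f) (n : ℕ) (x : E3) :
    hardyDiv ε χ f n x = (1 - 2 * n) * (iw ε x ^ (n + 1) * (χ x * f x ^ 2))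
      + 2 * (n + 1) * ε * (iw ε x ^ (n + 2) * (χ x * f x ^ 2))
      + iw ε x ^ (n + 1) * f x ^ 2 * (∑ i, x i * pd i χ x)
      + 2 * iw ε x ^ (n + 1) * χ x * f x * ∑ i, x i * pd i f x := by
  have h1 := fun i => contDiff_coord i
  have h2 := sm_iw hε
  have h3 : ∀ i, pd i (fun x => x i * (iw ε x ^ (n + 1) * (χ x * f x ^ 2))) x
      = iw ε x ^ (n + 1) * (χ x * f x ^ 2)
        - 2 * (n + 1) * x i ^ 2 * iw ε x ^ (n + 2) * (χ x * f x ^ 2)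
        + iw ε x ^ (n + 1) * f x ^ 2 * (x i * pd i χ x)
        + 2 * iw ε x ^ (n + 1) * χ x * f x * (x i * pd i f x) := by
    intro i
    rw [pd_mul (h1 i) (by fun_prop), pd_mul (by fun_prop) (by fun_prop), pd_pow n h2,
      pd_mul hχ (by fun_prop), pd_sq hf, pd_coord]
    simp only [pd_iw hε, if_true]
    ring
  have h4 := nsq_add_mul_iw hε x
  have h5 : nsq 0 x = x 0 ^ 2 + x 1 ^ 2 + x 2 ^ 2 := by
    simp [nsq, Fin.sum_univ_three]
  simp only [hardyDiv, h3, Fin.sum_univ_three]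
  rw [h5] at h4
  linear_combination (-(2 * (n + 1)) * iw ε x ^ (n + 1) * (χ x * f x ^ 2)) * h4

theorem sm_hardyDiv (hε : 0 < ε) (hχ : Sm χ) (hf : Sm f) (n : ℕ) : Sm (hardyDiv ε χ f n) := by
  have h1 := fun i => contDiff_coord i
  have h2 := sm_iw hε
  unfold hardyDiv
  fun_prop

theorem hardyDiv_eq_zero_of_notMem (n : ℕ) {x : E3} (hx : x ∉ tsupport χ) :
    hardyDiv ε χ f n x = 0 := by
  refine Finset.sum_eq_zero fun i _ => pd_eq_zero_of_notMem fun h => hx ?_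
  refine closure_mono (fun y hy => ?_) h
  intro h0
  exact hy (by simp [h0])

theorem integral_hardyDiv (hε : 0 < ε) (hχ : Sm χ) (hc : HasCompactSupport χ) (hf : Sm f) (n : ℕ) :
    ∫ x, hardyDiv ε χ f n x = 0 := by
  have h1 := fun i => contDiff_coord i
  have h2 := sm_iw hε
  have hcs : ∀ i, HasCompactSupport fun x : E3 => x i * (iw ε x ^ (n + 1) * (χ x * f x ^ 2)) :=
    fun i => hasCompactSupport_of_forall hc fun x hx => by
      rw [image_eq_zero_of_notMem_tsupport hx]; ring
  unfold hardyDiv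
  rw [integral_finsetSum _ fun i _ => sm_integrable (by fun_prop) (hasCompactSupport_pd (hcs i))]
  exact Finset.sum_eq_zero fun i _ => integral_pd_eq_zero (by fun_prop) (hcs i)

theorem sq_radial_le (hε : 0 < ε) (x : E3) :
    (∑ i, x i * pd i f x) ^ 2 * iw ε x ≤ gsq f x := by
  have h1 : (∑ i, x i * pd i f x) ^ 2 ≤ nsq 0 x * gsq f x := by
    have := Finset.sum_mul_sq_le_sq_mul_sq Finset.univ (fun i => x i) fun i => pd i f x
    simpa [nsq, gsq] using this
  have h2 := mul_le_mul_of_nonneg_right h1 (iw_pos hε x).le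
  have h3 := mul_le_mul_of_nonneg_right (nsq_mul_iw_le hε x) (gsq_nonneg f x)
  linarith

/-- The weighted integral `∫ χ f² / (|x|² + ε) ^ n`. -/
def hI (χ : E3 → ℝ) (ε : ℝ) (n : ℕ) (f : E3 → ℝ) : ℝ := ∫ x, iw ε x ^ n * (χ x * f x ^ 2)

theorem hI_integrable (hε : 0 < ε) (h : RadialCut r χ) (hf : Sm f) (n : ℕ) :
    Integrable fun x => iw ε x ^ n * (χ x * f x ^ 2) := by
  have h2 := sm_iw hε
  have h3 := h.sm
  exact sm_integrable_of_forall (by fun_prop) h.compact fun x hx => by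
    rw [image_eq_zero_of_notMem_tsupport hx]; ring

/-- Hardy's inequality. -/
theorem hI_succ_le (hε : 0 < ε) (h : RadialCut r χ) (hf : Sm f) (n : ℕ) :
    hI χ ε (n + 2) f ≤ 8 * ε * hI χ ε (n + 3) f
      + 16 / (n + 2) ^ 2 * ∑ i, hI χ ε (n + 1) (pd i f) := by
  have hT := integral_hardyDiv hε h.sm h.compact hf (n + 1)
  have iT : Integrable (hardyDiv ε χ f (n + 1)) :=
    sm_integrable_of_forall (sm_hardyDiv hε h.sm hf _) h.compact
      fun x hx => hardyDiv_eq_zero_of_notMem _ hx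
  have i3 := hI_integrable hε h hf (n + 3)
  have i2 := hI_integrable hε h hf (n + 2)
  have i1 := fun i => hI_integrable (f := pd i f) hε h (by fun_prop) (n + 1)
  have hn : (0 : ℝ) ≤ n := Nat.cast_nonneg n
  obtain ⟨m, hm⟩ : ∃ m : ℝ, m = 2 * n + 1 := ⟨_, rfl⟩
  have hm1 : 1 ≤ m := by rw [hm]; linarith
  have pt : ∀ x, iw ε x ^ (n + 2) * (χ x * f x ^ 2)
      ≤ -(2 / m) * hardyDiv ε χ f (n + 1) x + 8 * ε * (iw ε x ^ (n + 3) * (χ x * f x ^ 2))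
        + 16 / (n + 2) ^ 2 * ∑ i, iw ε x ^ (n + 1) * (χ x * pd i f x ^ 2) := by
    intro x
    have hw := iw_pos hε x
    have hχ := h.nonneg x
    have hid := hardyDiv_eq hε h.sm hf (n + 1) x
    push_cast at hid
    obtain ⟨X, hX⟩ : ∃ X, X = ∑ i, x i * pd i f x := ⟨_, rfl⟩
    have hXs := sq_radial_le (f := f) hε x
    rw [← hX] at hid hXs
    obtain ⟨A, hA⟩ : ∃ A, A = iw ε x ^ (n + 2) * (χ x * f x ^ 2) := ⟨_, rfl⟩
    obtain ⟨B, hB⟩ : ∃ B, B = iw ε x ^ (n + 1) * (χ x * gsq f x) := ⟨_, rfl⟩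
    obtain ⟨D, hD⟩ : ∃ D, D = iw ε x ^ (n + 3) * (χ x * f x ^ 2) := ⟨_, rfl⟩
    have hA0 : 0 ≤ A := by rw [hA]; positivity
    have hD0 : 0 ≤ D := by rw [hD]; positivity
    have hB0 : 0 ≤ B := by
      have := gsq_nonneg f x
      rw [hB]; positivity
    have hsum : ∑ i, iw ε x ^ (n + 1) * (χ x * pd i f x ^ 2) = B := by
      rw [hB, gsq, Finset.mul_sum, Finset.mul_sum]
    have hcross : 2 * iw ε x ^ (n + 2) * χ x * f x * X ≤ m / 2 * A + 2 / m * B := by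
      have h1 : 0 ≤ iw ε x ^ (n + 2) * χ x * ((m / 2) * (f x - 2 / m * X) ^ 2) := by positivity
      have h2 : (iw ε x ^ (n + 1) * χ x) * (X ^ 2 * iw ε x)
          ≤ (iw ε x ^ (n + 1) * χ x) * gsq f x :=
        mul_le_mul_of_nonneg_left hXs (by positivity)
      have h3 : iw ε x ^ (n + 2) * χ x * ((m / 2) * (f x - 2 / m * X) ^ 2)
          = m / 2 * A - 2 * iw ε x ^ (n + 2) * χ x * f x * X
            + 2 / m * ((iw ε x ^ (n + 1) * χ x) * (X ^ 2 * iw ε x)) := by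
        rw [hA]; field_simp; ring
      have h4 : 2 / m * ((iw ε x ^ (n + 1) * χ x) * (X ^ 2 * iw ε x)) ≤ 2 / m * B := by
        rw [hB, ← mul_assoc (iw ε x ^ (n + 1))]
        exact mul_le_mul_of_nonneg_left h2 (by positivity)
      linarith
    have hmono : iw ε x ^ (n + 2) * f x ^ 2 * (∑ i, x i * pd i χ x) ≤ 0 :=
      mul_nonpos_of_nonneg_of_nonpos (by positivity) (h.mono x)
    rw [hsum, ← hA, ← hD]
    have e1 : n + 1 + 1 = n + 2 := by ring
    have e2 : n + 1 + 2 = n + 3 := by ring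
    rw [e1, e2, ← hA, ← hD] at hid
    have main : m / 2 * A ≤ -hardyDiv ε χ f (n + 1) x + 2 * (n + 2) * ε * D + 2 / m * B := by
      rw [hm] at hcross ⊢
      linarith
    have main2 := mul_le_mul_of_nonneg_left main (by positivity : 0 ≤ 2 / m)
    have e3 : 2 / m * (m / 2 * A) = A := by field_simp
    have e4 : 2 / m * (-hardyDiv ε χ f (n + 1) x + 2 * (n + 2) * ε * D + 2 / m * B)
        = -(2 / m) * hardyDiv ε χ f (n + 1) x + (4 * (n + 2) / m) * (ε * D) + (2 / m) ^ 2 * B := by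
      ring
    rw [e3, e4] at main2
    have c1 : 4 * (n + 2) / m ≤ 8 := by
      rw [div_le_iff₀ (by positivity), hm]; linarith
    have c2 : (2 / m) ^ 2 ≤ 16 / (n + 2) ^ 2 := by
      rw [div_pow, div_le_div_iff₀ (by positivity) (by positivity), hm]
      nlinarith
    have := mul_le_mul_of_nonneg_right c1 (mul_nonneg hε.le hD0)
    have := mul_le_mul_of_nonneg_right c2 hB0
    linarith
  have key := integral_mono i2 (((iT.const_mul (-(2 / m))).add (i3.const_mul (8 * ε))).add
    ((integrable_finsetSum _ fun i _ => i1 i).const_mul (16 / ((n : ℝ) + 2) ^ 2))) pt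
  rw [integral_add' ((iT.const_mul (-(2 / m))).add (i3.const_mul (8 * ε)))
    ((integrable_finsetSum _ fun i _ => i1 i).const_mul (16 / ((n : ℝ) + 2) ^ 2)),
    integral_add' (iT.const_mul (-(2 / m))) (i3.const_mul (8 * ε)), integral_const_mul, hT,
    integral_const_mul, integral_const_mul, integral_finsetSum _ fun i _ => i1 i, mul_zero,
    zero_add] at key
  exact key

theorem RadialCut.exists_hI_one_le (h : RadialCut r χ) (hr : 0 < r) : ∃ K > 0, ∀ ε > 0,
    ∀ g : E3 → ℝ, Sm g → hI χ ε 1 g ≤ K * ∫ x in ball 0 (3 * r), (g x ^ 2 + gsq g x) := by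
  have hχs := h.sm
  have hco := fun i => contDiff_coord i
  obtain ⟨L, hL⟩ := exists_bound_closedBall (f := fun (_ : Unit) x => ∑ i, x i * pd i χ x)
    (fun _ => ContDiff.continuous (𝕜 := ℝ) (n := (⊤ : ℕ∞)) (by fun_prop)) 0 (2 * r)
  have hL0 : 0 ≤ L := (abs_nonneg _).trans (hL 0 (by simp; positivity) ())
  refine ⟨2 * (r⁻¹ ^ 2 * L) + 4, by positivity, fun ε hε g hg => ?_⟩
  have hT := integral_hardyDiv hε h.sm h.compact hg 0
  have iT : Integrable (hardyDiv ε χ g 0) :=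
    sm_integrable_of_forall (sm_hardyDiv hε h.sm hg _) h.compact
      fun x hx => hardyDiv_eq_zero_of_notMem _ hx
  have i1 := hI_integrable hε h hg 1
  have hG : Continuous fun x => g x ^ 2 + gsq g x :=
    ContDiff.continuous (𝕜 := ℝ) (n := (⊤ : ℕ∞)) (by fun_prop)
  have iG := ((integrableOn_ball_of_continuous hG 0 (3 * r)).integrable_indicator
    measurableSet_ball).const_mul (2 * (r⁻¹ ^ 2 * L) + 4)
  have pt : ∀ x, iw ε x ^ 1 * (χ x * g x ^ 2) ≤ 2 * hardyDiv ε χ g 0 x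
      + (2 * (r⁻¹ ^ 2 * L) + 4)
        * (ball (0 : E3) (3 * r)).indicator (fun x => g x ^ 2 + gsq g x) x := by
    intro x
    by_cases hx : x ∈ tsupport χ
    swap
    · rw [hardyDiv_eq_zero_of_notMem _ hx, image_eq_zero_of_notMem_tsupport hx]
      have : 0 ≤ (ball (0 : E3) (3 * r)).indicator (fun x => g x ^ 2 + gsq g x) x :=
        Set.indicator_nonneg (fun x _ => add_nonneg (sq_nonneg _) (gsq_nonneg _ _)) x
      have : 0 ≤ (2 * (r⁻¹ ^ 2 * L) + 4)
        * (ball (0 : E3) (3 * r)).indicator (fun x => g x ^ 2 + gsq g x) x := by positivity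
      linarith
    have hxm := h.tsupport_subset hx
    have hxb : x ∈ ball (0 : E3) (3 * r) := by
      rw [mem_closedBall_zero_iff] at hxm
      rw [mem_ball_zero_iff]
      linarith
    rw [Set.indicator_of_mem hxb]
    have hw := iw_pos hε x
    have hχ := h.nonneg x
    have hχ1 := h.le_one x
    have hgs := gsq_nonneg g x
    have hid := hardyDiv_eq hε h.sm hg 0 x
    obtain ⟨X, hX⟩ : ∃ X, X = ∑ i, x i * pd i g x := ⟨_, rfl⟩
    have hXs := sq_radial_le (f := g) hε x
    rw [← hX] at hid hXs
    have hcross : -(2 * iw ε x * χ x * g x * X)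
        ≤ 1 / 2 * (iw ε x * (χ x * g x ^ 2)) + 2 * (χ x * gsq g x) := by
      have h1 : 0 ≤ iw ε x * χ x * (1 / 2 * (g x + 2 * X) ^ 2) := by positivity
      have h2 := mul_le_mul_of_nonneg_left hXs (by positivity : 0 ≤ 2 * χ x)
      linarith
    have hrad : -(iw ε x * ∑ i, x i * pd i χ x) ≤ r⁻¹ ^ 2 * L := by
      by_cases hlt : ‖x‖ < r
      · have h0 : ∑ i, x i * pd i χ x = 0 := Finset.sum_eq_zero fun i _ => by
          rw [pd_congr isOpen_ball (g := fun _ => (1 : ℝ)) (fun y hy => h.one y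
            (mem_ball_zero_iff.1 hy).le) x (mem_ball_zero_iff.2 hlt), pd_const, mul_zero]
        rw [h0, mul_zero, neg_zero]
        positivity
      · have h1 : iw ε x ≤ r⁻¹ ^ 2 := by
          rw [iw, inv_pow]
          refine inv_anti₀ (by positivity) ?_
          rw [nsq_eq, dist_zero_right]
          have := pow_le_pow_left₀ hr.le (not_lt.1 hlt) 2
          linarith
        have h2 := neg_le_of_abs_le (hL x hxm ())
        have h3 : -∑ i, x i * pd i χ x ≤ L := by linarith
        rw [← mul_neg]
        exact (mul_le_mul_of_nonneg_left h3 hw.le).trans (mul_le_mul_of_nonneg_right h1 hL0)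
    have hrad2 := mul_le_mul_of_nonneg_left hrad (sq_nonneg (g x))
    have hχg := mul_le_mul_of_nonneg_right hχ1 hgs
    have hdrop : 0 ≤ ε * (iw ε x ^ 2 * (χ x * g x ^ 2)) := by positivity
    have hg2 := mul_nonneg (by positivity : 0 ≤ 2 * (r⁻¹ ^ 2 * L)) hgs
    simp only [Nat.cast_zero, mul_zero, sub_zero, zero_add, pow_one, one_mul, mul_one] at hid ⊢
    rw [hid]
    have := sq_nonneg (g x)
    linarith
  have key := integral_mono i1 ((iT.const_mul 2).add iG) pt
  rw [integral_add' (iT.const_mul 2) iG, integral_const_mul, hT, integral_const_mul,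
    integral_indicator measurableSet_ball, mul_zero, zero_add] at key
  exact key

theorem RadialCut.exists_hI_le_of_flat (h : RadialCut r χ) (hf : Sm f) (hfl : Flat f) (n : ℕ) :
    ∃ A ≥ 0, ∀ ε > 0, hI χ ε n f ≤ A := by
  obtain ⟨C, hC, H⟩ := hfl.exists_bound hf.continuous n (2 * r)
  have hχs := h.sm
  have ic : Integrable fun x => C ^ 2 * χ x :=
    (sm_integrable h.sm h.compact).const_mul _
  refine ⟨∫ x, C ^ 2 * χ x, integral_nonneg fun x => ?_, fun ε hε =>
    integral_mono (hI_integrable hε h hf n) ic fun x => ?_⟩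
  · have := h.nonneg x
    positivity
  · by_cases hx : x ∈ tsupport χ
    swap
    · simp [image_eq_zero_of_notMem_tsupport hx]
    have h1 := H x (mem_closedBall_zero_iff.1 (h.tsupport_subset hx))
    have h2 := sq_le_sq_of_abs_le h1
    have hw := iw_pos hε x
    have h3 : iw ε x ^ n * f x ^ 2 ≤ C ^ 2 := by
      have h4 := mul_le_mul_of_nonneg_left h2 (by positivity : 0 ≤ iw ε x ^ n)
      have h5 : iw ε x ^ n * (C * ‖x‖ ^ n) ^ 2 = C ^ 2 * (nsq 0 x * iw ε x) ^ n := by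
        rw [nsq_eq, dist_zero_right]; ring
      have h6 : (nsq 0 x * iw ε x) ^ n ≤ 1 :=
        pow_le_one₀ (mul_nonneg (nsq_zero_nonneg x) hw.le) (nsq_mul_iw_le hε x)
      have h7 := mul_le_mul_of_nonneg_left h6 (sq_nonneg C)
      linarith
    have := mul_le_mul_of_nonneg_right h3 (h.nonneg x)
    show iw ε x ^ n * (χ x * f x ^ 2) ≤ C ^ 2 * χ x
    linarith

theorem RadialCut.exists_hI_le (h : RadialCut r χ) (n : ℕ) (hf : Sm f) (hfl : Flat f) :
    ∃ A ≥ 0, ∀ ε > 0, ∀ M, (∀ l : List (Fin 3), l.length = n → hI χ ε 1 (pdl l f) ≤ M) →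
      hI χ ε (n + 1) f ≤ A * ε + 48 ^ n / ((n + 1).factorial : ℝ) ^ 2 * M := by
  induction n generalizing f with
  | zero =>
    refine ⟨0, le_rfl, fun ε hε M hM => ?_⟩
    simpa using hM [] rfl
  | succ n ih =>
    obtain ⟨A₀, hA₀, H₀⟩ := h.exists_hI_le_of_flat hf hfl (n + 3)
    choose A hA H using fun i => ih (f := pd i f) (by fun_prop) (hfl.pd hf i)
    refine ⟨8 * A₀ + 16 / (n + 2) ^ 2 * ∑ i, A i, ?_, fun ε hε M hM => ?_⟩
    · have := Finset.sum_nonneg fun i (_ : i ∈ Finset.univ) => hA i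
      positivity
    · have h1 := hI_succ_le hε h hf n
      have h2 := mul_le_mul_of_nonneg_left (H₀ ε hε) (by positivity : 0 ≤ 8 * ε)
      have h3 : ∑ i, hI χ ε (n + 1) (pd i f)
          ≤ ∑ i, (A i * ε + 48 ^ n / ((n + 1).factorial : ℝ) ^ 2 * M) :=
        Finset.sum_le_sum fun i _ => H i ε hε M fun l hl => hM (i :: l) (by simp [hl])
      rw [Finset.sum_add_distrib, ← Finset.sum_mul] at h3
      simp only [Finset.sum_const, Finset.card_univ, Fintype.card_fin, nsmul_eq_mul] at h3
      have h4 := mul_le_mul_of_nonneg_left h3 (by positivity : (0 : ℝ) ≤ 16 / (n + 2) ^ 2)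
      have e : (48 : ℝ) ^ (n + 1) / ((n + 1 + 1).factorial : ℝ) ^ 2 * M
          = 16 / ((n : ℝ) + 2) ^ 2 * ((3 : ℕ) * (48 ^ n / ((n + 1).factorial : ℝ) ^ 2 * M)) := by
        rw [Nat.factorial_succ (n + 1)]
        have : ((n + 1).factorial : ℝ) ≠ 0 := by positivity
        push_cast
        field_simp
        ring
      rw [e]
      linarith

end Hardy

section Decay

variable {s r H b α : ℝ} {f : E3 → ℝ}

/-- Gevrey bounds in `L²` on a ball around the origin. -/
def GevL2 (s r H b : ℝ) (f : E3 → ℝ) : Prop :=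
  ∀ l : List (Fin 3), ∫ x in ball (0 : E3) r, pdl l f x ^ 2 ≤ (H * gw s b l.length) ^ 2

theorem gw_succ_le (hs : 0 ≤ s) (hb : 0 < b) (n : ℕ) :
    gw s b (n + 1) ≤ b * gw s (b * 2 ^ s) n := by
  unfold gw
  have h1 : ((n + 1).factorial : ℝ) ^ s ≤ ((2 : ℝ) ^ s) ^ n * (n.factorial : ℝ) ^ s := by
    rw [← Real.rpow_natCast ((2 : ℝ) ^ s) n, ← Real.rpow_mul (by norm_num), mul_comm s,
      Real.rpow_mul (by norm_num), Real.rpow_natCast,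
      ← Real.mul_rpow (by positivity) (by positivity)]
    refine Real.rpow_le_rpow (by positivity) ?_ hs
    rw [Nat.factorial_succ]
    have h2 : n + 1 ≤ 2 ^ n := Nat.lt_two_pow_self
    exact_mod_cast Nat.mul_le_mul_right n.factorial h2
  have h3 := mul_le_mul_of_nonneg_left h1 (by positivity : 0 ≤ b ^ (n + 1))
  refine h3.trans (le_of_eq ?_)
  rw [mul_pow]; ring

theorem GevL2.pd (h : GevL2 s r H b f) (hs : 0 ≤ s) (hb : 0 < b) (hH : 0 ≤ H) (i : Fin 3) :
    GevL2 s r (H * b) (b * 2 ^ s) (pd i f) := fun l => by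
  refine (h (i :: l)).trans (pow_le_pow_left₀ (mul_nonneg hH (gw_pos hb _).le) ?_ 2)
  rw [List.length_cons, mul_assoc]
  exact mul_le_mul_of_nonneg_left (gw_succ_le hs hb _) hH

theorem GevL2.integral_le (h : GevL2 s (3 * r) H b f) (hs : 1 ≤ s) (hb : 1 ≤ b) (hH : 0 ≤ H)
    (hr : 0 < r) (hf : Sm f) (hfl : Flat f) : ∃ C ≥ 0, ∀ ρ, 0 < ρ → ρ ≤ r → ∀ n : ℕ,
      ∫ x in ball (0 : E3) ρ, f x ^ 2
        ≤ C * ((7 * b * ρ) ^ (n + 1) * ((n + 1).factorial : ℝ) ^ (s - 1)) ^ 2 := by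
  obtain ⟨χ, hχ⟩ := exists_radialCut hr
  obtain ⟨K, hK, HK⟩ := hχ.exists_hI_one_le hr
  have hb0 : 0 < b := by linarith
  refine ⟨4 * K * H ^ 2, by positivity, fun ρ hρ hρr n => ?_⟩
  obtain ⟨A, hA, HA⟩ := hχ.exists_hI_le n hf hfl
  obtain ⟨G, hG⟩ : ∃ G, G = gw s b (n + 1) := ⟨_, rfl⟩
  have hG0 : 0 < G := by rw [hG]; exact gw_pos hb0 _
  have hM : ∀ ε > 0, ∀ l : List (Fin 3), l.length = n →
      hI χ ε 1 (pdl l f) ≤ K * (4 * (H * G) ^ 2) := by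
    intro ε hε l hl
    have hsl : Sm (pdl l f) := by fun_prop
    have hInt : ∀ {g : E3 → ℝ}, Sm g → IntegrableOn (fun x => g x ^ 2) (ball 0 (3 * r)) :=
      fun hg => integrableOn_ball_of_continuous (hg.continuous.pow 2) _ _
    refine (HK ε hε _ hsl).trans (mul_le_mul_of_nonneg_left ?_ hK.le)
    have e : ∫ x in ball (0 : E3) (3 * r), (pdl l f x ^ 2 + gsq (pdl l f) x)
        = (∫ x in ball (0 : E3) (3 * r), pdl l f x ^ 2)
          + ∑ i, ∫ x in ball (0 : E3) (3 * r), pdl (i :: l) f x ^ 2 := by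
      simp only [gsq, pd_pdl hf, ← pdl_cons]
      rw [integral_add (hInt hsl) (integrable_finsetSum _ fun i _ => hInt (by fun_prop)),
        integral_finsetSum _ fun i _ => hInt (by fun_prop)]
    rw [e]
    have h1 := (h l).trans (pow_le_pow_left₀ (mul_nonneg hH (gw_pos hb0 _).le)
      (mul_le_mul_of_nonneg_left (gw_mono hs hb (by omega : l.length ≤ n + 1)) hH) 2)
    have h2 : ∑ i, ∫ x in ball (0 : E3) (3 * r), pdl (i :: l) f x ^ 2
        ≤ ∑ _i : Fin 3, (H * G) ^ 2 := Finset.sum_le_sum fun i _ => by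
      have := h (i :: l)
      rwa [List.length_cons, hl, ← hG] at this
    rw [← hG] at h1
    simp only [Finset.sum_const, Finset.card_univ, Fintype.card_fin, nsmul_eq_mul] at h2
    push_cast at h2
    linarith
  obtain ⟨c, hc⟩ : ∃ c, c = 48 ^ n / ((n + 1).factorial : ℝ) ^ 2 * (K * (4 * (H * G) ^ 2)) :=
    ⟨_, rfl⟩
  have step : ∀ ε > 0, ∫ x in ball (0 : E3) ρ, f x ^ 2 ≤ (ρ ^ 2 + ε) ^ (n + 1) * (A * ε + c) := by
    intro ε hε
    have h1 := HA ε hε _ (hM ε hε)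
    rw [← hc] at h1
    refine le_trans ?_ (mul_le_mul_of_nonneg_left h1 (by positivity))
    rw [hI, ← integral_const_mul, ← integral_indicator measurableSet_ball]
    refine integral_mono ((integrableOn_ball_of_continuous (hf.continuous.pow 2) 0
      ρ).integrable_indicator measurableSet_ball) ((hI_integrable hε hχ hf _).const_mul _)
      fun x => ?_
    have hw := iw_pos hε x
    have h0 := hχ.nonneg x
    by_cases hx : x ∈ ball (0 : E3) ρ
    · rw [Set.indicator_of_mem hx]
      rw [mem_ball_zero_iff] at hx
      show f x ^ 2 ≤ (ρ ^ 2 + ε) ^ (n + 1) * (iw ε x ^ (n + 1) * (χ x * f x ^ 2))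
      rw [hχ.one x (by linarith), one_mul, ← mul_assoc, ← mul_pow]
      refine le_mul_of_one_le_left (sq_nonneg _) (one_le_pow₀ ?_)
      rw [← nsq_add_mul_iw hε x]
      refine mul_le_mul_of_nonneg_right ?_ hw.le
      rw [nsq_eq, dist_zero_right]
      linarith [pow_le_pow_left₀ (norm_nonneg x) hx.le 2]
    · rw [Set.indicator_of_notMem hx]
      show 0 ≤ (ρ ^ 2 + ε) ^ (n + 1) * (iw ε x ^ (n + 1) * (χ x * f x ^ 2))
      positivity
  have lim : Filter.Tendsto (fun ε : ℝ => (ρ ^ 2 + ε) ^ (n + 1) * (A * ε + c))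
      (nhdsWithin 0 (Set.Ioi 0)) (nhds ((ρ ^ 2 + 0) ^ (n + 1) * (A * 0 + c))) :=
    ((by fun_prop : Continuous fun ε : ℝ => (ρ ^ 2 + ε) ^ (n + 1) * (A * ε + c)).tendsto
      0).mono_left nhdsWithin_le_nhds
  have h2 := ge_of_tendsto lim (by filter_upwards [self_mem_nhdsWithin] with ε hε using step ε hε)
  refine h2.trans ?_
  obtain ⟨F, hF⟩ : ∃ F : ℝ, F = ((n + 1).factorial : ℝ) := ⟨_, rfl⟩
  have hF0 : 0 < F := by rw [hF]; positivity
  have hFs : F ^ s = F * F ^ (s - 1) := by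
    rw [← Real.rpow_one_add' hF0.le (by linarith)]; congr 1; ring
  have e1 : (ρ ^ 2 + 0) ^ (n + 1) * (A * 0 + c)
      = 48 ^ n * (4 * K * H ^ 2 * (ρ ^ (n + 1) * b ^ (n + 1) * F ^ (s - 1)) ^ 2) := by
    rw [hc, hG, gw, ← hF, hFs]
    field_simp
    ring
  have e2 : 4 * K * H ^ 2 * ((7 * b * ρ) ^ (n + 1) * F ^ (s - 1)) ^ 2
      = 49 ^ (n + 1) * (4 * K * H ^ 2 * (ρ ^ (n + 1) * b ^ (n + 1) * F ^ (s - 1)) ^ 2) := by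
    have e3 : (49 : ℝ) ^ (n + 1) = (7 ^ (n + 1)) ^ 2 := by
      rw [← pow_mul, mul_comm (n + 1), pow_mul]; norm_num
    rw [e3, mul_pow, mul_pow]
    ring
  rw [← hF, e1, e2]
  refine mul_le_mul_of_nonneg_right ?_ (by positivity)
  calc (48 : ℝ) ^ n ≤ 49 ^ n := pow_le_pow_left₀ (by norm_num) (by norm_num) n
    _ ≤ 49 ^ (n + 1) := pow_le_pow_right₀ (by norm_num) (by omega)

theorem exists_rpow_le {γ c : ℝ} (hγ : 0 < γ) (hc : 0 < c) :
    ∃ ρ₀ > 0, ∀ ρ : ℝ, 0 < ρ → ρ < ρ₀ → ρ ^ γ ≤ c := by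
  refine ⟨c ^ γ⁻¹, by positivity, fun ρ hρ hlt => ?_⟩
  have := Real.rpow_le_rpow hρ.le hlt.le hγ.le
  rwa [← Real.rpow_mul hc.le, inv_mul_cancel₀ hγ.ne', Real.rpow_one] at this

theorem exists_gevrey_order (hs : 1 ≤ s) (hα : 0 < α) (hsα : α * (s - 1) < 1) {A : ℝ} (hA : 0 < A)
    (τ : ℝ) : ∃ ρ₀ > 0, ∀ ρ : ℝ, 0 < ρ → ρ < ρ₀ → ∃ n : ℕ,
      ((A * ρ) ^ (n + 1) * ((n + 1).factorial : ℝ) ^ (s - 1)) ^ 2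
        ≤ Real.exp (-(τ * ρ ^ (-α))) := by
  obtain ⟨η, hη⟩ : ∃ η, η = (1 - α * (s - 1)) / (2 * s) := ⟨_, rfl⟩
  have hη0 : 0 < η := by rw [hη]; exact div_pos (by linarith) (by linarith)
  obtain ⟨β, hβ⟩ : ∃ β, β = α + η := ⟨_, rfl⟩
  obtain ⟨γ, hγ⟩ : ∃ γ, γ = 1 - β * (s - 1) := ⟨_, rfl⟩
  have hγ0 : 0 < γ := by
    have h1 : η * (2 * s) = 1 - α * (s - 1) := by rw [hη]; field_simp
    rw [hγ, hβ]
    nlinarith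
  obtain ⟨ρ₁, hρ₁, H₁⟩ := exists_rpow_le hγ0
    (by positivity : 0 < (A * 2 ^ (s - 1))⁻¹ * Real.exp (-1))
  obtain ⟨ρ₂, hρ₂, H₂⟩ := exists_rpow_le hη0 (by positivity : 0 < (|τ| + 1)⁻¹)
  refine ⟨min 1 (min ρ₁ ρ₂), by positivity, fun ρ hρ hlt => ?_⟩
  simp only [lt_min_iff] at hlt
  obtain ⟨l1, l2, l3⟩ := hlt
  obtain ⟨P, hP⟩ : ∃ P, P = ρ ^ (-β) := ⟨_, rfl⟩
  have hP1 : 1 ≤ P := by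
    rw [hP]
    exact Real.one_le_rpow_of_pos_of_le_one_of_nonpos hρ l1.le (by linarith)
  refine ⟨⌊P⌋₊, ?_⟩
  obtain ⟨N, hN⟩ : ∃ N, N = ⌊P⌋₊ + 1 := ⟨_, rfl⟩
  rw [← hN]
  have hNP : P ≤ N := by
    rw [hN]; push_cast; exact (Nat.lt_floor_add_one P).le
  have hN2 : (N : ℝ) ≤ 2 * P := by
    have := Nat.floor_le (by linarith : 0 ≤ P)
    rw [hN]; push_cast; linarith
  have hs1 : 0 ≤ s - 1 := by linarith
  have h1 : (N.factorial : ℝ) ^ (s - 1) ≤ ((N : ℝ) ^ (s - 1)) ^ N := by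
    rw [← Real.rpow_natCast, ← Real.rpow_mul (by positivity), mul_comm,
      Real.rpow_mul (by positivity),
      Real.rpow_natCast]
    exact Real.rpow_le_rpow (by positivity) (by exact_mod_cast Nat.factorial_le_pow N) hs1
  have h2 : A * ρ * (N : ℝ) ^ (s - 1) ≤ Real.exp (-1) := by
    have h3 : (N : ℝ) ^ (s - 1) ≤ 2 ^ (s - 1) * P ^ (s - 1) := by
      rw [← Real.mul_rpow (by norm_num) (by linarith)]
      exact Real.rpow_le_rpow (by positivity) hN2 hs1
    have h4 : ρ * P ^ (s - 1) = ρ ^ γ := by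
      rw [hP, ← Real.rpow_mul hρ.le, ← Real.rpow_one_add' hρ.le, hγ]
      · congr 1; ring
      · have : 1 + -β * (s - 1) = γ := by rw [hγ]; ring
        rw [this]; exact hγ0.ne'
    have h5 := mul_le_mul_of_nonneg_left (H₁ ρ hρ l2) (by positivity : 0 ≤ A * 2 ^ (s - 1))
    have h6 := mul_le_mul_of_nonneg_left h3 (by positivity : 0 ≤ A * ρ)
    rw [← mul_assoc (A * 2 ^ (s - 1)), mul_inv_cancel₀ (by positivity), one_mul, ← h4] at h5
    linarith
  have h3 : (A * ρ) ^ N * (N.factorial : ℝ) ^ (s - 1) ≤ Real.exp (-N) := by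
    calc _ ≤ (A * ρ) ^ N * ((N : ℝ) ^ (s - 1)) ^ N :=
          mul_le_mul_of_nonneg_left h1 (by positivity)
      _ = (A * ρ * (N : ℝ) ^ (s - 1)) ^ N := by rw [mul_pow (A * ρ)]
      _ ≤ Real.exp (-1) ^ N := pow_le_pow_left₀ (by positivity) h2 N
      _ = _ := by rw [← Real.exp_nat_mul]; congr 1; ring
  refine (pow_le_pow_left₀ (by positivity) h3 2).trans ?_
  rw [← Real.exp_nat_mul, Real.exp_le_exp]
  have h4 : τ * ρ ^ (-α) ≤ P := by
    have h5 := H₂ ρ hρ l3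
    have h6 : P = ρ ^ (-α) * (ρ ^ η)⁻¹ := by
      rw [hP, ← Real.rpow_neg hρ.le, ← Real.rpow_add hρ, hβ]; congr 1; ring
    have h7 : τ ≤ (ρ ^ η)⁻¹ := by
      rw [le_inv_comm₀ (by positivity) (by positivity)] at h5
      linarith [le_abs_self τ]
    rw [h6, mul_comm]
    exact mul_le_mul_of_nonneg_left h7 (by positivity)
  have : (0 : ℝ) ≤ N := Nat.cast_nonneg N
  push_cast
  linarith

theorem GevL2.decayAt (h : GevL2 s (3 * r) H b f) (hs : 1 ≤ s) (hα : 0 < α)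
    (hsα : α * (s - 1) < 1) (hb : 1 ≤ b) (hH : 0 ≤ H) (hr : 0 < r) (hf : Sm f) (hfl : Flat f) :
    DecayAt 0 α fun x => f x ^ 2 := by
  obtain ⟨C, hC, HC⟩ := h.integral_le hs hb hH hr hf hfl
  intro τ
  obtain ⟨ρ₀, hρ₀, H₀⟩ := exists_gevrey_order hs hα hsα (by positivity : 0 < 7 * b) τ
  refine ⟨C, min ρ₀ r, lt_min hρ₀ hr, fun ρ hρ hlt => ?_⟩
  rw [lt_min_iff] at hlt
  obtain ⟨n, hn⟩ := H₀ ρ hρ hlt.1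
  exact (HC ρ hρ hlt.2.le n).trans (mul_le_mul_of_nonneg_left hn hC)

theorem DecayAt.add {c : E3} {F G : E3 → ℝ} (hF : DecayAt c α F) (hG : DecayAt c α G)
    (cF : Continuous F) (cG : Continuous G) : DecayAt c α fun x => F x + G x := by
  intro τ
  obtain ⟨C, ρ₀, hρ₀, H⟩ := hF τ
  obtain ⟨C', ρ₁, hρ₁, H'⟩ := hG τ
  refine ⟨C + C', min ρ₀ ρ₁, lt_min hρ₀ hρ₁, fun ρ hρ hlt => ?_⟩
  rw [lt_min_iff] at hlt
  rw [integral_add (integrableOn_ball_of_continuous cF c ρ)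
    (integrableOn_ball_of_continuous cG c ρ), add_mul]
  exact add_le_add (H ρ hρ hlt.1) (H' ρ hρ hlt.2)

theorem DecayAt.sum_three {c : E3} {F : Fin 3 → E3 → ℝ} (hF : ∀ i, DecayAt c α (F i))
    (cF : ∀ i, Continuous (F i)) : DecayAt c α fun x => ∑ i, F i x := by
  simp only [Fin.sum_univ_three]
  exact ((hF 0).add (hF 1) (cF 0) (cF 1)).add (hF 2) ((cF 0).add (cF 1)) (cF 2)

theorem GevL2.decayAt_gsq_add_sq (h : GevL2 s (3 * r) H b f) (hs : 1 ≤ s) (hα : 0 < α)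
    (hsα : α * (s - 1) < 1) (hb : 1 ≤ b) (hH : 0 ≤ H) (hr : 0 < r) (hf : Sm f) (hfl : Flat f) :
    DecayAt 0 α fun x => gsq f x + f x ^ 2 := by
  have hcp : ∀ i, Continuous fun x => _root_.pd i f x ^ 2 := fun i =>
    ContDiff.continuous (𝕜 := ℝ) (n := (⊤ : ℕ∞)) (by fun_prop)
  refine DecayAt.add (DecayAt.sum_three (fun i => ?_) hcp) (h.decayAt hs hα hsα hb hH hr hf hfl)
    (continuous_finsetSum _ fun i _ => hcp i) (hf.continuous.pow 2)
  have h2 : 1 ≤ (2 : ℝ) ^ s := Real.one_le_rpow (by norm_num) (by linarith)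
  exact (h.pd (by linarith) (by linarith) hH i).decayAt hs hα hsα
    (one_le_mul_of_one_le_of_one_le hb h2) (by positivity) hr (by fun_prop) (hfl.pd hf i)

end Decay

section Conclusion

variable {s α r H b : ℝ} {f : E3 → ℝ} {χ : E3 → ℝ} {B : Set E3}

theorem gevL2_of_cn_le (h : Cut B χ) (h1 : ∀ x ∈ ball (0 : E3) r, χ x = 1) (hf : Sm f)
    (hb : ∀ l : List (Fin 3), cn χ l.length (pdl l f) ≤ H * gw s b l.length) :
    GevL2 s r H b f := fun l => by
  have hl : Sm (pdl l f) := contDiff_pdl hf l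
  refine le_trans ?_ (pow_le_pow_left₀ cn_nonneg (hb l) 2)
  rw [h.cn_sq hl]
  calc ∫ x in ball (0 : E3) r, pdl l f x ^ 2
      = ∫ x in ball (0 : E3) r, (χ x ^ (l.length + 1) * pdl l f x) ^ 2 :=
        setIntegral_congr_fun measurableSet_ball fun x hx => by
          simp only [h1 x hx, one_pow, one_mul]
    _ ≤ ∫ x, (χ x ^ (l.length + 1) * pdl l f x) ^ 2 :=
        setIntegral_le_integral (h.integrable_sq hl _)
          (Filter.Eventually.of_forall fun x => sq_nonneg _)

theorem decayAt_of_eq_zero {c : E3} {G : E3 → ℝ} (hr : 0 < r) (h : ∀ x ∈ ball c r, G x = 0) :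
    DecayAt c α G := fun τ => ⟨0, r, hr, fun ρ _ hlt => by
  rw [zero_mul, setIntegral_congr_fun (g := fun _ => (0 : ℝ)) measurableSet_ball
    fun x hx => h x (ball_subset_ball hlt.le hx)]
  simp⟩

theorem jetSq_divg_eq_zero {u : E3 → Fin 3 → ℝ} {U : Set E3} (hU : IsOpen U)
    (h : ∀ x ∈ U, ∀ m, u x m = 0) : ∀ x ∈ U, jetSq (fun m x => u x m) (divg u) x = 0 := by
  have h0 : ∀ i : Fin 3, ∀ f : E3 → ℝ, (∀ x ∈ U, f x = 0) → ∀ x ∈ U, pd i f x = 0 :=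
    fun i f hf x hx => by
      rw [pd_congr hU (g := fun _ => (0 : ℝ)) hf x hx]
      simp [pd]
  have hd : ∀ x ∈ U, divg u x = 0 := fun x hx =>
    Finset.sum_eq_zero fun i _ => h0 i _ (fun y hy => h y hy i) x hx
  intro x hx
  simp [jetSq, gsq, h x hx, hd x hx, h0 _ _ hd x hx, fun k m => h0 k _ (fun y hy => h y hy m) x hx]

theorem LocalModel.decayAt {u : E3 → Fin 3 → ℝ} (hr : 0 < r)
    (h : LocalModel s α (ball 0 r) (fun m x => u x m) (divg u)) (hs : 1 ≤ s) (hα : 0 < α)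
    (hsα : α * (s - 1) < 1) (hfl : ∀ m, Flat fun x => u x m) :
    DecayAt 0 α (jetSq (fun m x => u x m) (divg u)) := by
  obtain ⟨a₁, a₂, p, q, c, d, h₂, h₁, h₀, b₁, b₀, K, κ₁, g₁, K₁, κ₂, g₂, K₂, S, T, hc₁, hc₂⟩ := h
  let χ : ContDiffBump (0 : E3) := ⟨r / 2, 3 * r / 4, by positivity, by linarith⟩
  have hχ : Cut (ball 0 r) χ :=
    ⟨χ.contDiff, χ.hasCompactSupport, fun _ => χ.nonneg, fun _ => χ.le_one, by
      rw [χ.tsupport_eq]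
      exact closedBall_subset_ball (by show 3 * r / 4 < r; linarith)⟩
  have h1 : ∀ x ∈ ball (0 : E3) (3 * (r / 6)), χ x = 1 := fun x hx =>
    χ.one_of_mem_closedBall (mem_closedBall.2 (by
      show dist x 0 ≤ r / 2
      linarith [mem_ball.1 hx]))
  obtain ⟨H, hH, b, hb, hG⟩ := S.gevrey_regularity T hc₁ hc₂ isOpen_ball hs hχ
  have hu := S.su
  have hv := S.sv
  have flv : Flat (divg u) := by
    have e : divg u = fun x => pd 0 (fun y => u y 0) x + pd 1 (fun y => u y 1) x
      + pd 2 (fun y => u y 2) x := by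
      funext x
      exact Fin.sum_univ_three _
    rw [e]
    exact (((hfl 0).pd (hu 0) 0).add ((hfl 1).pd (hu 1) 1)).add ((hfl 2).pd (hu 2) 2)
  have cc : ∀ f : E3 → ℝ, Sm f → Continuous fun x => gsq f x + f x ^ 2 := fun f hf =>
    ContDiff.continuous (𝕜 := ℝ) (n := (⊤ : ℕ∞)) (by unfold gsq; fun_prop)
  refine DecayAt.add (DecayAt.sum_three (fun m => ?_) fun m => cc _ (hu m)) ?_
    (continuous_finsetSum _ fun m _ => cc _ (hu m)) (cc _ hv)
  · exact (gevL2_of_cn_le hχ h1 (hu m) fun l => (hG l).1 m).decayAt_gsq_add_sq hs hα hsα hb hH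
      (by positivity) (hu m) (hfl m)
  · exact (gevL2_of_cn_le hχ h1 hv fun l => (hG l).2).decayAt_gsq_add_sq hs hα hsα hb hH
      (by positivity) hv flv

theorem flat_of_annulus_sum {u u' : E3 → Fin 3 → ℝ} (hr : 0 < r) (hu' : ∀ m, Sm fun x => u' x m)
    (he : ∀ x ∈ ball (0 : E3) r, ∀ m, u' x m = u x m)
    (h : ∀ N : ℝ, 0 < N → ∃ C > 0, ∃ δ > 0, ∀ R : ℝ, 0 < R → R < δ →
      (∫ x in {y : E3 | R ≤ ‖y‖ ∧ ‖y‖ ≤ 2 * R}, ∑ i, (u x i) ^ 2) ≤ C * R ^ N) (m : Fin 3) :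
    Flat fun x => u' x m := by
  refine flat_of_annulus (hu' m) fun N hN => ?_
  obtain ⟨C, hC, δ, hδ, H⟩ := h N hN
  refine ⟨C, hC, min δ (r / 2), by positivity, fun R hR hlt => ?_⟩
  rw [lt_min_iff] at hlt
  have hA : MeasurableSet {y : E3 | R ≤ ‖y‖ ∧ ‖y‖ ≤ 2 * R} :=
    (measurableSet_le measurable_const measurable_norm).inter
      (measurableSet_le measurable_norm measurable_const)
  have hAr : {y : E3 | R ≤ ‖y‖ ∧ ‖y‖ ≤ 2 * R} ⊆ ball 0 r := fun y hy => by
    rw [mem_ball_zero_iff]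
    linarith [hy.2, hlt.2]
  have hInt : ∀ f : E3 → ℝ, Continuous f → IntegrableOn f {y : E3 | R ≤ ‖y‖ ∧ ‖y‖ ≤ 2 * R} :=
    fun f hf => (integrableOn_ball_of_continuous hf 0 r).mono_set hAr
  have hc : ∀ i, Continuous fun x => u' x i ^ 2 := fun i => (hu' i).continuous.pow 2
  refine le_trans ?_ (H R hR hlt.1)
  rw [setIntegral_congr_fun (f := fun x => ∑ i, u x i ^ 2) (g := fun x => ∑ i, u' x i ^ 2) hA
    fun x hx => by simp only [he x (hAr hx)]]
  refine setIntegral_mono (hInt _ (hc m)) (hInt _ (continuous_finsetSum _ fun i _ => hc i))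
    fun x => ?_
  exact Finset.single_le_sum (f := fun i => u' x i ^ 2) (fun i _ => sq_nonneg _)
    (Finset.mem_univ m)

end Conclusion

/-- **Strong unique continuation for the residual stress system with Gevrey
coefficients** (Theorem 1.1).  If the residual stress `T = (t_jk)`, the Lamé
parameters `λ, μ` and the density `ρ > 0` lie in `G^s(Ω)`, the operators `P₁, P₂`
are uniformly elliptic, `α > (λ₃^ℓ - λ₁^ℓ)/λ₁^ℓ` for the eigenvalues of their
coefficient matrices at `0`, and `s < 1 + 1/α`, then any smooth solution `u` of
`∇·σ + κ²ρu = 0` in `Ω` that vanishes to infinite order at `0` (in the `L²`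
annulus sense) vanishes identically in `Ω`. -/
theorem sucp_residual_stress
    (Ω : Set E3) (hΩopen : IsOpen Ω) (hΩconn : IsConnected Ω) (h0Ω : (0 : E3) ∈ Ω)
    (s α κ : ℝ) (hs : 1 ≤ s) (hα : 0 < α) (hsα : s < 1 + 1 / α)
    (t : Fin 3 → Fin 3 → E3 → ℝ) (lam mu rho : E3 → ℝ)
    (htsym : ∀ j k : Fin 3, ∀ x ∈ Ω, t j k x = t k j x)
    (hdivT : ∀ x ∈ Ω, ∀ i : Fin 3, (∑ j, pd j (t i j) x) = 0)
    (hrho : ∀ x ∈ Ω, 0 < rho x)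
    (hGt : ∀ j k : Fin 3, GevreyOn s Ω (t j k))
    (hGlam : GevreyOn s Ω lam) (hGmu : GevreyOn s Ω mu) (hGrho : GevreyOn s Ω rho)
    (hell1 : UnifElliptic (a1coef t mu) Ω) (hell2 : UnifElliptic (a2coef t lam mu) Ω)
    (heig1 : EigCond (a1coef t mu) α) (heig2 : EigCond (a2coef t lam mu) α)
    (u : E3 → Fin 3 → ℝ) (hu : ∀ i : Fin 3, ContDiffOn ℝ (⊤ : ℕ∞) (fun x => u x i) Ω)
    (hsol : ResSystem t lam mu rho κ u Ω)
    (hflat : ∀ N : ℝ, 0 < N → ∃ C > 0, ∃ δ > 0, ∀ R : ℝ, 0 < R → R < δ →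
      (∫ x in {y : E3 | R ≤ ‖y‖ ∧ ‖y‖ ≤ 2 * R}, ∑ i, (u x i) ^ 2) ≤ C * R ^ N) :
    ∀ x ∈ Ω, ∀ i : Fin 3, u x i = 0 := by
  have hs0 : 0 ≤ s := by linarith
  have hsα' : α * (s - 1) < 1 := by
    have h1 : s - 1 < 1 / α := by linarith
    rw [lt_div_iff₀ hα] at h1
    linarith
  obtain ⟨Z, hZ⟩ : ∃ Z : Set E3, Z = {x | ∀ᶠ y in nhds x, ∀ i, u y i = 0} := ⟨_, rfl⟩
  have hZo : IsOpen Z := hZ ▸ isOpen_setOfPred_eventually_nhds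
  have hne : (Ω ∩ Z).Nonempty := by
    obtain ⟨r, hr, -, u', he, M⟩ := exists_localModel hΩopen hs0 htsym hdivT hGt hGlam hGmu hGrho
      hell1 hell2 hu hsol h0Ω (α := α) heig1 heig2
    have hsm : ∀ m, Sm fun x => u' x m := by
      obtain ⟨_, _, _, _, _, _, _, _, _, _, _, _, _, _, _, _, _, _, S, -⟩ := M
      exact S.su
    have hd := M.decayAt hr hs hα hsα' fun m => flat_of_annulus_sum hr hsm he hflat m
    obtain ⟨R, -, hR, r', hr', h0⟩ := M.eq_zero_of_decayAt hα hr
    refine ⟨0, h0Ω, ?_⟩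
    rw [hZ]
    filter_upwards [ball_mem_nhds 0 hr, ball_mem_nhds 0 hr'] with y hy hy' i
    rw [← he y hy]
    exact h0 0 (ball_subset_ball hR) hd y hy' i
  have hcl : closure Z ∩ Ω ⊆ Z := by
    rintro x ⟨hxc, hxΩ⟩
    obtain ⟨α₁, H₁⟩ := exists_eigCondAt (a1coef t mu) x
    obtain ⟨α₂, H₂⟩ := exists_eigCondAt (a2coef t lam mu) x
    obtain ⟨β, hβ⟩ : ∃ β, β = max 1 (max α₁ α₂) := ⟨_, rfl⟩
    have hβ0 : 0 < β := by rw [hβ]; exact lt_max_of_lt_left one_pos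
    obtain ⟨r₀, hr₀, -, u', he, M⟩ := exists_localModel hΩopen hs0 htsym hdivT hGt hGlam hGmu hGrho
      hell1 hell2 hu hsol hxΩ (α := β)
      (H₁ β (by rw [hβ]; exact (le_max_left _ _).trans (le_max_right _ _)))
      (H₂ β (by rw [hβ]; exact (le_max_right _ _).trans (le_max_right _ _)))
    obtain ⟨R, -, hR, r, hr, h0⟩ := M.eq_zero_of_decayAt hβ0 (half_pos hr₀)
    obtain ⟨c, hcZ, hc⟩ := Metric.mem_closure_iff.1 hxc (min (r₀ / 2) r) (by positivity)
    rw [lt_min_iff] at hc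
    have hcx : c ∈ ball x r₀ := by rw [mem_ball']; linarith [hc.1]
    obtain ⟨ε, hε, hεs⟩ := Metric.mem_nhds_iff.1
      (Filter.inter_mem (isOpen_ball.mem_nhds hcx) (hZo.mem_nhds hcZ))
    have hz : ∀ y ∈ ball c ε, ∀ m, u' y m = 0 := fun y hy m => by
      obtain ⟨h1, h2⟩ := hεs hy
      rw [hZ] at h2
      rw [he y h1]
      exact h2.self_of_nhds m
    have key := h0 c (fun y hy => by
        rw [mem_ball] at hy ⊢
        linarith [dist_triangle y c x, dist_comm c x, hc.1])
      (decayAt_of_eq_zero hε (jetSq_divg_eq_zero isOpen_ball hz))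
    rw [hZ]
    filter_upwards [ball_mem_nhds x hr₀, isOpen_ball.mem_nhds (mem_ball.2 hc.2)] with y hy hy' i
    rw [← he y hy]
    exact key y hy' i
  have hsub := hΩconn.isPreconnected.subset_of_closure_inter_subset hZo hne hcl
  intro x hx
  have hxZ := hsub hx
  rw [hZ] at hxZ
  exact hxZ.self_of_nhds
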